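/- Let n ≥ 2, m ≥ 1, and let Ω be a bounded connected open set in ℝⁿ with smooth boundary. Then the first nonzero Neumann eigenvalue of the even-multi-Laplacian operator Δ^{2m} satisfies Υ̂₁(Ω) ≤ Υ̂₁(B_Ω), where B_Ω is an open ball in ℝⁿ with the same Lebesgue volume as Ω. Moreover, equality holds if and only if Ω is itself a ball of that volume. -/

import Mathlib

open MeasureTheory Set

noncomputable section

/-- The Laplacian of `f` (sum of second partial derivatives), with all derivatives
taken within the set `S`. -/
def lapWithin {n : ℕ} (S : Set (EuclideanSpace ℝ (Fin n)))
    (f : EuclideanSpace ℝ (Fin n) → ℝ) (x : EuclideanSpace ℝ (Fin n)) : ℝ :=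
  ∑ i : Fin n, fderivWithin ℝ
    (fun y => fderivWithin ℝ f S y (EuclideanSpace.single i 1)) S x (EuclideanSpace.single i 1)

/-- A bounded open set in `ℝⁿ` with smooth boundary, presented by a smooth defining
function which is negative exactly on the set, vanishes exactly on the boundary, and has
nonvanishing gradient on the boundary. -/
structure SmoothDomain (n : ℕ) where
  carrier : Set (EuclideanSpace ℝ (Fin n))
  defining : EuclideanSpace ℝ (Fin n) → ℝ
  isOpen : IsOpen carrier
  isBounded : Bornology.IsBounded carrier
  smooth_defining : ContDiff ℝ (⊤ : ℕ∞) defining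
  carrier_eq : carrier = {x | defining x < 0}
  frontier_eq : frontier carrier = {x | defining x = 0}
  grad_ne_zero : ∀ x ∈ frontier carrier, gradient defining x ≠ 0

/-- The outward unit normal vector field on the boundary of a smooth domain. -/
def SmoothDomain.normal {n : ℕ} (D : SmoothDomain n) (x : EuclideanSpace ℝ (Fin n)) :
    EuclideanSpace ℝ (Fin n) :=
  ‖gradient D.defining x‖⁻¹ • gradient D.defining x

/-- The outward normal derivative `∂f/∂n` of `f`, computed within the closure of the domain. -/
def SmoothDomain.normalDeriv {n : ℕ} (D : SmoothDomain n)
    (f : EuclideanSpace ℝ (Fin n) → ℝ) (x : EuclideanSpace ℝ (Fin n)) : ℝ :=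
  fderivWithin ℝ f (closure D.carrier) x (D.normal x)

/-- `Υ` is a Neumann eigenvalue of the bi-harmonic operator `Δ²` on `D`:
there is a nonzero function `u`, smooth on the closure of `D`, with `Δ²u = Υ·u` in `D` and
`∂u/∂n = ∂(Δu)/∂n = 0` on `∂D`. -/
def IsBiharmonicNeumannEigenvalue {n : ℕ} (D : SmoothDomain n) (Υ : ℝ) : Prop :=
  ∃ u : EuclideanSpace ℝ (Fin n) → ℝ,
    ContDiffOn ℝ (⊤ : ℕ∞) u (closure D.carrier) ∧
    (∃ x ∈ closure D.carrier, u x ≠ 0) ∧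
    (∀ x ∈ D.carrier,
      lapWithin (closure D.carrier) (lapWithin (closure D.carrier) u) x = Υ * u x) ∧
    (∀ x ∈ frontier D.carrier, D.normalDeriv u x = 0) ∧
    (∀ x ∈ frontier D.carrier, D.normalDeriv (lapWithin (closure D.carrier) u) x = 0)

/-- `Υ` is a Neumann eigenvalue of the even-multi-Laplacian `Δ^(2m)` on `D`:
there is a nonzero function `u`, smooth on the closure of `D`, with `Δ^(2m)u = Υ·u` in `D` and
`∂(Δʲu)/∂n = 0` on `∂D` for every `j = 0, 1, …, 2m−1`. -/
def IsPolyharmonicNeumannEigenvalue {n : ℕ} (D : SmoothDomain n) (m : ℕ) (Υ : ℝ) : Prop :=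
  ∃ u : EuclideanSpace ℝ (Fin n) → ℝ,
    ContDiffOn ℝ (⊤ : ℕ∞) u (closure D.carrier) ∧
    (∃ x ∈ closure D.carrier, u x ≠ 0) ∧
    (∀ x ∈ D.carrier, (lapWithin (closure D.carrier))^[2 * m] u x = Υ * u x) ∧
    (∀ j < 2 * m, ∀ x ∈ frontier D.carrier,
      D.normalDeriv ((lapWithin (closure D.carrier))^[j] u) x = 0)

open Filter Topology
set_option linter.all false
variable {n : ℕ}

/-! ## P1: partial derivatives, domain basics -/
open Filter Topology
set_option linter.all false

abbrev Eu (n : ℕ) := EuclideanSpace ℝ (Fin n)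

/-- basis vector -/
abbrev bv {n : ℕ} (i : Fin n) : Eu n := EuclideanSpace.single i 1

/-- partial derivative -/
def pd {n : ℕ} (i : Fin n) (f : Eu n → ℝ) (x : Eu n) : ℝ := fderiv ℝ f x (bv i)

variable {n : ℕ}

lemma sum_bv (v : Eu n) : ∑ i, v i • bv i = v := by
  ext j; simp [Finset.sum_apply, Pi.single_apply]

lemma fderiv_eq_sum (f : Eu n → ℝ) (x v : Eu n) : fderiv ℝ f x v = ∑ i, v i * pd i f x := by
  conv_lhs => rw [← sum_bv v]
  simp [pd]

lemma clm_eq_sum (L : Eu n →L[ℝ] ℝ) (v : Eu n) : L v = ∑ i, v i * L (bv i) := by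
  conv_lhs => rw [← sum_bv v]
  simp

lemma gradient_apply (f : Eu n → ℝ) (x : Eu n) (i : Fin n) : gradient f x i = pd i f x := by
  have h : inner ℝ (gradient f x) (bv i) = fderiv ℝ f x (bv i) := by
    simp [gradient]
  rw [pd, ← h, EuclideanSpace.inner_single_right]; simp

lemma pd_add {i : Fin n} {f g : Eu n → ℝ} {x : Eu n} (hf : DifferentiableAt ℝ f x)
    (hg : DifferentiableAt ℝ g x) : pd i (fun y => f y + g y) x = pd i f x + pd i g x := by
  simp [pd, fderiv_fun_add hf hg]

lemma pd_sub {i : Fin n} {f g : Eu n → ℝ} {x : Eu n} (hf : DifferentiableAt ℝ f x)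
    (hg : DifferentiableAt ℝ g x) : pd i (fun y => f y - g y) x = pd i f x - pd i g x := by
  simp [pd, fderiv_fun_sub hf hg]

lemma pd_neg {i : Fin n} {f : Eu n → ℝ} {x : Eu n} :
    pd i (fun y => - f y) x = - pd i f x := by
  simp [pd, fderiv_fun_neg]

lemma pd_const {i : Fin n} {c : ℝ} {x : Eu n} : pd i (fun _ => c) x = 0 := by
  simp [pd]

lemma pd_mul {i : Fin n} {f g : Eu n → ℝ} {x : Eu n} (hf : DifferentiableAt ℝ f x)
    (hg : DifferentiableAt ℝ g x) :
    pd i (fun y => f y * g y) x = f x * pd i g x + pd i f x * g x := by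
  simp [pd, fderiv_fun_mul hf hg, mul_comm]

lemma pd_const_mul {i : Fin n} {f : Eu n → ℝ} {x : Eu n} (c : ℝ) (hf : DifferentiableAt ℝ f x) :
    pd i (fun y => c * f y) x = c * pd i f x := by
  rw [pd_mul (differentiableAt_const c) hf, pd_const]; ring

lemma pd_sum {ι : Type*} {i : Fin n} (s : Finset ι) {f : ι → Eu n → ℝ} {x : Eu n}
    (hf : ∀ j ∈ s, DifferentiableAt ℝ (f j) x) :
    pd i (fun y => ∑ j ∈ s, f j y) x = ∑ j ∈ s, pd i (f j) x := by
  simp [pd, fderiv_fun_sum hf]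

lemma pd_comp {i : Fin n} {h : ℝ → ℝ} {f : Eu n → ℝ} {x : Eu n} {h' : ℝ}
    (hh : HasDerivAt h h' (f x)) (hf : DifferentiableAt ℝ f x) :
    pd i (fun y => h (f y)) x = h' * pd i f x := by
  have := hh.comp_hasFDerivAt x hf.hasFDerivAt
  simp only [pd, Function.comp_def] at *
  rw [this.fderiv]; simp

lemma pd_congr {i : Fin n} {f g : Eu n → ℝ} {x : Eu n} (h : f =ᶠ[𝓝 x] g) :
    pd i f x = pd i g x := by simp [pd, h.fderiv_eq]

lemma pd_congr_on {i : Fin n} {f g : Eu n → ℝ} {U : Set (Eu n)} (hU : IsOpen U)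
    (h : EqOn f g U) : EqOn (pd i f) (pd i g) U := fun _ hx =>
  pd_congr (h.eventuallyEq_of_mem (hU.mem_nhds hx))

lemma pd_contDiffOn {i : Fin n} {f : Eu n → ℝ} {U : Set (Eu n)} (hU : IsOpen U) {k m : WithTop ℕ∞}
    (hf : ContDiffOn ℝ k f U) (h : m + 1 ≤ k) : ContDiffOn ℝ m (pd i f) U :=
  (hf.fderiv_of_isOpen hU h).clm_apply contDiffOn_const

lemma pd_smooth {i : Fin n} {f : Eu n → ℝ} {U : Set (Eu n)} (hU : IsOpen U)
    (hf : ContDiffOn ℝ (⊤ : ℕ∞) f U) : ContDiffOn ℝ (⊤ : ℕ∞) (pd i f) U :=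
  pd_contDiffOn hU hf (by simp)

lemma pd_contDiff {i : Fin n} {f : Eu n → ℝ} (hf : ContDiff ℝ (⊤ : ℕ∞) f) :
    ContDiff ℝ (⊤ : ℕ∞) (pd i f) := by
  rw [← contDiffOn_univ] at *; exact pd_smooth isOpen_univ hf

lemma pd_continuous {i : Fin n} {f : Eu n → ℝ} (hf : ContDiff ℝ 1 f) :
    Continuous (pd i f) := (hf.continuous_fderiv (by simp)).clm_apply continuous_const

lemma pd_continuousOn {i : Fin n} {f : Eu n → ℝ} {U : Set (Eu n)} (hU : IsOpen U)
    (hf : ContDiffOn ℝ 1 f U) : ContinuousOn (pd i f) U :=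
  (hf.continuousOn_fderiv_of_isOpen hU le_rfl).clm_apply continuousOn_const

lemma ContDiffOn.diffAt {f : Eu n → ℝ} {U : Set (Eu n)} {k : WithTop ℕ∞}
    (hf : ContDiffOn ℝ k f U) (hU : IsOpen U) (hk : k ≠ 0) {x : Eu n} (hx : x ∈ U) :
    DifferentiableAt ℝ f x :=
  (hf.differentiableOn hk x hx).differentiableAt (hU.mem_nhds hx)

lemma pd_comm {i j : Fin n} {f : Eu n → ℝ} {U : Set (Eu n)} (hU : IsOpen U)
    (hf : ContDiffOn ℝ 2 f U) {x : Eu n} (hx : x ∈ U) : pd i (pd j f) x = pd j (pd i f) x := by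
  have h1 : DifferentiableAt ℝ (fderiv ℝ f) x :=
    ((hf.fderiv_of_isOpen hU (m := 1) (by norm_num)).differentiableOn (by simp)).differentiableAt
      (hU.mem_nhds hx)
  have key : ∀ a b : Fin n, pd a (pd b f) x = fderiv ℝ (fderiv ℝ f) x (bv a) (bv b) := by
    intro a b
    have : pd b f = fun y => fderiv ℝ f y (bv b) := rfl
    rw [pd, this, fderiv_clm_apply h1 (differentiableAt_const _)]
    simp
  rw [key, key]
  have := (hf.contDiffAt (hU.mem_nhds hx)).isSymmSndFDerivAt (by simp)
  exact this (bv i) (bv j)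

lemma norm_fderiv_sq (f : Eu n → ℝ) (x : Eu n) : ‖fderiv ℝ f x‖ ^ 2 = ∑ i, (pd i f x) ^ 2 := by
  have h : ‖gradient f x‖ = ‖fderiv ℝ f x‖ := by simp [gradient]
  rw [← h, EuclideanSpace.norm_sq_eq]
  simp [gradient_apply]

namespace SmoothDomain
variable (D : SmoothDomain n)

lemma mem_iff {x : Eu n} : x ∈ D.carrier ↔ D.defining x < 0 := by
  rw [D.carrier_eq]; rfl

lemma closure_eq : closure D.carrier = {x | D.defining x ≤ 0} := by
  rw [closure_eq_self_union_frontier, D.frontier_eq]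
  ext x; simp [D.mem_iff, le_iff_lt_or_eq]

lemma isCompact_closure : IsCompact (closure D.carrier) := D.isBounded.isCompact_closure

lemma rho_smooth : ContDiff ℝ (⊤ : ℕ∞) D.defining := D.smooth_defining

lemma rho_c1 : ContDiff ℝ 1 D.defining := D.smooth_defining.of_le (by exact_mod_cast le_top)

lemma rho_cont : Continuous D.defining := D.smooth_defining.continuous

lemma rho_diff (x : Eu n) : DifferentiableAt ℝ D.defining x :=
  D.rho_c1.differentiable (by simp) x

lemma fderiv_ne {x : Eu n} (hx : x ∈ frontier D.carrier) : fderiv ℝ D.defining x ≠ 0 := by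
  intro h; exact D.grad_ne_zero x hx (by simp [gradient, h])

lemma measSet : MeasurableSet D.carrier := D.isOpen.measurableSet

lemma vol_lt_top : volume D.carrier < ⊤ := D.isBounded.measure_lt_top

instance : IsFiniteMeasure (volume.restrict D.carrier) := ⟨by simpa using D.vol_lt_top⟩

end SmoothDomain

/-! ## P2: divergence lemma -/

lemma integral_pd_zero {i : Fin n} {f : Eu n → ℝ} (hf : ContDiff ℝ 1 f) (hs : HasCompactSupport f) :
    ∫ x, pd i f x = 0 := by
  have h := integral_mul_fderiv_eq_neg_fderiv_mul_of_integrable (μ := (volume : Measure (Eu n)))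
    (f := fun _ => (1 : ℝ)) (g := f) (v := bv i)
    (by simp) (by
      simp only [one_mul]
      exact (pd_continuous hf).integrable_of_hasCompactSupport (hs.fderiv_apply (𝕜 := ℝ) (bv i)))
    (by simpa using hf.continuous.integrable_of_hasCompactSupport hs)
    (fun _ _ => differentiableAt_const _) (fun x _ => hf.differentiable (by simp) x)
  simpa [pd] using h

lemma exists_deriv_smoothTransition_bound : ∃ M : ℝ, 0 ≤ M ∧ ∀ x, |deriv Real.smoothTransition x| ≤ M := by
  have hc : Continuous (deriv Real.smoothTransition) :=
    (Real.smoothTransition.contDiff (n := 1)).continuous_deriv (by simp)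
  obtain ⟨M, hM⟩ := isCompact_Icc.exists_bound_of_continuousOn (s := Icc (-1:ℝ) 2) hc.continuousOn
  refine ⟨max M 0, le_max_right _ _, fun x => ?_⟩
  by_cases hx : x ∈ Icc (-1:ℝ) 2
  · exact (hM x hx).trans (le_max_left _ _)
  · have : deriv Real.smoothTransition x = 0 := by
      rw [mem_Icc, not_and_or, not_le, not_le] at hx
      rcases hx with h | h
      · have : Real.smoothTransition =ᶠ[𝓝 x] fun _ => 0 := by
          filter_upwards [Iio_mem_nhds h] with y hy
          exact Real.smoothTransition.zero_of_nonpos (by linarith [mem_Iio.1 hy])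
        simp [this.deriv_eq]
      · have : Real.smoothTransition =ᶠ[𝓝 x] fun _ => 1 := by
          filter_upwards [Ioi_mem_nhds h] with y hy
          exact Real.smoothTransition.one_of_one_le (by linarith [mem_Ioi.1 hy])
        simp [this.deriv_eq]
    simp [this]

lemma deriv_smoothTransition_nonneg (x : ℝ) : 0 ≤ deriv Real.smoothTransition x :=
  Real.smoothTransition.monotone.deriv_nonneg

lemma deriv_smoothTransition_eq_zero {x : ℝ} (hx : x ≤ 0 ∨ 1 ≤ x) :
    deriv Real.smoothTransition x = 0 := by
  rcases hx with h | h
  · have : IsLocalMin Real.smoothTransition x := by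
      refine Eventually.of_forall fun y => ?_
      rw [Real.smoothTransition.zero_of_nonpos h]; exact Real.smoothTransition.nonneg y
    exact this.deriv_eq_zero
  · have : IsLocalMax Real.smoothTransition x := by
      refine Eventually.of_forall fun y => ?_
      rw [Real.smoothTransition.one_of_one_le h]; exact Real.smoothTransition.le_one y
    exact this.deriv_eq_zero

namespace SmoothDomain
variable (D : SmoothDomain n)

/-- boundary cutoff: `0` for `-ρ ≤ ε`, `1` for `-ρ ≥ 2ε`. -/
def cut (ε : ℝ) (x : Eu n) : ℝ := Real.smoothTransition (-(D.defining x) / ε - 1)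

lemma cut_contDiff (ε : ℝ) : ContDiff ℝ (⊤ : ℕ∞) (D.cut ε) := by
  refine Real.smoothTransition.contDiff.comp ?_
  exact (D.smooth_defining.neg.div_const _).sub contDiff_const

lemma cut_nonneg (ε : ℝ) (x : Eu n) : 0 ≤ D.cut ε x := Real.smoothTransition.nonneg _
lemma cut_le_one (ε : ℝ) (x : Eu n) : D.cut ε x ≤ 1 := Real.smoothTransition.le_one _

lemma cut_zero {ε : ℝ} (hε : 0 < ε) {x : Eu n} (h : -ε ≤ D.defining x) : D.cut ε x = 0 := by
  apply Real.smoothTransition.zero_of_nonpos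
  rw [sub_nonpos, div_le_one hε]; linarith

lemma cut_one {ε : ℝ} (hε : 0 < ε) {x : Eu n} (h : D.defining x ≤ -(2 * ε)) : D.cut ε x = 1 := by
  apply Real.smoothTransition.one_of_one_le
  rw [le_sub_iff_add_le, le_div_iff₀ hε]; linarith

lemma pd_cut (ε : ℝ) (i : Fin n) (x : Eu n) :
    pd i (D.cut ε) x = -(deriv Real.smoothTransition (-(D.defining x) / ε - 1) / ε) * pd i D.defining x := by
  have h1 : HasDerivAt (fun t : ℝ => Real.smoothTransition (-t / ε - 1))
      (deriv Real.smoothTransition (-(D.defining x) / ε - 1) * (-1 / ε)) (D.defining x) := by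
    have h2 : HasDerivAt (fun t : ℝ => -t / ε - 1) (-1 / ε) (D.defining x) :=
      ((hasDerivAt_id _).neg.div_const ε).sub_const 1
    have h3 : HasDerivAt Real.smoothTransition (deriv Real.smoothTransition (-(D.defining x) / ε - 1))
      (-(D.defining x) / ε - 1) :=
      ((Real.smoothTransition.contDiff (n := 1)).differentiable (by simp) _).hasDerivAt
    exact h3.comp (D.defining x) h2
  have := pd_comp (i := i) h1 (D.rho_diff x)
  change pd i (fun y => Real.smoothTransition (-(D.defining y) / ε - 1)) x = _
  rw [this]; ring

lemma cut_mul_contDiff {ε : ℝ} (hε : 0 < ε) {k : WithTop ℕ∞} (hk : k ≤ (⊤ : ℕ∞)) {V : Eu n → ℝ}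
    (hV : ContDiffOn ℝ k V D.carrier) :
    ContDiff ℝ k (fun x => D.cut ε x * V x) := by
  rw [contDiff_iff_contDiffAt]
  intro x
  by_cases hx : x ∈ D.carrier
  · exact ((D.cut_contDiff ε).of_le hk).contDiffAt.mul (hV.contDiffAt (D.isOpen.mem_nhds hx))
  · have hx' : -ε < D.defining x := by
      rw [D.mem_iff, not_lt] at hx; linarith
    have : (fun x => D.cut ε x * V x) =ᶠ[𝓝 x] fun _ => 0 := by
      filter_upwards [D.rho_cont.continuousAt.eventually (Ioi_mem_nhds hx')] with y hy
      rw [D.cut_zero hε (le_of_lt hy), zero_mul]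
    exact contDiffAt_const.congr_of_eventuallyEq this

lemma cut_compactSupport {ε : ℝ} (hε : 0 < ε) : HasCompactSupport (D.cut ε) := by
  refine HasCompactSupport.intro D.isCompact_closure fun x hx => D.cut_zero hε ?_
  rw [D.closure_eq, mem_setOf_eq, not_le] at hx; linarith

lemma tendsto_strip {g : Eu n → ℝ} (hg : IntegrableOn g D.carrier) {M : ℝ} :
    Tendsto (fun k : ℕ => ∫ x in D.carrier,
      ({x | -(2 * (1 / ((k:ℝ) + 1))) < D.defining x}.indicator (fun x => M * |g x|)) x) atTop (𝓝 0) := by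
  have : (0 : ℝ) = ∫ x in D.carrier, (0 : ℝ) := by simp
  rw [this]
  refine tendsto_integral_of_dominated_convergence (fun x => ‖M * |g x|‖) ?_ ?_ ?_ ?_
  · intro k
    refine ((hg.abs.const_mul M).aestronglyMeasurable).indicator ?_
    exact (isOpen_lt continuous_const D.rho_cont).measurableSet
  · exact (hg.abs.const_mul M).norm
  · intro k; exact ae_of_all _ fun x => norm_indicator_le_norm_self _ _
  · rw [ae_restrict_iff' D.measSet]
    refine ae_of_all _ fun x hx => ?_
    rw [D.mem_iff] at hx
    have h1 : ∀ᶠ k : ℕ in atTop, 1 / ((k:ℝ) + 1) < -(D.defining x) / 2 :=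
      tendsto_one_div_add_atTop_nhds_zero_nat.eventually (Iio_mem_nhds (by linarith))
    refine tendsto_const_nhds.congr' ?_
    filter_upwards [h1] with k hk
    rw [indicator_of_notMem]
    simp only [mem_setOf_eq, not_lt]; linarith

lemma tendsto_cut {g : Eu n → ℝ} (hg : IntegrableOn g D.carrier) :
    Tendsto (fun k : ℕ => ∫ x in D.carrier, D.cut (1 / ((k:ℝ) + 1)) x * g x) atTop
      (𝓝 (∫ x in D.carrier, g x)) := by
  refine tendsto_integral_of_dominated_convergence (fun x => ‖g x‖) ?_ hg.norm ?_ ?_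
  · intro k
    exact (D.cut_contDiff _).continuous.aestronglyMeasurable.mul hg.aestronglyMeasurable
  · intro k; refine ae_of_all _ fun x => ?_
    rw [norm_mul, Real.norm_of_nonneg (D.cut_nonneg _ _)]
    exact mul_le_of_le_one_left (norm_nonneg _) (D.cut_le_one _ _)
  · rw [ae_restrict_iff' D.measSet]
    refine ae_of_all _ fun x hx => ?_
    rw [D.mem_iff] at hx
    have h1 : ∀ᶠ k : ℕ in atTop, 1 / ((k:ℝ) + 1) < -(D.defining x) / 2 :=
      tendsto_one_div_add_atTop_nhds_zero_nat.eventually (Iio_mem_nhds (by linarith))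
    refine tendsto_const_nhds.congr' ?_
    filter_upwards [h1] with k hk
    rw [D.cut_one (by positivity) (by linarith), one_mul]

/-- the one-sided divergence theorem -/
theorem divThm_nonneg {V : Fin n → Eu n → ℝ} (hV : ∀ i, ContDiffOn ℝ 1 (V i) D.carrier)
    (hint : IntegrableOn (fun x => ∑ i, pd i (V i) x) D.carrier) {g : Eu n → ℝ}
    (hg : IntegrableOn g D.carrier)
    (h : ∀ x ∈ D.carrier, D.defining x * g x ≤ ∑ i, V i x * pd i D.defining x) :
    0 ≤ ∫ x in D.carrier, ∑ i, pd i (V i) x := by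
  obtain ⟨M, hM0, hM⟩ := exists_deriv_smoothTransition_bound
  have key : ∀ k : ℕ, 0 ≤ (∫ x in D.carrier, D.cut (1 / ((k:ℝ) + 1)) x * ∑ i, pd i (V i) x) +
      ∫ x in D.carrier,
      ({x | -(2 * (1 / ((k:ℝ) + 1))) < D.defining x}.indicator (fun x => (2 * M) * |g x|)) x := by
    intro k
    set ε : ℝ := 1 / ((k:ℝ) + 1) with hε'
    have hε : 0 < ε := by positivity
    have hW : ∀ i, ContDiff ℝ 1 (fun x => D.cut ε x * V i x) := fun i =>
      D.cut_mul_contDiff hε (by exact_mod_cast le_top) (hV i)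
    have hWs : ∀ i, HasCompactSupport (fun x => D.cut ε x * V i x) := fun i =>
      (D.cut_compactSupport hε).mul_right
    have hWi : ∀ i, Integrable (pd i (fun x => D.cut ε x * V i x)) := fun i =>
      (pd_continuous (hW i)).integrable_of_hasCompactSupport ((hWs i).fderiv_apply (𝕜 := ℝ) (bv i))
    have h0 : ∫ x, ∑ i, pd i (fun x => D.cut ε x * V i x) x = 0 := by
      rw [integral_finsetSum _ (fun i _ => hWi i)]
      exact Finset.sum_eq_zero fun i _ => integral_pd_zero (hW i) (hWs i)
    have hoff : ∀ x, x ∉ D.carrier → ∑ i, pd i (fun x => D.cut ε x * V i x) x = 0 := by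
      intro x hx
      refine Finset.sum_eq_zero fun i _ => ?_
      have hx' : -ε < D.defining x := by
        rw [D.mem_iff, not_lt] at hx; linarith
      have : (fun x => D.cut ε x * V i x) =ᶠ[𝓝 x] fun _ => 0 := by
        filter_upwards [D.rho_cont.continuousAt.eventually (Ioi_mem_nhds hx')] with y hy
        rw [D.cut_zero hε (le_of_lt hy), zero_mul]
      rw [pd_congr this, pd_const]
    rw [← setIntegral_eq_integral_of_forall_compl_eq_zero hoff] at h0
    have hi1 : IntegrableOn (fun x => D.cut ε x * ∑ i, pd i (V i) x) D.carrier := by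
      refine hint.bdd_mul (c := 1) (D.cut_contDiff _).continuous.aestronglyMeasurable
        (ae_of_all _ fun x => ?_)
      rw [Real.norm_of_nonneg (D.cut_nonneg _ _)]; exact D.cut_le_one _ _
    have hi2 : IntegrableOn ({x | -(2 * ε) < D.defining x}.indicator (fun x => (2 * M) * |g x|))
        D.carrier :=
      (hg.abs.const_mul (2*M)).indicator (isOpen_lt continuous_const D.rho_cont).measurableSet
    rw [← integral_add hi1 hi2, ← h0]
    refine setIntegral_mono_on (integrable_finsetSum _ fun i _ => hWi i).integrableOn (hi1.add hi2)
      D.measSet fun x hx => ?_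
    have e1 : ∑ i, pd i (fun x => D.cut ε x * V i x) x = D.cut ε x * ∑ i, pd i (V i) x
        - (deriv Real.smoothTransition (-(D.defining x) / ε - 1) / ε) *
          ∑ i, V i x * pd i D.defining x := by
      rw [Finset.mul_sum, Finset.mul_sum, ← Finset.sum_sub_distrib]
      refine Finset.sum_congr rfl fun i _ => ?_
      rw [pd_mul ((D.cut_contDiff ε).differentiable (by simp) x)
        ((hV i).diffAt D.isOpen (by simp) hx), D.pd_cut]; ring
    rw [e1]
    have hx0 := D.mem_iff.1 hx
    set d := deriv Real.smoothTransition (-(D.defining x) / ε - 1) with hd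
    have hd0 : 0 ≤ d := deriv_smoothTransition_nonneg _
    have hdM : d ≤ M := (le_abs_self _).trans (hM _)
    have h2 := mul_le_mul_of_nonneg_left (h x hx) (div_nonneg hd0 hε.le)
    suffices hs : -(d / ε * (D.defining x * g x)) ≤
        ({x | -(2 * ε) < D.defining x}.indicator (fun x => (2 * M) * |g x|)) x by linarith
    by_cases hst : -(2 * ε) < D.defining x
    · rw [indicator_of_mem (by exact hst)]
      have : -(d / ε * (D.defining x * g x)) = d * (-(D.defining x) / ε) * g x := by ring
      rw [this]
      have h3 : -(D.defining x) / ε ≤ 2 := by rw [div_le_iff₀ hε]; linarith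
      have h3' : 0 ≤ -(D.defining x) / ε := div_nonneg (by linarith) hε.le
      calc d * (-(D.defining x) / ε) * g x ≤ d * (-(D.defining x) / ε) * |g x| :=
            mul_le_mul_of_nonneg_left (le_abs_self _) (by positivity)
        _ ≤ (M * 2) * |g x| := by gcongr
        _ = _ := by ring
    · rw [indicator_of_notMem (by exact hst)]
      have : d = 0 := by
        apply deriv_smoothTransition_eq_zero; right
        rw [le_sub_iff_add_le, le_div_iff₀ hε]; linarith
      simp [this]
  have hlim := (D.tendsto_cut hint).add (D.tendsto_strip (M := 2 * M) hg)
  rw [add_zero] at hlim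
  exact ge_of_tendsto' hlim key

theorem divThm_zero {V : Fin n → Eu n → ℝ} (hV : ∀ i, ContDiffOn ℝ 1 (V i) D.carrier)
    (hint : IntegrableOn (fun x => ∑ i, pd i (V i) x) D.carrier) {g : Eu n → ℝ}
    (hg : IntegrableOn g D.carrier)
    (h : ∀ x ∈ D.carrier, |∑ i, V i x * pd i D.defining x| ≤ -D.defining x * g x) :
    ∫ x in D.carrier, ∑ i, pd i (V i) x = 0 := by
  apply le_antisymm
  · have e : ∀ x, ∑ i, pd i (fun y => - V i y) x = - ∑ i, pd i (V i) x := fun x => by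
      rw [← Finset.sum_neg_distrib]; exact Finset.sum_congr rfl fun i _ => pd_neg
    have := D.divThm_nonneg (V := fun i y => - V i y) (fun i => (hV i).neg)
      (by simp only [e]; exact hint.neg) hg (fun x hx => by
        have := (abs_le.1 (h x hx)).2
        simp only [neg_mul, Finset.sum_neg_distrib]
        linarith)
    simp only [e] at this
    rw [integral_neg] at this; linarith
  · exact D.divThm_nonneg hV hint hg fun x hx => by
      have := (abs_le.1 (h x hx)).1; linarith

end SmoothDomain

/-! ## P3: L2 tools -/

section L2tools
variable {X : Type*} [MeasurableSpace X] {μ : Measure X} {f g : X → ℝ}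

lemma l2_mul (hf : MemLp f 2 μ) (hg : MemLp g 2 μ) : Integrable (fun x => f x * g x) μ :=
  hf.integrable_mul hg

lemma cs_int (hf : MemLp f 2 μ) (hg : MemLp g 2 μ) :
    (∫ x, f x * g x ∂μ) ^ 2 ≤ (∫ x, f x ^ 2 ∂μ) * ∫ x, g x ^ 2 ∂μ := by
  have h : ∀ t : ℝ, 0 ≤ (∫ x, g x ^ 2 ∂μ) * (t * t) + (2 * ∫ x, f x * g x ∂μ) * t + ∫ x, f x ^ 2 ∂μ := by
    intro t
    have : ∫ x, (f x + t * g x) ^ 2 ∂μ =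
        (∫ x, g x ^ 2 ∂μ) * (t * t) + (2 * ∫ x, f x * g x ∂μ) * t + ∫ x, f x ^ 2 ∂μ := by
      have e : ∀ x, (f x + t * g x) ^ 2 = f x ^ 2 + (2 * t) * (f x * g x) + (t * t) * g x ^ 2 := by
        intro x; ring
      simp only [e]
      have i1 : Integrable (fun x => f x ^ 2 + (2 * t) * (f x * g x)) μ :=
        hf.integrable_sq.add ((l2_mul hf hg).const_mul _)
      rw [integral_add i1 (hg.integrable_sq.const_mul _),
        integral_add hf.integrable_sq ((l2_mul hf hg).const_mul _),
        integral_const_mul, integral_const_mul]; ring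
    rw [← this]; exact integral_nonneg fun x => sq_nonneg _
  have := discrim_le_zero h
  rw [discrim] at this; nlinarith

lemma cs_abs (hf : MemLp f 2 μ) (hg : MemLp g 2 μ) :
    |∫ x, f x * g x ∂μ| ≤ √(∫ x, f x ^ 2 ∂μ) * √(∫ x, g x ^ 2 ∂μ) := by
  rw [← Real.sqrt_mul (integral_nonneg fun x => sq_nonneg _)]
  exact Real.abs_le_sqrt (cs_int hf hg)

lemma l2_bdd_mul {c : ℝ} (hg : MemLp g 2 μ) (hf : AEStronglyMeasurable f μ)
    (h : ∀ᵐ x ∂μ, |f x| ≤ c) : MemLp (fun x => f x * g x) 2 μ := by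
  refine (hg.const_mul c).mono (hf.mul hg.1) ?_
  filter_upwards [h] with x hx
  rw [norm_mul, norm_mul, Real.norm_eq_abs, Real.norm_eq_abs c]
  exact mul_le_mul_of_nonneg_right (hx.trans (le_abs_self _)) (norm_nonneg _)

/-- weak sequential compactness -/
lemma weak_subseq [IsFiniteMeasure μ] [MeasurableSpace.CountablyGenerated X] {F : ℕ → X → ℝ}
    (hF : ∀ k, MemLp (F k) 2 μ) {C : ℝ} (hC : ∀ k, ∫ x, F k x ^ 2 ∂μ ≤ C) :
    ∃ φ : ℕ → ℕ, StrictMono φ ∧ ∃ G : X → ℝ, MemLp G 2 μ ∧ ∀ h, MemLp h 2 μ →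
      Tendsto (fun k => ∫ x, F (φ k) x * h x ∂μ) atTop (𝓝 (∫ x, G x * h x ∂μ)) := by
  let u : ℕ → Lp ℝ 2 μ := fun k => (hF k).toLp (F k)
  have hin : ∀ (a b : X → ℝ) (ha : MemLp a 2 μ) (hb : MemLp b 2 μ),
      inner ℝ (ha.toLp a) (hb.toLp b) = ∫ x, a x * b x ∂μ := by
    intro a b ha hb
    rw [L2.inner_def]
    refine integral_congr_ae ?_
    filter_upwards [ha.coeFn_toLp, hb.coeFn_toLp] with x h1 h2
    rw [h1, h2]; simp [mul_comm]
  have hnorm : ∀ k, ‖u k‖ ≤ √C := by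
    intro k
    refine (le_abs_self _).trans (Real.abs_le_sqrt ?_)
    rw [← real_inner_self_eq_norm_sq, hin]
    simpa [sq] using hC k
  haveI : Fact ((2 : ENNReal) ≠ ⊤) := ⟨by simp⟩
  let L : ℕ → WeakDual ℝ (Lp ℝ 2 μ) := fun k =>
    StrongDual.toWeakDual (InnerProductSpace.toDual ℝ _ (u k))
  have hL : ∀ k, L k ∈ (WeakDual.toStrongDual ⁻¹' Metric.closedBall (0 : StrongDual ℝ (Lp ℝ 2 μ)) (√C)) := by
    intro k
    simp only [mem_preimage, Metric.mem_closedBall, dist_zero_right]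
    change ‖InnerProductSpace.toDual ℝ _ (u k)‖ ≤ _
    simpa using hnorm k
  obtain ⟨l, -, φ, hφ, hl⟩ := (WeakDual.isSeqCompact_closedBall ℝ (Lp ℝ 2 μ) 0 (√C)) hL
  let G : Lp ℝ 2 μ := (InnerProductSpace.toDual ℝ _).symm (WeakDual.toStrongDual l)
  refine ⟨φ, hφ, G, Lp.memLp G, fun h hh => ?_⟩
  have h1 := ((WeakDual.eval_continuous (𝕜 := ℝ) (hh.toLp h)).tendsto l).comp hl
  have e1 : (fun k => ∫ x, F (φ k) x * h x ∂μ) = fun k => (L (φ k)) (hh.toLp h) := by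
    ext k; rw [← hin _ _ (hF _) hh]; rfl
  have e2 : ∫ x, G x * h x ∂μ = l (hh.toLp h) := by
    rw [← hin _ _ (Lp.memLp G) hh]
    have : (Lp.memLp G).toLp G = G := Lp.toLp_coeFn G _
    rw [this]
    simp only [G]
    rw [InnerProductSpace.toDual_symm_apply]; rfl
  rw [e1, e2]; exact h1

/-- displacement estimate along a measure preserving flow -/
lemma flow_lintegral [SFinite μ] {φ : ℝ → X → X} (hφ : Measurable (fun p : ℝ × X => φ p.1 p.2))
    (hmp : ∀ s, MeasurePreserving (φ s) μ μ) (h0 : ∀ x, φ 0 x = x) {h k : X → ℝ} (hk : Measurable k)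
    (hd : ∀ᵐ x ∂μ, (∀ s, HasDerivAt (fun s => h (φ s x)) (k (φ s x)) s) ∧
      Continuous (fun s => k (φ s x))) {t : ℝ} (ht : 0 ≤ t) :
    ∫⁻ x, ENNReal.ofReal ((h (φ t x) - h x) ^ 2) ∂μ ≤
      ENNReal.ofReal (t ^ 2) * ∫⁻ x, ENNReal.ofReal (k x ^ 2) ∂μ := by
  have h1 : ∀ᵐ x ∂μ, ENNReal.ofReal ((h (φ t x) - h x) ^ 2) ≤
      ENNReal.ofReal t * ∫⁻ s in Ioc 0 t, ENNReal.ofReal (k (φ s x) ^ 2) := by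
    filter_upwards [hd] with x ⟨hx, hc⟩
    have e := intervalIntegral.integral_eq_sub_of_hasDerivAt (a := 0) (b := t)
      (fun s _ => hx s) (hc.intervalIntegrable _ _)
    simp only [h0] at e
    have hml : ∀ q : ℝ → ℝ, Continuous q → MemLp q 2 (volume.restrict (Ioc 0 t)) := fun q hq => by
      rw [memLp_two_iff_integrable_sq hq.aestronglyMeasurable]
      exact ((hq.pow 2).integrableOn_Icc).mono_set Ioc_subset_Icc_self
    have c := cs_int (hml (fun s => k (φ s x)) hc) (hml (fun _ => 1) continuous_const)
    rw [← e, intervalIntegral.integral_of_le ht]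
    simp only [mul_one, one_pow, integral_const, measureReal_restrict_apply_univ, Real.volume_real_Ioc,
      sub_zero, max_eq_left ht, smul_eq_mul] at c
    have i2 : IntegrableOn (fun s => k (φ s x) ^ 2) (Ioc 0 t) :=
      ((hc.pow 2).integrableOn_Icc).mono_set Ioc_subset_Icc_self
    rw [← ofReal_integral_eq_lintegral_ofReal i2 (ae_of_all _ fun s => sq_nonneg _),
      ← ENNReal.ofReal_mul ht]
    exact ENNReal.ofReal_le_ofReal (by linarith)
  refine (lintegral_mono_ae h1).trans ?_
  have hm2 : Measurable (fun p : X × ℝ => ENNReal.ofReal (k (φ p.2 p.1) ^ 2)) := by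
    exact ((hk.comp (hφ.comp measurable_swap)).pow_const 2).ennreal_ofReal
  rw [lintegral_const_mul _ hm2.lintegral_prod_right',
    lintegral_lintegral_swap (by exact hm2.aemeasurable)]
  have : ∀ s, ∫⁻ x, ENNReal.ofReal (k (φ s x) ^ 2) ∂μ = ∫⁻ x, ENNReal.ofReal (k x ^ 2) ∂μ := fun s =>
    (hmp s).lintegral_comp (f := fun x => ENNReal.ofReal (k x ^ 2)) ((hk.pow_const 2).ennreal_ofReal)
  simp only [this, lintegral_const, Measure.restrict_apply_univ, Real.volume_Ioc, sub_zero]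
  rw [mul_comm (∫⁻ x, _ ∂μ), ← mul_assoc, ← ENNReal.ofReal_mul ht, sq]

end L2tools

/-! ## P4: admissible functions, Rellich -/

lemma bdd_on_compact {f : Eu n → ℝ} (hf : Continuous f) {K : Set (Eu n)} (hK : IsCompact K) :
    ∃ M, 0 ≤ M ∧ ∀ x ∈ K, |f x| ≤ M := by
  obtain ⟨M, hM⟩ := hK.exists_bound_of_continuousOn hf.continuousOn
  exact ⟨max M 0, le_max_right _ _, fun x hx => (hM x hx).trans (le_max_left _ _)⟩

namespace SmoothDomain
variable (D : SmoothDomain n)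

/-- square integrable on the domain -/
abbrev L2 (f : Eu n → ℝ) : Prop := MemLp f 2 (volume.restrict D.carrier)

/-- `H¹ ∩ C¹` functions -/
structure Adm (v : Eu n → ℝ) : Prop where
  c1 : ContDiffOn ℝ 1 v D.carrier
  l2 : D.L2 v
  gl2 : ∀ i, D.L2 (pd i v)

def ip (u v : Eu n → ℝ) : ℝ := ∫ x in D.carrier, u x * v x
def dir (u v : Eu n → ℝ) : ℝ := ∫ x in D.carrier, ∑ i, pd i u x * pd i v x

variable {D}

lemma aesm_of_continuousOn {f : Eu n → ℝ} (hf : ContinuousOn f D.carrier) :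
    AEStronglyMeasurable f (volume.restrict D.carrier) := hf.aestronglyMeasurable D.measSet

lemma l2_mul_cont {a f : Eu n → ℝ} (ha : Continuous a) (hf : D.L2 f) : D.L2 (fun x => a x * f x) := by
  obtain ⟨M, _, hM⟩ := bdd_on_compact ha D.isCompact_closure
  refine l2_bdd_mul (c := M) hf ha.aestronglyMeasurable ?_
  rw [ae_restrict_iff' D.measSet]
  exact ae_of_all _ fun x hx => hM x (subset_closure hx)

lemma int_mul_cont {a f : Eu n → ℝ} (ha : Continuous a) (hf : IntegrableOn f D.carrier) :
    IntegrableOn (fun x => a x * f x) D.carrier := by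
  obtain ⟨M, _, hM⟩ := bdd_on_compact ha D.isCompact_closure
  refine Integrable.bdd_mul (c := M) hf ha.aestronglyMeasurable ?_
  rw [ae_restrict_iff' D.measSet]
  exact ae_of_all _ fun x hx => hM x (subset_closure hx)

lemma l2_cont {a : Eu n → ℝ} (ha : Continuous a) : D.L2 a := by
  simpa using l2_mul_cont (D := D) ha (memLp_const (1:ℝ))

lemma Adm.diff {v : Eu n → ℝ} (hv : D.Adm v) {x : Eu n} (hx : x ∈ D.carrier) :
    DifferentiableAt ℝ v x := hv.c1.diffAt D.isOpen (by simp) hx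

lemma l2_congr {f g : Eu n → ℝ} (hf : D.L2 f) (h : EqOn f g D.carrier) : D.L2 g := by
  refine (memLp_congr_ae ?_).1 hf
  rw [EventuallyEq, ae_restrict_iff' D.measSet]; exact ae_of_all _ h

lemma Adm.add {v w : Eu n → ℝ} (hv : D.Adm v) (hw : D.Adm w) : D.Adm (fun x => v x + w x) :=
  ⟨hv.c1.add hw.c1, hv.l2.add hw.l2, fun i => l2_congr ((hv.gl2 i).add (hw.gl2 i))
    fun x hx => (pd_add (hv.diff hx) (hw.diff hx)).symm⟩

lemma Adm.const_mul {v : Eu n → ℝ} (hv : D.Adm v) (c : ℝ) : D.Adm (fun x => c * v x) :=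
  ⟨contDiffOn_const.mul hv.c1, hv.l2.const_mul c, fun i => l2_congr ((hv.gl2 i).const_mul c)
    fun x hx => (pd_const_mul c (hv.diff hx)).symm⟩

lemma Adm.sub {v w : Eu n → ℝ} (hv : D.Adm v) (hw : D.Adm w) : D.Adm (fun x => v x - w x) :=
  ⟨hv.c1.sub hw.c1, hv.l2.sub hw.l2, fun i => l2_congr ((hv.gl2 i).sub (hw.gl2 i))
    fun x hx => (pd_sub (hv.diff hx) (hw.diff hx)).symm⟩

lemma adm_of_contDiff {v : Eu n → ℝ} (hv : ContDiff ℝ 1 v) : D.Adm v :=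
  ⟨hv.contDiffOn, l2_cont hv.continuous, fun i => l2_cont (pd_continuous hv)⟩

lemma int_dir {v w : Eu n → ℝ} (hv : D.Adm v) (hw : D.Adm w) :
    IntegrableOn (fun x => ∑ i, pd i v x * pd i w x) D.carrier :=
  integrable_finsetSum _ fun i _ => l2_mul (hv.gl2 i) (hw.gl2 i)

lemma int_ip {v w : Eu n → ℝ} (hv : D.Adm v) (hw : D.Adm w) :
    IntegrableOn (fun x => v x * w x) D.carrier := l2_mul hv.l2 hw.l2

lemma exists_grad_lower (D : SmoothDomain n) : ∃ c > 0, ∃ ε > 0, ∀ x ∈ closure D.carrier, -ε ≤ D.defining x →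
    c ≤ ∑ i, (pd i D.defining x) ^ 2 := by
  by_contra! H
  have H' : ∀ k : ℕ, ∃ x ∈ closure D.carrier, -(1 / ((k:ℝ) + 1)) ≤ D.defining x ∧
      ∑ i, (pd i D.defining x) ^ 2 < 1 / ((k:ℝ) + 1) := fun k =>
    H _ (by positivity) _ (by positivity)
  choose x hx h1 h2 using H'
  obtain ⟨z, hz, φ, hφ, hl⟩ := D.isCompact_closure.tendsto_subseq hx
  have hlim := (tendsto_one_div_add_atTop_nhds_zero_nat (𝕜 := ℝ)).comp hφ.tendsto_atTop
  have h3 : 0 ≤ D.defining z := by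
    have := ge_of_tendsto (b := (0:ℝ)) (((D.rho_cont.tendsto z).comp hl).add hlim)
      (Eventually.of_forall fun k => by have := h1 (φ k); simp only [Function.comp] at *; linarith)
    simpa using this
  have h4 : ∑ i, (pd i D.defining z) ^ 2 ≤ 0 := by
    have hc : Continuous fun x => ∑ i, (pd i D.defining x) ^ 2 :=
      continuous_finsetSum _ fun i _ => (pd_continuous D.rho_c1).pow 2
    exact le_of_tendsto_of_tendsto' ((hc.tendsto z).comp hl) hlim fun k => (h2 (φ k)).le
  have hzf : z ∈ frontier D.carrier := by
    rw [D.frontier_eq]; rw [D.closure_eq] at hz; exact le_antisymm hz h3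
  apply D.fderiv_ne hzf
  have := norm_fderiv_sq D.defining z
  have h5 : ‖fderiv ℝ D.defining z‖ = 0 := by nlinarith [norm_nonneg (fderiv ℝ D.defining z)]
  exact norm_eq_zero.1 h5

/-- concentration near the boundary is controlled -/
lemma strip_estimate (D : SmoothDomain n) : ∃ C > 0, ∃ ε₀ > 0, ∀ ε, 0 < ε → ε < ε₀ → ∀ v, D.Adm v →
    ∫ x in D.carrier, ({x | -ε < D.defining x}.indicator (fun x => v x ^ 2)) x ≤
      C * ε * (D.ip v v + D.dir v v) := by
  obtain ⟨c, hc, ε₀, hε₀, hlow⟩ := exists_grad_lower D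
  have hcl : Continuous fun x => ∑ i, pd i (pd i D.defining) x :=
    continuous_finsetSum _ fun i _ => (pd_contDiff (pd_contDiff D.smooth_defining)).continuous
  have hcg : Continuous fun x => ∑ i, (pd i D.defining x) ^ 2 :=
    continuous_finsetSum _ fun i _ => (pd_continuous D.rho_c1).pow 2
  obtain ⟨M1, hM10, hM1⟩ := bdd_on_compact hcl D.isCompact_closure
  obtain ⟨M2, hM20, hM2⟩ := bdd_on_compact hcg D.isCompact_closure
  refine ⟨Real.exp 1 / c * (M1 + M2 + 1), by positivity, ε₀, hε₀, fun ε hε hεε v hv => ?_⟩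
  let ψ : Eu n → ℝ := fun x => ε * (Real.exp (D.defining x / ε) - 1)
  have hψs : ContDiff ℝ (⊤ : ℕ∞) ψ := contDiff_const.mul
    ((Real.contDiff_exp.comp (D.smooth_defining.div_const _)).sub contDiff_const)
  have hψd : ∀ i x, pd i ψ x = Real.exp (D.defining x / ε) * pd i D.defining x := by
    intro i x
    have h1 : HasDerivAt (fun t : ℝ => ε * (Real.exp (t / ε) - 1)) (Real.exp (D.defining x / ε)) (D.defining x) := by
      have := ((((hasDerivAt_id (D.defining x)).div_const ε).exp).sub_const 1).const_mul ε
      exact this.congr_deriv (by simp only [id]; field_simp)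
    exact pd_comp h1 (D.rho_diff x)
  have hψ1 : ∀ x ∈ D.carrier, |ψ x| ≤ ε := by
    intro x hx
    have := D.mem_iff.1 hx
    have h1 : Real.exp (D.defining x / ε) ≤ 1 := Real.exp_le_one_iff.2 (div_nonpos_of_nonpos_of_nonneg this.le hε.le)
    have h2 := Real.exp_pos (D.defining x / ε)
    simp only [ψ]; rw [abs_le]; constructor <;> nlinarith
  have hψ2 : ∀ x ∈ D.carrier, |ψ x| ≤ -D.defining x := by
    intro x hx
    have := D.mem_iff.1 hx
    have h1 : Real.exp (D.defining x / ε) ≤ 1 := Real.exp_le_one_iff.2 (div_nonpos_of_nonpos_of_nonneg this.le hε.le)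
    have h2 := Real.add_one_le_exp (D.defining x / ε)
    have h3 : ε * (D.defining x / ε) = D.defining x := by field_simp
    simp only [ψ]; rw [abs_le]; constructor <;> nlinarith
  let V : Fin n → Eu n → ℝ := fun i x => (ψ x * pd i D.defining x) * (v x * v x)
  have hψ' : ∀ x, DifferentiableAt ℝ ψ x := fun x => hψs.differentiable (by simp) x
  have hρ' : ∀ i x, DifferentiableAt ℝ (pd i D.defining) x := fun i x =>
    (pd_contDiff D.smooth_defining).differentiable (by simp) x
  have hdiv : ∀ x ∈ D.carrier, ∑ i, pd i (V i) x =
      Real.exp (D.defining x / ε) * (∑ i, (pd i D.defining x) ^ 2) * (v x * v x)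
      + ψ x * (∑ i, pd i (pd i D.defining) x) * (v x * v x)
      + 2 * ψ x * ∑ i, (pd i D.defining x) * (v x * pd i v x) := by
    intro x hx
    simp only [Finset.mul_sum, Finset.sum_mul, ← Finset.sum_add_distrib]
    refine Finset.sum_congr rfl fun i _ => ?_
    have hvd := hv.diff hx
    change pd i (fun y => (ψ y * pd i D.defining y) * (v y * v y)) x = _
    rw [pd_mul ((hψ' x).fun_mul (hρ' i x)) (hvd.fun_mul hvd), pd_mul hvd hvd, pd_mul (hψ' x) (hρ' i x), hψd]
    ring
  have hvv := int_ip hv hv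
  have I1 : IntegrableOn (fun x => Real.exp (D.defining x / ε) * (∑ i, (pd i D.defining x) ^ 2) * (v x * v x)) D.carrier :=
    int_mul_cont ((Real.continuous_exp.comp (D.rho_cont.div_const _)).mul hcg) hvv
  have I2 : IntegrableOn (fun x => ψ x * (∑ i, pd i (pd i D.defining) x) * (v x * v x)) D.carrier :=
    int_mul_cont (hψs.continuous.mul hcl) hvv
  have I3 : IntegrableOn (fun x => 2 * ψ x * ∑ i, (pd i D.defining x) * (v x * pd i v x)) D.carrier :=
    int_mul_cont (continuous_const.mul hψs.continuous) (integrable_finsetSum _ fun i _ =>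
      int_mul_cont (pd_continuous D.rho_c1) (l2_mul hv.l2 (hv.gl2 i)))
  have hz := D.divThm_zero (V := V) (g := fun x => M2 * (v x * v x)) (fun i =>
      (((hψs.mul (pd_contDiff D.smooth_defining)).of_le (by exact_mod_cast le_top)).contDiffOn.mul
        (hv.c1.mul hv.c1)))
    ((integrableOn_congr_fun hdiv D.measSet).2 ((I1.add I2).add I3)) (hvv.const_mul _) (by
      intro x hx
      have e : ∑ i, V i x * pd i D.defining x = ψ x * (∑ i, (pd i D.defining x) ^ 2) * (v x * v x) := by
        simp only [Finset.mul_sum, Finset.sum_mul]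
        exact Finset.sum_congr rfl fun i _ => by simp only [V]; ring
      rw [e, abs_mul, abs_mul, abs_mul_self]
      have := hψ2 x hx
      have h2 := hM2 x (subset_closure hx)
      have h3 := D.mem_iff.1 hx
      calc _ ≤ (-D.defining x) * M2 * (v x * v x) := by
            apply mul_le_mul_of_nonneg_right _ (mul_self_nonneg _)
            exact mul_le_mul this h2 (abs_nonneg _) (by linarith)
        _ = _ := by ring)
  rw [setIntegral_congr_fun D.measSet hdiv] at hz
  have hdd := int_dir hv hv
  have hsum : D.ip v v + D.dir v v = ∫ x in D.carrier, (v x * v x + ∑ i, pd i v x * pd i v x) := by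
    rw [integral_add hvv hdd]; rfl
  have key : (∫ x in D.carrier, ({x | -ε < D.defining x}.indicator (fun x => v x ^ 2)) x) ≤
      ∫ x in D.carrier, (Real.exp 1 / c) * (((Real.exp (D.defining x / ε) * (∑ i, (pd i D.defining x) ^ 2) * (v x * v x)
      + ψ x * (∑ i, pd i (pd i D.defining) x) * (v x * v x)
      + 2 * ψ x * ∑ i, (pd i D.defining x) * (v x * pd i v x))) +
       ((M1 + M2 + 1) * ε) * (v x * v x + ∑ i, pd i v x * pd i v x)) := by
    refine setIntegral_mono_on ?_ ((((I1.add I2).add I3).add ((hvv.add hdd).const_mul _)).const_mul _) D.measSet ?_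
    · exact (hv.l2.integrable_sq).indicator (isOpen_lt continuous_const D.rho_cont).measurableSet
    · intro x hx
      have hx0 := D.mem_iff.1 hx
      have b1 : -(ε * M1 * (v x * v x)) ≤ ψ x * (∑ i, pd i (pd i D.defining) x) * (v x * v x) := by
        have : |ψ x * (∑ i, pd i (pd i D.defining) x) * (v x * v x)| ≤ ε * M1 * (v x * v x) := by
          rw [abs_mul, abs_mul, abs_mul_self]
          exact mul_le_mul_of_nonneg_right (mul_le_mul (hψ1 x hx) (hM1 x (subset_closure hx))
            (abs_nonneg _) hε.le) (mul_self_nonneg _)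
        exact (abs_le.1 this).1
      have b2 : -(ε * (M2 * (v x * v x) + ∑ i, pd i v x * pd i v x)) ≤
          2 * ψ x * ∑ i, (pd i D.defining x) * (v x * pd i v x) := by
        have h1 : |2 * ψ x * ∑ i, (pd i D.defining x) * (v x * pd i v x)| ≤
            ε * |∑ i, 2 * ((pd i D.defining x) * (v x * pd i v x))| := by
          rw [← Finset.mul_sum, abs_mul (2 * ψ x), abs_mul 2 (ψ x), abs_mul 2 (Finset.sum _ _)]
          have := mul_le_mul_of_nonneg_right (hψ1 x hx)
            (abs_nonneg (∑ i, (pd i D.defining x) * (v x * pd i v x)))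
          rw [abs_two]; linarith
        have h2 : |∑ i, 2 * ((pd i D.defining x) * (v x * pd i v x))| ≤
            M2 * (v x * v x) + ∑ i, pd i v x * pd i v x := by
          have h3 : |∑ i, 2 * ((pd i D.defining x) * (v x * pd i v x))| ≤
            ∑ i, ((pd i D.defining x) ^ 2 * (v x * v x) + pd i v x * pd i v x) := by
            refine (Finset.abs_sum_le_sum_abs _ _).trans (Finset.sum_le_sum fun i _ => ?_)
            rw [abs_le]; constructor <;>
            nlinarith [sq_nonneg (pd i D.defining x * v x - pd i v x),
              sq_nonneg (pd i D.defining x * v x + pd i v x)]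
          rw [Finset.sum_add_distrib, ← Finset.sum_mul] at h3
          have := mul_le_mul_of_nonneg_right ((le_abs_self _).trans (hM2 x (subset_closure hx)))
            (mul_self_nonneg (v x))
          linarith
        exact (abs_le.1 (h1.trans (mul_le_mul_of_nonneg_left h2 hε.le))).1
      have hgn : 0 ≤ ∑ i, pd i v x * pd i v x := Finset.sum_nonneg fun i _ => mul_self_nonneg _
      have hv0 := mul_self_nonneg (v x)
      set T1 := Real.exp (D.defining x / ε) * (∑ i, (pd i D.defining x) ^ 2) * (v x * v x) with hT1
      have hT1n : 0 ≤ T1 := by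
        have : 0 ≤ ∑ i, (pd i D.defining x) ^ 2 := Finset.sum_nonneg fun i _ => sq_nonneg _
        positivity
      have hbig : T1 ≤ (T1 + ψ x * (∑ i, pd i (pd i D.defining) x) * (v x * v x)
          + 2 * ψ x * ∑ i, (pd i D.defining x) * (v x * pd i v x)) +
          ((M1 + M2 + 1) * ε) * (v x * v x + ∑ i, pd i v x * pd i v x) := by
        nlinarith [mul_nonneg (mul_nonneg hM10 hε.le) hgn, mul_nonneg (mul_nonneg hM20 hε.le) hgn,
          mul_nonneg hε.le hv0]
      refine le_trans ?_ (mul_le_mul_of_nonneg_left hbig (by positivity))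
      by_cases hst : -ε < D.defining x
      · rw [indicator_of_mem (by exact hst)]
        have e1 : Real.exp (-1) ≤ Real.exp (D.defining x / ε) := by
          apply Real.exp_le_exp.2; rw [le_div_iff₀ hε]; linarith
        have e2 := hlow x (subset_closure hx) (by linarith)
        have e3 : Real.exp (-1) * c * (v x * v x) ≤ T1 :=
          mul_le_mul_of_nonneg_right (mul_le_mul e1 e2 hc.le (Real.exp_pos _).le) hv0
        have e4 : Real.exp 1 / c * (Real.exp (-1) * c * (v x * v x)) = v x ^ 2 := by
          have : Real.exp 1 * Real.exp (-1) = 1 := by rw [← Real.exp_add]; simp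
          field_simp
          linear_combination (v x ^ 2) * this
        rw [← e4]; exact mul_le_mul_of_nonneg_left e3 (by positivity)
      · rw [indicator_of_notMem (by exact hst)]; positivity
  refine key.trans (le_of_eq ?_)
  have hI := (I1.add I2).add I3
  rw [integral_const_mul]
  have : ∫ x in D.carrier, (((Real.exp (D.defining x / ε) * (∑ i, (pd i D.defining x) ^ 2) * (v x * v x)
      + ψ x * (∑ i, pd i (pd i D.defining) x) * (v x * v x)
      + 2 * ψ x * ∑ i, (pd i D.defining x) * (v x * pd i v x))) +
       ((M1 + M2 + 1) * ε) * (v x * v x + ∑ i, pd i v x * pd i v x)) =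
       0 + ((M1 + M2 + 1) * ε) * (D.ip v v + D.dir v v) := by
    rw [← hz, hsum, ← integral_const_mul]
    exact integral_add hI ((hvv.add hdd).const_mul _)
  rw [this]; ring

end SmoothDomain

/-! ## P5: mollification -/

def moll (k f : Eu n → ℝ) (x : Eu n) : ℝ := ∫ y, k (x - y) * f y

lemma moll_eq_conv (k f : Eu n → ℝ) : moll k f = convolution f k (ContinuousLinearMap.mul ℝ ℝ) volume := by
  ext x; simp only [moll, convolution_def, ContinuousLinearMap.mul_apply', mul_comm]

lemma moll_smooth {k f : Eu n → ℝ} (hk : ContDiff ℝ (⊤ : ℕ∞) k) (hc : HasCompactSupport k)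
    (hf : LocallyIntegrable f) : ContDiff ℝ (⊤ : ℕ∞) (moll k f) := by
  rw [moll_eq_conv]; exact hc.contDiff_convolution_right _ hf hk

lemma pd_compactSupport {k : Eu n → ℝ} (hc : HasCompactSupport k) (i : Fin n) :
    HasCompactSupport (pd i k) := hc.fderiv_apply (𝕜 := ℝ) _

lemma sq_integral_le {X : Type*} [MeasurableSpace X] {ν : Measure X} [IsProbabilityMeasure ν]
    {g : X → ℝ} (hg : AEStronglyMeasurable g ν) :
    ENNReal.ofReal ((∫ x, g x ∂ν) ^ 2) ≤ ∫⁻ x, ENNReal.ofReal (g x ^ 2) ∂ν := by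
  by_cases h : MemLp g 2 ν
  · have h1 := cs_int h (memLp_const (1:ℝ))
    rw [← ofReal_integral_eq_lintegral_ofReal h.integrable_sq (ae_of_all _ fun x => sq_nonneg _)]
    apply ENNReal.ofReal_le_ofReal
    simpa using h1
  · have : ∫⁻ x, ENNReal.ofReal (g x ^ 2) ∂ν = ⊤ := by
      by_contra h'
      apply h
      rw [memLp_two_iff_integrable_sq hg]
      refine ⟨hg.pow 2, ?_⟩
      rw [hasFiniteIntegral_iff_ofReal (ae_of_all _ fun x => sq_nonneg _)]
      exact lt_top_iff_ne_top.2 h'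
    rw [this]; exact le_top

section
variable (b : ContDiffBump (0 : Eu n))

/-- standard mollifier -/
def eta : Eu n → ℝ := b.normed volume

lemma eta_smooth : ContDiff ℝ (⊤ : ℕ∞) (eta b) := b.contDiff_normed
lemma eta_cs : HasCompactSupport (eta b) := b.hasCompactSupport_normed
lemma eta_nonneg (x : Eu n) : 0 ≤ eta b x := b.nonneg_normed x
lemma eta_int : ∫ x, eta b x = 1 := b.integral_normed
lemma eta_cont : Continuous (eta b) := (eta_smooth b).continuous
lemma eta_zero {x : Eu n} (hx : b.rOut ≤ ‖x‖) : eta b x = 0 := by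
  have := b.support_normed_eq (μ := volume)
  by_contra h
  have : x ∈ Function.support (b.normed volume) := h
  rw [b.support_normed_eq] at this
  simp at this; linarith

def nu : Measure (Eu n) := volume.withDensity fun y => ENNReal.ofReal (eta b y)

lemma eta_integrable : Integrable (eta b) := (eta_cont b).integrable_of_hasCompactSupport (eta_cs b)

instance : IsProbabilityMeasure (nu b) := ⟨by
  rw [nu, withDensity_apply _ MeasurableSet.univ, setLIntegral_univ,
    ← ofReal_integral_eq_lintegral_ofReal (eta_integrable b) (ae_of_all _ (eta_nonneg b)), eta_int]; simp⟩

lemma eta_meas : Measurable fun y => ENNReal.ofReal (eta b y) := (eta_cont b).measurable.ennreal_ofReal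

lemma integral_nu (g : Eu n → ℝ) : ∫ y, g y ∂(nu b) = ∫ y, eta b y * g y := by
  rw [nu, integral_withDensity_eq_integral_toReal_smul (eta_meas b) (ae_of_all _ fun _ => by simp)]
  simp only [ENNReal.toReal_ofReal (eta_nonneg b _), smul_eq_mul]

lemma moll_eq_nu (f : Eu n → ℝ) (x : Eu n) : moll (eta b) f x = ∫ y, f (x - y) ∂(nu b) := by
  rw [integral_nu, moll, ← integral_sub_left_eq_self (fun y => eta b (x - y) * f y) volume x]
  simp

lemma integrable_nu {f : Eu n → ℝ} (hf : LocallyIntegrable f) (x : Eu n) :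
    Integrable (fun y => f (x - y)) (nu b) := by
  rw [nu, integrable_withDensity_iff_integrable_smul' (eta_meas b) (ae_of_all _ fun _ => by simp)]
  simp only [ENNReal.toReal_ofReal (eta_nonneg b _), smul_eq_mul]
  have h1 : LocallyIntegrable (fun y => f (x - y)) := by
    rw [locallyIntegrable_iff]
    intro K hK
    have hK' : IsCompact ((fun y => x - y) '' K) := hK.image (by fun_prop)
    have := (locallyIntegrable_iff.1 hf) _ hK'
    have mp := Measure.measurePreserving_sub_left (volume : Measure (Eu n)) x
    have e : MeasurableEmbedding (fun y : Eu n => x - y) := (Homeomorph.subLeft x).measurableEmbedding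
    exact (mp.integrableOn_image e).1 this
  exact h1.integrable_smul_left_of_hasCompactSupport (eta_cont b) (eta_cs b)

lemma moll_sub_self {f : Eu n → ℝ} (hf : LocallyIntegrable f) (x : Eu n) :
    moll (eta b) f x - f x = ∫ y, (f (x - y) - f x) ∂(nu b) := by
  rw [integral_sub (integrable_nu b hf x) (integrable_const _), moll_eq_nu]; simp

lemma lintegral_nu {g : Eu n → ENNReal} (hg : Measurable g) : ∫⁻ y, g y ∂(nu b) = ∫⁻ y, ENNReal.ofReal (eta b y) * g y := by
  rw [nu, lintegral_withDensity_eq_lintegral_mul _ (eta_meas b) hg]; rfl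

lemma moll_err {f : Eu n → ℝ} (hm : Measurable f) (hf : LocallyIntegrable f) {C : ℝ} (hC : 0 ≤ C)
    (hT : ∀ y, ∫⁻ x, ENNReal.ofReal ((f (x - y) - f x) ^ 2) ≤ ENNReal.ofReal (C * ‖y‖ ^ 2)) :
    ∫⁻ x, ENNReal.ofReal ((moll (eta b) f x - f x) ^ 2) ≤ ENNReal.ofReal (C * b.rOut ^ 2) := by
  have hm2 : Measurable fun p : Eu n × Eu n => ENNReal.ofReal ((f (p.1 - p.2) - f p.1) ^ 2) := by fun_prop
  calc _ ≤ ∫⁻ x, ∫⁻ y, ENNReal.ofReal ((f (x - y) - f x) ^ 2) ∂(nu b) := by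
        refine lintegral_mono fun x => ?_
        rw [moll_sub_self b hf]
        exact sq_integral_le (Measurable.aestronglyMeasurable (by fun_prop))
    _ = ∫⁻ y, ∫⁻ x, ENNReal.ofReal ((f (x - y) - f x) ^ 2) ∂volume ∂(nu b) :=
        lintegral_lintegral_swap hm2.aemeasurable
    _ ≤ ∫⁻ y, ENNReal.ofReal (C * ‖y‖ ^ 2) ∂(nu b) := lintegral_mono fun y => hT y
    _ = ∫⁻ y, ENNReal.ofReal (eta b y) * ENNReal.ofReal (C * ‖y‖ ^ 2) := lintegral_nu b (by fun_prop)
    _ ≤ ∫⁻ y, ENNReal.ofReal (eta b y) * ENNReal.ofReal (C * b.rOut ^ 2) := by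
        refine lintegral_mono fun y => ?_
        by_cases hy : b.rOut ≤ ‖y‖
        · simp [eta_zero b hy]
        · push Not at hy
          gcongr
    _ = ∫⁻ y, ENNReal.ofReal (C * b.rOut ^ 2) ∂(nu b) := (lintegral_nu b measurable_const).symm
    _ = _ := by simp

end

lemma trans_bound {f : Eu n → ℝ} (hf : ContDiff ℝ 1 f) (hs : HasCompactSupport f) (y : Eu n) :
    ∫⁻ x, ENNReal.ofReal ((f (x - y) - f x) ^ 2) ≤
      ENNReal.ofReal ((∫ x, ∑ i, pd i f x ^ 2) * ‖y‖ ^ 2) := by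
  have hcd : Continuous (fun x => fderiv ℝ f x (-y)) := (hf.continuous_fderiv (by simp)).clm_apply continuous_const
  have h := flow_lintegral (μ := (volume : Measure (Eu n))) (φ := fun s x => x - s • y) (h := f)
    (k := fun x => fderiv ℝ f x (-y)) (t := 1) (by fun_prop)
    (fun s => measurePreserving_sub_right _ _) (by simp) hcd.measurable
    (ae_of_all _ fun x => ⟨fun s => by
      have h1 : HasDerivAt (fun s : ℝ => x - s • y) (-y) s := by
        have := ((hasDerivAt_id s).smul_const y).const_sub x
        simpa using this
      exact ((hf.differentiable (by simp)) (x - s • y)).hasFDerivAt.comp_hasDerivAt s h1,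
      hcd.comp (by fun_prop)⟩) zero_le_one
  simp only [one_smul, one_pow, ENNReal.ofReal_one, one_mul] at h
  refine h.trans ?_
  have hcs : Continuous (fun x => ∑ i, pd i f x ^ 2) := continuous_finsetSum _ fun i _ => (pd_continuous hf).pow 2
  have hint : Integrable (fun x => ∑ i, pd i f x ^ 2) :=
    integrable_finsetSum _ fun i _ => ((pd_continuous hf).pow 2).integrable_of_hasCompactSupport
      (by simpa [pow_two] using (pd_compactSupport hs i).mul_right (f' := pd i f))
  rw [← integral_mul_const, ofReal_integral_eq_lintegral_ofReal (hint.mul_const _)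
    (ae_of_all _ fun x => mul_nonneg (Finset.sum_nonneg fun i _ => sq_nonneg _) (sq_nonneg _))]
  refine lintegral_mono fun x => ENNReal.ofReal_le_ofReal ?_
  rw [← norm_fderiv_sq, ← mul_pow]
  have := (fderiv ℝ f x).le_opNorm (-y)
  rw [norm_neg, Real.norm_eq_abs] at this
  exact sq_le_sq' (by linarith [abs_le.1 this]) (by linarith [abs_le.1 this])

/-! ## P5b: Rellich -/

lemma real_of_lint {X : Type*} [MeasurableSpace X] {μ : Measure X} {g : X → ℝ} {C : ℝ} (hC : 0 ≤ C)
    (hm : AEStronglyMeasurable g μ) (h0 : ∀ x, 0 ≤ g x)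
    (h : ∫⁻ x, ENNReal.ofReal (g x) ∂μ ≤ ENNReal.ofReal C) : Integrable g μ ∧ ∫ x, g x ∂μ ≤ C := by
  refine ⟨⟨hm, ?_⟩, ?_⟩
  · rw [hasFiniteIntegral_iff_ofReal (ae_of_all _ h0)]
    exact h.trans_lt ENNReal.ofReal_lt_top
  · rw [integral_eq_lintegral_of_nonneg_ae (ae_of_all _ h0) hm]
    exact ENNReal.toReal_le_of_le_ofReal hC h

lemma exists_bump {r : ℝ} (hr : 0 < r) : ∃ b : ContDiffBump (0 : Eu n), b.rOut = r :=
  ⟨⟨r / 2, r, by positivity, by linarith⟩, rfl⟩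

namespace SmoothDomain
variable {D : SmoothDomain n}

lemma ip_nonneg (v : Eu n → ℝ) : 0 ≤ D.ip v v := integral_nonneg fun x => mul_self_nonneg _
lemma dir_nonneg (v : Eu n → ℝ) : 0 ≤ D.dir v v :=
  integral_nonneg fun x => Finset.sum_nonneg fun i _ => mul_self_nonneg _

lemma ip_sub_le {v w : Eu n → ℝ} (hv : D.Adm v) (hw : D.Adm w) :
    D.ip (fun x => v x - w x) (fun x => v x - w x) ≤ 2 * D.ip v v + 2 * D.ip w w := by
  rw [ip, ip, ip, ← integral_const_mul, ← integral_const_mul, ← integral_add ((int_ip hv hv).const_mul 2) ((int_ip hw hw).const_mul 2)]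
  refine integral_mono (int_ip (hv.sub hw) (hv.sub hw)) (((int_ip hv hv).const_mul 2).add ((int_ip hw hw).const_mul 2)) fun x => ?_
  simp only [Pi.add_apply]
  nlinarith [sq_nonneg (v x + w x)]

lemma dir_sub_le {v w : Eu n → ℝ} (hv : D.Adm v) (hw : D.Adm w) :
    D.dir (fun x => v x - w x) (fun x => v x - w x) ≤ 2 * D.dir v v + 2 * D.dir w w := by
  rw [dir, dir, dir, ← integral_const_mul, ← integral_const_mul, ← integral_add ((int_dir hv hv).const_mul 2) ((int_dir hw hw).const_mul 2)]
  refine setIntegral_mono_on (int_dir (hv.sub hw) (hv.sub hw)) (((int_dir hv hv).const_mul 2).add ((int_dir hw hw).const_mul 2)) D.measSet fun x hx => ?_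
  simp only [Pi.add_apply, Finset.mul_sum, ← Finset.sum_add_distrib]
  refine Finset.sum_le_sum fun i _ => ?_
  rw [pd_sub (hv.diff hx) (hw.diff hx)]
  nlinarith [sq_nonneg (pd i v x + pd i w x)]

lemma cut_off {δ : ℝ} (hδ : 0 < δ) {x : Eu n} (hx : x ∉ D.carrier) : D.cut δ x = 0 := by
  apply D.cut_zero hδ; rw [D.mem_iff] at hx; linarith

lemma pd_cut_mul_off {δ : ℝ} (hδ : 0 < δ) {x : Eu n} (hx : x ∉ D.carrier) (v : Eu n → ℝ) (i : Fin n) :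
    pd i (fun y => D.cut δ y * v y) x = 0 := by
  have : (fun y => D.cut δ y * v y) =ᶠ[𝓝 x] fun _ => 0 := by
    rw [D.mem_iff] at hx
    filter_upwards [(isOpen_lt continuous_const D.rho_cont : IsOpen {y | -δ < D.defining y}).mem_nhds
      (by simp only [mem_setOf_eq]; linarith)] with y hy
    rw [D.cut_zero hδ (le_of_lt hy), zero_mul]
  rw [pd_congr this, pd_const]

lemma cut_grad_bound (D : SmoothDomain n) {δ : ℝ} (hδ : 0 < δ) : ∃ M ≥ 0, ∀ v, D.Adm v →
    ∫ x, ∑ i, pd i (fun y => D.cut δ y * v y) x ^ 2 ≤ M * (D.ip v v + D.dir v v) := by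
  have hc1 : ContDiff ℝ 1 (D.cut δ) := (D.cut_contDiff δ).of_le (by exact_mod_cast le_top)
  have hcg : Continuous fun x => ∑ i, (pd i (D.cut δ) x) ^ 2 :=
    continuous_finsetSum _ fun i _ => (pd_continuous hc1).pow 2
  obtain ⟨M, hM0, hM⟩ := bdd_on_compact hcg D.isCompact_closure
  refine ⟨2 * M + 2, by positivity, fun v hv => ?_⟩
  rw [← setIntegral_eq_integral_of_forall_compl_eq_zero (s := D.carrier) (fun x hx =>
    Finset.sum_eq_zero fun i _ => by rw [pd_cut_mul_off hδ hx]; simp)]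
  have hcv : D.Adm (fun y => D.cut δ y * v y) := adm_of_contDiff
    (D.cut_mul_contDiff hδ (by exact_mod_cast le_top) hv.c1)
  have hs : D.ip v v + D.dir v v = ∫ x in D.carrier, (v x * v x + ∑ i, pd i v x * pd i v x) := by
    rw [integral_add (int_ip hv hv) (int_dir hv hv)]; rfl
  rw [hs, ← integral_const_mul]
  refine setIntegral_mono_on ?_ (((int_ip hv hv).add (int_dir hv hv)).const_mul _) D.measSet fun x hx => ?_
  · simpa only [pow_two] using int_dir hcv hcv
  · have h1 : ∑ i, pd i (fun y => D.cut δ y * v y) x ^ 2 ≤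
        ∑ i, (2 * (pd i (D.cut δ) x) ^ 2 * (v x * v x) + 2 * (pd i v x * pd i v x)) := by
      refine Finset.sum_le_sum fun i _ => ?_
      rw [pd_mul (hc1.differentiable (by simp) x) (hv.diff hx)]
      have a := D.cut_nonneg δ x
      have b := D.cut_le_one δ x
      have : (D.cut δ x * pd i v x) ^ 2 ≤ (pd i v x) ^ 2 := by
        rw [mul_pow]; exact mul_le_of_le_one_left (sq_nonneg _) (by nlinarith)
      nlinarith [sq_nonneg (D.cut δ x * pd i v x - pd i (D.cut δ) x * v x)]
    refine h1.trans ?_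
    rw [Finset.sum_add_distrib, ← Finset.sum_mul, ← Finset.mul_sum, ← Finset.mul_sum]
    have h2 := (le_abs_self _).trans (hM x (subset_closure hx))
    have h3 : 0 ≤ ∑ i, pd i v x * pd i v x := Finset.sum_nonneg fun i _ => mul_self_nonneg _
    nlinarith [mul_le_mul_of_nonneg_right h2 (mul_self_nonneg (v x)), mul_nonneg hM0 h3, mul_self_nonneg (v x)]

/-- the key splitting estimate -/
lemma split_est (D : SmoothDomain n) {ε : ℝ} (hε : 0 < ε) : ∃ δ > 0, ∃ b : ContDiffBump (0 : Eu n), ∀ v, D.Adm v →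
    D.ip v v ≤ ε * (D.ip v v + D.dir v v) +
      4 * ∫ x in D.carrier, (moll (eta b) (fun y => D.cut δ y * v y) x) ^ 2 := by
  obtain ⟨C, hC, ε₀, hε₀, hst⟩ := strip_estimate D
  obtain ⟨δ, hδ, hδ1, hδ2⟩ : ∃ δ > 0, 2 * δ < ε₀ ∧ 2 * (C * (2 * δ)) ≤ ε / 2 := by
    refine ⟨min (ε₀ / 4) (ε / (8 * C)), by positivity, ?_, ?_⟩
    · have := min_le_left (ε₀ / 4) (ε / (8 * C)); linarith
    · have := min_le_right (ε₀ / 4) (ε / (8 * C))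
      have h2 : C * (ε / (8 * C)) = ε / 8 := by field_simp
      nlinarith [mul_le_mul_of_nonneg_left this hC.le]
  obtain ⟨M, hM0, hM⟩ := cut_grad_bound D hδ
  obtain ⟨r, hr, hr1⟩ : ∃ r > 0, 4 * (M * r ^ 2) ≤ ε / 2 := by
    have ht : Tendsto (fun r : ℝ => 4 * (M * r ^ 2)) (𝓝[>] 0) (𝓝 0) := by
      have : Continuous fun r : ℝ => 4 * (M * r ^ 2) := by fun_prop
      have h := this.tendsto 0
      simp at h; exact h.mono_left nhdsWithin_le_nhds
    obtain ⟨r, h1, h2⟩ := ((ht.eventually (gt_mem_nhds (by positivity : 0 < ε / 2))).and self_mem_nhdsWithin).exists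
    exact ⟨r, h2, h1.le⟩
  obtain ⟨b, hb⟩ := exists_bump (n := n) hr
  refine ⟨δ, hδ, b, fun v hv => ?_⟩
  set f : Eu n → ℝ := fun y => D.cut δ y * v y with hf
  have hfc : ContDiff ℝ 1 f := D.cut_mul_contDiff hδ (by exact_mod_cast le_top) hv.c1
  have hfs : HasCompactSupport f := (D.cut_compactSupport hδ).mul_right
  have hfl : LocallyIntegrable f := hfc.continuous.locallyIntegrable
  have hA : ContDiff ℝ (⊤ : ℕ∞) (moll (eta b) f) := moll_smooth (eta_smooth b) (eta_cs b) hfl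
  have hS : 0 ≤ D.ip v v + D.dir v v := add_nonneg (ip_nonneg v) (dir_nonneg v)
  set S := D.ip v v + D.dir v v
  have herr := moll_err b hfc.continuous.measurable hfl (C := M * S) (by positivity) fun y =>
    (trans_bound hfc hfs y).trans (ENNReal.ofReal_le_ofReal (by gcongr; exact hM v hv))
  have hcA : Continuous (fun x => (moll (eta b) f x - f x) ^ 2) := (hA.continuous.sub hfc.continuous).pow 2
  obtain ⟨e1, e2⟩ := real_of_lint (μ := volume.restrict D.carrier) (g := fun x => (moll (eta b) f x - f x) ^ 2)
    (C := M * S * b.rOut ^ 2) (by positivity) hcA.aestronglyMeasurable (fun x => sq_nonneg _)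
    ((setLIntegral_le_lintegral _ _).trans herr)
  have e3 := hst (2 * δ) (by positivity) hδ1 v hv
  have i1 : IntegrableOn ({x | -(2 * δ) < D.defining x}.indicator (fun x => v x ^ 2)) D.carrier :=
    (hv.l2.integrable_sq).indicator (isOpen_lt continuous_const D.rho_cont).measurableSet
  have i2 : IntegrableOn (fun x => moll (eta b) f x ^ 2) D.carrier := (l2_cont (D := D) hA.continuous).integrable_sq
  have key : D.ip v v ≤ ∫ x in D.carrier, (2 * ({x | -(2 * δ) < D.defining x}.indicator (fun x => v x ^ 2)) x +
      4 * (moll (eta b) f x - f x) ^ 2) + 4 * moll (eta b) f x ^ 2 := by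
    refine setIntegral_mono_on (int_ip hv hv) (((i1.const_mul 2).add (e1.const_mul 4)).add (i2.const_mul 4)) D.measSet fun x hx => ?_
    by_cases h : -(2 * δ) < D.defining x
    · rw [indicator_of_mem (by exact h)]
      have a := D.cut_nonneg δ x
      have b' := D.cut_le_one δ x
      have : f x = D.cut δ x * v x := rfl
      nlinarith [sq_nonneg (moll (eta b) f x - f x), sq_nonneg (moll (eta b) f x), sq_nonneg (v x)]
    · rw [indicator_of_notMem (by exact h)]
      have : f x = v x := by simp only [hf]; rw [D.cut_one hδ (by linarith), one_mul]
      rw [this]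
      nlinarith [sq_nonneg (moll (eta b) f x - v x + moll (eta b) f x)]
  have heq : ∫ x in D.carrier, (2 * ({x | -(2 * δ) < D.defining x}.indicator (fun x => v x ^ 2)) x +
      4 * (moll (eta b) f x - f x) ^ 2) + 4 * moll (eta b) f x ^ 2 =
      (2 * (∫ x in D.carrier, ({x | -(2 * δ) < D.defining x}.indicator (fun x => v x ^ 2)) x) +
      4 * ∫ x in D.carrier, (moll (eta b) f x - f x) ^ 2) + 4 * ∫ x in D.carrier, moll (eta b) f x ^ 2 := by
    have j : IntegrableOn (fun x => 2 * ({x | -(2 * δ) < D.defining x}.indicator (fun x => v x ^ 2)) x +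
      4 * (moll (eta b) f x - f x) ^ 2) D.carrier := (i1.const_mul 2).add (e1.const_mul 4)
    rw [integral_add j (i2.const_mul 4), integral_add (i1.const_mul 2) (e1.const_mul 4)]
    simp only [integral_const_mul]
  rw [heq] at key
  rw [hb] at e2
  nlinarith [mul_le_mul_of_nonneg_right hδ2 hS, mul_le_mul_of_nonneg_right hr1 hS]

lemma moll_cut_eq {δ : ℝ} (hδ : 0 < δ) (k : Eu n → ℝ) (v : Eu n → ℝ) (x : Eu n) :
    moll k (fun y => D.cut δ y * v y) x = ∫ y in D.carrier, v y * (k (x - y) * D.cut δ y) := by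
  rw [moll, ← setIntegral_eq_integral_of_forall_compl_eq_zero (s := D.carrier) (fun y hy => by
    rw [cut_off hδ hy]; ring)]
  exact integral_congr_ae (ae_of_all _ fun y => by ring)

theorem rellich (D : SmoothDomain n) {v : ℕ → Eu n → ℝ} (hv : ∀ k, D.Adm (v k)) {C : ℝ}
    (hC : ∀ k, D.ip (v k) (v k) + D.dir (v k) (v k) ≤ C) :
    ∃ φ : ℕ → ℕ, StrictMono φ ∧ ∃ u, D.L2 u ∧
      Tendsto (fun k => ∫ x in D.carrier, (v (φ k) x - u x) ^ 2) atTop (𝓝 0) := by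
  obtain ⟨φ, hφ, G, hG, hw⟩ := weak_subseq (fun k => (hv k).l2) (C := C) (fun k => by
    have := dir_nonneg (D := D) (v k)
    have h2 := hC k
    simp only [ip, ← pow_two] at h2
    linarith)
  have hC0 : 0 ≤ C := (add_nonneg (ip_nonneg _) (dir_nonneg _)).trans (hC 0)
  refine ⟨φ, hφ, G, hG, ?_⟩
  -- Cauchy
  have hcau : ∀ ε > 0, ∃ N, ∀ k ≥ N, ∀ l ≥ N, D.ip (fun x => v (φ k) x - v (φ l) x) (fun x => v (φ k) x - v (φ l) x) ≤ ε := by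
    intro ε hε
    obtain ⟨δ, hδ, b, hb⟩ := split_est D (ε := ε / (2 * (4 * C + 1))) (by positivity)
    set A : (Eu n → ℝ) → Eu n → ℝ := fun w => moll (eta b) (fun y => D.cut δ y * w y) with hA
    obtain ⟨M, hM⟩ : ∃ M, ∀ x, |eta b x| ≤ M := by
      obtain ⟨M, hM⟩ := (eta_cs b).exists_bound_of_continuous (eta_cont b); exact ⟨M, hM⟩
    have hker : ∀ x, D.L2 (fun y => eta b (x - y) * D.cut δ y) := fun x => l2_cont
      (((eta_cont b).comp (by fun_prop)).mul (D.cut_contDiff δ).continuous)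
    have hM0 : 0 ≤ M := (abs_nonneg _).trans (hM 0)
    have hkb : ∀ x, ∫ y in D.carrier, (eta b (x - y) * D.cut δ y) ^ 2 ≤ M ^ 2 * volume.real D.carrier := by
      intro x
      calc _ ≤ ∫ y in D.carrier, M ^ 2 := by
            refine integral_mono (hker x).integrable_sq (integrable_const _) fun y => ?_
            simp only
            rw [mul_pow, ← sq_abs (eta b _)]
            have h1 := D.cut_nonneg δ y
            have h2 := D.cut_le_one δ y
            calc _ ≤ M ^ 2 * 1 := by gcongr; exact hM _; nlinarith
              _ = _ := by ring
        _ = _ := by simp [mul_comm]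
    have hbd : ∀ w, D.L2 w → ∀ x, A w x ^ 2 ≤ (∫ y in D.carrier, w y ^ 2) * (M ^ 2 * volume.real D.carrier) := by
      intro w hw x
      simp only [hA]; rw [moll_cut_eq hδ]
      exact (cs_int hw (hker x)).trans (mul_le_mul_of_nonneg_left (hkb x) (integral_nonneg fun y => sq_nonneg _))
    have hlin : ∀ w w', D.L2 w → D.L2 w' → ∀ x, A (fun y => w y - w' y) x = A w x - A w' x := by
      intro w w' hw hw' x
      simp only [hA]; rw [moll_cut_eq hδ, moll_cut_eq hδ, moll_cut_eq hδ,
        ← integral_sub (l2_mul hw (hker x)) (l2_mul hw' (hker x))]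
      exact integral_congr_ae (ae_of_all _ fun y => by ring)
    have hAc : ∀ w, D.L2 w → Continuous (A w) := by
      intro w hw
      refine (moll_smooth (eta_smooth b) (eta_cs b) ?_).continuous
      apply Integrable.locallyIntegrable
      have : (fun y => D.cut δ y * w y) = D.carrier.indicator (fun y => D.cut δ y * w y) := by
        ext y; by_cases hy : y ∈ D.carrier
        · rw [indicator_of_mem hy]
        · rw [indicator_of_notMem hy, cut_off hδ hy, zero_mul]
      rw [this, integrable_indicator_iff D.measSet]
      exact (l2_mul_cont (D.cut_contDiff δ).continuous hw).integrable (by norm_num)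
    have hlim : Tendsto (fun k => ∫ x in D.carrier, (A (fun y => v (φ k) y - G y) x) ^ 2) atTop (𝓝 0) := by
      have h0 : (0:ℝ) = ∫ x in D.carrier, (0:ℝ) := by simp
      rw [h0]
      refine tendsto_integral_of_dominated_convergence
        (fun _ => (2 * C + 2 * ∫ y in D.carrier, G y ^ 2) * (M ^ 2 * volume.real D.carrier)) ?_ (integrable_const _) ?_ ?_
      · intro k; exact ((hAc _ ((hv _).l2.sub hG)).pow 2).aestronglyMeasurable
      · intro k
        refine ae_of_all _ fun x => ?_
        rw [Real.norm_eq_abs, abs_of_nonneg (sq_nonneg _)]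
        refine (hbd _ ((hv _).l2.sub hG) x).trans ?_
        gcongr
        have i1 := (hv (φ k)).l2.integrable_sq
        have i2 := hG.integrable_sq
        have h3 : ∫ y in D.carrier, (v (φ k) y - G y) ^ 2 ≤ ∫ y in D.carrier, (2 * v (φ k) y ^ 2 + 2 * G y ^ 2) :=
          integral_mono ((hv _).l2.sub hG).integrable_sq ((i1.const_mul 2).add (i2.const_mul 2)) fun y => by
            simp only; nlinarith [sq_nonneg (v (φ k) y + G y)]
        rw [integral_add (i1.const_mul 2) (i2.const_mul 2), integral_const_mul, integral_const_mul] at h3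
        have h4 := hC (φ k)
        have h5 := dir_nonneg (D := D) (v (φ k))
        simp only [ip, ← pow_two] at h4
        simp only [Pi.sub_apply]
        linarith
      · refine ae_of_all _ fun x => ?_
        have := (((hw _ (hker x)).sub_const (∫ y in D.carrier, G y * (eta b (x - y) * D.cut δ y)))).pow 2
        rw [sub_self, zero_pow two_ne_zero] at this
        refine this.congr fun k => ?_
        rw [hlin _ _ (hv _).l2 hG]; simp only [hA]; rw [moll_cut_eq hδ, moll_cut_eq hδ]
    obtain ⟨N, hN⟩ := (hlim.eventually (gt_mem_nhds (by positivity : 0 < ε / 32))).exists_forall_of_atTop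
    refine ⟨N, fun k hk l hl => ?_⟩
    have h1 := hb _ ((hv (φ k)).sub (hv (φ l)))
    have h2 := ip_sub_le (hv (φ k)) (hv (φ l))
    have h3 := dir_sub_le (hv (φ k)) (hv (φ l))
    have h4 := hC (φ k)
    have h5 := hC (φ l)
    have h6 : ∫ x in D.carrier, (A (fun y => v (φ k) y - v (φ l) y) x) ^ 2 ≤
        2 * (∫ x in D.carrier, (A (fun y => v (φ k) y - G y) x) ^ 2) +
        2 * ∫ x in D.carrier, (A (fun y => v (φ l) y - G y) x) ^ 2 := by
      have j : ∀ w, D.L2 w → IntegrableOn (fun x => A w x ^ 2) D.carrier := fun w hw =>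
        (l2_cont (D := D) (hAc w hw)).integrable_sq
      have jk := (j _ ((hv (φ k)).l2.sub hG)).const_mul 2
      have jl := (j _ ((hv (φ l)).l2.sub hG)).const_mul 2
      rw [← integral_const_mul, ← integral_const_mul]
      refine le_trans ?_ (integral_add jk jl).le
      refine integral_mono (j _ ((hv (φ k)).l2.sub (hv (φ l)).l2)) (jk.add jl) fun x => ?_
      have e1 := hlin _ _ (hv (φ k)).l2 hG x
      have e2 := hlin _ _ (hv (φ l)).l2 hG x
      have e3 := hlin _ _ (hv (φ k)).l2 (hv (φ l)).l2 x
      simp only [Pi.add_apply, Pi.sub_def]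
      rw [e1, e2, e3]
      nlinarith [sq_nonneg ((A (v (φ k)) x - A G x) + (A (v (φ l)) x - A G x))]
    have h7 := hN k hk
    have h8 := hN l hl
    have h9 : ε / (2 * (4 * C + 1)) * (D.ip (fun x => v (φ k) x - v (φ l) x) (fun x => v (φ k) x - v (φ l) x) +
        D.dir (fun x => v (φ k) x - v (φ l) x) (fun x => v (φ k) x - v (φ l) x)) ≤ ε / (2 * (4 * C + 1)) * (4 * C + 1) := by
      apply mul_le_mul_of_nonneg_left _ (by positivity); linarith
    have h10 : ε / (2 * (4 * C + 1)) * (4 * C + 1) = ε / 2 := by field_simp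
    linarith
  rw [Metric.tendsto_atTop]
  intro ε hε
  obtain ⟨N, hN⟩ := hcau (ε / 2) (by positivity)
  refine ⟨N, fun k hk => ?_⟩
  have hd : D.L2 (fun x => v (φ k) x - G x) := (hv _).l2.sub hG
  rw [Real.dist_eq, sub_zero, abs_of_nonneg (integral_nonneg fun x => sq_nonneg _)]
  set I := ∫ x in D.carrier, (v (φ k) x - G x) ^ 2 with hI
  have hI0 : 0 ≤ I := integral_nonneg fun x => sq_nonneg _
  have hlim : Tendsto (fun l => ∫ x in D.carrier, (v (φ k) x - v (φ l) x) * (v (φ k) x - G x)) atTop (𝓝 I) := by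
    have h1 := (hw _ hd).const_sub (∫ x in D.carrier, v (φ k) x * (v (φ k) x - G x))
    have e : I = (∫ x in D.carrier, v (φ k) x * (v (φ k) x - G x)) - ∫ x in D.carrier, G x * (v (φ k) x - G x) := by
      rw [← integral_sub (l2_mul (hv _).l2 hd) (l2_mul hG hd)]
      exact integral_congr_ae (ae_of_all _ fun y => by ring)
    rw [e]
    refine h1.congr fun l => ?_
    rw [← integral_sub (l2_mul (hv _).l2 hd) (l2_mul (hv _).l2 hd)]
    exact integral_congr_ae (ae_of_all _ fun y => by ring)
  have h2 : ∀ᶠ l in atTop, (∫ x in D.carrier, (v (φ k) x - v (φ l) x) * (v (φ k) x - G x)) ^ 2 ≤ ε / 2 * I := by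
    filter_upwards [eventually_ge_atTop N] with l hl
    refine (cs_int ((hv (φ k)).l2.sub (hv (φ l)).l2) hd).trans ?_
    refine mul_le_mul_of_nonneg_right ?_ hI0
    have := hN k hk l hl
    simp only [ip, ← pow_two] at this
    exact this
  have h3 := le_of_tendsto (hlim.pow 2) h2
  by_contra! hcon
  nlinarith

end SmoothDomain

/-! ## P6: Weyl lemma -/

def wpsi (t : ℝ) : ℝ := Real.smoothTransition (1 - t)
def wkap (t : ℝ) : ℝ := (∫ x in t..1, wpsi x) / 2
def wthe (N : ℝ) (t : ℝ) : ℝ := - N * wpsi t - 2 * t * deriv wpsi t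

lemma wpsi_smooth : ContDiff ℝ (⊤ : ℕ∞) wpsi :=
  Real.smoothTransition.contDiff.comp (contDiff_const.sub contDiff_id)
lemma wpsi_cont : Continuous wpsi := wpsi_smooth.continuous
lemma wpsi_zero {t : ℝ} (h : 1 ≤ t) : wpsi t = 0 := Real.smoothTransition.zero_of_nonpos (by linarith)
lemma wpsi_nonneg (t : ℝ) : 0 ≤ wpsi t := Real.smoothTransition.nonneg _
lemma wpsi_le_one (t : ℝ) : wpsi t ≤ 1 := Real.smoothTransition.le_one _
lemma wpsi_pos {t : ℝ} (h : t < 1) : 0 < wpsi t := Real.smoothTransition.pos_of_pos (by linarith)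
lemma wpsi_hd (t : ℝ) : HasDerivAt wpsi (deriv wpsi t) t :=
  ((wpsi_smooth.differentiable (by simp)) t).hasDerivAt
lemma dwpsi_cont : Continuous (deriv wpsi) := wpsi_smooth.continuous_deriv (by exact_mod_cast le_top)
lemma dwpsi_zero {t : ℝ} (h : 1 ≤ t) : deriv wpsi t = 0 := by
  have h1 : EqOn (deriv wpsi) 0 (Ioi 1) := by
    intro s hs
    have : wpsi =ᶠ[𝓝 s] fun _ => 0 := by
      filter_upwards [Ioi_mem_nhds hs] with r hr using wpsi_zero (le_of_lt hr)
    simp [this.deriv_eq]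
  have := h1.closure dwpsi_cont continuous_const
  rw [closure_Ioi] at this
  exact this h

lemma wkap_hd (t : ℝ) : HasDerivAt wkap (- wpsi t / 2) t := by
  have := intervalIntegral.integral_hasDerivAt_left (wpsi_cont.intervalIntegrable t 1)
    wpsi_cont.stronglyMeasurable.stronglyMeasurableAtFilter wpsi_cont.continuousAt
  exact this.div_const 2

lemma wkap_smooth : ContDiff ℝ (⊤ : ℕ∞) wkap := by
  rw [contDiff_infty_iff_deriv]
  refine ⟨fun t => (wkap_hd t).differentiableAt, ?_⟩
  have : deriv wkap = fun t => - wpsi t / 2 := by ext t; exact (wkap_hd t).deriv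
  rw [this]; exact wpsi_smooth.neg.div_const 2

lemma wkap_zero {t : ℝ} (h : 1 ≤ t) : wkap t = 0 := by
  rw [wkap, intervalIntegral.integral_zero_ae]; · simp
  refine ae_of_all _ fun x hx => ?_
  rw [uIoc_of_ge h] at hx
  exact wpsi_zero hx.1.le

lemma wthe_cont (N : ℝ) : Continuous (wthe N) := by
  have := wpsi_cont; have := dwpsi_cont
  unfold wthe; fun_prop
lemma wthe_zero (N : ℝ) {t : ℝ} (h : 1 ≤ t) : wthe N t = 0 := by
  simp [wthe, wpsi_zero h, dwpsi_zero h]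
lemma wthe_bdd (N : ℝ) : ∃ C, 0 ≤ C ∧ ∀ t, 0 ≤ t → |wthe N t| ≤ C := by
  obtain ⟨C, hC⟩ := (isCompact_Icc (a := (0:ℝ)) (b := 1)).exists_bound_of_continuousOn (wthe_cont N).continuousOn
  refine ⟨max C 0, le_max_right _ _, fun t ht => ?_⟩
  rcases le_total t 1 with h | h
  · exact (hC t ⟨ht, h⟩).trans (le_max_left _ _)
  · rw [wthe_zero N h, abs_zero]; exact le_max_right _ _

instance : (volume : Measure (Eu n × ℝ)).IsAddHaarMeasure := by
  rw [Measure.volume_eq_prod]; infer_instance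

def qq (w : Eu n × ℝ) : ℝ := ‖w.1‖ ^ 2 + w.2 ^ 2
lemma qq_nonneg (w : Eu n × ℝ) : 0 ≤ qq w := by unfold qq; positivity
lemma qq_smooth : ContDiff ℝ (⊤ : ℕ∞) (qq (n := n)) := by
  unfold qq
  exact (contDiff_fst.norm_sq ℝ).add (contDiff_snd.pow 2)
lemma qq_cont : Continuous (qq (n := n)) := qq_smooth.continuous
lemma le_of_qq {w : Eu n × ℝ} {ε : ℝ} (he : 0 < ε) (h : qq w / ε ^ 2 < 1) : ‖w‖ ≤ ε := by
  rw [div_lt_one (by positivity)] at h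
  unfold qq at h
  rw [Prod.norm_def, max_le_iff]
  refine ⟨abs_le_of_sq_le_sq' (by nlinarith [sq_nonneg w.2]) he.le |>.2, ?_⟩
  exact abs_le_of_sq_le_sq (by nlinarith [sq_nonneg ‖w.1‖]) he.le

lemma comp_qq_zero {f : ℝ → ℝ} (hf : ∀ t, 1 ≤ t → f t = 0) {ε : ℝ} (he : 0 < ε) {w : Eu n × ℝ}
    (hw : ε < ‖w‖) : f (qq w / ε ^ 2) = 0 := by
  apply hf; by_contra h; push Not at h
  exact absurd (le_of_qq he h) (not_le.2 hw)

lemma comp_qq_cs {f : ℝ → ℝ} (hf : ∀ t, 1 ≤ t → f t = 0) {ε : ℝ} (he : 0 < ε) :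
    HasCompactSupport fun w : Eu n × ℝ => f (qq w / ε ^ 2) := by
  refine HasCompactSupport.of_support_subset_isCompact (isCompact_closedBall 0 ε) fun w hw => ?_
  by_contra h
  simp only [Metric.mem_closedBall, dist_zero_right, not_le] at h
  exact hw (comp_qq_zero hf he h)

lemma comp_qq_cs' {f : ℝ → ℝ} (hf : ∀ t, 1 ≤ t → f t = 0) {ε : ℝ} (he : 0 < ε) (w : Eu n × ℝ) :
    HasCompactSupport fun w' : Eu n × ℝ => f (qq (w - w') / ε ^ 2) := by
  exact (comp_qq_cs hf he).comp_homeomorph (Homeomorph.subLeft w)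

def weta (ε : ℝ) (w : Eu n × ℝ) : ℝ := (ε ^ (n+1))⁻¹ * wpsi (qq w / ε ^ 2)

lemma weta_smooth (ε : ℝ) : ContDiff ℝ (⊤ : ℕ∞) (weta (n := n) ε) :=
  contDiff_const.mul (wpsi_smooth.comp (qq_smooth.div_const _))
lemma weta_cs {ε : ℝ} (he : 0 < ε) : HasCompactSupport (weta (n := n) ε) :=
  (comp_qq_cs (fun t => wpsi_zero) he).mul_left

def wM (V : Eu n × ℝ → ℝ) (ε : ℝ) (w : Eu n × ℝ) : ℝ := ∫ w', weta ε (w - w') * V w'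

lemma wM_smooth {V : Eu n × ℝ → ℝ} (hV : LocallyIntegrable V) {ε : ℝ} (he : 0 < ε) :
    ContDiff ℝ (⊤ : ℕ∞) (wM V ε) := by
  have : wM V ε = convolution V (weta ε) (ContinuousLinearMap.mul ℝ ℝ) volume := by
    ext x; simp only [wM, convolution_def, ContinuousLinearMap.mul_apply', mul_comm]
  rw [this]
  exact (weta_cs he).contDiff_convolution_right _ hV (weta_smooth ε)

def wc (n : ℕ) : ℝ := ∫ w : Eu n × ℝ, wpsi (qq w)

lemma wc_pos : 0 < wc n := by
  have hc := comp_qq_cs (n := n) (fun t => wpsi_zero) one_pos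
  simp only [one_pow, div_one] at hc
  have hct : Continuous fun w : Eu n × ℝ => wpsi (qq w) := wpsi_cont.comp qq_cont
  exact hct.integral_pos_of_hasCompactSupport_nonneg_nonzero hc (fun w => wpsi_nonneg _)
    (x := 0) (wpsi_pos (by simp [qq])).ne'

lemma weta_int {ε : ℝ} (he : 0 < ε) (w : Eu n × ℝ) : ∫ w', weta ε (w - w') = wc n := by
  rw [integral_sub_left_eq_self (fun x => weta ε x) volume w]
  have := Measure.integral_comp_inv_smul (volume : Measure (Eu n × ℝ)) (fun w => wpsi (qq w)) ε
  have h2 : ∀ w : Eu n × ℝ, qq (ε⁻¹ • w) = qq w / ε ^ 2 := by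
    intro w; simp only [qq, Prod.smul_fst, Prod.smul_snd, norm_smul, norm_inv, Real.norm_eq_abs, smul_eq_mul]
    rw [mul_pow, inv_pow, sq_abs]; field_simp
  simp only [h2] at this
  simp only [weta]
  rw [integral_const_mul, this, wc]
  have hf : Module.finrank ℝ (Eu n × ℝ) = n + 1 := by simp [Module.finrank_prod]
  rw [hf, abs_of_pos (by positivity), smul_eq_mul, ← mul_assoc, inv_mul_cancel₀ (by positivity), one_mul]

lemma wM_tendsto {V : Eu n × ℝ → ℝ} (hV : LocallyIntegrable V) :
    ∀ᵐ w, Tendsto (fun ε => wM V ε w) (𝓝[>] 0) (𝓝 (wc n * V w)) := by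
  have hc := wc_pos (n := n)
  filter_upwards [(Besicovitch.vitaliFamily (volume : Measure (Eu n × ℝ))).ae_tendsto_average_norm_sub hV] with w hw
  have h1 := hw.comp (Besicovitch.tendsto_filterAt volume w)
  have hf : Module.finrank ℝ (Eu n × ℝ) = n + 1 := by simp [Module.finrank_prod]
  have := tendsto_integral_smul_of_tendsto_average_norm_sub
    (g := fun ε w' => (wc n)⁻¹ * weta ε (w - w'))
    ((wc n)⁻¹ * (volume : Measure (Eu n × ℝ)).real (Metric.closedBall 0 1)) h1 ?_ ?_ ?_ ?_
  · have h3 := this.const_mul (wc n)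
    refine h3.congr fun ε => ?_
    simp only [smul_eq_mul, mul_assoc, integral_const_mul, wM]
    field_simp
  · filter_upwards with i using hV.integrableOn_isCompact (isCompact_closedBall _ _)
  · refine tendsto_const_nhds.congr' ?_
    filter_upwards [self_mem_nhdsWithin] with ε he
    rw [integral_const_mul, weta_int he, inv_mul_cancel₀ hc.ne']
  · filter_upwards [self_mem_nhdsWithin] with ε he
    intro w' hw'
    by_contra h
    simp only [Metric.mem_closedBall, not_le, dist_comm w' w, dist_eq_norm] at h
    apply hw'
    simp only [weta]
    rw [comp_qq_zero (fun t => wpsi_zero) he h]; simp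
  · filter_upwards [self_mem_nhdsWithin] with ε he
    have he' : (0:ℝ) < ε := he
    intro w'
    rw [Measure.addHaar_real_closedBall' _ _ he'.le, hf]
    simp only [weta]
    rw [abs_of_nonneg (mul_nonneg (inv_nonneg.2 hc.le) (mul_nonneg (by positivity) (wpsi_nonneg _)))]
    have hv : 0 < (volume : Measure (Eu n × ℝ)).real (Metric.closedBall 0 1) :=
      ENNReal.toReal_pos (Metric.measure_closedBall_pos _ _ one_pos).ne' (measure_closedBall_lt_top).ne
    rw [mul_div_mul_right _ _ hv.ne', div_eq_mul_inv]
    refine mul_le_mul_of_nonneg_left ?_ (inv_nonneg.2 hc.le)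
    exact mul_le_of_le_one_right (by positivity) (wpsi_le_one _)

/-- derivative in ε -/
lemma weta_hd {ε : ℝ} (he : 0 < ε) (w : Eu n × ℝ) :
    HasDerivAt (fun ε => weta ε w) ((ε ^ (n+2))⁻¹ * wthe (n+1) (qq w / ε ^ 2)) ε := by
  have h1 : HasDerivAt (fun ε : ℝ => (ε ^ (n+1))⁻¹) (-((n+1) * ε ^ n) / (ε ^ (n+1)) ^ 2) ε := by
    have := (hasDerivAt_pow (n+1) ε).fun_inv (by positivity)
    exact this.congr_deriv (by push_cast; simp)
  have h2 : HasDerivAt (fun ε : ℝ => qq w / ε ^ 2) (- 2 * qq w / ε ^ 3) ε := by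
    have := ((hasDerivAt_pow 2 ε).fun_inv (by positivity)).const_mul (qq w)
    refine (this.congr_deriv ?_).congr_of_eventuallyEq (by filter_upwards with x; rw [div_eq_mul_inv])
    push_cast; field_simp
  have h3 := h1.fun_mul ((wpsi_hd (qq w / ε ^ 2)).comp ε h2)
  refine h3.congr_deriv ?_
  simp only [wthe, Function.comp]
  field_simp
  ring

lemma wM_hd {V : Eu n × ℝ → ℝ} (hV : LocallyIntegrable V) {ε : ℝ} (he : 0 < ε) (w : Eu n × ℝ) :
    HasDerivAt (fun ε => wM V ε w) ((ε ^ (n+2))⁻¹ * ∫ w', wthe (n+1) (qq (w - w') / ε ^ 2) * V w') ε := by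
  obtain ⟨C, hC0, hC⟩ := wthe_bdd (n+1)
  have hint : ∀ f : ℝ → ℝ, Continuous f → (∀ t, 1 ≤ t → f t = 0) → ∀ ε, 0 < ε →
      Integrable fun w' => f (qq (w - w') / ε ^ 2) * V w' := by
    intro f hf hf0 ε he
    have := hV.integrable_smul_left_of_hasCompactSupport (g := fun w' => f (qq (w - w') / ε ^ 2))
      (hf.comp ((qq_cont.comp (continuous_const.sub continuous_id)).div_const _)) (comp_qq_cs' hf0 he w)
    simpa using this
  have hint2 : ∀ ε, 0 < ε → Integrable fun w' => weta ε (w - w') * V w' := by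
    intro ε he
    have := (hint wpsi wpsi_cont (fun t => wpsi_zero) ε he).const_mul (ε ^ (n+1))⁻¹
    refine this.congr (ae_of_all _ fun x => ?_)
    simp only [weta]; ring
  have key := hasDerivAt_integral_of_dominated_loc_of_deriv_le (μ := (volume : Measure (Eu n × ℝ)))
    (F := fun ε w' => weta ε (w - w') * V w') (x₀ := ε) (s := Ioo (ε/2) (2*ε))
    (F' := fun ε w' => ((ε ^ (n+2))⁻¹ * wthe (n+1) (qq (w - w') / ε ^ 2)) * V w')
    (bound := fun w' => (Metric.closedBall w (2*ε)).indicator (fun w' => (((ε/2) ^ (n+2))⁻¹ * C) * ‖V w'‖) w')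
    (Ioo_mem_nhds (by linarith) (by linarith)) ?_ (hint2 ε he) ?_ ?_ ?_ ?_
  · refine key.2.congr_deriv ?_
    simp only [mul_assoc]; rw [integral_const_mul]
  · filter_upwards [Ioi_mem_nhds he] with e h using (hint2 e h).aestronglyMeasurable
  · have := (hint (wthe (n+1)) (wthe_cont _) (fun t => wthe_zero _) ε he).const_mul (ε ^ (n+2))⁻¹
    refine (this.congr (ae_of_all _ fun x => ?_)).aestronglyMeasurable
    ring
  · refine ae_of_all _ fun w' e hE => ?_
    have he0 : 0 < e := by linarith [hE.1]
    rw [norm_mul, norm_mul]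
    by_cases hw' : w' ∈ Metric.closedBall w (2*ε)
    · rw [indicator_of_mem hw']
      refine mul_le_mul_of_nonneg_right ?_ (norm_nonneg _)
      refine mul_le_mul ?_ (hC _ (div_nonneg (qq_nonneg _) (by positivity))) (norm_nonneg _) (by positivity)
      rw [Real.norm_of_nonneg (by positivity)]
      refine inv_anti₀ (by positivity) (pow_le_pow_left₀ (by linarith) hE.1.le _)
    · rw [indicator_of_notMem hw']
      have : e < ‖w - w'‖ := by
        simp only [Metric.mem_closedBall, not_le, dist_comm w' w, dist_eq_norm] at hw'
        linarith [hE.2]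
      rw [comp_qq_zero (fun t => wthe_zero _) he0 this]; simp
  · rw [integrable_indicator_iff measurableSet_closedBall]
    exact ((hV.integrableOn_isCompact (isCompact_closedBall _ _)).norm).const_mul _
  · refine ae_of_all _ fun w' e hE => ?_
    have he0 : 0 < e := by linarith [hE.1]
    exact (weta_hd he0 (w - w')).mul_const (V w')

lemma pd_normsq (x : Eu n) (i : Fin n) (y : Eu n) : pd i (fun y => ‖x - y‖ ^ 2) y = 2 * (y i - x i) := by
  have h : HasFDerivAt (fun y : Eu n => x - y) (-(ContinuousLinearMap.id ℝ (Eu n))) y :=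
    (hasFDerivAt_id y).const_sub x
  rw [pd, h.norm_sq.fderiv]
  simp [bv, inner_sub_left, EuclideanSpace.inner_single_right]

lemma pd_coord (i : Fin n) (c : ℝ) (y : Eu n) : pd i (fun y => y i - c) y = 1 := by
  have h : HasFDerivAt (fun y : Eu n => y i - c) (EuclideanSpace.proj i : Eu n →L[ℝ] ℝ) y :=
    ((EuclideanSpace.proj i : Eu n →L[ℝ] ℝ).hasFDerivAt).sub_const c
  rw [pd, h.fderiv]; simp [bv]

section
variable {x : Eu n} {t ε : ℝ}

lemma wphi_smooth (x : Eu n) (c ε : ℝ) : ContDiff ℝ (⊤ : ℕ∞) fun y : Eu n => wkap ((‖x - y‖ ^ 2 + c) / ε ^ 2) :=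
  wkap_smooth.comp ((((contDiff_const.sub contDiff_id).norm_sq ℝ).add contDiff_const).div_const _)

lemma pd_arg (x : Eu n) (c ε : ℝ) (i : Fin n) (y : Eu n) :
    pd i (fun y => (‖x - y‖ ^ 2 + c) / ε ^ 2) y = 2 * (y i - x i) / ε ^ 2 := by
  have h1 : (fun y : Eu n => (‖x - y‖ ^ 2 + c) / ε ^ 2) = fun y => (ε ^ 2)⁻¹ * (‖x - y‖ ^ 2 + c) := by
    ext y; rw [div_eq_inv_mul]
  have hd : DifferentiableAt ℝ (fun y : Eu n => ‖x - y‖ ^ 2) y :=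
    (((contDiff_const.sub contDiff_id).norm_sq ℝ : ContDiff ℝ (⊤ : ℕ∞) _).differentiable (by simp)) y
  rw [h1, pd_const_mul _ (hd.add_const c), pd_add hd (by fun_prop), pd_normsq, pd_const]
  field_simp; ring

lemma diff_arg (x : Eu n) (c ε : ℝ) (y : Eu n) :
    DifferentiableAt ℝ (fun y => (‖x - y‖ ^ 2 + c) / ε ^ 2) y :=
  (((((contDiff_const.sub contDiff_id).norm_sq ℝ : ContDiff ℝ (⊤ : ℕ∞) _).add contDiff_const).div_const _).differentiable (by simp)) y

lemma pd_wphi (x : Eu n) (c ε : ℝ) (i : Fin n) :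
    pd i (fun y : Eu n => wkap ((‖x - y‖ ^ 2 + c) / ε ^ 2)) =
     fun y => - (ε^2)⁻¹ * (wpsi ((‖x - y‖ ^ 2 + c) / ε ^ 2) * (y i - x i)) := by
  ext y
  rw [pd_comp (wkap_hd _) (diff_arg x c ε y), pd_arg]
  field_simp

lemma pd_pd_wphi (x : Eu n) (c ε : ℝ) (i : Fin n) (y : Eu n) :
    pd i (pd i (fun y : Eu n => wkap ((‖x - y‖ ^ 2 + c) / ε ^ 2))) y =
     - (ε^2)⁻¹ * (wpsi ((‖x - y‖ ^ 2 + c) / ε ^ 2) + deriv wpsi ((‖x - y‖ ^ 2 + c) / ε ^ 2) * (2 * (y i - x i)^2 / ε ^ 2)) := by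
  have hd : DifferentiableAt ℝ (fun y => wpsi ((‖x - y‖ ^ 2 + c) / ε ^ 2)) y :=
    (wpsi_hd _).differentiableAt.comp y (diff_arg x c ε y)
  have hd2 : DifferentiableAt ℝ (fun y : Eu n => y i - x i) y := by fun_prop
  rw [pd_wphi, pd_const_mul _ (hd.fun_mul hd2), pd_mul hd hd2, pd_comp (wpsi_hd _) (diff_arg x c ε y), pd_arg, pd_coord]
  field_simp

lemma lap_wphi (x : Eu n) (c ε : ℝ) (y : Eu n) :
    ∑ i, pd i (pd i (fun y : Eu n => wkap ((‖x - y‖ ^ 2 + c) / ε ^ 2))) y =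
     - (ε^2)⁻¹ * (n * wpsi ((‖x - y‖ ^ 2 + c) / ε ^ 2) + deriv wpsi ((‖x - y‖ ^ 2 + c) / ε ^ 2) * (2 * ‖x - y‖^2 / ε ^ 2)) := by
  simp only [pd_pd_wphi]
  rw [← Finset.mul_sum, Finset.sum_add_distrib, ← Finset.mul_sum, ← Finset.sum_div, ← Finset.mul_sum,
    EuclideanSpace.norm_sq_eq (x - y)]
  simp only [Finset.sum_const, Finset.card_univ, Fintype.card_fin, nsmul_eq_mul]
  congr 5
  refine Finset.sum_congr rfl fun i _ => ?_
  rw [PiLp.sub_apply, Real.norm_eq_abs, sq_abs]; ring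

lemma one_dim (c t ε a : ℝ) (he : 0 < ε) (hc : 0 ≤ c) :
    ∫ s, (- (ε^2)⁻¹ * (wpsi ((c + (t - s)^2) / ε ^ 2) + deriv wpsi ((c + (t - s)^2) / ε ^ 2) * (2 * (t - s)^2 / ε ^ 2)))
        * Real.cosh (a * s) = a ^ 2 * ∫ s, wkap ((c + (t - s)^2) / ε ^ 2) * Real.cosh (a * s) := by
  have harg : ∀ s, HasDerivAt (fun s => (c + (t - s)^2) / ε ^ 2) (2 * (s - t) / ε ^ 2) s := by
    intro s
    have := ((((hasDerivAt_id s).const_sub t).pow 2).const_add c).div_const (ε^2)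
    exact this.congr_deriv (by simp; ring)
  have hcosh : ∀ s, HasDerivAt (fun s => Real.cosh (a * s)) (a * Real.sinh (a * s)) s := fun s => by
    have := ((hasDerivAt_id s).const_mul a).cosh
    exact this.congr_deriv (by simp; ring)
  have hsinh : ∀ s, HasDerivAt (fun s => Real.sinh (a * s)) (a * Real.cosh (a * s)) s := fun s => by
    have := ((hasDerivAt_id s).const_mul a).sinh
    exact this.congr_deriv (by simp; ring)
  have cs : ∀ f : ℝ → ℝ, (∀ t, 1 ≤ t → f t = 0) → HasCompactSupport fun s => f ((c + (t - s)^2) / ε ^ 2) := by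
    intro f hf
    refine HasCompactSupport.of_support_subset_isCompact (isCompact_Icc (a := t - ε) (b := t + ε)) fun s hs => ?_
    by_contra h
    apply hs; apply hf
    rw [le_div_iff₀ (by positivity)]
    rw [mem_Icc, not_and_or, not_le, not_le] at h
    rcases h with h | h <;> nlinarith
  have hcont : ∀ f : ℝ → ℝ, Continuous f → Continuous fun s => f ((c + (t - s)^2) / ε ^ 2) := by
    intro f hf; fun_prop
  have hk := wkap_smooth.continuous
  have I1 : Integrable fun s => wkap ((c + (t - s)^2) / ε ^ 2) * Real.cosh (a * s) :=
    (((hcont _ hk).mul (by fun_prop)).integrable_of_hasCompactSupport (cs _ fun t => wkap_zero).mul_right)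
  have I2 : Integrable fun s => wkap ((c + (t - s)^2) / ε ^ 2) * Real.sinh (a * s) :=
    (((hcont _ hk).mul (by fun_prop)).integrable_of_hasCompactSupport (cs _ fun t => wkap_zero).mul_right)
  have I3 : Integrable fun s => (- (ε^2)⁻¹ * (wpsi ((c + (t - s)^2) / ε ^ 2) + deriv wpsi ((c + (t - s)^2) / ε ^ 2) * (2 * (t - s)^2 / ε ^ 2)))
        * Real.cosh (a * s) := by
    have h1 := hcont _ wpsi_cont
    have h2 := hcont _ dwpsi_cont
    refine Continuous.integrable_of_hasCompactSupport (by fun_prop) ?_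
    exact (((cs _ fun t => wpsi_zero).add (cs _ fun t => dwpsi_zero).mul_right).mul_left).mul_right
  have I4 : Integrable fun s => (- (ε^2)⁻¹ * (wpsi ((c + (t - s)^2) / ε ^ 2) * (s - t))) * Real.cosh (a * s) := by
    have h1 := hcont _ wpsi_cont
    refine Continuous.integrable_of_hasCompactSupport (by fun_prop) ?_
    exact (((cs _ fun t => wpsi_zero).mul_right).mul_left).mul_right
  have hd : ∀ s, HasDerivAt (fun s => (- (ε^2)⁻¹ * (wpsi ((c + (t - s)^2) / ε ^ 2) * (s - t))) * Real.cosh (a * s)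
      - a * (wkap ((c + (t - s)^2) / ε ^ 2) * Real.sinh (a * s)))
      ((- (ε^2)⁻¹ * (wpsi ((c + (t - s)^2) / ε ^ 2) + deriv wpsi ((c + (t - s)^2) / ε ^ 2) * (2 * (t - s)^2 / ε ^ 2)))
        * Real.cosh (a * s) - a ^ 2 * (wkap ((c + (t - s)^2) / ε ^ 2) * Real.cosh (a * s))) s := by
    intro s
    have h1 : HasDerivAt (fun s => wpsi ((c + (t - s)^2) / ε ^ 2)) _ s := (wpsi_hd _).comp s (harg s)
    have h2 : HasDerivAt (fun s => wkap ((c + (t - s)^2) / ε ^ 2)) _ s := (wkap_hd _).comp s (harg s)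
    have h3 := ((((h1.fun_mul ((hasDerivAt_id' s).sub_const t)).const_mul (- (ε^2)⁻¹)).fun_mul (hcosh s)).fun_sub
      ((h2.fun_mul (hsinh s)).const_mul a))
    refine h3.congr_deriv ?_
    field_simp; ring
  have := integral_eq_zero_of_hasDerivAt_of_integrable hd (I3.sub (I1.const_mul _)) (I4.sub (I2.const_mul _))
  rw [integral_sub I3 (I1.const_mul _), integral_const_mul] at this
  linarith

lemma locInt_prod {U : Eu n → ℝ} (hU : Integrable U) (a : ℝ) :
    LocallyIntegrable fun w : Eu n × ℝ => U w.1 * Real.cosh (a * w.2) := by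
  rw [locallyIntegrable_iff]
  intro K hK
  obtain ⟨R, hR⟩ := hK.isBounded.subset_closedBall 0
  have h1 : Integrable fun w : Eu n × ℝ => U w.1 * (Icc (-R) R).indicator (fun s => Real.cosh (a * s)) w.2 := by
    have : Integrable ((Icc (-R) R).indicator (fun s => Real.cosh (a * s))) := by
      rw [integrable_indicator_iff measurableSet_Icc]
      exact (Continuous.continuousOn (by fun_prop)).integrableOn_compact isCompact_Icc
    exact hU.mul_prod this
  refine (h1.integrableOn (s := K)).congr_fun (fun w hw => ?_) hK.measurableSet
  have h2 := hR hw
  rw [Metric.mem_closedBall, dist_zero_right, Prod.norm_def, max_le_iff] at h2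
  simp only
  rw [indicator_of_mem (show w.2 ∈ Icc (-R) R from abs_le.1 h2.2)]

set_option maxHeartbeats 400000 in
lemma weyl_zero {Ω : Set (Eu n)} {U : Eu n → ℝ} (hU : Integrable U) {a : ℝ}
    (hw : ∀ φ : Eu n → ℝ, ContDiff ℝ (⊤ : ℕ∞) φ → HasCompactSupport φ → tsupport φ ⊆ Ω →
      ∫ y, (∑ i, pd i (pd i φ) y) * U y = -(a^2) * ∫ y, φ y * U y)
    {x : Eu n} {ε : ℝ} (he : 0 < ε) (hx : Metric.closedBall x ε ⊆ Ω) (t : ℝ) :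
    ∫ w' : Eu n × ℝ, wthe (n+1) (qq ((x,t) - w') / ε ^ 2) * (U w'.1 * Real.cosh (a * w'.2)) = 0 := by
  have hV := locInt_prod hU a
  obtain ⟨w, hw'⟩ : ∃ w : Eu n × ℝ, w = (x, t) := ⟨_, rfl⟩
  rw [← hw']
  have hint : ∀ f : Eu n × ℝ → ℝ, Continuous f → HasCompactSupport f →
      Integrable fun w' => f w' * (U w'.1 * Real.cosh (a * w'.2)) := by
    intro f hf hf0
    simpa using hV.integrable_smul_left_of_hasCompactSupport hf hf0
  have hq : Continuous fun w' : Eu n × ℝ => qq (w - w') / ε ^ 2 :=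
    (qq_cont.comp (continuous_const.sub continuous_id)).div_const _
  have c1 := wpsi_cont.comp hq
  have c2 := dwpsi_cont.comp hq
  have c3 := wkap_smooth.continuous.comp hq
  have s1 := comp_qq_cs' (fun t => wpsi_zero) he w
  have s2 := comp_qq_cs' (fun t => dwpsi_zero) he w
  have s3 := comp_qq_cs' (fun t => wkap_zero) he w
  have IK := hint (fun w' => wkap (qq (w - w') / ε ^ 2)) c3 s3
  have c1' : Continuous fun w' => wpsi (qq (w - w') / ε ^ 2) := c1
  have c2' : Continuous fun w' => deriv wpsi (qq (w - w') / ε ^ 2) := c2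
  have gen : ∀ (k : ℝ) (g : Eu n × ℝ → ℝ), Continuous g → Integrable fun w' =>
      (- (ε^2)⁻¹ * (k * wpsi (qq (w - w') / ε ^ 2) + deriv wpsi (qq (w - w') / ε ^ 2) * g w')) * (U w'.1 * Real.cosh (a * w'.2)) := by
    intro k g hg
    refine hint _ (by fun_prop) ?_
    refine HasCompactSupport.of_support_subset_isCompact (isCompact_closedBall w ε) fun y hy => ?_
    by_contra h
    apply hy
    rw [Metric.mem_closedBall, not_le, dist_comm, dist_eq_norm] at h
    simp only
    rw [comp_qq_zero (fun t => wpsi_zero) he h, comp_qq_zero (fun t => dwpsi_zero) he h]; simp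
  have IA := gen n (fun w' => 2 * ‖x - w'.1‖^2 / ε ^ 2) (by fun_prop)
  have IB := gen 1 (fun w' => 2 * (t - w'.2)^2 / ε ^ 2) (by fun_prop)
  simp only [one_mul] at IB
  have hqe : ∀ y s, qq (w - (y, s)) = ‖x - y‖^2 + (t - s)^2 := by
    intro y s; simp only [hw', qq, Prod.mk_sub_mk]
  have hA : ∫ w' : Eu n × ℝ, (- (ε^2)⁻¹ * (n * wpsi (qq (w - w') / ε ^ 2) + deriv wpsi (qq (w - w') / ε ^ 2) * (2 * ‖x - w'.1‖^2 / ε ^ 2))) * (U w'.1 * Real.cosh (a * w'.2))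
      = -(a^2) * ∫ w' : Eu n × ℝ, wkap (qq (w - w') / ε ^ 2) * (U w'.1 * Real.cosh (a * w'.2)) := by
    rw [Measure.volume_eq_prod] at IA IK ⊢
    rw [integral_prod_symm _ IA, integral_prod_symm _ IK, ← integral_const_mul]
    congr 1; ext s
    simp only [← mul_assoc _ (U _) _]
    rw [integral_mul_const, integral_mul_const, ← mul_assoc]
    congr 1
    simp only [hqe]
    rw [← hw _ (wphi_smooth x ((t-s)^2) ε)]
    · simp only [lap_wphi]
    · refine HasCompactSupport.of_support_subset_isCompact (isCompact_closedBall x ε) fun y hy => ?_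
      by_contra h
      apply hy; apply wkap_zero
      rw [Metric.mem_closedBall, not_le, dist_comm, dist_eq_norm] at h
      rw [le_div_iff₀ (by positivity)]; nlinarith [sq_nonneg (t-s)]
    · refine (closure_minimal (fun y hy => ?_) Metric.isClosed_closedBall).trans hx
      by_contra h
      apply hy; apply wkap_zero
      rw [Metric.mem_closedBall, not_le, dist_comm, dist_eq_norm] at h
      rw [le_div_iff₀ (by positivity)]; nlinarith [sq_nonneg (t-s)]
  have hB : ∫ w' : Eu n × ℝ, (- (ε^2)⁻¹ * (wpsi (qq (w - w') / ε ^ 2) + deriv wpsi (qq (w - w') / ε ^ 2) * (2 * (t - w'.2)^2 / ε ^ 2))) * (U w'.1 * Real.cosh (a * w'.2))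
      = (a^2) * ∫ w' : Eu n × ℝ, wkap (qq (w - w') / ε ^ 2) * (U w'.1 * Real.cosh (a * w'.2)) := by
    rw [Measure.volume_eq_prod] at IB IK ⊢
    rw [integral_prod _ IB, integral_prod _ IK, ← integral_const_mul]
    congr 1; ext y
    simp only [mul_left_comm _ (U _) _]
    rw [integral_const_mul, integral_const_mul]
    simp only [hqe]
    rw [one_dim _ t ε a he (by positivity)]; ring
  have := integral_add IA IB
  rw [hA, hB] at this
  rw [← add_mul, neg_add_cancel, zero_mul] at this
  have h2 := congrArg (fun z => ε^2 * z) this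
  simp only [mul_zero] at h2
  rw [← integral_const_mul] at h2
  rw [← h2]
  congr 1; ext w''
  have : qq (w - w'') = ‖x - w''.1‖^2 + (t - w''.2)^2 := hqe w''.1 w''.2
  rw [wthe]
  generalize wpsi (qq (w - w'') / ε ^ 2) = A
  generalize deriv wpsi (qq (w - w'') / ε ^ 2) = B
  rw [this]
  field_simp; ring


/-- Weyl's lemma. -/
lemma weyl {Ω : Set (Eu n)} (hO : IsOpen Ω) (hne : Ωᶜ.Nonempty) {U : Eu n → ℝ} (hU : Integrable U) {a : ℝ}
    (hw : ∀ φ : Eu n → ℝ, ContDiff ℝ (⊤ : ℕ∞) φ → HasCompactSupport φ → tsupport φ ⊆ Ω →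
      ∫ y, (∑ i, pd i (pd i φ) y) * U y = -(a^2) * ∫ y, φ y * U y) :
    ∃ v : Eu n → ℝ, ContDiffOn ℝ (⊤ : ℕ∞) v Ω ∧ ∀ᵐ x, x ∈ Ω → U x = v x := by
  have hV := locInt_prod hU a
  have hc := wc_pos (n := n)
  set V : Eu n × ℝ → ℝ := fun w => U w.1 * Real.cosh (a * w.2) with hVd
  set d : Eu n → ℝ := fun x => Metric.infDist x Ωᶜ with hd
  have dcont : Continuous d := Metric.continuous_infDist_pt _
  have dpos : ∀ x ∈ Ω, 0 < d x := fun x hx =>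
    (hO.isClosed_compl.notMem_iff_infDist_pos hne).1 (fun h => h hx)
  have dball : ∀ x ε, ε < d x → Metric.closedBall x ε ⊆ Ω := by
    intro x ε h y hy
    by_contra h'
    have : d x ≤ dist x y := Metric.infDist_le_dist_of_mem h'
    rw [Metric.mem_closedBall, dist_comm] at hy
    linarith
  have hconst : ∀ x t ε ε', 0 < ε → ε < d x → 0 < ε' → ε' < d x → wM V ε (x,t) = wM V ε' (x,t) := by
    intro x t ε ε' h1 h2 h3 h4
    have hD : ∀ e ∈ Ioo 0 (d x), HasDerivAt (fun ε => wM V ε (x,t)) 0 e := by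
      intro e hE
      have := wM_hd hV hE.1 (x,t)
      rwa [weyl_zero hU hw hE.1 (dball x e hE.2) t, mul_zero] at this
    exact isOpen_Ioo.is_const_of_deriv_eq_zero isPreconnected_Ioo
      (fun e hE => (hD e hE).differentiableAt.differentiableWithinAt) (fun e hE => (hD e hE).deriv)
      ⟨h1, h2⟩ ⟨h3, h4⟩
  refine ⟨fun x => (wc n)⁻¹ * wM V (d x / 2) (x, 0), ?_, ?_⟩
  · intro x hx
    have h0 := dpos x hx
    have h1 : ContDiff ℝ (⊤ : ℕ∞) fun y : Eu n => (wc n)⁻¹ * wM V (d x / 2) (y, 0) :=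
      contDiff_const.mul ((wM_smooth hV (half_pos h0)).comp (contDiff_id.prodMk contDiff_const))
    refine (h1.contDiffAt.congr_of_eventuallyEq ?_).contDiffWithinAt
    filter_upwards [dcont.continuousAt.eventually (lt_mem_nhds (half_lt_self h0))] with y hy
    rw [hconst y 0 (d y / 2) (d x / 2) (by linarith) (by linarith) (by linarith) hy]
  · have h1 := wM_tendsto hV
    rw [Measure.volume_eq_prod] at h1
    filter_upwards [Measure.ae_ae_of_ae_prod h1] with x hx hxO
    have h0 := dpos x hxO
    have h2 : (fun t => wM V (d x / 2) (x, t)) =ᵐ[volume] fun t => wc n * (U x * Real.cosh (a * t)) := by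
      filter_upwards [hx] with t ht
      refine tendsto_nhds_unique ?_ ht
      refine tendsto_const_nhds.congr' ?_
      filter_upwards [Ioo_mem_nhdsGT h0] with e hE
      exact hconst x t _ _ (by linarith) (by linarith) hE.1 hE.2
    have h3 := (Continuous.ae_eq_iff_eq volume
      ((wM_smooth hV (half_pos h0)).continuous.comp (by fun_prop : Continuous fun t : ℝ => (x, t))) (by fun_prop)).1 h2
    have h4 := congrFun h3 0
    simp only [Function.comp, mul_zero, Real.cosh_zero, mul_one] at h4
    rw [h4]; field_simp

end

/-! ## P6c: variational characterisation -/
namespace SmoothDomain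
variable {D : SmoothDomain n}

lemma ip_expand {f g : Eu n → ℝ} (hf : D.Adm f) (hg : D.Adm g) (t : ℝ) :
    D.ip (fun x => f x + t * g x) (fun x => f x + t * g x) = D.ip g g * (t * t) + (2 * D.ip f g) * t + D.ip f f := by
  have h1 := int_ip hf hf; have h2 := (int_ip hf hg).const_mul (2*t); have h3 := (int_ip hg hg).const_mul (t*t)
  have : D.ip (fun x => f x + t * g x) (fun x => f x + t * g x) =
      ∫ x in D.carrier, (f x * f x + 2 * t * (f x * g x)) + t * t * (g x * g x) := by
    rw [ip]; congr 1; ext x; ring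
  have h12 : Integrable (fun x => f x * f x + 2 * t * (f x * g x)) (volume.restrict D.carrier) := h1.add h2
  rw [this, integral_add h12 h3, integral_add h1 h2, integral_const_mul, integral_const_mul]
  simp only [ip]; ring

lemma dir_expand {f g : Eu n → ℝ} (hf : D.Adm f) (hg : D.Adm g) (t : ℝ) :
    D.dir (fun x => f x + t * g x) (fun x => f x + t * g x) = D.dir g g * (t * t) + (2 * D.dir f g) * t + D.dir f f := by
  have h1 := int_dir hf hf; have h2 := (int_dir hf hg).const_mul (2*t); have h3 := (int_dir hg hg).const_mul (t*t)
  have : D.dir (fun x => f x + t * g x) (fun x => f x + t * g x) =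
      ∫ x in D.carrier, ((∑ i, pd i f x * pd i f x) + 2 * t * (∑ i, pd i f x * pd i g x)) + t * t * (∑ i, pd i g x * pd i g x) := by
    rw [dir]; refine setIntegral_congr_fun D.measSet fun x hx => ?_
    simp only [Finset.mul_sum, ← Finset.sum_add_distrib]
    refine Finset.sum_congr rfl fun i _ => ?_
    rw [pd_add (hf.diff hx) ((hg.const_mul t).diff hx), pd_const_mul _ (hg.diff hx)]; ring
  have h12 : Integrable (fun x => (∑ i, pd i f x * pd i f x) + 2 * t * (∑ i, pd i f x * pd i g x)) (volume.restrict D.carrier) := h1.add h2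
  rw [this, integral_add h12 h3, integral_add h1 h2, integral_const_mul, integral_const_mul]
  simp only [dir]; ring

lemma zero_of_int {f : Eu n → ℝ} (hf : ContinuousOn f D.carrier) (h2 : IntegrableOn (fun x => f x * f x) D.carrier)
    (h : ∫ x in D.carrier, f x * f x = 0) : EqOn f 0 D.carrier := by
  rw [integral_eq_zero_iff_of_nonneg (fun x => mul_self_nonneg _) h2] at h
  refine Measure.eqOn_open_of_ae_eq (μ := volume) ?_ D.isOpen hf continuousOn_const
  filter_upwards [h] with x hx
  simpa using hx

lemma l2_int {f : Eu n → ℝ} (hf : D.L2 f) : IntegrableOn f D.carrier := hf.integrable one_le_two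

lemma Adm.int {v : Eu n → ℝ} (hv : D.Adm v) : IntegrableOn v D.carrier := l2_int hv.l2

lemma adm_const (c : ℝ) : D.Adm (fun _ => c) := adm_of_contDiff contDiff_const

variable (D)
/-- values of the Rayleigh quotient -/
def ray : Set ℝ := {r | ∃ v, D.Adm v ∧ ∫ x in D.carrier, v x = 0 ∧ D.ip v v = 1 ∧ r = D.dir v v}
def lam : ℝ := sInf D.ray
variable {D}

lemma ray_bdd : BddBelow D.ray := ⟨0, by rintro r ⟨v, hv, -, -, rfl⟩; exact dir_nonneg v⟩

lemma lam_nonneg : 0 ≤ D.lam := Real.sInf_nonneg (by rintro r ⟨v, hv, -, -, rfl⟩; exact dir_nonneg v)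

lemma ip_smul (c : ℝ) (v : Eu n → ℝ) : D.ip (fun x => c * v x) (fun x => c * v x) = c ^ 2 * D.ip v v := by
  rw [ip, ip, ← integral_const_mul]; congr 1; ext x; ring

lemma dir_smul (c : ℝ) {v : Eu n → ℝ} (hv : D.Adm v) : D.dir (fun x => c * v x) (fun x => c * v x) = c ^ 2 * D.dir v v := by
  rw [dir, dir, ← integral_const_mul]; refine setIntegral_congr_fun D.measSet fun x hx => ?_
  simp only [Finset.mul_sum]
  refine Finset.sum_congr rfl fun i _ => ?_
  rw [pd_const_mul _ (hv.diff hx)]; ring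

lemma lam_le {v : Eu n → ℝ} (hv : D.Adm v) (h0 : ∫ x in D.carrier, v x = 0) :
    D.lam * D.ip v v ≤ D.dir v v := by
  rcases (ip_nonneg (D := D) v).eq_or_lt with h | h
  · rw [← h, mul_zero]; exact dir_nonneg v
  · set c := (√(D.ip v v))⁻¹ with hc
    have hc2 : c ^ 2 * D.ip v v = 1 := by
      rw [hc, inv_pow, Real.sq_sqrt h.le, inv_mul_cancel₀ h.ne']
    have : D.lam ≤ c ^ 2 * D.dir v v := by
      refine csInf_le ray_bdd ⟨fun x => c * v x, hv.const_mul c, ?_, ?_, (dir_smul c hv).symm⟩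
      · rw [integral_const_mul, h0, mul_zero]
      · rw [ip_smul, hc2]
    calc D.lam * D.ip v v ≤ c ^ 2 * D.dir v v * D.ip v v := mul_le_mul_of_nonneg_right this h.le
      _ = (c ^ 2 * D.ip v v) * D.dir v v := by ring
      _ = _ := by rw [hc2, one_mul]

lemma q_cs {f g : Eu n → ℝ} (hf : D.Adm f) (hg : D.Adm g) (h0 : ∫ x in D.carrier, f x = 0)
    (h1 : ∫ x in D.carrier, g x = 0) :
    (D.dir f g - D.lam * D.ip f g) ^ 2 ≤ (D.dir f f - D.lam * D.ip f f) * (D.dir g g - D.lam * D.ip g g) := by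
  have h : ∀ t : ℝ, 0 ≤ (D.dir g g - D.lam * D.ip g g) * (t * t) + (2 * (D.dir f g - D.lam * D.ip f g)) * t
      + (D.dir f f - D.lam * D.ip f f) := by
    intro t
    have := lam_le (hf.add (hg.const_mul t)) (by
      rw [integral_add hf.int (hg.const_mul t).int, h0, integral_const_mul, h1]; simp)
    rw [ip_expand hf hg, dir_expand hf hg] at this
    linarith
  have := discrim_le_zero h
  rw [discrim] at this
  nlinarith

lemma dir_sub_const {f g : Eu n → ℝ} (c : ℝ) : D.dir f (fun x => g x - c) = D.dir f g := by
  have : ∀ i x, pd i (fun x => g x - c) x = pd i g x := by intro i x; simp [pd, fderiv_sub_const]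
  simp [dir, this]

lemma vol_real_pos (hne : D.carrier.Nonempty) : 0 < volume.real D.carrier :=
  ENNReal.toReal_pos (D.isOpen.measure_pos _ hne).ne' D.vol_lt_top.ne

lemma compl_ne (hn : 1 ≤ n) : D.carrierᶜ.Nonempty := by
  by_contra h
  rw [not_nonempty_iff_eq_empty, compl_empty_iff] at h
  have hb := D.isBounded
  rw [h] at hb
  haveI : Nonempty (Fin n) := ⟨⟨0, hn⟩⟩
  exact NormedSpace.unbounded_univ ℝ (Eu n) hb

lemma ray_nonempty (hn : 1 ≤ n) (hne : D.carrier.Nonempty) : D.ray.Nonempty := by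
  let i : Fin n := ⟨0, hn⟩
  have hV := vol_real_pos hne
  set c := (volume.real D.carrier)⁻¹ * ∫ x in D.carrier, x i with hc
  have hv : ContDiff ℝ 1 (fun x : Eu n => x i - c) := by fun_prop
  have hi : IntegrableOn (fun x : Eu n => x i) D.carrier := (adm_of_contDiff (v := fun x : Eu n => x i) (by fun_prop)).int
  have hA : D.Adm _ := adm_of_contDiff hv
  have h0 : ∫ x in D.carrier, (x i - c) = 0 := by
    rw [integral_sub hi (integrable_const c)]
    simp only [setIntegral_const, smul_eq_mul, hc]
    field_simp; simp
  have hpos : 0 < D.ip (fun x : Eu n => x i - c) (fun x => x i - c) := by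
    refine (ip_nonneg _).lt_of_ne fun h => ?_
    have hz := zero_of_int hv.continuous.continuousOn (int_ip hA hA) h.symm
    obtain ⟨x, hx⟩ := hne
    have := pd_congr_on (i := i) D.isOpen hz hx
    rw [pd_coord] at this
    have h3 : pd i (0 : Eu n → ℝ) x = 0 := pd_const
    rw [h3] at this
    norm_num at this
  set s := (√(D.ip (fun x : Eu n => x i - c) (fun x => x i - c)))⁻¹
  refine ⟨_, fun x => s * (x i - c), hA.const_mul s, ?_, ?_, rfl⟩
  · rw [integral_const_mul, h0, mul_zero]
  · rw [ip_smul, inv_pow, Real.sq_sqrt hpos.le, inv_mul_cancel₀ hpos.ne']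

lemma int_pd_mul {v φ : Eu n → ℝ} (hv : D.Adm v) (hφ : ContDiff ℝ (⊤ : ℕ∞) φ) (hc : HasCompactSupport φ)
    (hs : tsupport φ ⊆ D.carrier) (i : Fin n) :
    ∫ x in D.carrier, v x * pd i φ x = - ∫ x in D.carrier, pd i v x * φ x := by
  have hA : D.Adm φ := adm_of_contDiff (hφ.of_le (by exact_mod_cast le_top))
  have hz : ∀ x, x ∉ D.carrier → φ x = 0 := fun x hx => image_eq_zero_of_notMem_tsupport fun h => hx (hs h)
  have hd : ∀ x, DifferentiableAt ℝ φ x := hφ.differentiable (by simp)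
  have hcd : ContDiff ℝ 1 (fun x => v x * φ x) := by
    rw [contDiff_iff_contDiffAt]
    intro x
    by_cases hx : x ∈ tsupport φ
    · exact ((hv.c1.contDiffAt (D.isOpen.mem_nhds (hs hx))).mul (hφ.contDiffAt.of_le (by exact_mod_cast le_top)))
    · refine contDiffAt_const (c := (0:ℝ)) |>.congr_of_eventuallyEq ?_
      filter_upwards [(isClosed_tsupport φ).isOpen_compl.mem_nhds hx] with y hy
      rw [image_eq_zero_of_notMem_tsupport hy, mul_zero]
  have := integral_pd_zero hcd (hc.mul_left) (i := i)
  have h2 : ∫ x in D.carrier, pd i (fun x => v x * φ x) x = 0 := by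
    rw [setIntegral_eq_integral_of_forall_compl_eq_zero, this]
    intro x hx
    have hx' : x ∉ tsupport φ := fun h => hx (hs h)
    have : (fun x => v x * φ x) =ᶠ[𝓝 x] fun _ => 0 := by
      filter_upwards [(isClosed_tsupport φ).isOpen_compl.mem_nhds hx'] with y hy
      rw [image_eq_zero_of_notMem_tsupport hy, mul_zero]
    rw [pd_congr this, pd_const]
  have h3 : ∫ x in D.carrier, pd i (fun x => v x * φ x) x = ∫ x in D.carrier, (v x * pd i φ x + pd i v x * φ x) :=
    setIntegral_congr_fun D.measSet fun x hx => pd_mul (hv.diff hx) (hd x)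
  rw [h3, integral_add (l2_mul hv.l2 (hA.gl2 i)) (l2_mul (hv.gl2 i) hA.l2)] at h2
  linarith

lemma tendsto_ip_of_l2 {v : ℕ → Eu n → ℝ} {u w : Eu n → ℝ} (hv : ∀ k, D.L2 (v k)) (hu : D.L2 u) (hw : D.L2 w)
    (h : Tendsto (fun k => ∫ x in D.carrier, (v k x - u x) ^ 2) atTop (𝓝 0)) :
    Tendsto (fun k => ∫ x in D.carrier, v k x * w x) atTop (𝓝 (∫ x in D.carrier, u x * w x)) := by
  rw [tendsto_iff_norm_sub_tendsto_zero]
  have h2 : Tendsto (fun k => √(∫ x in D.carrier, (v k x - u x) ^ 2) * √(∫ x in D.carrier, w x ^ 2)) atTop (𝓝 0) := by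
    have := (h.sqrt).mul_const (√(∫ x in D.carrier, w x ^ 2))
    simpa using this
  refine squeeze_zero (fun _ => norm_nonneg _) (fun k => ?_) h2
  have := cs_abs ((hv k).sub hu) hw
  have e : ∫ x in D.carrier, (v k x - u x) * w x = (∫ x in D.carrier, v k x * w x) - ∫ x in D.carrier, u x * w x := by
    rw [← integral_sub (l2_mul (hv k) hw) (l2_mul hu hw)]; congr 1; ext x; ring
  rw [Real.norm_eq_abs, ← e]; exact this

/-- existence of a first eigenfunction, smooth in the interior -/
theorem exists_eigen (hn : 1 ≤ n) (hne : D.carrier.Nonempty) :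
    ∃ u, ContDiffOn ℝ (⊤ : ℕ∞) u D.carrier ∧ D.Adm u ∧ D.ip u u = 1 ∧ ∫ x in D.carrier, u x = 0 ∧
      ∀ v, D.Adm v → D.dir u v = D.lam * D.ip u v := by
  have hV := vol_real_pos hne
  -- minimizing sequence
  obtain ⟨r, -, hr, hrm⟩ := exists_seq_tendsto_sInf (ray_nonempty (D := D) hn hne) ray_bdd
  choose v hv h0 h1 hrv using hrm
  have hr' : Tendsto (fun k => D.dir (v k) (v k)) atTop (𝓝 D.lam) := hr.congr hrv
  obtain ⟨C, hC⟩ := hr'.bddAbove_range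
  have hC' : ∀ k, D.dir (v k) (v k) ≤ C := fun k => hC ⟨k, rfl⟩
  obtain ⟨φ, hφ, u, hu, hlim⟩ := D.rellich hv (C := 1 + C) (fun k => by rw [h1]; linarith [hC' k])
  have hgs : ∀ k i, ∫ x in D.carrier, pd i (v k) x ^ 2 ≤ C := by
    intro k i
    refine le_trans ?_ (hC' k)
    refine integral_mono (hv k |>.gl2 i).integrable_sq (int_dir (hv k) (hv k)) fun x => ?_
    simp only
    have := Finset.single_le_sum (f := fun i => pd i (v k) x * pd i (v k) x) (fun i _ => mul_self_nonneg _) (Finset.mem_univ i)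
    rw [sq]; exact this
  -- weak limits of all the gradients, one index at a time
  have hsub : ∀ s : Finset (Fin n), ∃ ψ : ℕ → ℕ, StrictMono ψ ∧ ∃ p : Fin n → Eu n → ℝ, ∀ i ∈ s, D.L2 (p i) ∧
      ∀ h, D.L2 h → Tendsto (fun k => ∫ x in D.carrier, pd i (v (φ (ψ k))) x * h x) atTop (𝓝 (∫ x in D.carrier, p i x * h x)) := by
    intro s
    induction s using Finset.induction_on with
    | empty => exact ⟨id, strictMono_id, fun _ _ => 0, by simp⟩
    | insert i s his ih =>
      obtain ⟨ψ, hψ, p, hp⟩ := ih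
      obtain ⟨χ, hχ, G, hG, hw⟩ := weak_subseq (F := fun k => pd i (v (φ (ψ k)))) (fun k => (hv _).gl2 i) (C := C) (fun k => hgs _ i)
      refine ⟨ψ ∘ χ, hψ.comp hχ, Function.update p i G, fun j hj => ?_⟩
      by_cases hji : j = i
      · subst hji; simp only [Function.update_self]; exact ⟨hG, hw⟩
      · have hjs : j ∈ s := by simpa [hji] using hj
        simp only [Function.update_of_ne hji]
        exact ⟨(hp j hjs).1, fun h hh => ((hp j hjs).2 h hh).comp hχ.tendsto_atTop⟩
  obtain ⟨ψ, hψ, p, hp⟩ := hsub Finset.univ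
  have hpl : ∀ i, D.L2 (p i) := fun i => (hp i (Finset.mem_univ _)).1
  set w : ℕ → Eu n → ℝ := fun k => v (φ (ψ k)) with hw
  have hwA : ∀ k, D.Adm (w k) := fun k => hv _
  have hwl : Tendsto (fun k => ∫ x in D.carrier, (w k x - u x) ^ 2) atTop (𝓝 0) := hlim.comp hψ.tendsto_atTop
  have hwp : ∀ i h, D.L2 h → Tendsto (fun k => ∫ x in D.carrier, pd i (w k) x * h x) atTop (𝓝 (∫ x in D.carrier, p i x * h x)) :=
    fun i => (hp i (Finset.mem_univ _)).2
  have hwu : ∀ h, D.L2 h → Tendsto (fun k => ∫ x in D.carrier, w k x * h x) atTop (𝓝 (∫ x in D.carrier, u x * h x)) :=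
    fun h hh => tendsto_ip_of_l2 (fun k => (hwA k).l2) hu hh hwl
  have hwQ : Tendsto (fun k => D.dir (w k) (w k) - D.lam * D.ip (w k) (w k)) atTop (𝓝 0) := by
    have := (hr'.comp (hφ.tendsto_atTop.comp hψ.tendsto_atTop)).sub_const D.lam
    simp only [sub_self] at this
    refine this.congr fun k => ?_
    simp only [Function.comp, hw, h1, mul_one]
  have hu0 : ∫ x in D.carrier, u x = 0 := by
    have := hwu (fun _ => 1) (memLp_const _)
    simp only [mul_one, hw, h0] at this
    exact (tendsto_nhds_unique this tendsto_const_nhds)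
  have hu1 : ∫ x in D.carrier, u x * u x = 1 := by
    have h3 := hwu u hu
    have h4 : Tendsto (fun k => ∫ x in D.carrier, (w k x - u x) ^ 2) atTop (𝓝 (1 - 2 * (∫ x in D.carrier, u x * u x) + ∫ x in D.carrier, u x * u x)) := by
      refine ((((h3.const_mul 2).const_sub 1)).add_const (∫ x in D.carrier, u x * u x)).congr fun k => ?_
      have a1 := int_ip (hwA k) (hwA k)
      have a2 := (l2_mul (hwA k).l2 hu).const_mul 2
      have a3 := l2_mul hu hu
      have : ∫ x in D.carrier, (w k x - u x) ^ 2 = ∫ x in D.carrier, (w k x * w k x - 2 * (w k x * u x)) + u x * u x := by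
        congr 1; ext x; ring
      have a12 : Integrable (fun x => w k x * w k x - 2 * (w k x * u x)) (volume.restrict D.carrier) := a1.sub a2
      rw [this, integral_add a12 a3, integral_sub a1 a2, integral_const_mul]
      have := h1 (φ (ψ k)); rw [ip] at this
      rw [this]
    have := tendsto_nhds_unique hwl h4
    linarith
  -- weak equation
  have hweak : ∀ g, D.Adm g → ∑ i, ∫ x in D.carrier, p i x * pd i g x = D.lam * ∫ x in D.carrier, u x * g x := by
    intro g hg
    set c := (volume.real D.carrier)⁻¹ * ∫ x in D.carrier, g x with hc
    have hgc : D.Adm (fun x => g x - c) := hg.sub (adm_const c)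
    have hgc0 : ∫ x in D.carrier, (g x - c) = 0 := by
      rw [integral_sub hg.int (integrable_const c)]
      simp only [setIntegral_const, smul_eq_mul, hc]
      field_simp; simp
    have t1 : Tendsto (fun k => (D.dir (w k) (fun x => g x - c) - D.lam * D.ip (w k) (fun x => g x - c)) ^ 2) atTop (𝓝 0) := by
      have := hwQ.mul_const (D.dir (fun x => g x - c) (fun x => g x - c) - D.lam * D.ip (fun x => g x - c) (fun x => g x - c))
      rw [zero_mul] at this
      exact squeeze_zero (fun _ => sq_nonneg _) (fun k => q_cs (hwA k) hgc (h0 _) hgc0) this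
    have t2 : Tendsto (fun k => (D.dir (w k) (fun x => g x - c) - D.lam * D.ip (w k) (fun x => g x - c))) atTop (𝓝 0) := by
      have := t1.sqrt
      simp only [Real.sqrt_sq_eq_abs, Real.sqrt_zero] at this
      exact (tendsto_zero_iff_abs_tendsto_zero _).2 this
    have t3 : Tendsto (fun k => (D.dir (w k) (fun x => g x - c) - D.lam * D.ip (w k) (fun x => g x - c))) atTop
        (𝓝 ((∑ i, ∫ x in D.carrier, p i x * pd i g x) - D.lam * ∫ x in D.carrier, u x * (g x - c))) := by
      refine Tendsto.sub ?_ ((hwu _ hgc.l2).const_mul _)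
      have : ∀ k, D.dir (w k) (fun x => g x - c) = ∑ i, ∫ x in D.carrier, pd i (w k) x * pd i g x := by
        intro k
        rw [dir_sub_const, dir, integral_finset_sum]
        exact fun i _ => l2_mul ((hwA k).gl2 i) (hg.gl2 i)
      simp only [this]
      exact tendsto_finset_sum _ fun i _ => hwp i _ (hg.gl2 i)
    have t4 := tendsto_nhds_unique t2 t3
    have t5 : ∫ x in D.carrier, u x * (g x - c) = ∫ x in D.carrier, u x * g x := by
      have : ∀ x, u x * (g x - c) = u x * g x - c * u x := fun x => by ring
      simp only [this]
      rw [integral_sub (l2_mul hu hg.l2) ((l2_int hu).const_mul c), integral_const_mul, hu0]; simp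
    rw [t5] at t4; linarith
  -- distributional derivative
  have hdist : ∀ i (f : Eu n → ℝ), ContDiff ℝ (⊤ : ℕ∞) f → HasCompactSupport f → tsupport f ⊆ D.carrier →
      ∫ x in D.carrier, u x * pd i f x = - ∫ x in D.carrier, p i x * f x := by
    intro i f hf hfc hfs
    have hA : D.Adm f := adm_of_contDiff (hf.of_le (by exact_mod_cast le_top))
    have t1 := hwu _ (hA.gl2 i)
    have t2 := (hwp i _ hA.l2).neg
    refine tendsto_nhds_unique t1 (t2.congr fun k => ?_)
    rw [int_pd_mul (hwA k) hf hfc hfs]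
  have hiu : Integrable (D.carrier.indicator u) := (integrable_indicator_iff D.measSet).2 (l2_int hu)
  have hind : ∀ g : Eu n → ℝ, ∫ y, g y * D.carrier.indicator u y = ∫ y in D.carrier, u y * g y := by
    intro g
    rw [← integral_indicator D.measSet]
    congr 1; ext y
    by_cases hy : y ∈ D.carrier
    · simp [hy, mul_comm]
    · simp [hy]
  have pdts : ∀ (f : Eu n → ℝ) i, tsupport (pd i f) ⊆ tsupport f := fun f i =>
    (tsupport_fderiv_apply_subset ℝ (bv i))
  obtain ⟨U, hU, hUe⟩ := weyl D.isOpen (compl_ne hn) hiu (a := √D.lam) (by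
    intro f hf hfc hfs
    rw [Real.sq_sqrt lam_nonneg, hind, hind]
    have hA : D.Adm f := adm_of_contDiff (hf.of_le (by exact_mod_cast le_top))
    simp only [Finset.mul_sum]
    rw [integral_finset_sum]
    · rw [Finset.sum_congr rfl fun i _ => hdist i (pd i f) (pd_contDiff hf) (pd_compactSupport hfc i) ((pdts f i).trans hfs),
        Finset.sum_neg_distrib, hweak f hA]; ring
    · exact fun i _ => l2_mul hu ((adm_of_contDiff ((pd_contDiff hf).of_le (by exact_mod_cast le_top)) : D.Adm (pd i f)).gl2 i))
  have hUu : ∀ᵐ x ∂(volume.restrict D.carrier), u x = U x := by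
    rw [ae_restrict_iff' D.measSet]
    filter_upwards [hUe] with x hx hxD
    simpa [hxD] using hx hxD
  have hUl : D.L2 U := (memLp_congr_ae hUu).1 hu
  have hUs : ∀ i, ContDiffOn ℝ (⊤ : ℕ∞) (pd i U) D.carrier := fun i => pd_smooth D.isOpen hU
  have hpU : ∀ i, ∀ᵐ x ∂(volume.restrict D.carrier), p i x = pd i U x := by
    intro i
    have hl : LocallyIntegrableOn (fun x => p i x - pd i U x) D.carrier :=
      (l2_int (hpl i)).locallyIntegrableOn.sub ((hUs i).continuousOn.locallyIntegrableOn D.measSet)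
    have := D.isOpen.ae_eq_zero_of_integral_contDiff_smul_eq_zero hl (fun g hg hgc hgs => ?_)
    · rw [ae_restrict_iff' D.measSet]
      filter_upwards [this] with x hx hxD
      linarith [hx hxD]
    · -- use `U` times a cutoff
      have hA : D.Adm g := adm_of_contDiff (hg.of_le (by exact_mod_cast le_top))
      have hz : ∀ x, x ∉ D.carrier → g x = 0 := fun x hx => image_eq_zero_of_notMem_tsupport fun h => hx (hgs h)
      have e1 := hdist i g hg hgc hgs
      have hUg : ∫ x in D.carrier, u x * pd i g x = ∫ x in D.carrier, U x * pd i g x :=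
        integral_congr_ae (by filter_upwards [hUu] with x hx; rw [hx])
      rw [hUg] at e1
      have hcd : ContDiff ℝ 1 (fun x => U x * g x) := by
        rw [contDiff_iff_contDiffAt]
        intro x
        by_cases hx : x ∈ tsupport g
        · exact (((hU.contDiffAt (D.isOpen.mem_nhds (hgs hx))).of_le (by exact_mod_cast le_top)).mul (hg.contDiffAt.of_le (by exact_mod_cast le_top)))
        · refine contDiffAt_const (c := (0:ℝ)) |>.congr_of_eventuallyEq ?_
          filter_upwards [(isClosed_tsupport g).isOpen_compl.mem_nhds hx] with y hy
          rw [image_eq_zero_of_notMem_tsupport hy, mul_zero]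
      have hgU : Continuous (fun x => pd i U x * g x) := by
        rw [continuous_iff_continuousAt]
        intro x
        by_cases hx : x ∈ tsupport g
        · exact ((hUs i).continuousOn.continuousAt (D.isOpen.mem_nhds (hgs hx))).mul hg.continuous.continuousAt
        · refine (continuousAt_const (y := (0:ℝ))).congr ?_
          filter_upwards [(isClosed_tsupport g).isOpen_compl.mem_nhds hx] with y hy
          rw [image_eq_zero_of_notMem_tsupport hy, mul_zero]
      have hgUi : Integrable (fun x => pd i U x * g x) := hgU.integrable_of_hasCompactSupport hgc.mul_left
      have hzero := integral_pd_zero hcd (hgc.mul_left) (i := i)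
      have h2 : ∫ x in D.carrier, pd i (fun x => U x * g x) x = 0 := by
        rw [setIntegral_eq_integral_of_forall_compl_eq_zero, hzero]
        intro x hx
        have hx' : x ∉ tsupport g := fun h => hx (hgs h)
        have : (fun x => U x * g x) =ᶠ[𝓝 x] fun _ => 0 := by
          filter_upwards [(isClosed_tsupport g).isOpen_compl.mem_nhds hx'] with y hy
          rw [image_eq_zero_of_notMem_tsupport hy, mul_zero]
        rw [pd_congr this, pd_const]
      have h3 : ∫ x in D.carrier, pd i (fun x => U x * g x) x = ∫ x in D.carrier, (U x * pd i g x + pd i U x * g x) :=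
        setIntegral_congr_fun D.measSet fun x hx => pd_mul (hU.diffAt D.isOpen (by simp) hx) (hg.differentiable (by simp) x)
      rw [h3, integral_add (l2_mul hUl (hA.gl2 i)) hgUi.integrableOn, e1] at h2
      have h4 : ∫ x, g x • (p i x - pd i U x) = ∫ x in D.carrier, g x • (p i x - pd i U x) := by
        rw [setIntegral_eq_integral_of_forall_compl_eq_zero]
        intro x hx; rw [hz x hx]; simp
      rw [h4]
      have h5 : ∀ x, g x • (p i x - pd i U x) = p i x * g x - pd i U x * g x := fun x => by simp only [smul_eq_mul]; ring
      simp only [h5]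
      rw [integral_sub (l2_mul (hpl i) hA.l2) hgUi.integrableOn]
      linarith
  have hUA : D.Adm U := ⟨hU.of_le (by exact_mod_cast le_top), hUl, fun i => (memLp_congr_ae (hpU i)).1 (hpl i)⟩
  refine ⟨U, hU, hUA, ?_, ?_, ?_⟩
  · rw [← hu1, ip]; exact integral_congr_ae (by filter_upwards [hUu] with x hx; rw [hx])
  · rw [← hu0]; exact integral_congr_ae (by filter_upwards [hUu] with x hx; rw [hx])
  · intro g hg
    have := hweak g hg
    rw [dir, integral_finset_sum _ (fun i _ => l2_mul (hUA.gl2 i) (hg.gl2 i)), ip]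
    have e2 : ∫ x in D.carrier, U x * g x = ∫ x in D.carrier, u x * g x :=
      integral_congr_ae (by filter_upwards [hUu] with x hx; rw [hx])
    rw [e2, ← this]
    refine Finset.sum_congr rfl fun i _ => integral_congr_ae ?_
    filter_upwards [hpU i] with x hx; rw [hx]

lemma lam_pos (hn : 1 ≤ n) (hne : IsConnected D.carrier) : 0 < D.lam := by
  refine lam_nonneg.lt_of_ne fun h => ?_
  obtain ⟨u, hu, hA, h1, h0, hw⟩ := exists_eigen (D := D) hn hne.nonempty
  have hd := hw u hA
  rw [← h, zero_mul, dir, integral_eq_zero_iff_of_nonneg (fun x => Finset.sum_nonneg fun i _ => mul_self_nonneg _)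
    (int_dir hA hA)] at hd
  have hz : EqOn (fun x => ∑ i, pd i u x * pd i u x) 0 D.carrier := by
    refine Measure.eqOn_open_of_ae_eq (μ := volume) hd D.isOpen ?_ continuousOn_const
    exact continuousOn_finset_sum _ fun i _ => (pd_smooth D.isOpen hu).continuousOn.mul (pd_smooth D.isOpen hu).continuousOn
  have hf : EqOn (fderiv ℝ u) 0 D.carrier := by
    intro x hx
    have := hz hx
    simp only [Pi.zero_apply] at this
    rw [Finset.sum_eq_zero_iff_of_nonneg (fun i _ => mul_self_nonneg _)] at this
    have h2 : ∀ i, pd i u x = 0 := fun i => mul_self_eq_zero.1 (this i (Finset.mem_univ _))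
    ext v
    rw [fderiv_eq_sum]; simp [h2]
  obtain ⟨a, ha⟩ := D.isOpen.exists_is_const_of_fderiv_eq_zero hne.isPreconnected (hu.differentiableOn (by simp)) hf
  have hV := vol_real_pos hne.nonempty
  have e0 : ∫ x in D.carrier, u x = volume.real D.carrier * a := by
    rw [setIntegral_congr_fun D.measSet (g := fun _ => a) (fun x hx => ha x hx)]; simp
  have ha0 : a = 0 := by
    rw [e0] at h0; rcases mul_eq_zero.1 h0 with h | h
    · exact absurd h hV.ne'
    · exact h
  have e1 : D.ip u u = 0 := by
    rw [ip, setIntegral_congr_fun D.measSet (g := fun _ => 0) (fun x hx => by simp [ha x hx, ha0])]; simp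
  linarith

end SmoothDomain

/-! ## P7a: tangential translations in a half space -/

lemma weak_of_ae {X : Type*} [MeasurableSpace X] {μ : Measure X} {F : ℕ → X → ℝ} {f v : X → ℝ} {C : ℝ}
    (hF : ∀ k, MemLp (F k) 2 μ) (hf : MemLp f 2 μ) (hv : MemLp v 2 μ) (hC : ∀ k, ∫ x, F k x ^ 2 ∂μ ≤ C)
    (h : ∀ᵐ x ∂μ, Tendsto (fun k => F k x) atTop (𝓝 (f x))) :
    Tendsto (fun k => ∫ x, F k x * v x ∂μ) atTop (𝓝 (∫ x, f x * v x ∂μ)) := by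
  set K := 2 * C + 2 * ∫ x, f x ^ 2 ∂μ with hK
  have hg : ∀ k, MemLp (fun x => |F k x - f x|) 2 μ := fun k => ((hF k).sub hf).abs
  have hgK : ∀ k, ∫ x, |F k x - f x| ^ 2 ∂μ ≤ K := by
    intro k
    have i1 := (hF k).integrable_sq; have i2 := hf.integrable_sq
    calc ∫ x, |F k x - f x| ^ 2 ∂μ ≤ ∫ x, (2 * F k x ^ 2 + 2 * f x ^ 2) ∂μ := by
          refine integral_mono (hg k).integrable_sq ((i1.const_mul 2).add (i2.const_mul 2)) fun x => ?_
          simp only [Pi.add_apply, sq_abs]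
          nlinarith [sq_nonneg (F k x + f x)]
      _ = 2 * (∫ x, F k x ^ 2 ∂μ) + 2 * ∫ x, f x ^ 2 ∂μ := by
          rw [integral_add (i1.const_mul 2) (i2.const_mul 2), integral_const_mul, integral_const_mul]
      _ ≤ K := by rw [hK]; linarith [hC k]
  have hK0 : 0 ≤ K := le_trans (integral_nonneg fun x => sq_nonneg _) (hgK 0)
  rw [Metric.tendsto_atTop]
  intro ε hε
  obtain ⟨M, hM, hMe⟩ : ∃ M : ℝ, 0 < M ∧ K / M < ε / 2 := by
    refine ⟨2 * (K + 1) / ε, by positivity, ?_⟩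
    rw [div_lt_div_iff₀ (by positivity) (by norm_num)]
    have : ε * (2 * (K + 1) / ε) = 2 * (K + 1) := by field_simp
    rw [this]; linarith
  -- dominated part
  have hmeas : ∀ k, AEStronglyMeasurable (fun x => min (|F k x - f x|) (M * |v x|) * |v x|) μ := fun k =>
    ((hg k).1.inf ((hv.abs).1.const_mul M)).mul hv.abs.1
  have hdom : Tendsto (fun k => ∫ x, min (|F k x - f x|) (M * |v x|) * |v x| ∂μ) atTop (𝓝 (∫ x, (0:ℝ) ∂μ)) := by
    refine tendsto_integral_of_dominated_convergence (fun x => M * v x ^ 2) hmeas (hv.integrable_sq.const_mul M) ?_ ?_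
    · intro k; refine ae_of_all _ fun x => ?_
      rw [Real.norm_of_nonneg (mul_nonneg (le_min (abs_nonneg _) (by positivity)) (abs_nonneg _)), ← sq_abs (v x)]
      nlinarith [min_le_right (|F k x - f x|) (M * |v x|), abs_nonneg (v x)]
    · filter_upwards [h] with x hx
      have h1 : Tendsto (fun k => |F k x - f x|) atTop (𝓝 0) := by
        have := (hx.sub_const (f x)).abs; simpa using this
      have h2 : Tendsto (fun k => |F k x - f x| * |v x|) atTop (𝓝 0) := by simpa using h1.mul_const (|v x|)
      refine squeeze_zero (fun k => mul_nonneg (le_min (abs_nonneg _) (by positivity)) (abs_nonneg _)) (fun k => ?_) h2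
      exact mul_le_mul_of_nonneg_right (min_le_left _ _) (abs_nonneg _)
  rw [integral_zero, Metric.tendsto_atTop] at hdom
  obtain ⟨N, hN⟩ := hdom (ε / 2) (by positivity)
  refine ⟨N, fun k hk => ?_⟩
  have e1 := hN k hk
  rw [Real.dist_eq, sub_zero] at e1
  rw [Real.dist_eq, ← integral_sub (l2_mul (hF k) hv) (l2_mul hf hv)]
  have hpt : ∀ x, |F k x * v x - f x * v x| ≤ min (|F k x - f x|) (M * |v x|) * |v x| + M⁻¹ * |F k x - f x| ^ 2 := by
    intro x
    rw [← sub_mul, abs_mul]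
    rcases le_total (|F k x - f x|) (M * |v x|) with hh | hh
    · rw [min_eq_left hh]; have : 0 ≤ M⁻¹ * |F k x - f x| ^ 2 := by positivity
      linarith
    · rw [min_eq_right hh]
      have h3 : |v x| ≤ M⁻¹ * |F k x - f x| := by
        rw [inv_mul_eq_div, le_div_iff₀ hM]; linarith
      have h4 : 0 ≤ M * |v x| * |v x| := by positivity
      nlinarith [abs_nonneg (F k x - f x)]
  have imin : Integrable (fun x => min (|F k x - f x|) (M * |v x|) * |v x|) μ := by
    refine (l2_mul (hg k) hv.abs).mono (hmeas k) (ae_of_all _ fun x => ?_)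
    rw [Real.norm_of_nonneg (mul_nonneg (le_min (abs_nonneg _) (by positivity)) (abs_nonneg _)),
      Real.norm_eq_abs]
    refine le_trans ?_ (le_abs_self _)
    exact mul_le_mul_of_nonneg_right (min_le_left _ _) (abs_nonneg _)
  have isq := (hg k).integrable_sq.const_mul M⁻¹
  calc |∫ x, (F k x * v x - f x * v x) ∂μ| ≤ ∫ x, |F k x * v x - f x * v x| ∂μ := abs_integral_le_integral_abs
    _ ≤ ∫ x, (min (|F k x - f x|) (M * |v x|) * |v x| + M⁻¹ * |F k x - f x| ^ 2) ∂μ :=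
        integral_mono ((l2_mul (hF k) hv).sub (l2_mul hf hv)).abs (imin.add isq) hpt
    _ = (∫ x, min (|F k x - f x|) (M * |v x|) * |v x| ∂μ) + M⁻¹ * ∫ x, |F k x - f x| ^ 2 ∂μ := by
        rw [integral_add imin isq, integral_const_mul]
    _ ≤ (∫ x, min (|F k x - f x|) (M * |v x|) * |v x| ∂μ) + M⁻¹ * K := by
        have := mul_le_mul_of_nonneg_left (hgK k) (inv_nonneg.2 hM.le); linarith
    _ < ε / 2 + ε / 2 := by
        rw [inv_mul_eq_div]; have := le_abs_self (∫ x, min (|F k x - f x|) (M * |v x|) * |v x| ∂μ); linarith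
    _ = ε := by ring

/-- half space -/
def Hs (l : Fin n) : Set (Eu n) := {y | y l < 0}
/-- Lebesgue measure on the half space -/
def hm (l : Fin n) : Measure (Eu n) := volume.restrict (Hs l)
/-- translation -/
def tr (e : Fin n) (s : ℝ) (f : Eu n → ℝ) : Eu n → ℝ := fun y => f (y + s • bv e)

variable {l e : Fin n}

lemma Hs_open : IsOpen (Hs l) := isOpen_lt (by fun_prop) continuous_const
lemma Hs_meas : MeasurableSet (Hs l) := Hs_open.measurableSet
lemma Hs_tr (he : e ≠ l) (s : ℝ) (y : Eu n) : y + s • bv e ∈ Hs l ↔ y ∈ Hs l := by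
  simp [Hs, he.symm]

lemma Hs_convex : Convex ℝ (Hs l) := by
  intro x hx y hy a b ha hb hab
  simp only [Hs, mem_setOf_eq] at *
  simp only [PiLp.add_apply, PiLp.smul_apply, smul_eq_mul]
  rcases ha.eq_or_lt with h | h
  · have : b = 1 := by linarith
    rw [← h, this]; simpa using hy
  · nlinarith

instance : SFinite (hm l) := by unfold hm; infer_instance

lemma mp_tr (he : e ≠ l) (s : ℝ) : MeasurePreserving (fun y : Eu n => y + s • bv e) (hm l) (hm l) := by
  have := (measurePreserving_add_right (volume : Measure (Eu n)) (s • bv e)).restrict_preimage (Hs_meas (l := l))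
  have h2 : (fun y : Eu n => y + s • bv e) ⁻¹' Hs l = Hs l := by ext y; exact Hs_tr he s y
  rw [h2] at this
  exact this

lemma int_tr (he : e ≠ l) (s : ℝ) (f : Eu n → ℝ) : ∫ y, tr e s f y ∂(hm l) = ∫ y, f y ∂(hm l) :=
  (mp_tr he s).integral_comp (Homeomorph.addRight (s • bv e : Eu n)).measurableEmbedding f

lemma tr_l2 (he : e ≠ l) (s : ℝ) {f : Eu n → ℝ} (hf : MemLp f 2 (hm l)) : MemLp (tr e s f) 2 (hm l) :=
  hf.comp_measurePreserving (mp_tr he s)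

lemma pd_tr (i : Fin n) (s : ℝ) (f : Eu n → ℝ) : pd i (tr e s f) = tr e s (pd i f) := by
  ext y; show fderiv ℝ (fun y => f (y + s • bv e)) y (bv i) = fderiv ℝ f (y + s • bv e) (bv i); rw [fderiv_comp_add_right]

lemma tr_contDiffOn (he : e ≠ l) (s : ℝ) {k : WithTop ℕ∞} {f : Eu n → ℝ} (hf : ContDiffOn ℝ k f (Hs l)) :
    ContDiffOn ℝ k (tr e s f) (Hs l) :=
  hf.comp (by fun_prop : ContDiff ℝ k (fun y : Eu n => y + s • bv e)).contDiffOn fun y hy => (Hs_tr he s y).2 hy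

lemma hm_aesm {f : Eu n → ℝ} (hf : ContinuousOn f (Hs l)) : AEStronglyMeasurable f (hm l) :=
  hf.aestronglyMeasurable Hs_meas

lemma int_tr_sub (he : e ≠ l) (s : ℝ) {f g : Eu n → ℝ} (hf : MemLp f 2 (hm l)) (hg : MemLp g 2 (hm l)) :
    ∫ y, f y * (tr e (-s) g y - g y) ∂(hm l) = ∫ y, (tr e s f y - f y) * g y ∂(hm l) := by
  have e1 : ∫ y, f y * tr e (-s) g y ∂(hm l) = ∫ y, tr e s f y * g y ∂(hm l) := by
    rw [← int_tr he s (fun y => f y * tr e (-s) g y)]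
    congr 1; ext y; simp [tr]
  simp only [mul_sub, sub_mul]
  rw [integral_sub (l2_mul hf (tr_l2 he _ hg)) (l2_mul hf hg), integral_sub (l2_mul (tr_l2 he _ hf) hg) (l2_mul hf hg), e1]

lemma tr_hasDerivAt (he : e ≠ l) {f : Eu n → ℝ} (hf : ContDiffOn ℝ 1 f (Hs l)) {y : Eu n} (hy : y ∈ Hs l) (s : ℝ) :
    HasDerivAt (fun s => f (y + s • bv e)) (pd e f (y + s • bv e)) s := by
  have h1 := (hf.diffAt Hs_open (by simp) ((Hs_tr he s y).2 hy)).hasFDerivAt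
  have h2 : HasDerivAt (fun s : ℝ => y + s • (bv e : Eu n)) (bv e) s := by
    simpa using ((hasDerivAt_id s).smul_const (bv e : Eu n)).const_add y
  exact h1.comp_hasDerivAt s h2

lemma tr_bound (he : e ≠ l) {f : Eu n → ℝ} (hf : ContDiffOn ℝ 1 f (Hs l)) (hl : MemLp (pd e f) 2 (hm l)) (t : ℝ) :
    MemLp (fun y => tr e t f y - f y) 2 (hm l) ∧
      ∫ y, (tr e t f y - f y) ^ 2 ∂(hm l) ≤ t ^ 2 * ∫ y, pd e f y ^ 2 ∂(hm l) := by
  classical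
  have hc : ContinuousOn (pd e f) (Hs l) := pd_continuousOn Hs_open hf
  have hk : Measurable ((Hs l).indicator (fun y => t * pd e f y)) := by
    rw [← piecewise_eq_indicator]
    exact ContinuousOn.measurable_piecewise (continuousOn_const.mul hc) continuousOn_const Hs_meas
  have h := flow_lintegral (μ := hm l) (φ := fun s y => y + (s * t) • bv e) (h := f)
    (k := (Hs l).indicator (fun y => t * pd e f y)) (t := 1) (by fun_prop)
    (fun s => mp_tr he _) (by simp) hk ?_ zero_le_one
  · have e2 : ∫⁻ y, ENNReal.ofReal ((Hs l).indicator (fun y => t * pd e f y) y ^ 2) ∂(hm l) =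
        ENNReal.ofReal (t ^ 2 * ∫ y, pd e f y ^ 2 ∂(hm l)) := by
      rw [← integral_const_mul, ofReal_integral_eq_lintegral_ofReal (hl.integrable_sq.const_mul _)
        (ae_of_all _ fun y => by positivity)]
      refine setLIntegral_congr_fun Hs_meas fun y hy => ?_
      simp only [indicator_of_mem hy, mul_pow]
    rw [e2] at h
    simp only [one_mul, one_pow, ENNReal.ofReal_one] at h
    have hm1 : AEStronglyMeasurable (fun y => tr e t f y - f y) (hm l) :=
      (hm_aesm (tr_contDiffOn he t hf).continuousOn).sub (hm_aesm hf.continuousOn)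
    have := real_of_lint (μ := hm l) (g := fun y => (tr e t f y - f y) ^ 2) (C := t ^ 2 * ∫ y, pd e f y ^ 2 ∂(hm l))
      (mul_nonneg (sq_nonneg _) (integral_nonneg fun y => sq_nonneg _)) (hm1.pow 2) (fun y => sq_nonneg _) h
    exact ⟨(memLp_two_iff_integrable_sq hm1).2 this.1, this.2⟩
  · refine (ae_restrict_iff' Hs_meas).2 (ae_of_all _ fun y hy => ⟨fun s => ?_, ?_⟩)
    · rw [indicator_of_mem ((Hs_tr he _ y).2 hy)]
      have := (tr_hasDerivAt he hf hy (s * t)).comp s ((hasDerivAt_id s).mul_const t)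
      refine this.congr_deriv ?_
      simp; ring
    · have : (fun s : ℝ => (Hs l).indicator (fun y => t * pd e f y) (y + (s * t) • bv e)) =
          fun s => t * pd e f (y + (s * t) • bv e) := by
        ext s; rw [indicator_of_mem ((Hs_tr he _ y).2 hy)]
      rw [this]
      exact continuous_const.mul (hc.comp_continuous (by fun_prop) fun s => (Hs_tr he _ y).2 hy)

lemma dq_tendsto (he : e ≠ l) {f : Eu n → ℝ} (hf : ContDiffOn ℝ 1 f (Hs l)) {y : Eu n} (hy : y ∈ Hs l)
    {s : ℕ → ℝ} (hs : Tendsto s atTop (𝓝 0)) (hs0 : ∀ k, s k ≠ 0) :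
    Tendsto (fun k => (s k)⁻¹ * (tr e (s k) f y - f y)) atTop (𝓝 (pd e f y)) := by
  have h := tr_hasDerivAt he hf hy 0
  rw [hasDerivAt_iff_tendsto_slope_zero] at h
  have h2 : Tendsto s atTop (𝓝[≠] 0) := tendsto_nhdsWithin_iff.2 ⟨hs, Eventually.of_forall hs0⟩
  have := h.comp h2
  simpa [tr, Function.comp_def] using this

lemma tr_weak (he : e ≠ l) {f v : Eu n → ℝ} (hf : ContDiffOn ℝ 1 f (Hs l)) (hl : MemLp (pd e f) 2 (hm l))
    (hv : MemLp v 2 (hm l)) {s : ℕ → ℝ} (hs : Tendsto s atTop (𝓝 0)) (hs0 : ∀ k, s k ≠ 0) :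
    Tendsto (fun k => (s k)⁻¹ * ∫ y, (tr e (s k) f y - f y) * v y ∂(hm l)) atTop (𝓝 (∫ y, pd e f y * v y ∂(hm l))) := by
  have := weak_of_ae (μ := hm l) (F := fun k y => (s k)⁻¹ * (tr e (s k) f y - f y)) (f := pd e f) (v := v)
    (C := ∫ y, pd e f y ^ 2 ∂(hm l)) (fun k => (tr_bound he hf hl _).1.const_mul _) hl hv (fun k => ?_)
    ((ae_restrict_iff' Hs_meas).2 (ae_of_all _ fun y hy => dq_tendsto he hf hy hs hs0))
  · refine this.congr fun k => ?_
    rw [← integral_const_mul]; congr 1; ext y; ring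
  · simp only [mul_pow]
    rw [integral_const_mul]
    have h1 := (tr_bound he hf hl (s k)).2
    have h2 : 0 < s k ^ 2 := by have := hs0 k; positivity
    rw [inv_pow, inv_mul_le_iff₀ h2]; exact h1

lemma fatou_l2 (he : e ≠ l) {f : Eu n → ℝ} (hf : ContDiffOn ℝ 1 f (Hs l)) {C t0 : ℝ} (ht0 : 0 < t0) (hC : 0 ≤ C)
    (hl : MemLp f 2 (hm l))
    (h : ∀ t, 0 < t → t < t0 → ∫ y, (tr e t f y - f y) ^ 2 ∂(hm l) ≤ C * t ^ 2) : MemLp (pd e f) 2 (hm l) := by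
  have hm1 : AEStronglyMeasurable (pd e f) (hm l) := hm_aesm (pd_continuousOn Hs_open hf)
  set s : ℕ → ℝ := fun k => t0 / (k + 2) with hs
  have hs1 : ∀ k, 0 < s k := fun k => by positivity
  have hs2 : ∀ k, s k < t0 := fun k => by
    rw [hs]; simp only; rw [div_lt_iff₀ (by positivity)]; nlinarith [(Nat.cast_nonneg k : (0:ℝ) ≤ k)]
  have hst : Tendsto s atTop (𝓝 0) := by
    have : Tendsto (fun k : ℕ => (k : ℝ) + 2) atTop atTop := tendsto_atTop_add_const_right _ _ tendsto_natCast_atTop_atTop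
    exact this.const_div_atTop t0
  have hsm : ∀ k, AEStronglyMeasurable (fun y => (s k)⁻¹ * (tr e (s k) f y - f y)) (hm l) := fun k =>
    ((tr_l2 he _ hl).1.sub hl.1).const_mul _
  have hlim : ∫⁻ y, ENNReal.ofReal (pd e f y ^ 2) ∂(hm l) ≤ ENNReal.ofReal C := by
    have e1 : ∫⁻ y, ENNReal.ofReal (pd e f y ^ 2) ∂(hm l) =
        ∫⁻ y, liminf (fun k => ENNReal.ofReal (((s k)⁻¹ * (tr e (s k) f y - f y)) ^ 2)) atTop ∂(hm l) := by
      refine setLIntegral_congr_fun Hs_meas fun y hy => ?_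
      have := (ENNReal.tendsto_ofReal ((dq_tendsto he hf hy hst (fun k => (hs1 k).ne')).pow 2))
      exact this.liminf_eq.symm
    rw [e1]
    refine (lintegral_liminf_le' fun k => ((hsm k).pow 2).aemeasurable.ennreal_ofReal).trans ?_
    refine liminf_le_of_frequently_le' (Frequently.of_forall fun k => ?_)
    have hi : Integrable (fun y => ((s k)⁻¹ * (tr e (s k) f y - f y)) ^ 2) (hm l) :=
      (((tr_l2 he _ hl).sub hl).const_mul _).integrable_sq
    change ∫⁻ y, ENNReal.ofReal (((s k)⁻¹ * (tr e (s k) f y - f y)) ^ 2) ∂(hm l) ≤ _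
    rw [← ofReal_integral_eq_lintegral_ofReal hi (ae_of_all _ fun y => sq_nonneg _)]
    apply ENNReal.ofReal_le_ofReal
    simp only [mul_pow]
    rw [integral_const_mul, inv_pow, inv_mul_le_iff₀ (by have := hs1 k; positivity)]
    linarith [h (s k) (hs1 k) (hs2 k)]
  have := real_of_lint (μ := hm l) hC (hm1.pow 2) (fun y => sq_nonneg _) hlim
  exact (memLp_two_iff_integrable_sq hm1).2 this.1

/-! ## P7b: energy estimate in the half space -/

/-- admissible test functions on the half space -/
structure HAdm (l : Fin n) (v : Eu n → ℝ) : Prop where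
  c1 : ContDiffOn ℝ 1 v (Hs l)
  l2 : MemLp v 2 (hm l)
  gl2 : ∀ i, MemLp (pd i v) 2 (hm l)

/-- elliptic coefficients near `y0` -/
structure Coef (y0 : Eu n) (r1 c0 : ℝ) (a : Fin n → Fin n → Eu n → ℝ) : Prop where
  smooth : ∀ i j, ContDiff ℝ (⊤ : ℕ∞) (a i j)
  cs : ∀ i j, HasCompactSupport (a i j)
  pos : 0 < c0
  ell : ∀ y ∈ Metric.ball y0 r1, ∀ ξ : Fin n → ℝ, c0 * ∑ i, ξ i ^ 2 ≤ ∑ i, (∑ j, a i j y * ξ j) * ξ i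

variable {l e : Fin n} {y0 : Eu n} {r1 c0 : ℝ} {a : Fin n → Fin n → Eu n → ℝ}

lemma HAdm.diff {v : Eu n → ℝ} (hv : HAdm l v) {y : Eu n} (hy : y ∈ Hs l) : DifferentiableAt ℝ v y :=
  hv.c1.diffAt Hs_open (by simp) hy

lemma hm_congr {f g : Eu n → ℝ} (h : ∀ y ∈ Hs l, f y = g y) : f =ᵐ[hm l] g :=
  (ae_restrict_iff' Hs_meas).2 (ae_of_all _ h)

lemma hm_l2_congr {f g : Eu n → ℝ} (hf : MemLp f 2 (hm l)) (h : ∀ y ∈ Hs l, f y = g y) : MemLp g 2 (hm l) :=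
  (memLp_congr_ae (hm_congr h)).1 hf

lemma HAdm.sub {v w : Eu n → ℝ} (hv : HAdm l v) (hw : HAdm l w) : HAdm l (fun y => v y - w y) :=
  ⟨hv.c1.sub hw.c1, hv.l2.sub hw.l2, fun i => hm_l2_congr ((hv.gl2 i).sub (hw.gl2 i))
    fun y hy => (pd_sub (hv.diff hy) (hw.diff hy)).symm⟩

lemma HAdm.tr (he : e ≠ l) (s : ℝ) {v : Eu n → ℝ} (hv : HAdm l v) : HAdm l (tr e s v) :=
  ⟨tr_contDiffOn he s hv.c1, tr_l2 he s hv.l2, fun i => by rw [pd_tr]; exact tr_l2 he s (hv.gl2 i)⟩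

lemma Coef.bdd (hc : Coef y0 r1 c0 a) : ∃ M ≥ 0, ∀ i j y, |a i j y| ≤ M := by
  have : ∀ i j, ∃ M, ∀ y, ‖a i j y‖ ≤ M := fun i j => (hc.cs i j).exists_bound_of_continuous (hc.smooth i j).continuous
  choose M hM using this
  refine ⟨∑ i, ∑ j, |M i j|, by positivity, fun i j y => (hM i j y).trans ((le_abs_self _).trans ?_)⟩
  refine (Finset.single_le_sum (f := fun j => |M i j|) (fun j _ => abs_nonneg _) (Finset.mem_univ j)).trans ?_
  exact Finset.single_le_sum (f := fun i => ∑ j, |M i j|) (fun i _ => by positivity) (Finset.mem_univ i)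

lemma Coef.lip (hc : Coef y0 r1 c0 a) : ∃ L ≥ 0, ∀ i j y, ∀ (e : Fin n) (t : ℝ), |a i j (y + t • bv e) - a i j y| ≤ L * |t| := by
  have : ∀ i j, ∃ C, LipschitzWith C (a i j) := fun i j =>
    ((hc.smooth i j).of_le (by exact_mod_cast le_top : (1 : WithTop ℕ∞) ≤ _)).lipschitzWith_of_hasCompactSupport (hc.cs i j) (by simp)
  choose C hC using this
  refine ⟨∑ i, ∑ j, (C i j : ℝ), by positivity, fun i j y e t => ?_⟩
  have h1 := (hC i j).dist_le_mul (y + t • bv e) y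
  rw [Real.dist_eq, dist_eq_norm, add_sub_cancel_left, norm_smul, EuclideanSpace.norm_single] at h1
  simp only [norm_one, mul_one, Real.norm_eq_abs] at h1
  refine h1.trans (mul_le_mul_of_nonneg_right ?_ (abs_nonneg _))
  refine (Finset.single_le_sum (f := fun j => (C i j : ℝ)) (fun j _ => (C i j).coe_nonneg) (Finset.mem_univ j)).trans ?_
  exact Finset.single_le_sum (f := fun i => ∑ j, (C i j : ℝ)) (fun i _ => by positivity) (Finset.mem_univ i)

lemma l2_sum {X ι : Type*} [MeasurableSpace X] {μ : Measure X} (s : Finset ι) {f : ι → X → ℝ}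
    (h : ∀ i ∈ s, MemLp (f i) 2 μ) : MemLp (fun x => ∑ i ∈ s, f i x) 2 μ := memLp_finset_sum s h

lemma energy (hc : Coef y0 r1 c0 a) (he : e ≠ l) {r2 : ℝ} (hr : r2 < r1) {W : Eu n → ℝ} (hW : ContDiffOn ℝ (⊤ : ℕ∞) W (Hs l))
    (hA : HAdm l W) (hsup : ∀ y ∈ Hs l, r2 < dist y y0 → ∀ j, pd j W y = 0) {G : Fin n → Eu n → ℝ} {F : Eu n → ℝ}
    (hG : ∀ i, ContDiffOn ℝ 1 (G i) (Hs l)) (hGl : ∀ i, MemLp (G i) 2 (hm l)) (hGe : ∀ i, MemLp (pd e (G i)) 2 (hm l))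
    (hF : MemLp F 2 (hm l))
    (hw : ∀ v, HAdm l v → ∫ y, (∑ i, ((∑ j, a i j y * pd j W y) + G i y) * pd i v y) ∂(hm l) = ∫ y, F y * v y ∂(hm l)) :
    ∀ j, MemLp (pd e (pd j W)) 2 (hm l) := by
  obtain ⟨M, hM0, hM⟩ := hc.bdd
  obtain ⟨L, hL0, hL⟩ := hc.lip
  have hc0 := hc.pos
  set K : ℝ := √(∫ y, F y ^ 2 ∂(hm l)) + ((∑ i : Fin n, ∑ j, L * √(∫ y, pd j W y ^ 2 ∂(hm l))) + ∑ i, √(∫ y, pd e (G i) y ^ 2 ∂(hm l))) with hK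
  have hK0 : 0 ≤ K := by positivity
  have ham : ∀ i j, AEStronglyMeasurable (a i j) (hm l) := fun i j => (hc.smooth i j).continuous.aestronglyMeasurable
  have hAi : ∀ i, MemLp (fun y => (∑ j, a i j y * pd j W y) + G i y) 2 (hm l) := fun i =>
    (l2_sum _ fun j _ => l2_bdd_mul (hA.gl2 j) (ham i j) (ae_of_all _ (hM i j))).add (hGl i)
  have key : ∀ t, 0 < t → t < r1 - r2 → ∀ j, ∫ y, (tr e t (pd j W) y - pd j W y) ^ 2 ∂(hm l) ≤ (K / c0) ^ 2 * t ^ 2 := by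
    intro t ht htr j
    set X : Eu n → ℝ := fun y => tr e t W y - W y with hX
    set P : Fin n → Eu n → ℝ := fun i y => tr e t (pd i W) y - pd i W y with hP
    have hXA : HAdm l X := (hA.tr he t).sub hA
    have hPX : ∀ i, ∀ y ∈ Hs l, pd i X y = P i y := by
      intro i y hy
      rw [hX, pd_sub ((hA.tr he t).diff hy) (hA.diff hy), pd_tr]
    have hPl : ∀ i, MemLp (P i) 2 (hm l) := fun i => (tr_l2 he t (hA.gl2 i)).sub (hA.gl2 i)
    set v : Eu n → ℝ := fun y => tr e (-t) X y - X y with hv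
    have hvA : HAdm l v := (hXA.tr he _).sub hXA
    have hPv : ∀ i, ∀ y ∈ Hs l, pd i v y = tr e (-t) (P i) y - P i y := by
      intro i y hy
      rw [hv, pd_sub ((hXA.tr he _).diff hy) (hXA.diff hy), pd_tr, hPX i y hy]
      simp only [tr]; rw [hPX i _ ((Hs_tr he _ y).2 hy)]
    set E2 := ∫ y, ∑ i, P i y ^ 2 ∂(hm l) with hE2
    have hPi : ∀ i, ∫ y, P i y ^ 2 ∂(hm l) ≤ E2 := by
      intro i
      refine integral_mono (hPl i).integrable_sq (integrable_finset_sum _ fun i _ => (hPl i).integrable_sq) fun y => ?_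
      exact Finset.single_le_sum (f := fun i => P i y ^ 2) (fun i _ => sq_nonneg _) (Finset.mem_univ i)
    have hE0 : 0 ≤ E2 := integral_nonneg fun y => Finset.sum_nonneg fun i _ => sq_nonneg _
    have hPs : ∀ i, √(∫ y, P i y ^ 2 ∂(hm l)) ≤ √E2 := fun i => Real.sqrt_le_sqrt (hPi i)
    -- weak form
    have h1 := hw v hvA
    have h2 : ∫ y, (∑ i, ((∑ j, a i j y * pd j W y) + G i y) * pd i v y) ∂(hm l) =
        ∑ i, ∫ y, (tr e t (fun y => (∑ j, a i j y * pd j W y) + G i y) y - ((∑ j, a i j y * pd j W y) + G i y)) * P i y ∂(hm l) := by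
      rw [integral_congr_ae (hm_congr (l := l) (g := fun y => ∑ i, ((∑ j, a i j y * pd j W y) + G i y) * (tr e (-t) (P i) y - P i y))
        fun y hy => Finset.sum_congr rfl fun i _ => by rw [hPv i y hy])]
      have hi : ∀ i ∈ Finset.univ, Integrable (fun y => ((∑ j, a i j y * pd j W y) + G i y) * (tr e (-t) (P i) y - P i y)) (hm l) :=
        fun i _ => l2_mul (hAi i) ((tr_l2 he _ (hPl i)).sub (hPl i))
      rw [integral_finset_sum _ hi]
      exact Finset.sum_congr rfl fun i _ => int_tr_sub he t (hAi i) (hPl i)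
    have hat : ∀ i j, MemLp (fun y => a i j (y + t • bv e) * P j y) 2 (hm l) := fun i j =>
      l2_bdd_mul (hPl j) ((hc.smooth i j).continuous.comp (by fun_prop)).aestronglyMeasurable (ae_of_all _ fun y => hM i j _)
    have hda : ∀ i j, MemLp (fun y => (a i j (y + t • bv e) - a i j y) * pd j W y) 2 (hm l) := fun i j =>
      l2_bdd_mul (hA.gl2 j) (((hc.smooth i j).continuous.comp (by fun_prop)).sub (hc.smooth i j).continuous).aestronglyMeasurable
        (ae_of_all _ fun y => hL i j y e t)
    have hdG : ∀ i, MemLp (fun y => tr e t (G i) y - G i y) 2 (hm l) := fun i => (tr_bound he (hG i) (hGe i) t).1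
    have h3 : ∀ i, ∫ y, (tr e t (fun y => (∑ j, a i j y * pd j W y) + G i y) y - ((∑ j, a i j y * pd j W y) + G i y)) * P i y ∂(hm l)
        = (∫ y, (∑ j, a i j (y + t • bv e) * P j y) * P i y ∂(hm l)) +
          ((∑ j, ∫ y, ((a i j (y + t • bv e) - a i j y) * pd j W y) * P i y ∂(hm l)) + ∫ y, (tr e t (G i) y - G i y) * P i y ∂(hm l)) := by
      intro i
      have i1 := l2_mul (l2_sum Finset.univ fun j _ => hat i j) (hPl i)
      have i2 : ∀ j ∈ Finset.univ, Integrable (fun y => ((a i j (y + t • bv e) - a i j y) * pd j W y) * P i y) (hm l) :=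
        fun j _ => l2_mul (hda i j) (hPl i)
      have i3 := l2_mul (hdG i) (hPl i)
      have i4 : Integrable (fun y => (∑ j, ((a i j (y + t • bv e) - a i j y) * pd j W y) * P i y) + (tr e t (G i) y - G i y) * P i y) (hm l) :=
        (integrable_finset_sum _ i2).add i3
      rw [← integral_finset_sum _ i2, ← integral_add (integrable_finset_sum _ i2) i3, ← integral_add i1 i4]
      congr 1; ext y
      simp only [tr, hP]
      rw [← Finset.sum_mul, ← add_mul, ← add_mul]
      congr 1
      rw [← add_assoc, ← Finset.sum_add_distrib, ← sub_sub, add_sub_right_comm, ← Finset.sum_sub_distrib, add_sub_assoc]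
      congr 1
      exact Finset.sum_congr rfl fun j _ => by ring
    have hell : c0 * E2 ≤ ∑ i, ∫ y, (∑ j, a i j (y + t • bv e) * P j y) * P i y ∂(hm l) := by
      rw [hE2, ← integral_const_mul, ← integral_finset_sum _ fun i _ => l2_mul (l2_sum Finset.univ fun j _ => hat i j) (hPl i)]
      refine integral_mono_ae ((integrable_finset_sum _ fun i _ => (hPl i).integrable_sq).const_mul _)
        (integrable_finset_sum _ fun i _ => l2_mul (l2_sum Finset.univ fun j _ => hat i j) (hPl i)) ?_
      refine (ae_restrict_iff' Hs_meas).2 (ae_of_all _ fun y hy => ?_)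
      by_cases hb : y + t • bv e ∈ Metric.ball y0 r1
      · exact hc.ell _ hb fun i => P i y
      · rw [Metric.mem_ball, not_lt] at hb
        have hd : dist (y + t • bv e) y0 ≤ t + dist y y0 := by
          refine (dist_triangle _ y _).trans ?_
          rw [dist_eq_norm, add_sub_cancel_left, norm_smul, EuclideanSpace.norm_single]
          simp [abs_of_pos ht]
        have hP0 : ∀ i, P i y = 0 := by
          intro i
          simp only [hP, tr]
          rw [hsup y hy (by linarith) i, hsup _ ((Hs_tr he t y).2 hy) (by linarith) i, sub_zero]
        simp [hP0]
    -- estimates of the right-hand side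
    have b1 : |∫ y, F y * v y ∂(hm l)| ≤ √(∫ y, F y ^ 2 ∂(hm l)) * (t * √E2) := by
      refine (cs_abs hF hvA.l2).trans (mul_le_mul_of_nonneg_left ?_ (Real.sqrt_nonneg _))
      have hXe : MemLp (pd e X) 2 (hm l) := hXA.gl2 e
      have := (tr_bound he hXA.c1 hXe (-t)).2
      have heq : ∫ y, pd e X y ^ 2 ∂(hm l) = ∫ y, P e y ^ 2 ∂(hm l) :=
        integral_congr_ae (hm_congr (l := l) fun y hy => by simp only [hPX e y hy])
      rw [heq] at this
      have h5 : ∫ y, v y ^ 2 ∂(hm l) ≤ t ^ 2 * E2 := by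
        refine this.trans ?_
        rw [neg_sq]; exact mul_le_mul_of_nonneg_left (hPi e) (sq_nonneg _)
      refine (Real.sqrt_le_sqrt h5).trans ?_
      rw [Real.sqrt_mul (sq_nonneg _), Real.sqrt_sq ht.le]
    have b2 : ∀ i j, |∫ y, ((a i j (y + t • bv e) - a i j y) * pd j W y) * P i y ∂(hm l)| ≤ (L * √(∫ y, pd j W y ^ 2 ∂(hm l))) * (t * √E2) := by
      intro i j
      refine (cs_abs (hda i j) (hPl i)).trans ?_
      have h5 : ∫ y, ((a i j (y + t • bv e) - a i j y) * pd j W y) ^ 2 ∂(hm l) ≤ (L * t) ^ 2 * ∫ y, pd j W y ^ 2 ∂(hm l) := by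
        rw [← integral_const_mul]
        refine integral_mono (hda i j).integrable_sq ((hA.gl2 j).integrable_sq.const_mul _) fun y => ?_
        simp only [mul_pow]
        refine mul_le_mul_of_nonneg_right ?_ (sq_nonneg _)
        have := hL i j y e t
        rw [abs_of_pos ht] at this
        rw [← mul_pow]; exact sq_le_sq' (by linarith [(abs_le.1 this).1]) (abs_le.1 this).2
      have h6 := Real.sqrt_le_sqrt h5
      rw [Real.sqrt_mul (sq_nonneg _), Real.sqrt_sq (by positivity)] at h6
      calc _ ≤ (L * t * √(∫ y, pd j W y ^ 2 ∂(hm l))) * √E2 := mul_le_mul h6 (hPs i) (Real.sqrt_nonneg _) (by positivity)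
        _ = _ := by ring
    have b3 : ∀ i, |∫ y, (tr e t (G i) y - G i y) * P i y ∂(hm l)| ≤ √(∫ y, pd e (G i) y ^ 2 ∂(hm l)) * (t * √E2) := by
      intro i
      refine (cs_abs (hdG i) (hPl i)).trans ?_
      have h6 := Real.sqrt_le_sqrt (tr_bound he (hG i) (hGe i) t).2
      rw [Real.sqrt_mul (sq_nonneg _), Real.sqrt_sq ht.le] at h6
      calc _ ≤ (t * √(∫ y, pd e (G i) y ^ 2 ∂(hm l))) * √E2 := mul_le_mul h6 (hPs i) (Real.sqrt_nonneg _) (by positivity)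
        _ = _ := by ring
    rw [h2, Finset.sum_congr rfl fun i _ => h3 i, Finset.sum_add_distrib, Finset.sum_add_distrib] at h1
    have hfin : c0 * E2 ≤ K * (t * √E2) := by
      rw [hK, add_mul, add_mul]
      have c2 : -(∑ i : Fin n, (∑ j, L * √(∫ y, pd j W y ^ 2 ∂(hm l))) * (t * √E2)) ≤
          ∑ i, ∑ j, ∫ y, ((a i j (y + t • bv e) - a i j y) * pd j W y) * P i y ∂(hm l) := by
        rw [← Finset.sum_neg_distrib]
        refine Finset.sum_le_sum fun i _ => ?_
        rw [Finset.sum_mul, ← Finset.sum_neg_distrib]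
        exact Finset.sum_le_sum fun j _ => (abs_le.1 (b2 i j)).1
      have c3 : -(∑ i, √(∫ y, pd e (G i) y ^ 2 ∂(hm l)) * (t * √E2)) ≤ ∑ i, ∫ y, (tr e t (G i) y - G i y) * P i y ∂(hm l) := by
        rw [← Finset.sum_neg_distrib]
        exact Finset.sum_le_sum fun i _ => (abs_le.1 (b3 i)).1
      have := (abs_le.1 b1).2
      rw [← Finset.sum_mul] at c2 c3
      linarith
    have hsE : √E2 ^ 2 = E2 := Real.sq_sqrt hE0
    have hEb : √E2 ≤ K / c0 * t := by
      rw [div_mul_eq_mul_div, le_div_iff₀ hc0]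
      rcases (Real.sqrt_nonneg E2).eq_or_lt with h0 | h0
      · rw [← h0]; simp; positivity
      · have : (√E2 * c0) * √E2 ≤ (K * t) * √E2 := by nlinarith
        exact le_of_mul_le_mul_right this h0
    calc _ ≤ E2 := hPi j
      _ = √E2 ^ 2 := hsE.symm
      _ ≤ (K / c0 * t) ^ 2 := pow_le_pow_left₀ (Real.sqrt_nonneg _) hEb 2
      _ = _ := by ring
  intro j
  exact fatou_l2 he ((pd_smooth Hs_open hW).of_le (by exact_mod_cast le_top)) (sub_pos.2 hr) (sq_nonneg (K / c0)) (hA.gl2 j) fun t h1 h2 => key t h1 h2 j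

/-! ## P7c: classes of functions with square integrable derivatives -/

lemma nat_le_inf (k : ℕ) : (k : WithTop ℕ∞) ≤ ((⊤ : ℕ∞) : WithTop ℕ∞) := by exact_mod_cast (le_top : (k : ℕ∞) ≤ ⊤)
lemma two_le_inf : (2 : WithTop ℕ∞) ≤ ((⊤ : ℕ∞) : WithTop ℕ∞) := nat_le_inf 2

/-- all derivatives of order `≤ k` in the directions of `S` are square integrable on `U` -/
def TS (S : Set (Fin n)) (U : Set (Eu n)) : ℕ → (Eu n → ℝ) → Prop
  | 0, g => MemLp g 2 (volume.restrict U)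
  | k + 1, g => MemLp g 2 (volume.restrict U) ∧ ∀ e ∈ S, TS S U k (pd e g)

section TSsec
variable {S : Set (Fin n)} {U V : Set (Eu n)} {k : ℕ} {f g : Eu n → ℝ}

lemma TS.l2 (h : TS S U k g) : MemLp g 2 (volume.restrict U) := by
  cases k with
  | zero => exact h
  | succ k => exact h.1

lemma TS.down (h : TS S U (k + 1) g) : TS S U k g := by
  induction k generalizing g with
  | zero => exact h.1
  | succ k ih => exact ⟨h.1, fun e he => ih (h.2 e he)⟩

lemma TS.congr (hU : IsOpen U) (h : TS S U k f) (hfg : ∀ y ∈ U, f y = g y) : TS S U k g := by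
  induction k generalizing f g with
  | zero => exact (memLp_congr_ae ((ae_restrict_iff' hU.measurableSet).2 (ae_of_all _ hfg))).1 h
  | succ k ih =>
    refine ⟨(memLp_congr_ae ((ae_restrict_iff' hU.measurableSet).2 (ae_of_all _ hfg))).1 h.1, fun e he => ih (h.2 e he) ?_⟩
    exact fun y hy => pd_congr (Filter.eventuallyEq_of_mem (hU.mem_nhds hy) hfg)

lemma TS.mono_set (h : TS S U k g) (hVU : V ⊆ U) : TS S V k g := by
  induction k generalizing g with
  | zero => exact MemLp.mono_measure (Measure.restrict_mono hVU le_rfl) h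
  | succ k ih => exact ⟨MemLp.mono_measure (Measure.restrict_mono hVU le_rfl) h.1, fun e he => ih (h.2 e he)⟩

lemma TS.add (hU : IsOpen U) (hf : ContDiffOn ℝ (⊤ : ℕ∞) f U) (hg : ContDiffOn ℝ (⊤ : ℕ∞) g U) (h1 : TS S U k f) (h2 : TS S U k g) :
    TS S U k (fun y => f y + g y) := by
  induction k generalizing f g with
  | zero => exact MemLp.add h1 h2
  | succ k ih =>
    refine ⟨MemLp.add h1.1 h2.1, fun e he => ?_⟩
    refine (ih (pd_smooth hU hf) (pd_smooth hU hg) (h1.2 e he) (h2.2 e he)).congr hU fun y hy => ?_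
    exact (pd_add (hf.diffAt hU (by simp) hy) (hg.diffAt hU (by simp) hy)).symm

lemma TS.zero : TS S U k (fun _ => 0) := by
  induction k with
  | zero => exact MemLp.zero
  | succ k ih =>
    refine ⟨MemLp.zero, fun e he => ?_⟩
    have : pd e (fun _ : Eu n => (0 : ℝ)) = fun _ => 0 := by ext y; exact pd_const
    rw [this]; exact ih

lemma TS.sum (hU : IsOpen U) {ι : Type*} (s : Finset ι) {f : ι → Eu n → ℝ} (hf : ∀ i ∈ s, ContDiffOn ℝ (⊤ : ℕ∞) (f i) U)
    (h : ∀ i ∈ s, TS S U k (f i)) : TS S U k (fun y => ∑ i ∈ s, f i y) := by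
  classical
  induction s using Finset.induction_on with
  | empty => simpa using TS.zero
  | insert i s hi ih =>
    simp only [Finset.sum_insert hi]
    refine TS.add hU (hf i (by simp)) ?_ (h i (by simp)) (ih (fun j hj => hf j (by simp [hj])) fun j hj => h j (by simp [hj]))
    exact ContDiffOn.sum fun j hj => hf j (by simp [hj])

lemma TS.mul (hU : IsOpen U) (hf : ContDiff ℝ (⊤ : ℕ∞) f) (hc : HasCompactSupport f) (hg : ContDiffOn ℝ (⊤ : ℕ∞) g U) (h : TS S U k g) :
    TS S U k (fun y => f y * g y) := by
  have base : ∀ {f g : Eu n → ℝ}, ContDiff ℝ (⊤ : ℕ∞) f → HasCompactSupport f → MemLp g 2 (volume.restrict U) →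
      MemLp (fun y => f y * g y) 2 (volume.restrict U) := by
    intro f g hf hc hg
    obtain ⟨M, hM⟩ := hc.exists_bound_of_continuous hf.continuous
    exact l2_bdd_mul hg hf.continuous.aestronglyMeasurable (ae_of_all _ hM)
  induction k generalizing f g with
  | zero => exact base hf hc h
  | succ k ih =>
    refine ⟨base hf hc h.1, fun e he => ?_⟩
    refine ((ih hf hc (pd_smooth hU hg) (h.2 e he)).add hU (hf.contDiffOn.mul (pd_smooth hU hg))
      ((pd_contDiff hf).contDiffOn.mul hg) (ih (pd_contDiff hf) (pd_compactSupport hc e) hg h.down)).congr hU fun y hy => ?_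
    exact (pd_mul (hf.differentiable (by simp) y) (hg.diffAt hU (by simp) hy)).symm

lemma TS.ext (hU : IsOpen U) (hV : IsOpen V) {K : Set (Eu n)} (hK : IsClosed K) (hUV : U ⊆ V) (hKU : V ∩ K ⊆ U)
    (h0 : ∀ y ∈ V, y ∉ K → g y = 0) (h : TS S U k g) : TS S V k g := by
  have base : ∀ {g : Eu n → ℝ}, (∀ y ∈ V, y ∉ K → g y = 0) → MemLp g 2 (volume.restrict U) → MemLp g 2 (volume.restrict V) := by
    intro g h0 h
    have h1 : MemLp (U.indicator g) 2 (volume.restrict V) :=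
      MemLp.mono_measure Measure.restrict_le_self ((memLp_indicator_iff_restrict hU.measurableSet).2 h)
    refine (memLp_congr_ae ((ae_restrict_iff' hV.measurableSet).2 (ae_of_all _ fun y hy => ?_))).1 h1
    by_cases hyU : y ∈ U
    · rw [indicator_of_mem hyU]
    · rw [indicator_of_notMem hyU, h0 y hy fun hyK => hyU (hKU ⟨hy, hyK⟩)]
  induction k generalizing g with
  | zero => exact base h0 h
  | succ k ih =>
    refine ⟨base h0 h.1, fun e he => ih (fun y hy hyK => ?_) (h.2 e he)⟩
    have : pd e g y = pd e (fun _ => (0:ℝ)) y :=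
      pd_congr (Filter.eventuallyEq_of_mem ((hV.inter hK.isOpen_compl).mem_nhds ⟨hy, hyK⟩) fun z hz => h0 z hz.1 hz.2)
    rw [this]; exact pd_const

end TSsec

variable {l e : Fin n} {y0 : Eu n} {r1 c0 : ℝ} {a : Fin n → Fin n → Eu n → ℝ}

/-- global weak equation on the half space -/
def GWeak (l : Fin n) (a : Fin n → Fin n → Eu n → ℝ) (W : Eu n → ℝ) (G : Fin n → Eu n → ℝ) (F : Eu n → ℝ) : Prop :=
  ∀ v, HAdm l v → ∫ y, (∑ i, ((∑ j, a i j y * pd j W y) + G i y) * pd i v y) ∂(hm l) = ∫ y, F y * v y ∂(hm l)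

lemma GWeak.diff (hc : Coef y0 r1 c0 a) (he : e ≠ l) {W : Eu n → ℝ} (hW : ContDiffOn ℝ (⊤ : ℕ∞) W (Hs l))
    (hA : HAdm l W) (h2 : ∀ j, MemLp (pd e (pd j W)) 2 (hm l)) {G : Fin n → Eu n → ℝ} {F : Eu n → ℝ}
    (hG : ∀ i, ContDiffOn ℝ (⊤ : ℕ∞) (G i) (Hs l)) (hGl : ∀ i, MemLp (G i) 2 (hm l)) (hGe : ∀ i, MemLp (pd e (G i)) 2 (hm l))
    (hF : ContDiffOn ℝ (⊤ : ℕ∞) F (Hs l)) (hFl : MemLp F 2 (hm l)) (hFe : MemLp (pd e F) 2 (hm l)) (hw : GWeak l a W G F) :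
    GWeak l a (pd e W) (fun i y => (∑ j, pd e (a i j) y * pd j W y) + pd e (G i) y) (pd e F) := by
  obtain ⟨M, hM0, hM⟩ := hc.bdd
  have ham : ∀ i j, AEStronglyMeasurable (a i j) (hm l) := fun i j => (hc.smooth i j).continuous.aestronglyMeasurable
  intro v hv
  set h : Fin n → Eu n → ℝ := fun i y => (∑ j, a i j y * pd j W y) + G i y with hh
  have hs : ∀ i, ContDiffOn ℝ (⊤ : ℕ∞) (h i) (Hs l) := fun i =>
    (ContDiffOn.sum fun j _ => (hc.smooth i j).contDiffOn.mul (pd_smooth Hs_open hW)).add (hG i)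
  have hl2 : ∀ i, MemLp (h i) 2 (hm l) := fun i =>
    (l2_sum _ fun j _ => l2_bdd_mul (hA.gl2 j) (ham i j) (ae_of_all _ (hM i j))).add (hGl i)
  have hpd : ∀ i, ∀ y ∈ Hs l, pd e (h i) y = (∑ j, a i j y * pd j (pd e W) y) + ((∑ j, pd e (a i j) y * pd j W y) + pd e (G i) y) := by
    intro i y hy
    have da : ∀ j, DifferentiableAt ℝ (a i j) y := fun j => (hc.smooth i j).differentiable (by simp) y
    have dw : ∀ j, DifferentiableAt ℝ (pd j W) y := fun j => (pd_smooth Hs_open hW).diffAt Hs_open (by simp) hy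
    have dG := (hG i).diffAt Hs_open (by simp) hy
    have dm : ∀ j ∈ Finset.univ, DifferentiableAt ℝ (fun y => a i j y * pd j W y) y := fun j _ => (da j).mul (dw j)
    have ds : DifferentiableAt ℝ (fun y => ∑ j, a i j y * pd j W y) y := DifferentiableAt.fun_sum dm
    rw [hh]
    change pd e (fun y => (∑ j, a i j y * pd j W y) + G i y) y = _
    rw [pd_add ds dG, pd_sum _ dm, ← add_assoc, ← Finset.sum_add_distrib]
    congr 1
    refine Finset.sum_congr rfl fun j _ => ?_
    rw [pd_mul (da j) (dw j), pd_comm Hs_open (hW.of_le two_le_inf) hy]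
  have hpl : ∀ i, MemLp (pd e (h i)) 2 (hm l) := by
    intro i
    have hb : ∀ j, MemLp (fun y => pd e (a i j) y * pd j W y) 2 (hm l) := by
      intro j
      obtain ⟨M', hM'⟩ := (pd_compactSupport (hc.cs i j) e).exists_bound_of_continuous (pd_contDiff (hc.smooth i j)).continuous
      exact l2_bdd_mul (hA.gl2 j) (pd_contDiff (hc.smooth i j)).continuous.aestronglyMeasurable (ae_of_all _ hM')
    have h3 : ∀ j, MemLp (fun y => a i j y * pd j (pd e W) y) 2 (hm l) := fun j =>
      l2_bdd_mul (hm_l2_congr (h2 j) fun y hy => pd_comm Hs_open (hW.of_le two_le_inf) hy) (ham i j) (ae_of_all _ (hM i j))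
    have h4 : MemLp (fun y => (∑ j, a i j y * pd j (pd e W) y) + ((∑ j, pd e (a i j) y * pd j W y) + pd e (G i) y)) 2 (hm l) :=
      (l2_sum Finset.univ fun j _ => h3 j).add ((l2_sum Finset.univ fun j _ => hb j).add (hGe i))
    exact hm_l2_congr h4 fun y hy => (hpd i y hy).symm
  have key : ∀ s : ℝ, ∑ i, ∫ y, (tr e s (h i) y - h i y) * pd i v y ∂(hm l) = ∫ y, (tr e s F y - F y) * v y ∂(hm l) := by
    intro s
    have h1 := hw _ ((hv.tr he (-s)).sub hv)
    rw [int_tr_sub he s hFl hv.l2] at h1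
    rw [← h1]
    have heq : ∀ y ∈ Hs l, (∑ i, h i y * pd i (fun y => tr e (-s) v y - v y) y) = ∑ i, h i y * (tr e (-s) (pd i v) y - pd i v y) := by
      intro y hy
      refine Finset.sum_congr rfl fun i _ => ?_
      rw [pd_sub ((hv.tr he _).diff hy) (hv.diff hy), pd_tr]
    rw [integral_congr_ae (hm_congr heq)]
    have hi : ∀ i ∈ Finset.univ, Integrable (fun y => h i y * (tr e (-s) (pd i v) y - pd i v y)) (hm l) :=
      fun i _ => l2_mul (hl2 i) ((tr_l2 he _ (hv.gl2 i)).sub (hv.gl2 i))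
    rw [integral_finset_sum _ hi]
    exact Finset.sum_congr rfl fun i _ => (int_tr_sub he s (hl2 i) (hv.gl2 i)).symm
  set s : ℕ → ℝ := fun k => 1 / ((k : ℝ) + 1) with hsd
  have hs1 : ∀ k, s k ≠ 0 := fun k => by rw [hsd]; positivity
  have hs0 : Tendsto s atTop (𝓝 0) := tendsto_one_div_add_atTop_nhds_zero_nat
  have hC1 : ∀ {f : Eu n → ℝ}, ContDiffOn ℝ (⊤ : ℕ∞) f (Hs l) → ContDiffOn ℝ 1 f (Hs l) := fun h => h.of_le (by exact_mod_cast le_top)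
  have t1 := tr_weak he (hC1 hF) hFe hv.l2 hs0 hs1
  have t2 := tendsto_finset_sum Finset.univ fun i _ => tr_weak he (hC1 (hs i)) (hpl i) (hv.gl2 i) hs0 hs1
  have t3 := tendsto_nhds_unique (t1.congr fun k => by rw [← key (s k), Finset.mul_sum]) t2
  rw [t3, ← integral_finset_sum _ fun i _ => l2_mul (hpl i) (hv.gl2 i)]
  refine integral_congr_ae (hm_congr fun y hy => Finset.sum_congr rfl fun i _ => ?_)
  rw [hpd i y hy]

/-- tangential regularity, global form -/
lemma GWeak.reg (hc : Coef y0 r1 c0 a) {r2 : ℝ} (hr : r2 < r1) (k : ℕ) : ∀ {W : Eu n → ℝ} {G : Fin n → Eu n → ℝ} {F : Eu n → ℝ},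
    ContDiffOn ℝ (⊤ : ℕ∞) W (Hs l) → HAdm l W → (∀ y ∈ Hs l, r2 < dist y y0 → W y = 0) →
    (∀ i, ContDiffOn ℝ (⊤ : ℕ∞) (G i) (Hs l)) → ContDiffOn ℝ (⊤ : ℕ∞) F (Hs l) → (∀ i, TS {l}ᶜ (Hs l) (k + 1) (G i)) →
    TS {l}ᶜ (Hs l) k F → GWeak l a W G F → ∀ j, TS {l}ᶜ (Hs l) (k + 1) (pd j W) := by
  have hsup : ∀ {W : Eu n → ℝ}, (∀ y ∈ Hs l, r2 < dist y y0 → W y = 0) → ∀ y ∈ Hs l, r2 < dist y y0 → ∀ j, pd j W y = 0 := by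
    intro W h y hy hd j
    have ho : IsOpen (Hs l ∩ {y | r2 < dist y y0}) := Hs_open.inter (isOpen_lt continuous_const (by fun_prop))
    have : pd j W y = pd j (fun _ => (0:ℝ)) y := pd_congr (Filter.eventuallyEq_of_mem (ho.mem_nhds ⟨hy, hd⟩) fun z hz => h z hz.1 hz.2)
    rw [this]; exact pd_const
  have hC1 : ∀ {f : Eu n → ℝ}, ContDiffOn ℝ (⊤ : ℕ∞) f (Hs l) → ContDiffOn ℝ 1 f (Hs l) := fun h => h.of_le (by exact_mod_cast le_top)
  induction k with
  | zero =>
    intro W G F hW hA h0 hG hF hGt hFt hw j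
    exact ⟨hA.gl2 j, fun e he => energy hc he hr hW hA (hsup h0) (fun i => hC1 (hG i)) (fun i => (hGt i).1) (fun i => (hGt i).2 e he) hFt hw j⟩
  | succ k ih =>
    intro W G F hW hA h0 hG hF hGt hFt hw j
    refine ⟨hA.gl2 j, fun e he => ?_⟩
    have h2 := energy hc he hr hW hA (hsup h0) (fun i => hC1 (hG i)) (fun i => (hGt i).1) (fun i => ((hGt i).2 e he).l2) hFt.1 hw
    have hcm : ∀ j, ∀ y ∈ Hs l, pd e (pd j W) y = pd j (pd e W) y := fun j y hy => pd_comm Hs_open (hW.of_le two_le_inf) hy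
    have hw' := hw.diff hc he hW hA h2 hG (fun i => (hGt i).1) (fun i => ((hGt i).2 e he).l2) hF hFt.1 (hFt.2 e he).l2
    have hAe : HAdm l (pd e W) := ⟨hC1 (pd_smooth Hs_open hW), hA.gl2 e, fun i => hm_l2_congr (h2 i) (hcm i)⟩
    have ih1 := ih hW hA h0 hG hF (fun i => (hGt i).down) hFt.down hw
    have sm : ∀ i j, ContDiffOn ℝ (⊤ : ℕ∞) (fun y => pd e (a i j) y * pd j W y) (Hs l) := fun i j =>
      (pd_contDiff (hc.smooth i j)).contDiffOn.mul (pd_smooth Hs_open hW)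
    have := ih (pd_smooth Hs_open hW) hAe (fun y hy hd => hsup h0 y hy hd e)
      (fun i => (ContDiffOn.sum fun j _ => sm i j).add (pd_smooth Hs_open (hG i))) (pd_smooth Hs_open hF)
      (fun i => TS.add Hs_open (ContDiffOn.sum fun j _ => sm i j) (pd_smooth Hs_open (hG i))
        (TS.sum Hs_open _ (fun j _ => sm i j) fun j _ => TS.mul Hs_open (pd_contDiff (hc.smooth i j)) (pd_compactSupport (hc.cs i j) e)
          (pd_smooth Hs_open hW) (ih1 j)) ((hGt i).2 e he)) (hFt.2 e he) hw' j
    exact this.congr Hs_open fun y hy => (hcm j y hy).symm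

/-! ## P7d: localisation and tangential regularity -/

/-- half ball -/
def Uh (l : Fin n) (y0 : Eu n) (r : ℝ) : Set (Eu n) := Hs l ∩ Metric.ball y0 r

variable {l e : Fin n} {y0 : Eu n} {r r1 c0 : ℝ} {a : Fin n → Fin n → Eu n → ℝ}

lemma Uh_open : IsOpen (Uh l y0 r) := Hs_open.inter Metric.isOpen_ball
lemma Uh_mono {r' : ℝ} (h : r' ≤ r) : Uh l y0 r' ⊆ Uh l y0 r := inter_subset_inter_right _ (Metric.ball_subset_ball h)

/-- cut-off functions -/
structure CutF (y0 : Eu n) (r : ℝ) (ζ : Eu n → ℝ) : Prop where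
  smooth : ContDiff ℝ (⊤ : ℕ∞) ζ
  cs : HasCompactSupport ζ
  sub : tsupport ζ ⊆ Metric.ball y0 r

lemma CutF.mul {ζ φ : Eu n → ℝ} (h : CutF y0 r ζ) (hφ : ContDiff ℝ (⊤ : ℕ∞) φ) : CutF y0 r (fun y => ζ y * φ y) :=
  ⟨h.smooth.mul hφ, h.cs.mul_right, (closure_mono (Function.support_mul_subset_left ζ φ)).trans h.sub⟩

lemma pd_tsupport {ζ : Eu n → ℝ} (i : Fin n) : tsupport (pd i ζ) ⊆ tsupport ζ := by
  refine closure_minimal (fun y hy => ?_) isClosed_closure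
  by_contra h
  refine hy ?_
  have : pd i ζ y = pd i (fun _ => (0:ℝ)) y :=
    pd_congr (Filter.eventuallyEq_of_mem ((isClosed_tsupport ζ).isOpen_compl.mem_nhds h) fun z hz => image_eq_zero_of_notMem_tsupport hz)
  rw [this]; exact pd_const

lemma CutF.pd {ζ : Eu n → ℝ} (h : CutF y0 r ζ) (i : Fin n) : CutF y0 r (pd i ζ) :=
  ⟨pd_contDiff h.smooth, pd_compactSupport h.cs i, (pd_tsupport i).trans h.sub⟩

lemma CutF.contDiffOn {ζ g : Eu n → ℝ} (h : CutF y0 r ζ) (hg : ContDiffOn ℝ (⊤ : ℕ∞) g (Uh l y0 r)) :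
    ContDiffOn ℝ (⊤ : ℕ∞) (fun y => ζ y * g y) (Hs l) := by
  intro y hy
  by_cases hs : y ∈ tsupport ζ
  · exact (h.smooth.contDiffAt.mul (hg.contDiffAt (Uh_open.mem_nhds ⟨hy, h.sub hs⟩))).contDiffWithinAt
  · have : (fun y => ζ y * g y) =ᶠ[𝓝 y] fun _ => 0 :=
      Filter.eventuallyEq_of_mem ((isClosed_tsupport ζ).isOpen_compl.mem_nhds hs)
        fun z hz => by simp [image_eq_zero_of_notMem_tsupport hz]
    exact (contDiffAt_const.congr_of_eventuallyEq this).contDiffWithinAt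

lemma CutF.ts {ζ g : Eu n → ℝ} (h : CutF y0 r ζ) (hg : ContDiffOn ℝ (⊤ : ℕ∞) g (Uh l y0 r)) {S : Set (Fin n)} {k : ℕ}
    (hk : TS S (Uh l y0 r) k g) : TS S (Hs l) k (fun y => ζ y * g y) :=
  TS.ext Uh_open Hs_open (isClosed_tsupport ζ) inter_subset_left (inter_subset_inter_right _ h.sub)
    (fun y hy hn => by simp [image_eq_zero_of_notMem_tsupport hn]) (TS.mul Uh_open h.smooth h.cs hg hk)

lemma CutF.pd_mul {ζ g : Eu n → ℝ} (h : CutF y0 r ζ) (hg : ContDiffOn ℝ (⊤ : ℕ∞) g (Uh l y0 r)) (j : Fin n) {y : Eu n} (hy : y ∈ Hs l) :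
    _root_.pd j (fun y => ζ y * g y) y = ζ y * _root_.pd j g y + _root_.pd j ζ y * g y := by
  by_cases hs : y ∈ tsupport ζ
  · exact _root_.pd_mul (h.smooth.differentiable (by simp) y) (hg.diffAt Uh_open (by simp) ⟨hy, h.sub hs⟩)
  · have : _root_.pd j (fun y => ζ y * g y) y = _root_.pd j (fun _ => (0:ℝ)) y :=
      pd_congr (Filter.eventuallyEq_of_mem ((isClosed_tsupport ζ).isOpen_compl.mem_nhds hs)
        fun z hz => by simp [image_eq_zero_of_notMem_tsupport hz])
    rw [this, pd_const, image_eq_zero_of_notMem_tsupport hs, image_eq_zero_of_notMem_tsupport fun h => hs (pd_tsupport j h)]; simp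

lemma HAdm.cut {v ζ : Eu n → ℝ} (hv : HAdm l v) (h : ContDiff ℝ (⊤ : ℕ∞) ζ) (hc : HasCompactSupport ζ) : HAdm l (fun y => ζ y * v y) := by
  have base : ∀ {f g : Eu n → ℝ}, ContDiff ℝ (⊤ : ℕ∞) f → HasCompactSupport f → MemLp g 2 (hm l) → MemLp (fun y => f y * g y) 2 (hm l) := by
    intro f g hf hc hg
    obtain ⟨M, hM⟩ := hc.exists_bound_of_continuous hf.continuous
    exact l2_bdd_mul hg hf.continuous.aestronglyMeasurable (ae_of_all _ hM)
  refine ⟨(h.contDiffOn.of_le (nat_le_inf 1)).mul hv.c1, base h hc hv.l2, fun i => ?_⟩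
  have : MemLp (fun y => ζ y * pd i v y + pd i ζ y * v y) 2 (hm l) :=
    (base h hc (hv.gl2 i)).add (base (pd_contDiff h) (pd_compactSupport hc i) hv.l2)
  exact hm_l2_congr this fun y hy => (pd_mul (h.differentiable (by simp) y) (hv.diff hy)).symm

lemma exists_cut (y0 : Eu n) {r' r : ℝ} (h0 : 0 < r') (h : r' < r) :
    ∃ ζ, CutF y0 r ζ ∧ (∀ y ∈ Metric.ball y0 r', ζ y = 1) ∧ ∃ r'' < r, ∀ y, r'' < dist y y0 → ζ y = 0 := by
  let f : ContDiffBump y0 := ⟨r', (r' + r) / 2, h0, by linarith⟩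
  refine ⟨f, ⟨f.contDiff, f.hasCompactSupport, ?_⟩, fun y hy => ?_, (r' + r) / 2, by linarith, fun y hy => ?_⟩
  · rw [f.tsupport_eq]; exact Metric.closedBall_subset_ball (show (r' + r) / 2 < r by linarith)
  · exact f.one_of_mem_closedBall (Metric.ball_subset_closedBall hy)
  · exact f.zero_of_le_dist hy.le

/-- local weak solution in a half ball, smooth in the interior -/
structure LocSol (l : Fin n) (y0 : Eu n) (r1 c0 : ℝ) (a : Fin n → Fin n → Eu n → ℝ) (b w : Eu n → ℝ) : Prop where
  coef : Coef y0 r1 c0 a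
  pos : 0 < r1
  bs : ContDiff ℝ (⊤ : ℕ∞) b
  bc : HasCompactSupport b
  smooth : ContDiffOn ℝ (⊤ : ℕ∞) w (Uh l y0 r1)
  l2 : MemLp w 2 (volume.restrict (Uh l y0 r1))
  gl2 : ∀ j, MemLp (pd j w) 2 (volume.restrict (Uh l y0 r1))
  weak : ∀ v, HAdm l v → (∃ r' < r1, ∀ y ∈ Hs l, r' < dist y y0 → v y = 0) →
    ∫ y, ∑ i, (∑ j, a i j y * pd j w y) * pd i v y ∂(hm l) = ∫ y, b y * w y * v y ∂(hm l)

variable {b w : Eu n → ℝ}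

lemma LocSol.step (h : LocSol l y0 r1 c0 a b w) {k : ℕ} {r' : ℝ} (h0 : 0 < r') (hr' : r' < r) (hr : r ≤ r1)
    (hw : TS {l}ᶜ (Uh l y0 r) k w) (hdw : ∀ j, TS {l}ᶜ (Uh l y0 r) k (pd j w)) : ∀ j, TS {l}ᶜ (Uh l y0 r') (k + 1) (pd j w) := by
  obtain ⟨ζ, hζ, hζ1, r'', hr'', hζ0⟩ := exists_cut y0 h0 hr'
  have hws : ContDiffOn ℝ (⊤ : ℕ∞) w (Uh l y0 r) := h.smooth.mono (Uh_mono hr)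
  have hds : ∀ j, ContDiffOn ℝ (⊤ : ℕ∞) (pd j w) (Uh l y0 r) := fun j => pd_smooth Uh_open hws
  have hw1 : TS {l}ᶜ (Uh l y0 r) (k + 1) w := ⟨hw.l2, fun e _ => hdw e⟩
  have has := h.coef.smooth
  have cA : ∀ i j, CutF y0 r (fun y => ζ y * a i j y) := fun i j => hζ.mul (has i j)
  have cG : ∀ i j, CutF y0 r (fun y => pd j ζ y * (-1 * a i j y)) := fun i j => (hζ.pd j).mul (contDiff_const.mul (has i j))
  have cF : ∀ i j, CutF y0 r (fun y => pd i ζ y * a i j y) := fun i j => (hζ.pd i).mul (has i j)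
  have cF' : ∀ i j, CutF y0 r (fun y => pd i ζ y * (-1 * a i j y)) := fun i j => (hζ.pd i).mul (contDiff_const.mul (has i j))
  have cb : CutF y0 r (fun y => ζ y * b y) := hζ.mul h.bs
  set W : Eu n → ℝ := fun y => ζ y * w y with hW
  set G : Fin n → Eu n → ℝ := fun i y => ∑ j, (pd j ζ y * (-1 * a i j y)) * w y with hG
  set F : Eu n → ℝ := fun y => (ζ y * b y) * w y + ∑ i, ∑ j, (pd i ζ y * (-1 * a i j y)) * pd j w y with hF
  have t0 : TS {l}ᶜ (Uh l y0 r) 0 w := hw.l2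
  have td0 : ∀ j, TS {l}ᶜ (Uh l y0 r) 0 (pd j w) := fun j => (hdw j).l2
  have hWs := hζ.contDiffOn hws
  have hWA : HAdm l W := by
    refine ⟨hWs.of_le (nat_le_inf 1), hζ.ts hws t0, fun j => ?_⟩
    have : MemLp (fun y => ζ y * pd j w y + pd j ζ y * w y) 2 (hm l) := (hζ.ts (hds j) (td0 j)).l2.add ((hζ.pd j).ts hws t0).l2
    exact hm_l2_congr this fun y hy => (hζ.pd_mul hws j hy).symm
  have hF2s := fun i : Fin n => ContDiffOn.sum (s := Finset.univ) fun j _ => (cF' i j).contDiffOn (hds j)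
  have hF2t := fun i : Fin n => TS.sum Hs_open Finset.univ (fun j _ => (cF' i j).contDiffOn (hds j)) fun j _ => (cF' i j).ts (hds j) (hdw j)
  have hFs : ContDiffOn ℝ (⊤ : ℕ∞) F (Hs l) := (cb.contDiffOn hws).add (ContDiffOn.sum fun i _ => hF2s i)
  have hFt : TS {l}ᶜ (Hs l) k F := TS.add Hs_open (cb.contDiffOn hws) (ContDiffOn.sum fun i _ => hF2s i) (cb.ts hws hw)
    (TS.sum Hs_open Finset.univ (fun i _ => hF2s i) fun i _ => hF2t i)
  have key := GWeak.reg (l := l) (r2 := r'') h.coef (by linarith) k (W := W) (G := G) (F := F) hWs hWA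
    (fun y _ hd => by simp [hW, hζ0 y hd]) (fun i => ContDiffOn.sum fun j _ => (cG i j).contDiffOn hws) hFs
    (fun i => TS.sum Hs_open _ (fun j _ => (cG i j).contDiffOn hws) fun j _ => (cG i j).ts hws hw1) hFt ?_
  · intro j
    refine ((key j).mono_set inter_subset_left).congr Uh_open fun y hy => pd_congr ?_
    refine Filter.eventuallyEq_of_mem (Uh_open.mem_nhds hy) fun z hz => ?_
    simp [hW, hζ1 z hz.2]
  · intro v hv
    have h1 := h.weak _ (hv.cut hζ.smooth hζ.cs) ⟨r'', by linarith, fun y _ hd => by simp [hζ0 y hd]⟩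
    have iX : Integrable (fun y => ∑ i, (∑ j, (ζ y * a i j y) * pd j w y) * pd i v y) (hm l) :=
      integrable_finset_sum _ fun i _ => l2_mul (l2_sum Finset.univ fun j _ => (cA i j).ts (hds j) (td0 j)) (hv.gl2 i)
    have iY : Integrable (fun y => (∑ i, ∑ j, (pd i ζ y * a i j y) * pd j w y) * v y) (hm l) :=
      l2_mul (l2_sum Finset.univ fun i _ => l2_sum Finset.univ fun j _ => (cF i j).ts (hds j) (td0 j)) hv.l2
    have iF : Integrable (fun y => F y * v y) (hm l) := l2_mul hFt.l2 hv.l2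
    have e1 : ∫ y, ∑ i, (∑ j, a i j y * pd j w y) * pd i (fun y => ζ y * v y) y ∂(hm l) =
        ∫ y, ((∑ i, (∑ j, (ζ y * a i j y) * pd j w y) * pd i v y) + (∑ i, ∑ j, (pd i ζ y * a i j y) * pd j w y) * v y) ∂(hm l) := by
      refine integral_congr_ae (hm_congr fun y hy => ?_)
      rw [Finset.sum_mul, ← Finset.sum_add_distrib]
      refine Finset.sum_congr rfl fun i _ => ?_
      rw [pd_mul (hζ.smooth.differentiable (by simp) y) (hv.diff hy), Finset.sum_mul, Finset.sum_mul, Finset.sum_mul, ← Finset.sum_add_distrib]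
      exact Finset.sum_congr rfl fun j _ => by ring
    have e2 : ∫ y, b y * w y * (ζ y * v y) ∂(hm l) = ∫ y, (F y * v y + (∑ i, ∑ j, (pd i ζ y * a i j y) * pd j w y) * v y) ∂(hm l) := by
      congr 1; ext y
      have : ∑ i, ∑ j, pd i ζ y * (-1 * a i j y) * pd j w y = - ∑ i, ∑ j, (pd i ζ y * a i j y) * pd j w y := by
        rw [← Finset.sum_neg_distrib]
        refine Finset.sum_congr rfl fun i _ => ?_
        rw [← Finset.sum_neg_distrib]
        exact Finset.sum_congr rfl fun j _ => by ring
      simp only [hF]; rw [this]; ring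
    have e3 : ∫ y, (∑ i, ((∑ j, a i j y * pd j W y) + G i y) * pd i v y) ∂(hm l) =
        ∫ y, ∑ i, (∑ j, (ζ y * a i j y) * pd j w y) * pd i v y ∂(hm l) := by
      refine integral_congr_ae (hm_congr fun y hy => ?_)
      refine Finset.sum_congr rfl fun i _ => ?_
      congr 1
      simp only [hG]
      rw [← Finset.sum_add_distrib]
      refine Finset.sum_congr rfl fun j _ => ?_
      rw [hW, hζ.pd_mul hws j hy]; ring
    rw [e1, e2, integral_add iX iY, integral_add iF iY] at h1
    rw [e3]; linarith

/-- tangential regularity -/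
lemma LocSol.tang (h : LocSol l y0 r1 c0 a b w) (k : ℕ) : ∃ r, 0 < r ∧ r ≤ r1 ∧ TS {l}ᶜ (Uh l y0 r) k w ∧ ∀ j, TS {l}ᶜ (Uh l y0 r) k (pd j w) := by
  induction k with
  | zero => exact ⟨r1, h.pos, le_rfl, h.l2, h.gl2⟩
  | succ k ih =>
    obtain ⟨r, h0, hr, hw, hd⟩ := ih
    refine ⟨r / 2, by linarith, by linarith, ⟨hw.l2.mono_measure (Measure.restrict_mono (Uh_mono (by linarith)) le_rfl), fun e _ => ?_⟩,
      h.step (by linarith) (by linarith) hr hw hd⟩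
    exact (hd e).mono_set (Uh_mono (by linarith))

/-! ## P7e: strong form and normal regularity -/

lemma cutc {U : Set (Eu n)} (hU : IsOpen U) {k : WithTop ℕ∞} {g φ : Eu n → ℝ} (hg : ContDiffOn ℝ k g U) (hφ : ContDiff ℝ k φ) (hs : tsupport φ ⊆ U) :
    ContDiff ℝ k (fun y => g y * φ y) := by
  rw [contDiff_iff_contDiffAt]
  intro y
  by_cases h : y ∈ tsupport φ
  · exact (hg.contDiffAt (hU.mem_nhds (hs h))).mul hφ.contDiffAt
  · have : (fun y => g y * φ y) =ᶠ[𝓝 y] fun _ => 0 :=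
      Filter.eventuallyEq_of_mem ((isClosed_tsupport φ).isOpen_compl.mem_nhds h)
        fun z hz => by simp [image_eq_zero_of_notMem_tsupport hz]
    exact contDiffAt_const.congr_of_eventuallyEq this

lemma cutc_pd {U : Set (Eu n)} (hU : IsOpen U) {g φ : Eu n → ℝ} (hg : ContDiffOn ℝ 1 g U) (hφ : ContDiff ℝ 1 φ) (hs : tsupport φ ⊆ U) (i : Fin n) (y : Eu n) :
    pd i (fun y => g y * φ y) y = g y * pd i φ y + pd i g y * φ y := by
  by_cases h : y ∈ tsupport φ
  · exact pd_mul (hg.diffAt hU (by simp) (hs h)) (hφ.differentiable (by simp) y)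
  · have : pd i (fun y => g y * φ y) y = pd i (fun _ => (0:ℝ)) y :=
      pd_congr (Filter.eventuallyEq_of_mem ((isClosed_tsupport φ).isOpen_compl.mem_nhds h)
        fun z hz => by simp [image_eq_zero_of_notMem_tsupport hz])
    rw [this, pd_const, image_eq_zero_of_notMem_tsupport h, image_eq_zero_of_notMem_tsupport fun h' => h (pd_tsupport i h')]; simp

variable {l e : Fin n} {y0 : Eu n} {r r1 c0 : ℝ} {a : Fin n → Fin n → Eu n → ℝ} {b w : Eu n → ℝ}

lemma LocSol.strong (h : LocSol l y0 r1 c0 a b w) {y : Eu n} (hy : y ∈ Uh l y0 r1) :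
    (∑ i, pd i (fun y => ∑ j, a i j y * pd j w y) y) + b y * w y = 0 := by
  set U := Uh l y0 r1
  have hU : IsOpen U := Uh_open
  set A : Fin n → Eu n → ℝ := fun i y => ∑ j, a i j y * pd j w y with hA
  have hAs : ∀ i, ContDiffOn ℝ (⊤ : ℕ∞) (A i) U := fun i =>
    ContDiffOn.sum fun j _ => (h.coef.smooth i j).contDiffOn.mul (pd_smooth hU h.smooth)
  have hA1 : ∀ i, ContDiffOn ℝ 1 (A i) U := fun i => (hAs i).of_le (nat_le_inf 1)
  have hdiv : ContDiffOn ℝ (⊤ : ℕ∞) (fun y => ∑ i, pd i (A i) y) U := ContDiffOn.sum fun i _ => pd_smooth hU (hAs i)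
  have hbw : ContDiffOn ℝ (⊤ : ℕ∞) (fun y => b y * w y) U := h.bs.contDiffOn.mul h.smooth
  have hE : ContDiffOn ℝ (⊤ : ℕ∞) (fun y => (∑ i, pd i (A i) y) + b y * w y) U := hdiv.add hbw
  have hae := hU.ae_eq_zero_of_integral_contDiff_smul_eq_zero (μ := volume)
    (hE.continuousOn.locallyIntegrableOn hU.measurableSet) (fun φ hφ hc hs => ?_)
  · exact Measure.eqOn_open_of_ae_eq (μ := volume) ((ae_restrict_iff' hU.measurableSet).2 hae) hU hE.continuousOn continuousOn_const hy
  · have hφ1 : ContDiff ℝ 1 φ := hφ.of_le (nat_le_inf 1)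
    have hint : ∀ {g ψ : Eu n → ℝ}, ContinuousOn g U → Continuous ψ → HasCompactSupport ψ → tsupport ψ ⊆ U → Integrable (fun y => g y * ψ y) := by
      intro g ψ hg hψ hc hs
      exact (cutc (k := 0) hU (contDiffOn_zero.2 hg) (contDiff_zero.2 hψ) hs).continuous.integrable_of_hasCompactSupport hc.mul_left
    have hH : HAdm l φ := ⟨hφ1.contDiffOn, (hφ.continuous.memLp_of_hasCompactSupport hc).restrict _,
      fun i => ((pd_continuous hφ1).memLp_of_hasCompactSupport (pd_compactSupport hc i)).restrict _⟩
    obtain ⟨r', hr', hsr⟩ := exists_lt_subset_ball (isClosed_tsupport φ) (hs.trans inter_subset_right)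
    have h1 := h.weak φ hH ⟨r', hr', fun y _ hd => image_eq_zero_of_notMem_tsupport fun hy => by
      have := Metric.mem_ball.1 (hsr hy); linarith⟩
    have hz : ∀ y, y ∉ Hs l → y ∉ tsupport φ := fun y hy hs' => hy (hs hs').1
    rw [hm, setIntegral_eq_integral_of_forall_compl_eq_zero, setIntegral_eq_integral_of_forall_compl_eq_zero] at h1
    rotate_left
    · intro y hy; simp [image_eq_zero_of_notMem_tsupport (hz y hy)]
    · intro y hy
      refine Finset.sum_eq_zero fun i _ => ?_
      rw [image_eq_zero_of_notMem_tsupport fun h' => hz y hy (pd_tsupport i h'), mul_zero]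
    have h2 : ∀ i, ∫ y, (A i y * pd i φ y + pd i (A i) y * φ y) = 0 := by
      intro i
      rw [← integral_pd_zero (i := i) (cutc hU (hA1 i) hφ1 hs) hc.mul_left]
      congr 1; ext y; exact (cutc_pd hU (hA1 i) hφ1 hs i y).symm
    have i1 : ∀ i, Integrable (fun y => A i y * pd i φ y) := fun i =>
      hint (hAs i).continuousOn (pd_continuous hφ1) (pd_compactSupport hc i) ((pd_tsupport i).trans hs)
    have i2 : ∀ i, Integrable (fun y => pd i (A i) y * φ y) := fun i =>
      hint (pd_smooth hU (hAs i)).continuousOn hφ.continuous hc hs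
    have i3 : Integrable (fun y => b y * w y * φ y) := hint hbw.continuousOn hφ.continuous hc hs
    have h3 : (∫ y, ∑ i, A i y * pd i φ y) + ∫ y, ∑ i, pd i (A i) y * φ y = 0 := by
      rw [integral_finset_sum _ fun i _ => i1 i, integral_finset_sum _ fun i _ => i2 i, ← Finset.sum_add_distrib]
      refine Finset.sum_eq_zero fun i _ => ?_
      rw [← integral_add (i1 i) (i2 i)]; exact h2 i
    have h4 : ∫ y, φ y • ((∑ i, pd i (A i) y) + b y * w y) = (∫ y, ∑ i, pd i (A i) y * φ y) + ∫ y, b y * w y * φ y := by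
      rw [← integral_add (integrable_finset_sum _ fun i _ => i2 i) i3]
      congr 1; ext y
      simp only [smul_eq_mul]
      rw [← Finset.sum_mul]; ring
    rw [h4, ← h1]; rw [add_comm]; exact h3

/-- class with normal derivatives up to order `p` -/
def WS (l : Fin n) (y0 : Eu n) (r1 : ℝ) : ℕ → (Eu n → ℝ) → Prop
  | 0, g => ∀ k, ∃ r, 0 < r ∧ r ≤ r1 ∧ TS {l}ᶜ (Uh l y0 r) k g
  | p + 1, g => (∀ k, ∃ r, 0 < r ∧ r ≤ r1 ∧ TS {l}ᶜ (Uh l y0 r) k g) ∧ WS l y0 r1 p (pd l g)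

section WSsec
variable {f g : Eu n → ℝ} {p : ℕ}

lemma WS.zero' (h : WS l y0 r1 p g) : WS l y0 r1 0 g := by
  cases p with
  | zero => exact h
  | succ p => exact h.1

lemma WS.down (h : WS l y0 r1 (p + 1) g) : WS l y0 r1 p g := by
  induction p generalizing g with
  | zero => exact h.1
  | succ p ih => exact ⟨h.1, ih h.2⟩

lemma WS.congr {r2 : ℝ} (h2 : 0 < r2) (h : WS l y0 r1 p f) (hfg : ∀ y ∈ Uh l y0 r2, f y = g y) : WS l y0 r1 p g := by
  have base : ∀ {f g : Eu n → ℝ}, WS l y0 r1 0 f → (∀ y ∈ Uh l y0 r2, f y = g y) → WS l y0 r1 0 g := by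
    intro f g h hfg k
    obtain ⟨r, h0, hr, ht⟩ := h k
    exact ⟨min r r2, lt_min h0 h2, (min_le_left _ _).trans hr, (ht.mono_set (Uh_mono (min_le_left _ _))).congr Uh_open
      fun y hy => hfg y (Uh_mono (min_le_right _ _) hy)⟩
  induction p generalizing f g with
  | zero => exact base h hfg
  | succ p ih => exact ⟨base h.1 hfg, ih h.2 fun y hy => pd_congr_on Uh_open (fun z hz => hfg z hz) hy⟩

lemma WS.add (hf : ContDiffOn ℝ (⊤ : ℕ∞) f (Uh l y0 r1)) (hg : ContDiffOn ℝ (⊤ : ℕ∞) g (Uh l y0 r1)) (h0 : 0 < r1)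
    (h1 : WS l y0 r1 p f) (h2 : WS l y0 r1 p g) : WS l y0 r1 p (fun y => f y + g y) := by
  have base : ∀ {f g : Eu n → ℝ}, ContDiffOn ℝ (⊤ : ℕ∞) f (Uh l y0 r1) → ContDiffOn ℝ (⊤ : ℕ∞) g (Uh l y0 r1) →
      WS l y0 r1 0 f → WS l y0 r1 0 g → WS l y0 r1 0 (fun y => f y + g y) := by
    intro f g hf hg h1 h2 k
    obtain ⟨r, h0, hr, ht⟩ := h1 k
    obtain ⟨r', h0', hr', ht'⟩ := h2 k
    have hm : min r r' ≤ r1 := (min_le_left _ _).trans hr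
    exact ⟨min r r', lt_min h0 h0', hm, TS.add Uh_open (hf.mono (Uh_mono hm)) (hg.mono (Uh_mono hm))
      (ht.mono_set (Uh_mono (min_le_left _ _))) (ht'.mono_set (Uh_mono (min_le_right _ _)))⟩
  induction p generalizing f g with
  | zero => exact base hf hg h1 h2
  | succ p ih =>
    refine ⟨base hf hg h1.1 h2.1, (ih (pd_smooth Uh_open hf) (pd_smooth Uh_open hg) h1.2 h2.2).congr h0 fun y hy => ?_⟩
    exact (pd_add (hf.diffAt Uh_open (by simp) hy) (hg.diffAt Uh_open (by simp) hy)).symm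

lemma WS.zero (h0 : 0 < r1) : WS l y0 r1 p (fun _ => 0) := by
  induction p with
  | zero => exact fun k => ⟨r1, h0, le_rfl, TS.zero⟩
  | succ p ih =>
    refine ⟨fun k => ⟨r1, h0, le_rfl, TS.zero⟩, ?_⟩
    have : pd l (fun _ : Eu n => (0 : ℝ)) = fun _ => 0 := by ext y; exact pd_const
    rw [this]; exact ih

lemma WS.sum {ι : Type*} (s : Finset ι) {f : ι → Eu n → ℝ} (hf : ∀ i ∈ s, ContDiffOn ℝ (⊤ : ℕ∞) (f i) (Uh l y0 r1)) (h0 : 0 < r1)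
    (h : ∀ i ∈ s, WS l y0 r1 p (f i)) : WS l y0 r1 p (fun y => ∑ i ∈ s, f i y) := by
  classical
  induction s using Finset.induction_on with
  | empty => simpa using WS.zero h0
  | insert i s hi ih =>
    simp only [Finset.sum_insert hi]
    refine WS.add (hf i (by simp)) ?_ h0 (h i (by simp)) (ih (fun j hj => hf j (by simp [hj])) fun j hj => h j (by simp [hj]))
    exact ContDiffOn.sum fun j hj => hf j (by simp [hj])

lemma WS.mul (hf : ContDiff ℝ (⊤ : ℕ∞) f) (hc : HasCompactSupport f) (hg : ContDiffOn ℝ (⊤ : ℕ∞) g (Uh l y0 r1)) (h0 : 0 < r1)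
    (h : WS l y0 r1 p g) : WS l y0 r1 p (fun y => f y * g y) := by
  have base : ∀ {f g : Eu n → ℝ}, ContDiff ℝ (⊤ : ℕ∞) f → HasCompactSupport f → ContDiffOn ℝ (⊤ : ℕ∞) g (Uh l y0 r1) →
      WS l y0 r1 0 g → WS l y0 r1 0 (fun y => f y * g y) := by
    intro f g hf hc hg h k
    obtain ⟨r, h0, hr, ht⟩ := h k
    exact ⟨r, h0, hr, TS.mul Uh_open hf hc (hg.mono (Uh_mono hr)) ht⟩
  induction p generalizing f g with
  | zero => exact base hf hc hg h
  | succ p ih =>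
    refine ⟨base hf hc hg h.1, ((ih hf hc (pd_smooth Uh_open hg) h.2).add (hf.contDiffOn.mul (pd_smooth Uh_open hg))
      ((pd_contDiff hf).contDiffOn.mul hg) h0 (ih (pd_contDiff hf) (pd_compactSupport hc l) hg h.down)).congr h0 fun y hy => ?_⟩
    exact (pd_mul (hf.differentiable (by simp) y) (hg.diffAt Uh_open (by simp) hy)).symm

lemma WS.tan (he : e ≠ l) (hg : ContDiffOn ℝ (⊤ : ℕ∞) g (Uh l y0 r1)) (h0 : 0 < r1) (h : WS l y0 r1 p g) : WS l y0 r1 p (pd e g) := by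
  have base : ∀ {g : Eu n → ℝ}, WS l y0 r1 0 g → WS l y0 r1 0 (pd e g) := by
    intro g h k
    obtain ⟨r, h0, hr, ht⟩ := h (k + 1)
    exact ⟨r, h0, hr, ht.2 e he⟩
  induction p generalizing g with
  | zero => exact base h
  | succ p ih => exact ⟨base h.1, (ih (pd_smooth Uh_open hg) h.2).congr h0 fun y hy => pd_comm Uh_open (hg.of_le two_le_inf) hy⟩

lemma WS.full (hg : ContDiffOn ℝ (⊤ : ℕ∞) g (Uh l y0 r1)) (h0 : 0 < r1) (h : ∀ p, WS l y0 r1 p g) (k : ℕ) :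
    ∃ r, 0 < r ∧ r ≤ r1 ∧ TS univ (Uh l y0 r) k g := by
  induction k generalizing g with
  | zero =>
    obtain ⟨r, h0, hr, ht⟩ := h 0 0
    exact ⟨r, h0, hr, ht⟩
  | succ k ih =>
    have : ∀ i, ∃ r, 0 < r ∧ r ≤ r1 ∧ TS univ (Uh l y0 r) k (pd i g) := by
      intro i
      refine ih (pd_smooth Uh_open hg) fun p => ?_
      by_cases hi : i = l
      · subst hi; exact (h (p + 1)).2
      · exact (h p).tan hi hg h0
    choose r hr0 hr1 ht using this
    obtain ⟨r', h0', hr', ht'⟩ := h 0 0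
    haveI : Nonempty (Fin n) := ⟨l⟩
    set ρ := Finset.univ.inf' Finset.univ_nonempty r with hρ
    have hρ0 : 0 < ρ := (Finset.lt_inf'_iff _).2 fun i _ => hr0 i
    have hρi : ∀ i, ρ ≤ r i := fun i => Finset.inf'_le _ (Finset.mem_univ i)
    refine ⟨min r' ρ, lt_min h0' hρ0, (min_le_left _ _).trans hr', ?_, fun i _ => ?_⟩
    · exact (TS.mono_set (k := 0) (S := {l}ᶜ) ht' (Uh_mono (min_le_left _ _))).l2
    · exact (ht i).mono_set (Uh_mono ((min_le_right _ _).trans (hρi i)))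

end WSsec

/-- full regularity up to the flat boundary -/
lemma LocSol.full (h : LocSol l y0 r1 c0 a b w) (k : ℕ) : ∃ r, 0 < r ∧ r ≤ r1 ∧ TS univ (Uh l y0 r) k w := by
  have hr := h.pos
  have hs := h.smooth
  have hds : ∀ j, ContDiffOn ℝ (⊤ : ℕ∞) (pd j w) (Uh l y0 r1) := fun j => pd_smooth Uh_open hs
  have hdds : ∀ i j, ContDiffOn ℝ (⊤ : ℕ∞) (pd i (pd j w)) (Uh l y0 r1) := fun i j => pd_smooth Uh_open (hds j)
  have hall : ∀ y ∈ Metric.ball y0 r1, 0 < a l l y := by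
    intro y hy
    have := h.coef.ell y hy (fun i => if i = l then 1 else 0)
    simp at this
    linarith [h.coef.pos]
  obtain ⟨χ, hχ, hχ1, -⟩ := exists_cut y0 (half_pos hr) (half_lt_self hr)
  set c : Eu n → ℝ := fun y => χ y * (-(a l l y)⁻¹) with hc
  have hcs : ContDiff ℝ (⊤ : ℕ∞) c := by
    have : ContDiffOn ℝ (⊤ : ℕ∞) (fun y => -(a l l y)⁻¹) (Metric.ball y0 r1) :=
      ((h.coef.smooth l l).contDiffOn.inv fun y hy => (hall y hy).ne').neg
    have h2 := cutc Metric.isOpen_ball this hχ.smooth hχ.sub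
    have h3 : c = fun y => -(a l l y)⁻¹ * χ y := by ext y; simp only [hc]; ring
    rw [h3]; exact h2
  have hcc : HasCompactSupport c := hχ.cs.mul_right
  classical
  set a' : Fin n → Fin n → Eu n → ℝ := fun i j => if i = l ∧ j = l then fun _ => 0 else a i j with ha'
  have ha's : ∀ i j, ContDiff ℝ (⊤ : ℕ∞) (a' i j) := by
    intro i j; simp only [ha']; split_ifs
    · exact contDiff_const
    · exact h.coef.smooth i j
  have ha'c : ∀ i j, HasCompactSupport (a' i j) := by
    intro i j; simp only [ha']; split_ifs
    · exact HasCompactSupport.zero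
    · exact h.coef.cs i j
  set Q : Eu n → ℝ := fun y => (∑ i, ∑ j, (a' i j y * pd i (pd j w) y + pd i (a i j) y * pd j w y)) + b y * w y with hQ
  have s1 : ∀ i j, ContDiffOn ℝ (⊤ : ℕ∞) (fun y => a' i j y * pd i (pd j w) y) (Uh l y0 r1) := fun i j => (ha's i j).contDiffOn.mul (hdds i j)
  have s2 : ∀ i j, ContDiffOn ℝ (⊤ : ℕ∞) (fun y => pd i (a i j) y * pd j w y) (Uh l y0 r1) := fun i j =>
    (pd_contDiff (h.coef.smooth i j)).contDiffOn.mul (hds j)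
  have s3 : ContDiffOn ℝ (⊤ : ℕ∞) (fun y => b y * w y) (Uh l y0 r1) := h.bs.contDiffOn.mul hs
  have s4 : ∀ i, ContDiffOn ℝ (⊤ : ℕ∞) (fun y => ∑ j, (a' i j y * pd i (pd j w) y + pd i (a i j) y * pd j w y)) (Uh l y0 r1) :=
    fun i => ContDiffOn.sum fun j _ => (s1 i j).add (s2 i j)
  have s5 := ContDiffOn.sum (s := Finset.univ) fun i _ => s4 i
  have hQs : ContDiffOn ℝ (⊤ : ℕ∞) Q (Uh l y0 r1) := s5.add s3
  have hpde : ∀ y ∈ Uh l y0 (r1 / 2), c y * Q y = pd l (pd l w) y := by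
    intro y hy
    have hy1 : y ∈ Uh l y0 r1 := Uh_mono (by linarith) hy
    have hst := h.strong hy1
    have e1 : ∀ i, pd i (fun y => ∑ j, a i j y * pd j w y) y = ∑ j, (a i j y * pd i (pd j w) y + pd i (a i j) y * pd j w y) := by
      intro i
      have dm : ∀ j, DifferentiableAt ℝ (a i j) y := fun j => (h.coef.smooth i j).differentiable (by simp) y
      have dw : ∀ j, DifferentiableAt ℝ (pd j w) y := fun j => (hds j).diffAt Uh_open (by simp) hy1
      rw [pd_sum _ fun j _ => (dm j).fun_mul (dw j)]
      exact Finset.sum_congr rfl fun j _ => pd_mul (dm j) (dw j)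
    rw [Finset.sum_congr rfl fun i _ => e1 i] at hst
    have e2 : (∑ i, ∑ j, (a i j y * pd i (pd j w) y + pd i (a i j) y * pd j w y)) =
        a l l y * pd l (pd l w) y + ∑ i, ∑ j, (a' i j y * pd i (pd j w) y + pd i (a i j) y * pd j w y) := by
      have : a l l y * pd l (pd l w) y = ∑ i, ∑ j, (if i = l ∧ j = l then a i j y * pd i (pd j w) y else 0) := by
        rw [Finset.sum_eq_single l (fun i _ hi => by simp [hi]) (by simp), Finset.sum_eq_single l (fun i _ hi => by simp [hi]) (by simp)]
        simp
      rw [this, ← Finset.sum_add_distrib]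
      refine Finset.sum_congr rfl fun i _ => ?_
      rw [← Finset.sum_add_distrib]
      refine Finset.sum_congr rfl fun j _ => ?_
      simp only [ha']
      split_ifs <;> simp
    have hpos := hall y hy1.2
    have hQy : Q y = - (a l l y * pd l (pd l w) y) := by rw [e2] at hst; simp only [hQ]; linarith
    rw [hQy]; simp only [hc, hχ1 y hy.2]
    field_simp
  have key : ∀ p, WS l y0 r1 p w ∧ ∀ j, WS l y0 r1 p (pd j w) := by
    intro p
    induction p with
    | zero =>
      refine ⟨fun k => ?_, fun j k => ?_⟩
      · obtain ⟨r, h0, hr, ht, -⟩ := h.tang k; exact ⟨r, h0, hr, ht⟩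
      · obtain ⟨r, h0, hr, -, ht⟩ := h.tang k; exact ⟨r, h0, hr, ht j⟩
    | succ p ih =>
      obtain ⟨ih1, ih2⟩ := ih
      refine ⟨⟨ih1.zero', ih2 l⟩, fun j => ⟨(ih2 j).zero', ?_⟩⟩
      by_cases hj : j = l
      · subst hj
        refine (WS.mul hcs hcc hQs hr ?_).congr (half_pos hr) hpde
        refine WS.add s5 s3 hr (WS.sum _ (fun i _ => s4 i) hr fun i _ => WS.sum _ (fun k _ => (s1 i k).add (s2 i k)) hr fun k _ => ?_)
          (WS.mul h.bs h.bc hs hr ih1)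
        refine WS.add (s1 i k) (s2 i k) hr ?_ (WS.mul (pd_contDiff (h.coef.smooth i k)) (pd_compactSupport (h.coef.cs i k) i) (hds k) hr (ih2 k))
        by_cases hik : i = j ∧ k = j
        · have : (fun y => a' i k y * pd i (pd k w) y) = fun _ => 0 := by ext y; simp [ha', hik]
          rw [this]; exact WS.zero hr
        · refine WS.mul (ha's i k) (ha'c i k) (hdds i k) hr ?_
          by_cases hi : i = j
          · have hk : k ≠ j := fun h => hik ⟨hi, h⟩
            exact ((ih2 i).tan hk (hds i) hr).congr hr fun y hy => pd_comm Uh_open (hs.of_le two_le_inf) hy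
          · exact (ih2 k).tan hi (hds k) hr
      · exact ((ih2 l).tan hj (hds l) hr).congr hr fun y hy => pd_comm Uh_open (hs.of_le two_le_inf) hy
  exact WS.full hs hr (fun p => (key p).1) k

/-! ## P8: Sobolev bound in a half space -/

section Sob
variable {l : Fin n}

def Fe (l : Fin n) (g : Eu n → ℝ) (x : Fin n → ℝ) : ENNReal :=
  (Hs l).indicator (fun y => ‖g y‖ₑ) (WithLp.toLp 2 x)

lemma Fe_meas {g : Eu n → ℝ} (hg : ContinuousOn g (Hs l)) : Measurable (Fe l g) := by
  classical
  have h1 : Measurable ((Hs l).indicator g) := by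
    rw [← piecewise_eq_indicator]
    exact ContinuousOn.measurable_piecewise hg continuousOn_const Hs_meas
  have h2 : (Hs l).indicator (fun y => ‖g y‖ₑ) = fun y => ‖(Hs l).indicator g y‖ₑ := by
    funext y; rw [enorm_indicator_eq_indicator_enorm]
  have h3 : Measurable ((Hs l).indicator (fun y => ‖g y‖ₑ)) := by
    rw [h2]; exact h1.enorm
  exact h3.comp (WithLp.measurable_toLp 2 _)

lemma toLp_update (x : Fin n → ℝ) (i : Fin n) (s : ℝ) :
    WithLp.toLp 2 (Function.update x i (x i + s)) = (WithLp.toLp 2 x : Eu n) + s • (bv i : Eu n) := by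
  ext j
  by_cases h : j = i
  · subst h; simp [bv]
  · simp [bv, Function.update_of_ne h, h]

lemma Fe_le {g : Eu n → ℝ} (hg : ContDiffOn ℝ (⊤ : ℕ∞) g (Hs l)) {y0 : Eu n} {r : ℝ}
    (h0 : ∀ y ∈ Hs l, r < dist y y0 → g y = 0) (i : Fin n) (x : Fin n → ℝ) :
    Fe l g x ≤ ∫⁻ t, Fe l (pd i g) (Function.update x i t) := by
  by_cases hx : (WithLp.toLp 2 x : Eu n) ∈ Hs l
  swap
  · simp [Fe, hx]
  set z : Eu n := WithLp.toLp 2 x with hz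
  have hin : ∀ s : ℝ, s ≤ 0 → z + s • (bv i : Eu n) ∈ Hs l := by
    intro s hs
    have h1 : (z + s • (bv i : Eu n)) l ≤ z l := by
      by_cases h : l = i
      · subst h; simp [bv, hs]
      · simp [bv, h]
    exact lt_of_le_of_lt h1 hx
  have hd : ∀ s : ℝ, s ≤ 0 → HasDerivAt (fun s : ℝ => g (z + s • (bv i : Eu n))) (pd i g (z + s • (bv i : Eu n))) s := by
    intro s hs
    have h1 : HasFDerivAt g (fderiv ℝ g (z + s • (bv i : Eu n))) (z + s • (bv i : Eu n)) :=
      (hg.diffAt Hs_open (by simp) (hin s hs)).hasFDerivAt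
    have h2 : HasDerivAt (fun s : ℝ => z + s • (bv i : Eu n)) (bv i) s := by
      simpa using ((hasDerivAt_id s).smul_const (bv i : Eu n)).const_add z
    exact h1.comp_hasDerivAt s h2
  obtain ⟨M, hM0, hM⟩ : ∃ M : ℝ, 0 ≤ M ∧ g (z + (-M) • (bv i : Eu n)) = 0 := by
    refine ⟨|r| + dist z y0 + 1, by positivity, h0 _ (hin _ (by linarith [abs_nonneg r, dist_nonneg (x := z) (y := y0)])) ?_⟩
    have h1 : dist (z + (-(|r| + dist z y0 + 1)) • (bv i : Eu n)) z = |r| + dist z y0 + 1 := by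
      rw [dist_eq_norm, add_sub_cancel_left, norm_smul]
      have : ‖(bv i : Eu n)‖ = 1 := by simp [bv]
      rw [this, mul_one, norm_neg, Real.norm_of_nonneg (by positivity)]
    have h2 := dist_triangle (z + (-(|r| + dist z y0 + 1)) • (bv i : Eu n)) y0 z
    rw [dist_comm y0 z] at h2
    linarith [le_abs_self r]
  have hcont : ContinuousOn (fun s : ℝ => pd i g (z + s • (bv i : Eu n))) (Iic 0) := by
    refine ContinuousOn.comp (t := Hs l) (pd_smooth Hs_open hg).continuousOn (by fun_prop) fun s hs => hin s hs
  have hftc : ∫ s in (-M)..0, pd i g (z + s • (bv i : Eu n)) = g z := by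
    rw [intervalIntegral.integral_eq_sub_of_hasDerivAt (f := fun s : ℝ => g (z + s • (bv i : Eu n)))]
    · simp only [hM]; simp
    · intro s hs; rw [uIcc_of_le (by linarith)] at hs; exact hd s hs.2
    · refine ContinuousOn.intervalIntegrable (hcont.mono ?_)
      rw [uIcc_of_le (by linarith)]; exact fun s hs => hs.2
  have h1 : Fe l g x = ‖g z‖ₑ := by simp [Fe, hx, ← hz]
  rw [h1, ← hftc, intervalIntegral.integral_of_le (by linarith)]
  refine (enorm_integral_le_lintegral_enorm _).trans ?_
  have h2 : ∫⁻ t, Fe l (pd i g) (Function.update x i t) = ∫⁻ s, Fe l (pd i g) (Function.update x i (x i + s)) :=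
    (lintegral_add_left_eq_self (fun t => Fe l (pd i g) (Function.update x i t)) (x i)).symm
  rw [h2, ← lintegral_indicator measurableSet_Ioc]
  refine lintegral_mono fun s => ?_
  by_cases hs : s ∈ Ioc (-M) 0
  · have hs2 : z + s • (bv i : Eu n) ∈ Hs l := hin s hs.2
    have h3 : (WithLp.toLp 2 (Function.update x i (x i + s)) : Eu n) = z + s • (bv i : Eu n) := toLp_update x i s
    simp only [Fe, indicator_of_mem hs]
    rw [h3, indicator_of_mem hs2]
  · simp [indicator_of_notMem hs]

lemma sob_aux {y0 : Eu n} {r : ℝ} (s : Finset (Fin n)) : ∀ (k : ℕ) (g : Eu n → ℝ), ContDiffOn ℝ (⊤ : ℕ∞) g (Hs l) →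
    (∀ y ∈ Hs l, r < dist y y0 → g y = 0) → TS univ (Hs l) (k + s.card) g →
    ∃ h : Eu n → ℝ, ContDiffOn ℝ (⊤ : ℕ∞) h (Hs l) ∧ (∀ y ∈ Hs l, r < dist y y0 → h y = 0) ∧ TS univ (Hs l) k h ∧
      ∀ x, Fe l g x ≤ (∫⋯∫⁻_s, Fe l h ∂(fun _ => volume)) x := by
  classical
  induction s using Finset.induction_on with
  | empty =>
    intro k g hg h0 hT
    exact ⟨g, hg, h0, by simpa using hT, fun x => by simp⟩
  | insert i s hi ih =>
    intro k g hg h0 hT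
    rw [Finset.card_insert_of_notMem hi, show k + (s.card + 1) = (k + 1) + s.card by ring] at hT
    obtain ⟨h, h1, h2, h3, h4⟩ := ih (k + 1) g hg h0 hT
    refine ⟨pd i h, pd_smooth Hs_open h1, ?_, h3.2 i (mem_univ _), fun x => (h4 x).trans ?_⟩
    · intro y hy hd
      have : pd i h y = pd i (fun _ => (0:ℝ)) y := by
        refine pd_congr_on (U := Hs l ∩ {y | r < dist y y0}) (Hs_open.inter (isOpen_lt continuous_const (by fun_prop))) (fun z hz => h2 z hz.1 hz.2) ⟨hy, hd⟩
      rw [this, pd_const]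
    · rw [lmarginal_insert' _ (Fe_meas (pd_smooth Hs_open h1).continuousOn) hi]
      exact lmarginal_mono (fun x => Fe_le h1 h2 i x) x

theorem sob_bdd {y0 : Eu n} {r : ℝ} {g : Eu n → ℝ} (hg : ContDiffOn ℝ (⊤ : ℕ∞) g (Hs l))
    (h0 : ∀ y ∈ Hs l, r < dist y y0 → g y = 0) (hT : TS univ (Hs l) n g) : ∃ C, ∀ y ∈ Hs l, |g y| ≤ C := by
  obtain ⟨h, h1, h2, h3, h4⟩ := sob_aux (y0 := y0) (r := r) Finset.univ 0 g hg h0 (by simpa using hT)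
  have hL : MemLp h 2 (hm l) := h3
  have hI : Integrable h (hm l) := by
    have hi : IntegrableOn h (Hs l ∩ Metric.closedBall y0 r) := by
      have hfin : volume (Hs l ∩ Metric.closedBall y0 r) < ⊤ :=
        (measure_mono inter_subset_right).trans_lt (isCompact_closedBall y0 r).measure_lt_top
      haveI : IsFiniteMeasure (volume.restrict (Hs l ∩ Metric.closedBall y0 r)) := ⟨by simpa using hfin⟩
      exact (MemLp.mono_measure (Measure.restrict_mono inter_subset_left le_rfl) hL).integrable (by norm_num)
    refine IntegrableOn.of_forall_diff_eq_zero hi Hs_meas fun y hy => h2 y hy.1 ?_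
    by_contra hc
    exact hy.2 ⟨hy.1, by simpa using not_lt.1 hc⟩
  set K : ENNReal := ∫⁻ y, ‖h y‖ₑ ∂(hm l) with hK
  have hKf : K < ⊤ := hI.2
  refine ⟨K.toReal, fun y hy => ?_⟩
  have h5 := h4 (WithLp.ofLp y)
  rw [lmarginal_univ] at h5
  have h6 : ∫⁻ x, Fe l h x ∂(Measure.pi fun _ => volume) = K := by
    have := (PiLp.volume_preserving_toLp (Fin n)).lintegral_comp_emb (MeasurableEquiv.toLp 2 (Fin n → ℝ)).measurableEmbedding ((Hs l).indicator (fun y => ‖h y‖ₑ))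
    rw [hK, hm, ← lintegral_indicator Hs_meas, ← this]
    rfl
  rw [h6] at h5
  have h7 : Fe l g (WithLp.ofLp y) = ‖g y‖ₑ := by simp [Fe, hy]
  rw [h7] at h5
  have := ENNReal.toReal_mono hKf.ne h5
  simpa using this

end Sob

/-- all derivatives up to order `k` are bounded on `U` -/
def BS (U : Set (Eu n)) : ℕ → (Eu n → ℝ) → Prop
  | 0, g => ∃ C, ∀ y ∈ U, |g y| ≤ C
  | k + 1, g => (∃ C, ∀ y ∈ U, |g y| ≤ C) ∧ ∀ i, BS U k (pd i g)

section BSsec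
variable {l : Fin n} {U V : Set (Eu n)} {f g : Eu n → ℝ}

lemma BS.bd {k : ℕ} (h : BS U k g) : ∃ C, ∀ y ∈ U, |g y| ≤ C := by
  cases k with
  | zero => exact h
  | succ k => exact h.1

lemma BS.congr {k : ℕ} (hU : IsOpen U) (h : BS U k f) (hfg : ∀ y ∈ U, f y = g y) : BS U k g := by
  induction k generalizing f g with
  | zero => obtain ⟨C, hC⟩ := h; exact ⟨C, fun y hy => hfg y hy ▸ hC y hy⟩
  | succ k ih =>
    obtain ⟨⟨C, hC⟩, h2⟩ := h
    exact ⟨⟨C, fun y hy => hfg y hy ▸ hC y hy⟩, fun i => ih (h2 i) fun y hy => pd_congr_on hU hfg hy⟩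

lemma BS.mono {k : ℕ} (h : BS U k g) (hVU : V ⊆ U) : BS V k g := by
  induction k generalizing g with
  | zero => obtain ⟨C, hC⟩ := h; exact ⟨C, fun y hy => hC y (hVU hy)⟩
  | succ k ih =>
    obtain ⟨⟨C, hC⟩, h2⟩ := h
    exact ⟨⟨C, fun y hy => hC y (hVU hy)⟩, fun i => ih (h2 i)⟩

lemma sob_BS {y0 : Eu n} {r : ℝ} {k : ℕ} (hg : ContDiffOn ℝ (⊤ : ℕ∞) g (Hs l))
    (h0 : ∀ y ∈ Hs l, r < dist y y0 → g y = 0) (hT : TS univ (Hs l) (n + k) g) : BS (Hs l) k g := by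
  induction k generalizing g with
  | zero => exact sob_bdd hg h0 hT
  | succ k ih =>
    refine ⟨?_, fun i => ih (pd_smooth Hs_open hg) ?_ (hT.2 i (mem_univ i))⟩
    · have h : ∀ j, TS univ (Hs l) (n + j) g → TS univ (Hs l) n g := by
        intro j
        induction j with
        | zero => exact id
        | succ j ihj => exact fun h => ihj h.down
      exact sob_bdd hg h0 (h _ hT)
    · intro y hy hd
      have : pd i g y = pd i (fun _ => (0:ℝ)) y := by
        refine pd_congr_on (U := Hs l ∩ {y | r < dist y y0}) (Hs_open.inter (isOpen_lt continuous_const (by fun_prop))) (fun z hz => h0 z hz.1 hz.2) ⟨hy, hd⟩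
      rw [this, pd_const]

lemma BS_of_TS {y0 : Eu n} {r r' : ℝ} {k : ℕ} (hr' : 0 < r') (hr : r' < r) (hg : ContDiffOn ℝ (⊤ : ℕ∞) g (Uh l y0 r))
    (hT : TS univ (Uh l y0 r) (n + k) g) : BS (Uh l y0 r') k g := by
  obtain ⟨ζ, h1, h2, r'', h3, h4⟩ := exists_cut y0 hr' hr
  have h5 : BS (Hs l) k (fun y => ζ y * g y) := sob_BS (y0 := y0) (r := r'') (h1.contDiffOn hg) (fun y _ hd => by simp [h4 y hd]) (h1.ts hg hT)
  exact (h5.mono inter_subset_left).congr Uh_open fun y hy => by simp [h2 y hy.2]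

lemma BS.ext_cont (hV : IsOpen V) (hc : Convex ℝ V) (hf : ContDiffOn ℝ (⊤ : ℕ∞) f V) (h : BS V 1 f) :
    ∃ F : Eu n → ℝ, Continuous F ∧ EqOn f F V := by
  choose C hC using fun i => (h.2 i).bd
  have hb : ∀ x ∈ V, ‖fderiv ℝ f x‖ ≤ Real.sqrt (∑ i, C i ^ 2) := by
    intro x hx
    refine Real.le_sqrt_of_sq_le ?_
    rw [norm_fderiv_sq]
    exact Finset.sum_le_sum fun i _ => sq_le_sq' (by linarith [abs_le.1 (hC i x hx)]) (abs_le.1 (hC i x hx)).2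
  have hL : LipschitzOnWith (Real.sqrt (∑ i, C i ^ 2)).toNNReal f V := by
    refine Convex.lipschitzOnWith_of_nnnorm_fderiv_le (𝕜 := ℝ) (fun x hx => hf.diffAt hV (by simp) hx) (fun x hx => ?_) hc
    rw [← NNReal.coe_le_coe, coe_nnnorm, Real.coe_toNNReal _ (Real.sqrt_nonneg _)]
    exact hb x hx
  obtain ⟨F, hF, hE⟩ := hL.extend_real
  exact ⟨F, hF.continuous, hE⟩

lemma BS.ext_tendsto (hV : IsOpen V) (hc : Convex ℝ V) (hf : ContDiffOn ℝ (⊤ : ℕ∞) f V) (h : BS V 1 f) {x : Eu n} :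
    Tendsto f (𝓝[V] x) (𝓝 (extendFrom V f x)) := by
  obtain ⟨F, hF, hE⟩ := h.ext_cont hV hc hf
  refine tendsto_extendFrom ⟨F x, ?_⟩
  exact ((hF.tendsto x).mono_left nhdsWithin_le_nhds).congr' (eventually_nhdsWithin_of_forall fun y hy => (hE hy).symm)

theorem BS.ext {k : ℕ} (hV : IsOpen V) (hc : Convex ℝ V) (hf : ContDiffOn ℝ (⊤ : ℕ∞) f V) (h : BS V (k + 1) f) :
    ContDiffOn ℝ k (extendFrom V f) (closure V) := by
  rcases V.eq_empty_or_nonempty with rfl | hne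
  · simp
  have h1 : BS V 1 f := by
    refine ⟨h.bd, fun i => ?_⟩
    exact (h.2 i).bd
  have hcont : ContinuousOn (extendFrom V f) (closure V) :=
    continuousOn_extendFrom subset_rfl fun x _ => ⟨_, h1.ext_tendsto hV hc hf⟩
  have heq : ∀ x ∈ V, extendFrom V f x = f x := fun x hx =>
    extendFrom_eq (subset_closure hx) (hf.continuousOn.continuousWithinAt hx).tendsto
  have hud : UniqueDiffOn ℝ (closure V) := by
    refine uniqueDiffOn_convex hc.closure (hne.mono ?_)
    exact hV.subset_interior_iff.2 subset_closure
  induction k generalizing f with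
  | zero => exact_mod_cast (contDiffOn_zero (𝕜 := ℝ)).2 hcont
  | succ k ih =>
    have hpd : ∀ i, ContDiffOn ℝ k (extendFrom V (pd i f)) (closure V) := by
      intro i
      have hs : ContDiffOn ℝ (⊤ : ℕ∞) (pd i f) V := pd_smooth hV hf
      have h2 : BS V (k + 1) (pd i f) := h.2 i
      have h3 : BS V 1 (pd i f) := ⟨h2.bd, fun j => (h2.2 j).bd⟩
      refine ih hs h2 h3 ?_ ?_
      · exact continuousOn_extendFrom subset_rfl fun x _ => ⟨_, h3.ext_tendsto hV hc hs⟩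
      · exact fun x hx => extendFrom_eq (subset_closure hx) (hs.continuousOn.continuousWithinAt hx).tendsto
    set L : Eu n → (Eu n →L[ℝ] ℝ) := fun x => ∑ i, extendFrom V (pd i f) x • (EuclideanSpace.proj i : Eu n →L[ℝ] ℝ) with hL
    have hLs : ContDiffOn ℝ k L (closure V) := by
      refine ContDiffOn.sum fun i _ => (hpd i).smul contDiffOn_const
    have hfd : ∀ x, fderiv ℝ f x = ∑ i, pd i f x • (EuclideanSpace.proj i : Eu n →L[ℝ] ℝ) := by
      intro x; ext v
      rw [fderiv_eq_sum]
      simp [mul_comm]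
    have hder : ∀ x ∈ closure V, HasFDerivWithinAt (extendFrom V f) (L x) (closure V) x := by
      intro x hx
      refine hasFDerivWithinAt_closure_of_tendsto_fderiv (f := extendFrom V f) ?_ hc hV ?_ ?_
      · exact (hf.differentiableOn (by simp)).congr heq
      · exact fun y hy => (hcont y hy).mono subset_closure
      · have : Tendsto (fun y => ∑ i, pd i f y • (EuclideanSpace.proj i : Eu n →L[ℝ] ℝ)) (𝓝[V] x) (𝓝 (L x)) := by
          refine tendsto_finsetSum _ fun i _ => Tendsto.smul_const ?_ _
          have h2 : BS V (k + 1) (pd i f) := h.2 i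
          have h3 : BS V 1 (pd i f) := ⟨h2.bd, fun j => (h2.2 j).bd⟩
          exact h3.ext_tendsto hV hc (pd_smooth hV hf)
        refine this.congr' (eventually_nhdsWithin_of_forall fun y hy => ?_)
        rw [← hfd]
        exact (Filter.EventuallyEq.fderiv_eq (Filter.eventuallyEq_of_mem (hV.mem_nhds hy) heq)).symm
    push_cast
    rw [contDiffOn_succ_iff_hasFDerivWithinAt_of_uniqueDiffOn hud]
    exact ⟨by simp, L, hLs, hder⟩

/-- regularity up to the flat boundary -/
theorem LocSol.ext {l : Fin n} {y0 : Eu n} {r1 c0 : ℝ} {a : Fin n → Fin n → Eu n → ℝ} {b w : Eu n → ℝ}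
    (h : LocSol l y0 r1 c0 a b w) (k : ℕ) : ∃ r, 0 < r ∧ r ≤ r1 ∧
      (∀ x ∈ closure (Uh l y0 r), Tendsto w (𝓝[Uh l y0 r] x) (𝓝 (extendFrom (Uh l y0 r) w x))) ∧
      ContDiffOn ℝ k (extendFrom (Uh l y0 r) w) (closure (Uh l y0 r)) := by
  obtain ⟨r, hr, hr1, hT⟩ := h.full (n + (k + 1))
  have hs : ContDiffOn ℝ (⊤ : ℕ∞) w (Uh l y0 r) := h.smooth.mono (Uh_mono hr1)
  have hB : BS (Uh l y0 (r / 2)) (k + 1) w := BS_of_TS (by linarith) (by linarith) hs hT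
  have hc : Convex ℝ (Uh l y0 (r / 2)) := Hs_convex.inter (convex_ball _ _)
  have hs' := hs.mono (Uh_mono (show r / 2 ≤ r by linarith))
  have h1 : BS (Uh l y0 (r / 2)) 1 w := ⟨hB.bd, fun j => (hB.2 j).bd⟩
  exact ⟨r / 2, by linarith, by linarith, fun x _ => h1.ext_tendsto Uh_open hc hs', hB.ext Uh_open hc hs'⟩

end BSsec

/-! ## P9: flattening the boundary -/

namespace SmoothDomain
variable (D : SmoothDomain n)

/-- flattening map -/
def Psi (l : Fin n) (x : Eu n) : Eu n := x + (D.defining x - x l) • bv l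

def dPsi (l : Fin n) (x : Eu n) : Eu n →L[ℝ] Eu n :=
  ContinuousLinearMap.id ℝ (Eu n) + (fderiv ℝ D.defining x - (EuclideanSpace.proj l : Eu n →L[ℝ] ℝ)).smulRight (bv l)

/-- matrix `∂ᵢ Ψⱼ` -/
def pm (l : Fin n) (i j : Fin n) (x : Eu n) : ℝ := if j = l then pd i D.defining x else if i = j then 1 else 0

variable {D} {l : Fin n}

lemma Psi_smooth : ContDiff ℝ (⊤ : ℕ∞) (D.Psi l) := by
  have := D.rho_smooth
  have h2 : ContDiff ℝ (⊤ : ℕ∞) (fun x : Eu n => x l) := by fun_prop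
  exact contDiff_id.add ((this.sub h2).smul contDiff_const)

lemma Psi_deriv (x : Eu n) : HasFDerivAt (D.Psi l) (D.dPsi l x) x := by
  have h1 := (D.rho_diff x).hasFDerivAt
  have h2 : HasFDerivAt (fun x : Eu n => x l) (EuclideanSpace.proj l : Eu n →L[ℝ] ℝ) x := (EuclideanSpace.proj l : Eu n →L[ℝ] ℝ).hasFDerivAt
  exact (hasFDerivAt_id x).add ((h1.sub h2).smul_const (bv l))

lemma Psi_l (x : Eu n) : D.Psi l x l = D.defining x := by simp [Psi, bv]

lemma dPsi_det (x : Eu n) : (D.dPsi l x).det = pd l D.defining x := by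
  have h : ((D.dPsi l x : Eu n →L[ℝ] Eu n) : Eu n →ₗ[ℝ] Eu n) =
      LinearMap.transvection ((fderiv ℝ D.defining x - (EuclideanSpace.proj l : Eu n →L[ℝ] ℝ) : Eu n →L[ℝ] ℝ) : Eu n →ₗ[ℝ] ℝ) (bv l) := by
    ext v; simp [dPsi, LinearMap.transvection.apply]
  rw [ContinuousLinearMap.det, h, LinearMap.transvection.det]
  simp [pd, bv]

lemma dPsi_apply (x : Eu n) (i j : Fin n) : D.dPsi l x (bv i) j = D.pm l i j x := by
  simp only [dPsi, pm, pd, bv]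
  by_cases h1 : j = l
  · subst h1; simp
  · have h2 : (i = j) ↔ (j = i) := eq_comm
    simp [h1, h2]

structure FChart (D : SmoothDomain n) (l : Fin n) (x0 : Eu n) (r1 : ℝ) (Φ : Eu n → Eu n) (S T : Set (Eu n)) : Prop where
  pos : 0 < r1
  So : IsOpen S
  To : IsOpen T
  x0S : x0 ∈ S
  mΨ : ∀ x ∈ S, D.Psi l x ∈ Metric.ball (D.Psi l x0) r1
  mΦ : ∀ y ∈ Metric.ball (D.Psi l x0) r1, Φ y ∈ S
  left : ∀ x ∈ S, Φ (D.Psi l x) = x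
  right : ∀ y ∈ T, D.Psi l (Φ y) = y
  sub : Metric.closedBall (D.Psi l x0) r1 ⊆ T
  smooth : ContDiffOn ℝ (⊤ : ℕ∞) Φ T
  ne : ∀ y ∈ T, pd l D.defining (Φ y) ≠ 0

def dPsiE (x : Eu n) (hx : pd l D.defining x ≠ 0) : Eu n ≃L[ℝ] Eu n :=
  (LinearMap.equivOfDetNeZero ((D.dPsi l x : Eu n →L[ℝ] Eu n) : Eu n →ₗ[ℝ] Eu n) (by
    have := dPsi_det (D := D) (l := l) x; rw [ContinuousLinearMap.det] at this; rwa [this])).toContinuousLinearEquiv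

lemma dPsiE_coe (x : Eu n) (hx : pd l D.defining x ≠ 0) : ((D.dPsiE x hx : Eu n ≃L[ℝ] Eu n) : Eu n →L[ℝ] Eu n) = D.dPsi l x := by
  ext v; rfl

theorem exists_chart {x0 : Eu n} (hx0 : pd l D.defining x0 ≠ 0) : ∃ r1 Φ S T, D.FChart l x0 r1 Φ S T := by
  have hd : HasFDerivAt (D.Psi l) ((D.dPsiE x0 hx0 : Eu n ≃L[ℝ] Eu n) : Eu n →L[ℝ] Eu n) x0 := by
    rw [dPsiE_coe]; exact Psi_deriv x0
  set e := (Psi_smooth (D := D) (l := l)).contDiffAt.toOpenPartialHomeomorph (D.Psi l) hd (by simp) with he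
  have hec : ∀ x, e x = D.Psi l x := fun x => by
    rw [he, ContDiffAt.toOpenPartialHomeomorph_coe]
  have hxs : x0 ∈ e.source := ContDiffAt.mem_toOpenPartialHomeomorph_source _ hd (by simp)
  set T := e.target ∩ e.symm ⁻¹' {x | pd l D.defining x ≠ 0} with hT
  have hTo : IsOpen T := e.isOpen_inter_preimage_symm (isOpen_ne_fun (pd_continuous D.rho_c1) continuous_const)
  have hy0 : D.Psi l x0 ∈ T := by
    refine ⟨by rw [← hec]; exact e.map_source hxs, ?_⟩
    change pd l D.defining (e.symm (D.Psi l x0)) ≠ 0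
    rw [← hec, e.left_inv hxs]; exact hx0
  obtain ⟨r1, hr1, hsub⟩ := Metric.nhds_basis_closedBall.mem_iff.1 (hTo.mem_nhds hy0)
  refine ⟨r1, e.symm, e.source ∩ e ⁻¹' Metric.ball (D.Psi l x0) r1, T, hr1, e.isOpen_inter_preimage Metric.isOpen_ball, hTo, ?_, ?_, ?_, ?_, ?_, hsub, ?_, ?_⟩
  · exact ⟨hxs, by simp [hec, hr1]⟩
  · intro x hx; have := hx.2; rwa [mem_preimage, hec] at this
  · intro y hy
    have h1 := (hsub (Metric.ball_subset_closedBall hy)).1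
    exact ⟨e.map_target h1, by rw [mem_preimage, e.right_inv h1]; exact hy⟩
  · intro x hx; rw [← hec]; exact e.left_inv hx.1
  · intro y hy; rw [← hec]; exact e.right_inv hy.1
  · intro y hy
    have h2 : pd l D.defining (e.symm y) ≠ 0 := hy.2
    have h3 : HasFDerivAt e ((D.dPsiE (e.symm y) h2 : Eu n ≃L[ℝ] Eu n) : Eu n →L[ℝ] Eu n) (e.symm y) := by
      rw [dPsiE_coe, show (e : Eu n → Eu n) = D.Psi l from funext hec]; exact Psi_deriv _
    refine (e.contDiffAt_symm hy.1 h3 ?_).contDiffWithinAt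
    rw [show (e : Eu n → Eu n) = D.Psi l from funext hec]; exact Psi_smooth.contDiffAt
  · intro y hy; exact hy.2

end SmoothDomain

/-! ## P9b: change of variables -/

namespace SmoothDomain
namespace FChart
variable {D : SmoothDomain n} {l : Fin n} {x0 : Eu n} {r1 : ℝ} {Φ : Eu n → Eu n} {S T : Set (Eu n)}

lemma psiΦ (h : D.FChart l x0 r1 Φ S T) {y : Eu n} (hy : y ∈ Uh l (D.Psi l x0) r1) : D.Psi l (Φ y) = y :=
  h.right y (h.sub (Metric.ball_subset_closedBall hy.2))

lemma mapΦ (h : D.FChart l x0 r1 Φ S T) {y : Eu n} (hy : y ∈ Uh l (D.Psi l x0) r1) : Φ y ∈ S ∩ D.carrier := by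
  refine ⟨h.mΦ y hy.2, ?_⟩
  rw [D.mem_iff, ← Psi_l (l := l), h.psiΦ hy]
  exact hy.1

lemma mapΨ (h : D.FChart l x0 r1 Φ S T) {x : Eu n} (hx : x ∈ S ∩ D.carrier) : D.Psi l x ∈ Uh l (D.Psi l x0) r1 := by
  refine ⟨?_, h.mΨ x hx.1⟩
  change D.Psi l x l < 0
  rw [Psi_l]; exact D.mem_iff.1 hx.2

lemma image (h : D.FChart l x0 r1 Φ S T) : D.Psi l '' (S ∩ D.carrier) = Uh l (D.Psi l x0) r1 := by
  ext y; constructor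
  · rintro ⟨x, hx, rfl⟩; exact h.mapΨ hx
  · intro hy; exact ⟨Φ y, h.mapΦ hy, h.psiΦ hy⟩

lemma injOn (h : D.FChart l x0 r1 Φ S T) : InjOn (D.Psi l) (S ∩ D.carrier) := by
  intro x hx y hy e
  rw [← h.left x hx.1, ← h.left y hy.1, e]

lemma oSD (h : D.FChart l x0 r1 Φ S T) : IsOpen (S ∩ D.carrier) := h.So.inter D.isOpen

lemma compactK (h : D.FChart l x0 r1 Φ S T) : IsCompact (Φ '' Metric.closedBall (D.Psi l x0) r1) :=
  (isCompact_closedBall _ _).image_of_continuousOn (h.smooth.continuousOn.mono h.sub)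

lemma subK (h : D.FChart l x0 r1 Φ S T) : S ⊆ Φ '' Metric.closedBall (D.Psi l x0) r1 := fun x hx =>
  ⟨D.Psi l x, Metric.ball_subset_closedBall (h.mΨ x hx), h.left x hx⟩

lemma lower (h : D.FChart l x0 r1 Φ S T) : ∃ m > 0, ∀ x ∈ S, m ≤ |pd l D.defining x| := by
  obtain ⟨z, hz, hm⟩ := h.compactK.exists_isMinOn ⟨x0, h.subK h.x0S⟩ (pd_continuous (i := l) D.rho_c1).abs.continuousOn
  refine ⟨_, ?_, fun x hx => hm (h.subK hx)⟩
  obtain ⟨y, hy, rfl⟩ := hz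
  exact abs_pos.2 (h.ne y (h.sub hy))

lemma upper (h : D.FChart l x0 r1 Φ S T) {f : Eu n → ℝ} (hf : Continuous f) : ∃ M, 0 ≤ M ∧ ∀ x ∈ S, |f x| ≤ M := by
  obtain ⟨M, h0, hM⟩ := bdd_on_compact hf h.compactK
  exact ⟨M, h0, fun x hx => hM x (h.subK hx)⟩

lemma cv (h : D.FChart l x0 r1 Φ S T) (g : Eu n → ℝ) :
    ∫ y in Uh l (D.Psi l x0) r1, g y = ∫ x in S ∩ D.carrier, |pd l D.defining x| * g (D.Psi l x) := by
  rw [← h.image, integral_image_eq_integral_abs_det_fderiv_smul volume h.oSD.measurableSet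
    (fun x _ => (Psi_deriv x).hasFDerivWithinAt) h.injOn]
  simp [dPsi_det]

lemma cv_int (h : D.FChart l x0 r1 Φ S T) (g : Eu n → ℝ) :
    IntegrableOn g (Uh l (D.Psi l x0) r1) ↔ IntegrableOn (fun x => |pd l D.defining x| * g (D.Psi l x)) (S ∩ D.carrier) := by
  rw [← h.image, integrableOn_image_iff_integrableOn_abs_det_fderiv_smul volume h.oSD.measurableSet
    (fun x _ => (Psi_deriv x).hasFDerivWithinAt) h.injOn]
  simp [dPsi_det]

lemma pull (h : D.FChart l x0 r1 Φ S T) {g : Eu n → ℝ} (hc : ContinuousOn g (Uh l (D.Psi l x0) r1))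
    (hg : MemLp g 2 (volume.restrict (Uh l (D.Psi l x0) r1))) : D.L2 (S.indicator (fun x => g (D.Psi l x))) := by
  have hcc : ContinuousOn (fun x => g (D.Psi l x)) (S ∩ D.carrier) :=
    hc.comp Psi_smooth.continuous.continuousOn fun x hx => h.mapΨ hx
  rw [L2, memLp_indicator_iff_restrict h.So.measurableSet, Measure.restrict_restrict h.So.measurableSet,
    memLp_two_iff_integrable_sq (hcc.aestronglyMeasurable h.oSD.measurableSet)]
  have h1 := (h.cv_int (fun y => g y ^ 2)).1 hg.integrable_sq
  obtain ⟨m, hm, hm'⟩ := h.lower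
  refine Integrable.mono' (h1.const_mul m⁻¹) ((hcc.pow 2).aestronglyMeasurable h.oSD.measurableSet) ?_
  refine (ae_restrict_iff' h.oSD.measurableSet).2 (ae_of_all _ fun x hx => ?_)
  rw [Real.norm_of_nonneg (sq_nonneg _), ← mul_assoc]
  have : 1 ≤ m⁻¹ * |pd l D.defining x| := by
    rw [inv_mul_eq_div, one_le_div hm]; exact hm' x hx.1
  nlinarith [sq_nonneg (g (D.Psi l x))]

lemma push (h : D.FChart l x0 r1 Φ S T) {f : Eu n → ℝ} (hc : ContinuousOn f D.carrier)
    (hf : D.L2 f) : MemLp (fun y => f (Φ y)) 2 (volume.restrict (Uh l (D.Psi l x0) r1)) := by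
  have hΦc : ContinuousOn Φ (Uh l (D.Psi l x0) r1) := h.smooth.continuousOn.mono fun y hy => h.sub (Metric.ball_subset_closedBall hy.2)
  have hcc : ContinuousOn (fun y => f (Φ y)) (Uh l (D.Psi l x0) r1) := hc.comp hΦc fun y hy => (h.mapΦ hy).2
  rw [memLp_two_iff_integrable_sq (hcc.aestronglyMeasurable Uh_open.measurableSet)]
  refine (h.cv_int _).2 ?_
  have h1 : IntegrableOn (fun x => f x ^ 2) (S ∩ D.carrier) := IntegrableOn.mono_set hf.integrable_sq inter_subset_right
  obtain ⟨M, hM, hM'⟩ := h.upper (pd_continuous (i := l) D.rho_c1)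
  have h2 : IntegrableOn (fun x => |pd l D.defining x| * f x ^ 2) (S ∩ D.carrier) := by
    refine Integrable.mono' (h1.const_mul M) (((pd_continuous (i := l) D.rho_c1).abs.continuousOn.mul ((hc.mono inter_subset_right).pow 2)).aestronglyMeasurable h.oSD.measurableSet) ?_
    refine (ae_restrict_iff' h.oSD.measurableSet).2 (ae_of_all _ fun x hx => ?_)
    rw [Real.norm_of_nonneg (by positivity)]
    exact mul_le_mul_of_nonneg_right (hM' x hx.1) (sq_nonneg _)
  refine h2.congr_fun (fun x hx => ?_) h.oSD.measurableSet
  simp only [h.left x hx.1]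

end FChart

/-- chain rule -/
lemma pd_psi {D : SmoothDomain n} {l : Fin n} {v : Eu n → ℝ} {x : Eu n} (hv : DifferentiableAt ℝ v (D.Psi l x)) (i : Fin n) :
    pd i (fun x => v (D.Psi l x)) x = ∑ j, D.pm l i j x * pd j v (D.Psi l x) := by
  have h1 : HasFDerivAt (fun x => v (D.Psi l x)) ((fderiv ℝ v (D.Psi l x)).comp (D.dPsi l x)) x := hv.hasFDerivAt.comp x (Psi_deriv x)
  rw [pd, h1.fderiv, ContinuousLinearMap.comp_apply, fderiv_eq_sum]
  simp only [dPsi_apply]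

lemma pm_smooth {D : SmoothDomain n} {l : Fin n} (i j : Fin n) : ContDiff ℝ (⊤ : ℕ∞) (D.pm l i j) := by
  by_cases h : j = l
  · have : D.pm l i j = pd i D.defining := by funext x; simp [pm, h]
    rw [this]; exact pd_contDiff D.rho_smooth
  · have : D.pm l i j = fun _ => if i = j then (1:ℝ) else 0 := by funext x; simp [pm, h]
    rw [this]; exact contDiff_const

/-- ellipticity -/
lemma pm_ell {D : SmoothDomain n} {l : Fin n} {m M : ℝ} (hm : 0 < m) (hM : 0 ≤ M) {x : Eu n} (h1 : m ≤ |pd l D.defining x|)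
    (h2 : ∀ i, |pd i D.defining x| ≤ M) (ξ : Fin n → ℝ) :
    ∑ i, ξ i ^ 2 ≤ (n * (2 + 2 * (M ^ 2 + 1) / m ^ 2)) * ∑ i, (∑ j, D.pm l i j x * ξ j) ^ 2 := by
  set η : Fin n → ℝ := fun i => ∑ j, D.pm l i j x * ξ j with hη
  have hηl : η l = pd l D.defining x * ξ l := by
    rw [hη]; simp only
    rw [Finset.sum_eq_single l]
    · simp [pm]
    · intro j _ hj; simp [pm, hj, hj.symm]
    · simp
  have hηi : ∀ i, i ≠ l → η i = ξ i + pd i D.defining x * ξ l := by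
    intro i hi
    have : ∀ j, D.pm l i j x * ξ j = (if j = l then pd i D.defining x * ξ l else 0) + (if i = j then ξ i else 0) := by
      intro j
      by_cases h1 : j = l
      · subst h1; simp [pm, hi]
      · by_cases h2 : i = j
        · subst h2; simp [pm, h1]
        · simp [pm, h1, h2]
    rw [hη]; simp only [this, Finset.sum_add_distrib]
    simp; ring
  have hl2 : ξ l ^ 2 ≤ η l ^ 2 / m ^ 2 := by
    rw [le_div_iff₀ (by positivity), hηl, mul_pow]
    have : m ^ 2 ≤ (pd l D.defining x) ^ 2 := by rw [← sq_abs (pd l D.defining x)]; exact pow_le_pow_left₀ hm.le h1 2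
    nlinarith [sq_nonneg (ξ l)]
  have hle : ∀ i, η i ^ 2 ≤ ∑ i, η i ^ 2 := fun i => Finset.single_le_sum (f := fun i => η i ^ 2) (fun _ _ => sq_nonneg _) (Finset.mem_univ i)
  have key : ∀ i, ξ i ^ 2 ≤ (2 + 2 * (M ^ 2 + 1) / m ^ 2) * ∑ i, η i ^ 2 := by
    intro i
    set E := ∑ i, η i ^ 2
    have hE : 0 ≤ E := le_trans (sq_nonneg _) (hle l)
    have hl3 : ξ l ^ 2 ≤ E / m ^ 2 := hl2.trans (by gcongr; exact hle l)
    have e1 : (2 + 2 * (M ^ 2 + 1) / m ^ 2) * E = 2 * E + 2 * (M ^ 2 + 1) * (E / m ^ 2) := by ring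
    have hEm : 0 ≤ E / m ^ 2 := by positivity
    rw [e1]
    by_cases hi : i = l
    · subst hi; nlinarith [mul_nonneg (sq_nonneg M) hEm]
    · have h3 := hηi i hi
      have h4 : (pd i D.defining x) ^ 2 ≤ M ^ 2 := by rw [← sq_abs]; exact pow_le_pow_left₀ (abs_nonneg _) (h2 i) 2
      have h5 : (pd i D.defining x * ξ l) ^ 2 ≤ M ^ 2 * (E / m ^ 2) := by
        rw [mul_pow]; exact mul_le_mul h4 hl3 (sq_nonneg _) (sq_nonneg _)
      have h6 : ξ i ^ 2 ≤ 2 * η i ^ 2 + 2 * (pd i D.defining x * ξ l) ^ 2 := by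
        rw [h3]; nlinarith [sq_nonneg (ξ i + 2 * (pd i D.defining x * ξ l))]
      nlinarith [hle i]
  calc ∑ i, ξ i ^ 2 ≤ ∑ i : Fin n, (2 + 2 * (M ^ 2 + 1) / m ^ 2) * ∑ i, η i ^ 2 := Finset.sum_le_sum fun i _ => key i
    _ = _ := by simp; ring

end SmoothDomain

/-! ## P9c: regularity up to the boundary -/

namespace SmoothDomain
variable {D : SmoothDomain n} {l : Fin n} {x0 : Eu n} {r1 : ℝ} {Φ : Eu n → Eu n} {S T : Set (Eu n)}

section test
variable {v : Eu n → ℝ} {r' : ℝ}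

lemma FChart.V_zero (h : D.FChart l x0 r1 Φ S T) (hv0 : ∀ y ∈ Hs l, r' < dist y (D.Psi l x0) → v y = 0) {z : Eu n}
    (hz : z ∈ D.carrier) (hK : z ∉ Φ '' Metric.closedBall (D.Psi l x0) r') : S.indicator (fun x => v (D.Psi l x)) z = 0 := by
  by_cases hS : z ∈ S
  · rw [indicator_of_mem hS]
    refine hv0 _ (h.mapΨ ⟨hS, hz⟩).1 ?_
    by_contra hc
    exact hK ⟨D.Psi l z, by simpa using not_lt.1 hc, h.left z hS⟩
  · exact indicator_of_notMem hS _

lemma FChart.V_pd (h : D.FChart l x0 r1 Φ S T) (hv : HAdm l v) (hr : r' < r1) (hv0 : ∀ y ∈ Hs l, r' < dist y (D.Psi l x0) → v y = 0)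
    (i : Fin n) {x : Eu n} (hx : x ∈ D.carrier) :
    pd i (S.indicator (fun x => v (D.Psi l x))) x = ∑ j, D.pm l i j x * S.indicator (fun x => pd j v (D.Psi l x)) x := by
  by_cases hS : x ∈ S
  · have h1 : pd i (S.indicator (fun x => v (D.Psi l x))) x = pd i (fun x => v (D.Psi l x)) x :=
      pd_congr_on h.So (fun z hz => indicator_of_mem hz _) hS
    rw [h1, pd_psi (hv.diff (h.mapΨ ⟨hS, hx⟩).1)]
    simp [hS]
  · have hKc : IsClosed (Φ '' Metric.closedBall (D.Psi l x0) r') :=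
      ((isCompact_closedBall _ _).image_of_continuousOn (h.smooth.continuousOn.mono ((Metric.closedBall_subset_closedBall hr.le).trans h.sub))).isClosed
    have hxK : x ∉ Φ '' Metric.closedBall (D.Psi l x0) r' := by
      rintro ⟨y, hy, rfl⟩
      exact hS (h.mΦ y (Metric.closedBall_subset_ball hr hy))
    have h1 : pd i (S.indicator (fun x => v (D.Psi l x))) x = pd i (fun _ => (0:ℝ)) x :=
      pd_congr_on (U := D.carrier ∩ (Φ '' Metric.closedBall (D.Psi l x0) r')ᶜ) (D.isOpen.inter hKc.isOpen_compl) (fun z hz => h.V_zero hv0 hz.1 hz.2) ⟨hx, hxK⟩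
    rw [h1, pd_const]; simp [hS]

lemma FChart.V_adm (h : D.FChart l x0 r1 Φ S T) (hv : HAdm l v) (hr : r' < r1) (hv0 : ∀ y ∈ Hs l, r' < dist y (D.Psi l x0) → v y = 0) :
    D.Adm (S.indicator (fun x => v (D.Psi l x))) := by
  have hmono : volume.restrict (Uh l (D.Psi l x0) r1) ≤ hm l := Measure.restrict_mono inter_subset_left le_rfl
  refine ⟨?_, ?_, fun i => ?_⟩
  · intro x hx
    by_cases hS : x ∈ S
    · have h1 : ContDiffAt ℝ 1 v (D.Psi l x) := hv.c1.contDiffAt (Hs_open.mem_nhds (h.mapΨ ⟨hS, hx⟩).1)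
      have h2 : ContDiffAt ℝ 1 (fun x => v (D.Psi l x)) x := h1.comp x (Psi_smooth.of_le (by exact_mod_cast le_top)).contDiffAt
      exact (h2.congr_of_eventuallyEq (Filter.eventuallyEq_of_mem (h.So.mem_nhds hS) fun z hz => indicator_of_mem hz _)).contDiffWithinAt
    · have hKc : IsClosed (Φ '' Metric.closedBall (D.Psi l x0) r') :=
        ((isCompact_closedBall _ _).image_of_continuousOn (h.smooth.continuousOn.mono ((Metric.closedBall_subset_closedBall hr.le).trans h.sub))).isClosed
      have hxK : x ∉ Φ '' Metric.closedBall (D.Psi l x0) r' := by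
        rintro ⟨y, hy, rfl⟩
        exact hS (h.mΦ y (Metric.closedBall_subset_ball hr hy))
      have h2 : ContDiffAt ℝ 1 (fun _ : Eu n => (0:ℝ)) x := contDiffAt_const
      exact (h2.congr_of_eventuallyEq (Filter.eventuallyEq_of_mem ((D.isOpen.inter hKc.isOpen_compl).mem_nhds ⟨hx, hxK⟩) fun z hz => h.V_zero hv0 hz.1 hz.2)).contDiffWithinAt
  · exact h.pull (hv.c1.continuousOn.mono inter_subset_left) (hv.l2.mono_measure hmono)
  · have h1 : D.L2 (fun x => ∑ j, D.pm l i j x * S.indicator (fun x => pd j v (D.Psi l x)) x) := by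
      refine memLp_finset_sum _ fun j _ => ?_
      refine l2_mul_cont (pm_smooth i j).continuous (h.pull ((pd_continuousOn Hs_open hv.c1).mono inter_subset_left) ((hv.gl2 j).mono_measure hmono))
    refine (memLp_congr_ae ((ae_restrict_iff' D.measSet).2 (ae_of_all _ fun x hx => ?_))).1 h1
    exact (h.V_pd hv hr hv0 i hx).symm

end test

/-- Jacobian factor -/
def Jf (D : SmoothDomain n) (l : Fin n) (Φ : Eu n → Eu n) (y : Eu n) : ℝ := |pd l D.defining (Φ y)|⁻¹

lemma FChart.J_smooth (h : D.FChart l x0 r1 Φ S T) : ContDiffOn ℝ (⊤ : ℕ∞) (D.Jf l Φ) T := by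
  intro y hy
  have h1 : ContDiffWithinAt ℝ (⊤ : ℕ∞) (fun y => pd l D.defining (Φ y)) T y :=
    (pd_contDiff (i := l) D.rho_smooth).contDiffAt.comp_contDiffWithinAt y (h.smooth y hy)
  have h2 : ContDiffWithinAt ℝ (⊤ : ℕ∞) (fun y => |pd l D.defining (Φ y)|) T y :=
    ContDiffAt.comp_contDiffWithinAt (g := fun t : ℝ => |t|) y (contDiffAt_abs (h.ne y hy)) h1
  exact h2.inv (abs_ne_zero.2 (h.ne y hy))

def Af (D : SmoothDomain n) (l : Fin n) (Φ : Eu n → Eu n) (ζ : Eu n → ℝ) (j k : Fin n) (y : Eu n) : ℝ :=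
  (D.Jf l Φ y * ∑ i, D.pm l i j (Φ y) * D.pm l i k (Φ y)) * ζ y

lemma Af_sum (ζ : Eu n → ℝ) (y : Eu n) (ξ η : Fin n → ℝ) :
    ∑ j, (∑ k, D.Af l Φ ζ j k y * ξ k) * η j =
      ζ y * D.Jf l Φ y * ∑ i, (∑ k, D.pm l i k (Φ y) * ξ k) * (∑ j, D.pm l i j (Φ y) * η j) := by
  have h1 : ∀ j, (∑ k, D.Af l Φ ζ j k y * ξ k) * η j = ∑ k, ∑ i, ζ y * D.Jf l Φ y * ((D.pm l i k (Φ y) * ξ k) * (D.pm l i j (Φ y) * η j)) := by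
    intro j
    rw [Finset.sum_mul]
    refine Finset.sum_congr rfl fun k _ => ?_
    simp only [Af, Finset.mul_sum, Finset.sum_mul]
    refine Finset.sum_congr rfl fun i _ => by ring
  simp only [h1]
  simp only [Finset.sum_mul_sum]
  simp only [Finset.mul_sum]
  rw [Finset.sum_comm]
  rw [Finset.sum_congr rfl fun k _ => Finset.sum_comm]
  rw [Finset.sum_comm]

theorem FChart.locSol (h : D.FChart l x0 r1 Φ S T) {u : Eu n → ℝ} {μ : ℝ} (hu : ContDiffOn ℝ (⊤ : ℕ∞) u D.carrier)
    (ha : D.Adm u) (hw : ∀ v, D.Adm v → D.dir u v = μ * D.ip u v) :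
    ∃ r0 c0 a b, 0 < r0 ∧ r0 ≤ r1 ∧ LocSol l (D.Psi l x0) r0 c0 a b (fun y => u (Φ y)) := by
  have hpos := h.pos
  have hsubT : Uh l (D.Psi l x0) r1 ⊆ T := fun y hy => h.sub (Metric.ball_subset_closedBall hy.2)
  obtain ⟨ζ, hζ, hζ1, -⟩ := exists_cut (D.Psi l x0) (show 0 < r1 / 2 by linarith) (show r1 / 2 < r1 by linarith)
  have hζT : tsupport ζ ⊆ T := hζ.sub.trans (Metric.ball_subset_closedBall.trans h.sub)
  obtain ⟨m, hm0, hm0'⟩ := h.lower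
  have hU : ∀ i, ∃ M, 0 ≤ M ∧ ∀ x ∈ S, |pd i D.defining x| ≤ M := fun i => h.upper (pd_continuous (i := i) D.rho_c1)
  choose Mi hMi0 hMi using hU
  set M := ∑ i, Mi i with hM
  have hM0 : 0 ≤ M := Finset.sum_nonneg fun i _ => hMi0 i
  have hMb : ∀ i, ∀ x ∈ S, |pd i D.defining x| ≤ M := fun i x hx =>
    (hMi i x hx).trans (Finset.single_le_sum (f := Mi) (fun j _ => hMi0 j) (Finset.mem_univ i))
  set K : ℝ := n * (2 + 2 * (M ^ 2 + 1) / m ^ 2) with hK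
  have hK0 : 0 ≤ K := by positivity
  have hwsm : ContDiffOn ℝ (⊤ : ℕ∞) (fun y => u (Φ y)) (Uh l (D.Psi l x0) r1) :=
    hu.comp (h.smooth.mono hsubT) fun y hy => (h.mapΦ hy).2
  have hmono : volume.restrict (Uh l (D.Psi l x0) (r1 / 2)) ≤ volume.restrict (Uh l (D.Psi l x0) r1) := Measure.restrict_mono (Uh_mono (by linarith)) le_rfl
  refine ⟨r1 / 2, ((M + 1) * (K + 1))⁻¹, D.Af l Φ ζ, fun y => μ * (D.Jf l Φ y * ζ y), by linarith, by linarith, ?_⟩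
  refine ⟨⟨?_, ?_, by positivity, ?_⟩, by linarith, ?_, ?_, ?_, ?_, ?_, ?_⟩
  · intro j k
    refine cutc h.To ?_ hζ.smooth hζT
    exact h.J_smooth.mul (ContDiffOn.sum fun i _ => (((pm_smooth i j).comp_contDiffOn h.smooth).mul ((pm_smooth i k).comp_contDiffOn h.smooth)))
  · intro j k; exact hζ.cs.mul_left
  · intro y hy ξ
    have hyS : Φ y ∈ S := h.mΦ y (Metric.ball_subset_ball (by linarith) hy)
    rw [Af_sum, hζ1 y hy, one_mul]
    have e1 := pm_ell (l := l) hm0 hM0 (hm0' _ hyS) (fun i => hMb i _ hyS) ξ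
    rw [← hK] at e1
    have e2 : ∑ i, (∑ k, D.pm l i k (Φ y) * ξ k) * (∑ j, D.pm l i j (Φ y) * ξ j) = ∑ i, (∑ j, D.pm l i j (Φ y) * ξ j) ^ 2 :=
      Finset.sum_congr rfl fun i _ => (sq _).symm
    rw [e2]
    set E := ∑ i, (∑ j, D.pm l i j (Φ y) * ξ j) ^ 2
    have hE : 0 ≤ E := Finset.sum_nonneg fun i _ => sq_nonneg _
    have hJ : (M + 1)⁻¹ ≤ D.Jf l Φ y := by
      refine inv_anti₀ (lt_of_lt_of_le hm0 (hm0' _ hyS)) ((hMb l _ hyS).trans (by linarith))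
    calc ((M + 1) * (K + 1))⁻¹ * ∑ i, ξ i ^ 2 ≤ ((M + 1) * (K + 1))⁻¹ * ((K + 1) * E) :=
          mul_le_mul_of_nonneg_left (by nlinarith) (by positivity)
      _ = (M + 1)⁻¹ * E := by field_simp
      _ ≤ _ := mul_le_mul_of_nonneg_right hJ hE
  · exact contDiff_const.mul (cutc h.To h.J_smooth hζ.smooth hζT)
  · exact (hζ.cs.mul_left).mul_left
  · exact hwsm.mono (Uh_mono (by linarith))
  · exact (h.push hu.continuousOn ha.l2).mono_measure hmono
  · intro j
    refine MemLp.mono_measure hmono ?_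
    have hfc : ContinuousOn (fderiv ℝ Φ) T := h.smooth.continuousOn_fderiv_of_isOpen h.To (by simp)
    have hcoef : ∀ i, ContinuousOn (fun y => (fderiv ℝ Φ y (bv j)) i) T := by
      intro i
      have : ContinuousOn (fun y => fderiv ℝ Φ y (bv j)) T := hfc.clm_apply continuousOn_const
      exact (EuclideanSpace.proj i : Eu n →L[ℝ] ℝ).continuous.comp_continuousOn this
    have h1 : MemLp (fun y => ∑ i, (fderiv ℝ Φ y (bv j)) i * pd i u (Φ y)) 2 (volume.restrict (Uh l (D.Psi l x0) r1)) := by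
      refine memLp_finset_sum _ fun i _ => ?_
      obtain ⟨C, hC⟩ := (isCompact_closedBall (D.Psi l x0) r1).exists_bound_of_continuousOn ((hcoef i).mono h.sub)
      refine l2_bdd_mul (c := C) (h.push (pd_continuousOn D.isOpen (hu.of_le (by exact_mod_cast le_top))) (ha.gl2 i))
        (((hcoef i).mono hsubT).aestronglyMeasurable Uh_open.measurableSet) ?_
      exact (ae_restrict_iff' Uh_open.measurableSet).2 (ae_of_all _ fun y hy => hC y (Metric.ball_subset_closedBall hy.2))
    refine (memLp_congr_ae ((ae_restrict_iff' Uh_open.measurableSet).2 (ae_of_all _ fun y hy => ?_))).1 h1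
    have h2 : HasFDerivAt Φ (fderiv ℝ Φ y) y := ((h.smooth.contDiffAt (h.To.mem_nhds (hsubT hy))).differentiableAt (by simp)).hasFDerivAt
    have h3 : HasFDerivAt u (fderiv ℝ u (Φ y)) (Φ y) := (hu.diffAt D.isOpen (by simp) (h.mapΦ hy).2).hasFDerivAt
    have h4 : HasFDerivAt (fun y => u (Φ y)) _ y := h3.comp y h2
    rw [pd, h4.fderiv, ContinuousLinearMap.comp_apply, fderiv_eq_sum]
  · rintro v hv ⟨r', hr', hv0⟩
    have hr1 : r' < r1 := by linarith
    have hVa := h.V_adm hv hr1 hv0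
    set V := S.indicator (fun x => v (D.Psi l x)) with hV
    set w : Eu n → ℝ := fun y => u (Φ y) with hwdef
    have hpv0 : ∀ j, ∀ y ∈ Hs l, r' < dist y (D.Psi l x0) → pd j v y = 0 := by
      intro j y hy hd
      have : pd j v y = pd j (fun _ => (0:ℝ)) y :=
        pd_congr_on (U := Hs l ∩ {y | r' < dist y (D.Psi l x0)}) (Hs_open.inter (isOpen_lt continuous_const (by fun_prop))) (fun z hz => hv0 z hz.1 hz.2) ⟨hy, hd⟩
      rw [this, pd_const]
    have hout : ∀ y ∈ Hs l \ Uh l (D.Psi l x0) r1, r' < dist y (D.Psi l x0) := by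
      intro y hy
      by_contra hc
      exact hy.2 ⟨hy.1, lt_of_le_of_lt (not_lt.1 hc) hr1⟩
    have hupd : ∀ x ∈ S ∩ D.carrier, ∀ i, pd i u x = ∑ k, D.pm l i k x * pd k w (D.Psi l x) := by
      intro x hx i
      rw [← pd_psi (v := w) (hwsm.diffAt Uh_open (by simp) (h.mapΨ hx))]
      refine pd_congr_on h.oSD (fun z hz => ?_) hx
      simp only [hwdef, h.left z hz.1]
    have L1 : ∫ y, ∑ i, (∑ j, D.Af l Φ ζ i j y * pd j w y) * pd i v y ∂(hm l) = D.dir u V := by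
      have s1 : ∫ y, ∑ i, (∑ j, D.Af l Φ ζ i j y * pd j w y) * pd i v y ∂(hm l) =
          ∫ y in Uh l (D.Psi l x0) r1, ∑ i, (∑ j, D.Af l Φ ζ i j y * pd j w y) * pd i v y := by
        refine (setIntegral_eq_of_subset_of_forall_diff_eq_zero Hs_meas inter_subset_left fun y hy => ?_)
        refine Finset.sum_eq_zero fun i _ => ?_
        rw [hpv0 i y hy.1 (hout y hy), mul_zero]
      have s2 : D.dir u V = ∫ x in S ∩ D.carrier, ∑ i, pd i u x * pd i V x := by
        refine (setIntegral_eq_of_subset_of_forall_diff_eq_zero D.measSet inter_subset_right fun x hx => ?_)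
        refine Finset.sum_eq_zero fun i _ => ?_
        have hxS : x ∉ S := fun hc => hx.2 ⟨hc, hx.1⟩
        rw [hV, h.V_pd hv hr1 hv0 i hx.1]
        simp [hxS]
      rw [s1, h.cv, s2]
      refine setIntegral_congr_fun h.oSD.measurableSet fun x hx => ?_
      have hΨ := h.mapΨ hx
      have e1 : ∀ i, pd i V x = ∑ j, D.pm l i j x * pd j v (D.Psi l x) := by
        intro i; rw [hV, h.V_pd hv hr1 hv0 i hx.2]; simp [hx.1]
      simp only [e1]
      by_cases hd : r' < dist (D.Psi l x) (D.Psi l x0)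
      · simp [hpv0 _ _ hΨ.1 hd]
      · have hz : ζ (D.Psi l x) = 1 := hζ1 _ (lt_of_le_of_lt (not_lt.1 hd) hr')
        rw [Af_sum, hz, h.left x hx.1]
        have hne : |pd l D.defining x| ≠ 0 := (lt_of_lt_of_le hm0 (hm0' x hx.1)).ne'
        have hJ : |pd l D.defining x| * D.Jf l Φ (D.Psi l x) = 1 := by
          rw [Jf, h.left x hx.1, mul_inv_cancel₀ hne]
        rw [one_mul, ← mul_assoc, hJ, one_mul]
        exact Finset.sum_congr rfl fun i _ => by rw [hupd x hx i]
    have L2' : ∫ y, μ * (D.Jf l Φ y * ζ y) * w y * v y ∂(hm l) = μ * D.ip u V := by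
      have s1 : ∫ y, μ * (D.Jf l Φ y * ζ y) * w y * v y ∂(hm l) =
          ∫ y in Uh l (D.Psi l x0) r1, μ * (D.Jf l Φ y * ζ y) * w y * v y := by
        refine (setIntegral_eq_of_subset_of_forall_diff_eq_zero Hs_meas inter_subset_left fun y hy => ?_)
        rw [hv0 y hy.1 (hout y hy), mul_zero]
      have s2 : D.ip u V = ∫ x in S ∩ D.carrier, u x * V x := by
        refine (setIntegral_eq_of_subset_of_forall_diff_eq_zero D.measSet inter_subset_right fun x hx => ?_)
        have hxS : x ∉ S := fun hc => hx.2 ⟨hc, hx.1⟩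
        simp [hV, hxS]
      rw [s1, h.cv, s2, ← integral_const_mul]
      refine setIntegral_congr_fun h.oSD.measurableSet fun x hx => ?_
      have hΨ := h.mapΨ hx
      have e1 : V x = v (D.Psi l x) := by rw [hV, indicator_of_mem hx.1]
      simp only [e1]
      by_cases hd : r' < dist (D.Psi l x) (D.Psi l x0)
      · simp [hv0 _ hΨ.1 hd]
      · have hz : ζ (D.Psi l x) = 1 := hζ1 _ (lt_of_le_of_lt (not_lt.1 hd) hr')
        have hne : |pd l D.defining x| ≠ 0 := (lt_of_lt_of_le hm0 (hm0' x hx.1)).ne'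
        have hJ : |pd l D.defining x| * D.Jf l Φ (D.Psi l x) = 1 := by
          rw [Jf, h.left x hx.1, mul_inv_cancel₀ hne]
        simp only [hz, hwdef, h.left x hx.1]
        linear_combination μ * u x * v (D.Psi l x) * hJ
    rw [L1, L2', hw V hVa]

/-- smooth extension of eigenfunctions to the closure -/
theorem smooth_ext {u : Eu n → ℝ} {μ : ℝ} (hu : ContDiffOn ℝ (⊤ : ℕ∞) u D.carrier)
    (ha : D.Adm u) (hw : ∀ v, D.Adm v → D.dir u v = μ * D.ip u v) :
    ContDiffOn ℝ (⊤ : ℕ∞) (extendFrom D.carrier u) (closure D.carrier) ∧ ∀ x ∈ D.carrier, extendFrom D.carrier u x = u x := by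
  have heq : ∀ x ∈ D.carrier, extendFrom D.carrier u x = u x := fun x hx =>
    extendFrom_eq (subset_closure hx) (hu.continuousOn.continuousWithinAt hx).tendsto
  refine ⟨?_, heq⟩
  intro x0 hx0
  by_cases hx : x0 ∈ D.carrier
  · have h1 := hu.contDiffAt (D.isOpen.mem_nhds hx)
    exact (h1.congr_of_eventuallyEq (Filter.eventuallyEq_of_mem (D.isOpen.mem_nhds hx) heq)).contDiffWithinAt
  have hf : x0 ∈ frontier D.carrier := by rw [D.isOpen.frontier_eq]; exact ⟨hx0, hx⟩
  obtain ⟨l, hl⟩ : ∃ l, pd l D.defining x0 ≠ 0 := by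
    by_contra hc
    push Not at hc
    refine D.fderiv_ne hf ?_
    ext v; rw [fderiv_eq_sum]; simp [hc]
  obtain ⟨r1, Φ, S, T, h⟩ := exists_chart hl
  obtain ⟨r0, c0, a, b, hr0, hr01, hL⟩ := h.locSol hu ha hw
  rw [contDiffWithinAt_infty]
  intro k
  obtain ⟨r, hr, hrr, ht, hc⟩ := hL.ext k
  set y0 := D.Psi l x0
  set N := S ∩ D.Psi l ⁻¹' Metric.ball y0 r with hN
  have hNo : IsOpen N := h.So.inter (Metric.isOpen_ball.preimage Psi_smooth.continuous)
  have hx0N : x0 ∈ N := ⟨h.x0S, by simp [hr, y0]⟩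
  have hmaps : ∀ z ∈ N ∩ D.carrier, D.Psi l z ∈ Uh l y0 r := fun z hz => ⟨(h.mapΨ ⟨hz.1.1, hz.2⟩).1, hz.1.2⟩
  have htend : ∀ x ∈ N, Tendsto (D.Psi l) (𝓝[D.carrier] x) (𝓝[Uh l y0 r] (D.Psi l x)) := by
    intro x hx
    refine tendsto_nhdsWithin_iff.2 ⟨(Psi_smooth.continuous.tendsto x).mono_left nhdsWithin_le_nhds, ?_⟩
    filter_upwards [mem_nhdsWithin_of_mem_nhds (hNo.mem_nhds hx), self_mem_nhdsWithin] with z h1 h2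
    exact hmaps z ⟨h1, h2⟩
  have hcl : ∀ x ∈ N ∩ closure D.carrier, D.Psi l x ∈ closure (Uh l y0 r) := by
    intro x hx
    haveI := mem_closure_iff_nhdsWithin_neBot.1 hx.2
    have h1 : (𝓝[Uh l y0 r] (D.Psi l x)).NeBot := (htend x hx.1).neBot
    exact mem_closure_iff_nhdsWithin_neBot.2 h1
  have hE : ∀ x ∈ N ∩ closure D.carrier, extendFrom D.carrier u x = extendFrom (Uh l y0 r) (fun y => u (Φ y)) (D.Psi l x) := by
    intro x hx
    refine extendFrom_eq hx.2 ?_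
    refine ((ht _ (hcl x hx)).comp (htend x hx.1)).congr' ?_
    filter_upwards [mem_nhdsWithin_of_mem_nhds (hNo.mem_nhds hx.1)] with z hz
    simp only [Function.comp, h.left z hz.1]
  have h3 : ContDiffOn ℝ k (fun x => extendFrom (Uh l y0 r) (fun y => u (Φ y)) (D.Psi l x)) (N ∩ closure D.carrier) :=
    hc.comp (Psi_smooth.of_le (nat_le_inf k)).contDiffOn fun x hx => hcl x hx
  have h4 : ContDiffWithinAt ℝ k (extendFrom D.carrier u) (N ∩ closure D.carrier) x0 :=
    (h3 x0 ⟨hx0N, hx0⟩).congr hE (hE x0 ⟨hx0N, hx0⟩)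
  rw [inter_comm] at h4
  exact (contDiffWithinAt_inter (hNo.mem_nhds hx0N)).1 h4

end SmoothDomain

/-! ## P10: functions smooth up to the boundary, Green formula -/

namespace SmoothDomain
variable {D : SmoothDomain n}

lemma isOpen_sub (x : Eu n) (hx : x ∈ D.carrier) : closure D.carrier ∈ 𝓝 x :=
  mem_of_superset (D.isOpen.mem_nhds hx) subset_closure

lemma udo (D : SmoothDomain n) : UniqueDiffOn ℝ (closure D.carrier) := by
  intro x0 hx0
  by_cases hx : x0 ∈ D.carrier
  · exact uniqueDiffWithinAt_of_mem_nhds (isOpen_sub x0 hx)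
  have hfr : x0 ∈ frontier D.carrier := by
    rw [frontier, D.isOpen.interior_eq]; exact ⟨hx0, hx⟩
  have hρ0 : D.defining x0 = 0 := by
    have := D.frontier_eq ▸ hfr; exact this
  have hcone : ∀ v, fderiv ℝ D.defining x0 v < 0 → v ∈ tangentConeAt ℝ (closure D.carrier) x0 := by
    intro v hv
    have hd : HasDerivAt (fun t : ℝ => D.defining (x0 + t • v)) (fderiv ℝ D.defining x0 v) 0 := by
      have h1 : HasDerivAt (fun t : ℝ => x0 + t • v) v 0 := by
        simpa using ((hasDerivAt_id (0:ℝ)).smul_const v).const_add x0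
      have h2 : HasFDerivAt D.defining (fderiv ℝ D.defining x0) (x0 + (0:ℝ) • v) := by
        simpa using (D.rho_diff x0).hasFDerivAt
      exact h2.comp_hasDerivAt (0:ℝ) h1
    have hev : ∀ᶠ t in 𝓝[>] (0:ℝ), D.defining (x0 + t • v) < 0 := by
      have := hd.hasDerivWithinAt (s := Ioi 0)
      rw [hasDerivWithinAt_iff_tendsto_slope] at this
      have h3 := this.eventually (gt_mem_nhds hv)
      have e : Ioi (0:ℝ) \ {0} = Ioi 0 := by ext; simp
      rw [e] at h3
      filter_upwards [h3, self_mem_nhdsWithin] with t ht ht0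
      simp only [slope, hρ0, zero_smul, add_zero, sub_zero, vsub_eq_sub, smul_eq_mul] at ht
      have ht0' : (0:ℝ) < t := ht0
      by_contra hcon
      push Not at hcon
      have : 0 ≤ t⁻¹ * D.defining (x0 + t • v) := by positivity
      linarith
    refine mem_tangentConeAt_of_add_smul_mem (tendsto_id'.mpr <| nhdsGT_le_nhdsNE 0) ?_
    filter_upwards [hev] with t ht
    exact subset_closure (D.mem_iff.2 ht)
  refine ⟨?_, subset_closure hx0⟩
  obtain ⟨v0, hv0⟩ : ∃ v0, fderiv ℝ D.defining x0 v0 < 0 := by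
    by_contra hcon
    push Not at hcon
    apply D.fderiv_ne hfr
    ext v
    have h1 := hcon v
    have h2 := hcon (-v)
    simp at h2 ⊢; linarith
  have : (Submodule.span ℝ (tangentConeAt ℝ (closure D.carrier) x0) : Submodule ℝ (Eu n)) = ⊤ := by
    rw [eq_top_iff]
    intro w _
    set a := fderiv ℝ D.defining x0 with ha
    obtain ⟨c, hc, hc0⟩ : ∃ c : ℝ, a w + c * a v0 < 0 ∧ 0 < c := by
      refine ⟨(|a w| + 1) / (- a v0), ?_, by have : 0 < - a v0 := by linarith
                                             positivity⟩
      have : (|a w| + 1) / (- a v0) * a v0 = -(|a w| + 1) := by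
        have : a v0 ≠ 0 := hv0.ne
        field_simp
      rw [this]; linarith [le_abs_self (a w)]
    have h1 : w + c • v0 ∈ tangentConeAt ℝ (closure D.carrier) x0 := hcone _ (by simpa using hc)
    have h2 : v0 ∈ tangentConeAt ℝ (closure D.carrier) x0 := hcone _ hv0
    have := Submodule.sub_mem _ (Submodule.subset_span (R := ℝ) h1) (Submodule.smul_mem _ c (Submodule.subset_span (R := ℝ) h2))
    simpa using this
  rw [this]; simp

/-- smooth up to the boundary -/
abbrev SC (D : SmoothDomain n) (f : Eu n → ℝ) : Prop := ContDiffOn ℝ (⊤ : ℕ∞) f (closure D.carrier)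

/-- partial derivative within the closure -/
def pdw (D : SmoothDomain n) (i : Fin n) (f : Eu n → ℝ) (x : Eu n) : ℝ :=
  fderivWithin ℝ f (closure D.carrier) x (bv i)

lemma SC.smooth {f : Eu n → ℝ} (hf : D.SC f) : ContDiffOn ℝ (⊤ : ℕ∞) f D.carrier := hf.mono subset_closure

lemma SC.pdw {f : Eu n → ℝ} (hf : D.SC f) (i : Fin n) : D.SC (D.pdw i f) :=
  (hf.fderivWithin D.udo (by simp)).clm_apply contDiffOn_const

lemma pdw_eq {f : Eu n → ℝ} (i : Fin n) {x : Eu n} (hx : x ∈ D.carrier) : D.pdw i f x = pd i f x := by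
  rw [SmoothDomain.pdw, fderivWithin_of_mem_nhds (isOpen_sub x hx)]; rfl

lemma lapWithin_eq' {f : Eu n → ℝ} {x : Eu n} :
    lapWithin (closure D.carrier) f x = ∑ i, D.pdw i (D.pdw i f) x := rfl

lemma SC.lap {f : Eu n → ℝ} (hf : D.SC f) : D.SC (lapWithin (closure D.carrier) f) :=
  ContDiffOn.sum fun i _ => (hf.pdw i).pdw i

lemma lapWithin_eq {f : Eu n → ℝ} {x : Eu n} (hx : x ∈ D.carrier) :
    lapWithin (closure D.carrier) f x = ∑ i, pd i (pd i f) x := by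
  rw [lapWithin_eq']
  refine Finset.sum_congr rfl fun i _ => ?_
  rw [pdw_eq i hx]
  exact pd_congr_on D.isOpen (fun y hy => pdw_eq i hy) hx

lemma SC.bdd {f : Eu n → ℝ} (hf : ContinuousOn f (closure D.carrier)) :
    ∃ M, 0 ≤ M ∧ ∀ x ∈ closure D.carrier, |f x| ≤ M := by
  obtain ⟨M, hM⟩ := D.isCompact_closure.exists_bound_of_continuousOn hf
  exact ⟨max M 0, le_max_right _ _, fun x hx => (hM x hx).trans (le_max_left _ _)⟩

lemma SC.l2 {f : Eu n → ℝ} (hf : ContinuousOn f (closure D.carrier)) : D.L2 f := by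
  obtain ⟨M, hM0, hM⟩ := SC.bdd hf
  refine MemLp.of_bound (D.aesm_of_continuousOn (hf.mono subset_closure)) M ?_
  filter_upwards [ae_restrict_mem D.measSet] with x hx
  exact hM x (subset_closure hx)

lemma SC.adm {f : Eu n → ℝ} (hf : D.SC f) : D.Adm f where
  c1 := hf.smooth.of_le (by exact_mod_cast le_top)
  l2 := SC.l2 hf.continuousOn
  gl2 := fun i => l2_congr (SC.l2 (hf.pdw i).continuousOn) (fun x hx => pdw_eq i hx)

lemma fderiv_bdd {f : Eu n → ℝ} (hf : D.SC f) :
    ∃ M, 0 ≤ M ∧ ∀ x ∈ D.carrier, ‖fderiv ℝ f x‖ ≤ M := by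
  have h := hf.continuousOn_fderivWithin D.udo (by simp)
  obtain ⟨M, hM⟩ := D.isCompact_closure.exists_bound_of_continuousOn h
  refine ⟨max M 0, le_max_right _ _, fun x hx => ?_⟩
  rw [← fderivWithin_of_mem_nhds (isOpen_sub x hx)]
  exact (hM x (subset_closure hx)).trans (le_max_left _ _)

lemma bdry_local {h : Eu n → ℝ} (hh : D.SC h) (h0 : ∀ x ∈ frontier D.carrier, 0 ≤ h x)
    {x0 : Eu n} (hx0 : x0 ∈ frontier D.carrier) :
    ∃ r > 0, ∃ C, 0 ≤ C ∧ ∀ x ∈ D.carrier, x ∈ Metric.ball x0 r → C * D.defining x ≤ h x := by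
  obtain ⟨K, hK0, hK⟩ := fderiv_bdd hh
  have hρ0 : D.defining x0 = 0 := by have := D.frontier_eq ▸ hx0; exact this
  obtain ⟨v, hv⟩ : ∃ v, 0 < fderiv ℝ D.defining x0 v := by
    by_contra hcon
    push Not at hcon
    apply D.fderiv_ne hx0
    ext v
    have h1 := hcon v
    have h2 := hcon (-v)
    simp at h2 ⊢; linarith
  set c := fderiv ℝ D.defining x0 v / 2 with hc
  have hc0 : 0 < c := by positivity
  have hcont : Continuous fun y => fderiv ℝ D.defining y v :=
    (D.rho_c1.continuous_fderiv (by simp)).clm_apply continuous_const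
  obtain ⟨r, hr, hball⟩ := Metric.eventually_nhds_iff_ball.1 (hcont.continuousAt.eventually (lt_mem_nhds (show c < fderiv ℝ D.defining x0 v by rw [hc]; linarith)))
  -- choose radius
  set T := r / (2 * (‖v‖ + 1)) with hT
  have hT0 : 0 < T := by positivity
  obtain ⟨r2, hr2, hball2⟩ := Metric.eventually_nhds_iff_ball.1 (D.rho_cont.continuousAt.eventually (lt_mem_nhds (show -(c * T) < D.defining x0 by rw [hρ0]; have := mul_pos hc0 hT0; linarith)))
  have hTv : T * ‖v‖ < r / 2 := by
    have : T * (‖v‖ + 1) = r / 2 := by rw [hT]; field_simp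
    nlinarith
  refine ⟨min (r / 2) r2, by positivity, K * ‖v‖ / c, by positivity, fun x hx hxb => ?_⟩
  have hxb' := Metric.mem_ball.1 hxb
  have hin : ∀ t ∈ Icc (0:ℝ) T, x + t • v ∈ Metric.ball x0 r := by
    intro t ht
    rw [Metric.mem_ball]
    calc dist (x + t • v) x0 ≤ dist (x + t • v) x + dist x x0 := dist_triangle _ _ _
      _ = t * ‖v‖ + dist x x0 := by simp [dist_eq_norm, norm_smul, abs_of_nonneg ht.1]
      _ < r / 2 + r / 2 := by
          refine add_lt_add (lt_of_le_of_lt ?_ hTv) (hxb'.trans_le (min_le_left _ _))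
          exact mul_le_mul_of_nonneg_right ht.2 (norm_nonneg _)
      _ = r := by ring
  have hline : ∀ t : ℝ, HasDerivAt (fun t : ℝ => x + t • v) v t := fun t => by
    simpa using ((hasDerivAt_id t).smul_const v).const_add x
  have hder : ∀ t : ℝ, HasDerivAt (fun t : ℝ => D.defining (x + t • v)) (fderiv ℝ D.defining (x + t • v) v) t :=
    fun t => (D.rho_diff (x + t • v)).hasFDerivAt.comp_hasDerivAt t (hline t)
  set g : ℝ → ℝ := fun t => D.defining (x + t • v) with hg
  have hgrow : ∀ a ∈ Icc (0:ℝ) T, ∀ b ∈ Icc (0:ℝ) T, a ≤ b → c * (b - a) ≤ g b - g a := by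
    intro a ha b hb hab
    refine (convex_Icc (0:ℝ) T).mul_sub_le_image_sub_of_le_deriv (fun t _ => (hder t).continuousAt.continuousWithinAt)
      (fun t _ => (hder t).differentiableAt.differentiableWithinAt) (fun t ht => ?_) a ha b hb hab
    rw [(hder t).deriv]
    exact (hball _ (hin t (interior_subset ht))).le
  have hg0 : g 0 < 0 := by simpa [hg] using D.mem_iff.1 hx
  have hgT : 0 ≤ g T := by
    have h1 := hgrow 0 ⟨le_rfl, hT0.le⟩ T ⟨hT0.le, le_rfl⟩ hT0.le
    have h2 := hball2 x (Metric.mem_ball.2 (hxb'.trans_le (min_le_right _ _)))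
    simp only [hg, zero_smul, add_zero] at h1 ⊢
    linarith
  obtain ⟨t, ht, hgt⟩ := intermediate_value_Icc hT0.le (fun t _ => (hder t).continuousAt.continuousWithinAt : ContinuousOn g (Icc 0 T)) ⟨hg0.le, hgT⟩
  have ht0 : 0 < t := by
    rcases ht.1.lt_or_eq with h | h
    · exact h
    · rw [← h] at hgt; linarith
  have hfr : x + t • v ∈ frontier D.carrier := by rw [D.frontier_eq]; exact hgt
  have hins : ∀ s ∈ Ico (0:ℝ) t, x + s • v ∈ D.carrier := by
    intro s hs
    rw [D.mem_iff]
    have := hgrow s ⟨hs.1, hs.2.le.trans ht.2⟩ t ht hs.2.le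
    rw [hgt] at this
    have h3 : 0 < c * (t - s) := mul_pos hc0 (by linarith [hs.2])
    change g s < 0
    linarith
  have hcl : ∀ s ∈ Icc (0:ℝ) t, x + s • v ∈ closure D.carrier := by
    intro s hs
    rcases hs.2.lt_or_eq with h | h
    · exact subset_closure (hins s ⟨hs.1, h⟩)
    · rw [h]; exact frontier_subset_closure hfr
  have hcontl : Continuous fun t : ℝ => x + t • v := by fun_prop
  have hdh : ∀ s ∈ Ico (0:ℝ) t, HasDerivAt (fun s : ℝ => h (x + s • v)) (fderiv ℝ h (x + s • v) v) s := by
    intro s hs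
    exact (hh.smooth.diffAt D.isOpen (by simp) (hins s hs)).hasFDerivAt.comp_hasDerivAt s (hline s)
  have hest := (convex_Icc (0:ℝ) t).image_sub_le_mul_sub_of_deriv_le (f := fun s : ℝ => h (x + s • v)) (C := K * ‖v‖)
    (hh.continuousOn.comp hcontl.continuousOn hcl)
    (fun s hs => by
      rw [interior_Icc] at hs
      exact (hdh s ⟨hs.1.le, hs.2⟩).differentiableAt.differentiableWithinAt)
    (fun s hs => by
      rw [interior_Icc] at hs
      rw [(hdh s ⟨hs.1.le, hs.2⟩).deriv]
      refine (le_abs_self _).trans (((fderiv ℝ h (x + s • v)).le_opNorm v).trans ?_)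
      exact mul_le_mul_of_nonneg_right (hK _ (hins s ⟨hs.1.le, hs.2⟩)) (norm_nonneg _))
    0 ⟨le_rfl, ht0.le⟩ t ⟨ht0.le, le_rfl⟩ ht0.le
  have h5 := h0 _ hfr
  have h6 := hgrow 0 ⟨le_rfl, hT0.le⟩ t ht ht0.le
  rw [hgt] at h6
  simp only [hg, zero_smul, add_zero, sub_zero, zero_sub] at h6 hest
  have h7 : K * ‖v‖ / c * (c * t) ≤ K * ‖v‖ / c * (- D.defining x) :=
    mul_le_mul_of_nonneg_left h6 (by positivity)
  have h8 : K * ‖v‖ / c * (c * t) = K * ‖v‖ * t := by field_simp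
  linarith

lemma bdry_ge {h : Eu n → ℝ} (hh : D.SC h) (h0 : ∀ x ∈ frontier D.carrier, 0 ≤ h x) :
    ∃ C, 0 ≤ C ∧ ∀ x ∈ D.carrier, C * D.defining x ≤ h x := by
  have main : ∃ C, 0 ≤ C ∧ ∀ x ∈ D.carrier, x ∈ closure D.carrier → C * D.defining x ≤ h x := by
    refine D.isCompact_closure.induction_on (p := fun s => ∃ C, 0 ≤ C ∧ ∀ x ∈ D.carrier, x ∈ s → C * D.defining x ≤ h x)
      ⟨0, le_rfl, by simp⟩ ?_ ?_ ?_
    · rintro s t hst ⟨C, hC, h⟩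
      exact ⟨C, hC, fun x hx hs => h x hx (hst hs)⟩
    · rintro s t ⟨C, hC, h1⟩ ⟨C', hC', h2⟩
      refine ⟨max C C', hC.trans (le_max_left _ _), fun x hx hs => ?_⟩
      have hneg := D.mem_iff.1 hx
      rcases hs with hs | hs
      · exact (mul_le_mul_of_nonpos_right (le_max_left _ _) hneg.le).trans (h1 x hx hs)
      · exact (mul_le_mul_of_nonpos_right (le_max_right _ _) hneg.le).trans (h2 x hx hs)
    · intro x0 hx0
      by_cases hx : x0 ∈ D.carrier
      · have hneg := D.mem_iff.1 hx
        obtain ⟨M, hM0, hM⟩ := SC.bdd hh.continuousOn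
        have hev : ∀ᶠ y in 𝓝 x0, D.defining y < D.defining x0 / 2 :=
          D.rho_cont.continuousAt.eventually (gt_mem_nhds (by linarith))
        refine ⟨{y | D.defining y < D.defining x0 / 2}, mem_nhdsWithin_of_mem_nhds hev, M / (-(D.defining x0 / 2)), div_nonneg hM0 (by linarith), fun y hy hys => ?_⟩
        have h1 := (abs_le.1 (hM y (subset_closure hy))).1
        have h2 : D.defining y < D.defining x0 / 2 := hys
        have h3 : M / (-(D.defining x0 / 2)) * D.defining y ≤ M / (-(D.defining x0 / 2)) * (D.defining x0 / 2) :=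
          mul_le_mul_of_nonneg_left h2.le (div_nonneg hM0 (by linarith))
        have h4 : M / (-(D.defining x0 / 2)) * (D.defining x0 / 2) = -M := by
          have := hneg.ne
          field_simp
        linarith
      · obtain ⟨r, hr, C, hC, hb⟩ := bdry_local hh h0 (x0 := x0) (by rw [frontier, D.isOpen.interior_eq]; exact ⟨hx0, hx⟩)
        exact ⟨Metric.ball x0 r, mem_nhdsWithin_of_mem_nhds (Metric.ball_mem_nhds _ hr), C, hC, hb⟩
  obtain ⟨C, hC, h1⟩ := main
  exact ⟨C, hC, fun x hx => h1 x hx (subset_closure hx)⟩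

lemma bdry_zero {h : Eu n → ℝ} (hh : D.SC h) (h0 : ∀ x ∈ frontier D.carrier, h x = 0) :
    ∃ C, 0 ≤ C ∧ ∀ x ∈ D.carrier, |h x| ≤ - D.defining x * C := by
  obtain ⟨C, hC, h1⟩ := bdry_ge hh fun x hx => (h0 x hx).ge
  obtain ⟨C', hC', h2⟩ := bdry_ge hh.neg fun x hx => by simp [h0 x hx]
  refine ⟨max C C', hC.trans (le_max_left _ _), fun x hx => ?_⟩
  have hneg := D.mem_iff.1 hx
  have a1 := (mul_le_mul_of_nonpos_right (le_max_left C C') hneg.le).trans (h1 x hx)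
  have a2 := (mul_le_mul_of_nonpos_right (le_max_right C C') hneg.le).trans (h2 x hx)
  change _ ≤ - h x at a2
  rw [abs_le]; constructor <;> linarith

/-- conormal derivative -/
def cn (D : SmoothDomain n) (f : Eu n → ℝ) (x : Eu n) : ℝ := ∑ i, D.pdw i f x * pd i D.defining x

lemma SC.cn {f : Eu n → ℝ} (hf : D.SC f) : D.SC (D.cn f) :=
  ContDiffOn.sum fun i _ => (hf.pdw i).mul (pd_contDiff D.rho_smooth).contDiffOn

lemma normalDeriv_eq {f : Eu n → ℝ} {x : Eu n} :
    D.normalDeriv f x = ‖gradient D.defining x‖⁻¹ * D.cn f x := by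
  rw [SmoothDomain.normalDeriv, SmoothDomain.normal, map_smul, clm_eq_sum, smul_eq_mul]
  congr 1
  refine Finset.sum_congr rfl fun i _ => ?_
  rw [gradient_apply, mul_comm]; rfl

lemma normalDeriv_zero_iff {f : Eu n → ℝ} {x : Eu n} (hx : x ∈ frontier D.carrier) :
    D.normalDeriv f x = 0 ↔ D.cn f x = 0 := by
  rw [normalDeriv_eq, mul_eq_zero]
  have := D.grad_ne_zero x hx
  simp [this]

/-- divergence theorem for fields smooth up to the boundary with zero flux -/
lemma div_SC {V : Fin n → Eu n → ℝ} (hV : ∀ i, D.SC (V i))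
    (h : ∀ x ∈ frontier D.carrier, ∑ i, V i x * pd i D.defining x = 0) :
    ∫ x in D.carrier, ∑ i, pd i (V i) x = 0 := by
  obtain ⟨C, hC, hb⟩ := bdry_zero (h := fun x => ∑ i, V i x * pd i D.defining x)
    (ContDiffOn.sum fun i _ => (hV i).mul (pd_contDiff D.rho_smooth).contDiffOn) h
  refine D.divThm_zero (fun i => (hV i).smooth.of_le (by exact_mod_cast le_top)) ?_ (g := fun _ => C) (integrable_const C) hb
  exact integrable_finset_sum _ fun i _ => l2_int ((hV i).adm.gl2 i)

/-- Green's formula -/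
lemma green {f g : Eu n → ℝ} (hf : D.SC f) (hg : D.SC g)
    (h : ∀ x ∈ frontier D.carrier, g x * D.cn f x = 0) :
    D.ip g (lapWithin (closure D.carrier) f) = - D.dir g f := by
  have h1 := div_SC (V := fun i x => g x * D.pdw i f x) (fun i => hg.mul (hf.pdw i)) (fun x hx => by
    rw [← h x hx, SmoothDomain.cn, Finset.mul_sum]
    exact Finset.sum_congr rfl fun i _ => by ring)
  have h2 : ∀ x ∈ D.carrier, ∑ i, pd i (fun y => g y * D.pdw i f y) x =
      g x * lapWithin (closure D.carrier) f x + ∑ i, pd i g x * pd i f x := by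
    intro x hx
    rw [lapWithin_eq', Finset.mul_sum, ← Finset.sum_add_distrib]
    refine Finset.sum_congr rfl fun i _ => ?_
    rw [pd_mul (hg.smooth.diffAt D.isOpen (by simp) hx) ((hf.pdw i).smooth.diffAt D.isOpen (by simp) hx),
      pdw_eq i hx, pdw_eq i hx]
  rw [setIntegral_congr_fun D.measSet h2, integral_add (int_ip hg.adm hf.lap.adm) (int_dir hg.adm hf.adm)] at h1
  unfold ip dir
  linarith

end SmoothDomain

/-! ## P10b: identification of the first eigenvalue with lam ^ (2 m) -/

namespace SmoothDomain
variable {D : SmoothDomain n}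

lemma dir_comm (u v : Eu n → ℝ) : D.dir u v = D.dir v u := by
  unfold dir
  exact integral_congr_ae (Eventually.of_forall fun x => Finset.sum_congr rfl fun i _ => mul_comm _ _)

lemma ip_congr {u u' v v' : Eu n → ℝ} (h : EqOn u u' D.carrier) (h' : EqOn v v' D.carrier) :
    D.ip u v = D.ip u' v' :=
  setIntegral_congr_fun D.measSet fun x hx => by simp only [h hx, h' hx]

lemma dir_congr {u u' v v' : Eu n → ℝ} (h : EqOn u u' D.carrier) (h' : EqOn v v' D.carrier) :
    D.dir u v = D.dir u' v' :=
  setIntegral_congr_fun D.measSet fun x hx => Finset.sum_congr rfl fun i _ => by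
    rw [pd_congr_on D.isOpen h hx, pd_congr_on D.isOpen h' hx]

lemma SC.ext_zero {f g : Eu n → ℝ} (hf : D.SC f) (hg : D.SC g) (h : EqOn f g D.carrier) :
    EqOn f g (closure D.carrier) :=
  h.of_subset_closure hf.continuousOn hg.continuousOn subset_closure subset_rfl

lemma ip_cs {f g : Eu n → ℝ} (hf : D.L2 f) (hg : D.L2 g) : D.ip f g ^ 2 ≤ D.ip f f * D.ip g g := by
  have := cs_int hf hg
  simp only [sq] at this
  unfold ip; rw [sq]; exact this

lemma SC.iter {u : Eu n → ℝ} (hu : D.SC u) (j : ℕ) : D.SC ((lapWithin (closure D.carrier))^[j] u) := by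
  induction j with
  | zero => exact hu
  | succ j ih => rw [Function.iterate_succ_apply']; exact ih.lap

lemma lap_mean {w : Eu n → ℝ} (hw : D.SC w) (h : ∀ x ∈ frontier D.carrier, D.cn w x = 0) :
    ∫ x in D.carrier, lapWithin (closure D.carrier) w x = 0 := by
  have h1 := green hw (g := fun _ => (1:ℝ)) contDiffOn_const (fun x hx => by simp [h x hx])
  simpa [ip, dir, pd_const] using h1

lemma lap_step {w : Eu n → ℝ} (hw : D.SC w) (h : ∀ x ∈ frontier D.carrier, D.cn w x = 0)
    (h0 : ∫ x in D.carrier, w x = 0) :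
    D.lam ^ 2 * D.ip w w ≤ D.ip (lapWithin (closure D.carrier) w) (lapWithin (closure D.carrier) w) := by
  have h1 := green hw hw (fun x hx => by simp [h x hx])
  have h2 := lam_le hw.adm h0
  have h3 := ip_cs (D := D) hw.adm.l2 hw.lap.adm.l2
  rcases (ip_nonneg (D := D) w).eq_or_lt with h4 | h4
  · rw [← h4, mul_zero]; exact ip_nonneg _
  have h5 := lam_nonneg (D := D)
  rw [h1, neg_sq] at h3
  have h6 : (D.lam * D.ip w w) ^ 2 ≤ D.dir w w ^ 2 := pow_le_pow_left₀ (by positivity) h2 2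
  have h7 := h6.trans h3
  have : D.ip w w * (D.lam ^ 2 * D.ip w w) ≤ D.ip w w * D.ip (lapWithin (closure D.carrier) w) (lapWithin (closure D.carrier) w) := by
    calc _ = (D.lam * D.ip w w) ^ 2 := by ring
      _ ≤ _ := h7
  exact le_of_mul_le_mul_left this h4

lemma ip_pos {u : Eu n → ℝ} (hu : D.SC u) (h : ∃ x ∈ closure D.carrier, u x ≠ 0) : 0 < D.ip u u := by
  rcases (ip_nonneg (D := D) u).eq_or_lt with h4 | h4
  · obtain ⟨x, hx, hux⟩ := h
    have := zero_of_int hu.smooth.continuousOn (int_ip hu.adm hu.adm) h4.symm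
    exact absurd (SC.ext_zero hu (g := fun _ => 0) contDiffOn_const this hx) hux
  · exact h4

lemma eig_ge {m : ℕ} (hm1 : 1 ≤ m) {Υ : ℝ} (hΥ : 0 < Υ) (h : IsPolyharmonicNeumannEigenvalue D m Υ) :
    D.lam ^ (2 * m) ≤ Υ := by
  obtain ⟨u, hu, hne, heq, hbd⟩ := h
  set w : ℕ → Eu n → ℝ := fun j => (lapWithin (closure D.carrier))^[j] u with hw
  have hws : ∀ j, w (j + 1) = lapWithin (closure D.carrier) (w j) := fun j => by
    simp only [hw]; rw [Function.iterate_succ_apply']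
  have hsc : ∀ j, D.SC (w j) := fun j => SC.iter hu j
  have hcn : ∀ j < 2 * m, ∀ x ∈ frontier D.carrier, D.cn (w j) x = 0 := fun j hj x hx =>
    (normalDeriv_zero_iff hx).1 (hbd j hj x hx)
  have hmean' : ∀ j < 2 * m, ∫ x in D.carrier, w (j + 1) x = 0 := fun j hj => by
    rw [hws]; exact lap_mean (hsc j) (hcn j hj)
  have hmean : ∀ j < 2 * m, ∫ x in D.carrier, w j x = 0 := by
    intro j hj
    rcases j with _ | j
    · have h1 := hmean' (2 * m - 1) (by omega)
      rw [show 2 * m - 1 + 1 = 2 * m by omega] at h1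
      have h2 : ∫ x in D.carrier, w (2 * m) x = Υ * ∫ x in D.carrier, u x := by
        rw [← integral_const_mul]
        exact setIntegral_congr_fun D.measSet fun x hx => heq x hx
      rw [h2] at h1
      exact (mul_eq_zero.1 h1).resolve_left hΥ.ne'
    · exact hmean' j (by omega)
  have hl := lam_nonneg (D := D)
  have key : ∀ j ≤ 2 * m, (D.lam ^ j) ^ 2 * D.ip u u ≤ D.ip (w j) (w j) := by
    intro j
    induction j with
    | zero => intro _; simp [hw]
    | succ j ih =>
      intro hj
      have h1 := ih (by omega)
      have h2 := lap_step (hsc j) (hcn j (by omega)) (hmean j (by omega))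
      rw [← hws] at h2
      calc (D.lam ^ (j + 1)) ^ 2 * D.ip u u = D.lam ^ 2 * ((D.lam ^ j) ^ 2 * D.ip u u) := by ring
        _ ≤ D.lam ^ 2 * D.ip (w j) (w j) := mul_le_mul_of_nonneg_left h1 (by positivity)
        _ ≤ _ := h2
  have h3 := key (2 * m) le_rfl
  have h4 : D.ip (w (2 * m)) (w (2 * m)) = Υ ^ 2 * D.ip u u := by
    rw [← ip_smul]; exact ip_congr (fun x hx => heq x hx) (fun x hx => heq x hx)
  rw [h4] at h3
  have h5 := le_of_mul_le_mul_right h3 (ip_pos hu hne)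
  exact (pow_le_pow_iff_left₀ (by positivity) hΥ.le two_ne_zero).1 h5

lemma div_SC_nonneg {V : Fin n → Eu n → ℝ} (hV : ∀ i, D.SC (V i))
    (h : ∀ x ∈ frontier D.carrier, 0 ≤ ∑ i, V i x * pd i D.defining x) :
    0 ≤ ∫ x in D.carrier, ∑ i, pd i (V i) x := by
  obtain ⟨C, hC, hb⟩ := bdry_ge (h := fun x => ∑ i, V i x * pd i D.defining x)
    (ContDiffOn.sum fun i _ => (hV i).mul (pd_contDiff D.rho_smooth).contDiffOn) h
  refine D.divThm_nonneg (fun i => (hV i).smooth.of_le (by exact_mod_cast le_top)) ?_ (g := fun _ => C) (integrable_const C) (fun x hx => by rw [mul_comm]; exact hb x hx)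
  exact integrable_finset_sum _ fun i _ => l2_int ((hV i).adm.gl2 i)

/-- interior equation from the weak identity -/
lemma weak_lap {u : Eu n → ℝ} {μ : ℝ} (hu : D.SC u) (hw : ∀ v, D.Adm v → D.dir u v = μ * D.ip u v) :
    ∀ x ∈ closure D.carrier, lapWithin (closure D.carrier) u x = -μ * u x := by
  set w : Eu n → ℝ := fun x => lapWithin (closure D.carrier) u x + μ * u x with hwd
  have hwS : D.SC w := hu.lap.add (contDiffOn_const.mul hu)
  set g : Eu n → ℝ := fun x => D.defining x ^ 2 * w x with hg
  have hgS : D.SC g := (D.rho_smooth.contDiffOn.pow 2).mul hwS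
  have h1 := green hu hgS (fun x hx => by
    have : D.defining x = 0 := by have := D.frontier_eq ▸ hx; exact this
    simp [hg, this])
  have h2 := hw g hgS.adm
  rw [dir_comm, h2] at h1
  have hfS : D.SC (fun x => D.defining x * w x) := D.rho_smooth.contDiffOn.mul hwS
  have h3 : ∫ x in D.carrier, (D.defining x * w x) * (D.defining x * w x) = 0 := by
    have : ∫ x in D.carrier, (D.defining x * w x) * (D.defining x * w x) =
        D.ip g (lapWithin (closure D.carrier) u) + μ * D.ip u g := by
      unfold ip
      rw [← integral_const_mul, ← integral_add (int_ip hgS.adm hu.lap.adm) ((int_ip hu.adm hgS.adm).const_mul μ)]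
      exact integral_congr_ae (Eventually.of_forall fun x => by simp only [hg, hwd]; ring)
    rw [this, h1]; ring
  have h4 := zero_of_int hfS.smooth.continuousOn (int_ip hfS.adm hfS.adm) h3
  have h5 : EqOn w (fun _ => 0) D.carrier := fun x hx =>
    (mul_eq_zero.1 (h4 hx)).resolve_left (D.mem_iff.1 hx).ne
  intro x hx
  have := SC.ext_zero hwS contDiffOn_const h5 hx
  simp only [hwd] at this; linarith

lemma neumann_aux {u : Eu n → ℝ} {μ : ℝ} (hu : D.SC u) (hw : ∀ v, D.Adm v → D.dir u v = μ * D.ip u v)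
    {c : ℝ} (hc : 0 < c) {φ : Eu n → ℝ} (hφ : ContDiff ℝ (⊤ : ℕ∞) φ)
    (h : ∀ x ∈ frontier D.carrier, D.cn u x ^ 2 < c → φ x = 0) (e : Eu n) :
    ∫ x in D.carrier, fderiv ℝ φ x e = 0 := by
  have hlap := weak_lap hu hw
  have hprod : ∀ i, D.SC (fun y => D.cn u y * D.pdw i u y) := fun i => hu.cn.mul (hu.pdw i)
  -- bound
  have hq : Continuous fun x => φ x * ∑ i, e i * pd i D.defining x :=
    hφ.continuous.mul (continuous_finset_sum _ fun i _ => continuous_const.mul (pd_continuous D.rho_c1))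
  obtain ⟨M, hM0, hM⟩ := bdd_on_compact hq D.isCompact_closure
  have hdiv0 : ∫ x in D.carrier, ∑ i, pd i (fun y => D.cn u y * D.pdw i u y) x = 0 := by
    have h2 : ∀ x ∈ D.carrier, ∑ i, pd i (fun y => D.cn u y * D.pdw i u y) x =
        - μ * (u x * D.cn u x) + ∑ i, pd i u x * pd i (D.cn u) x := by
      intro x hx
      have : - μ * (u x * D.cn u x) = ∑ i, D.cn u x * D.pdw i (D.pdw i u) x := by
        rw [← Finset.mul_sum, ← lapWithin_eq', hlap x (subset_closure hx)]; ring
      rw [this, ← Finset.sum_add_distrib]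
      refine Finset.sum_congr rfl fun i _ => ?_
      rw [pd_mul (hu.cn.smooth.diffAt D.isOpen (by simp) hx) ((hu.pdw i).smooth.diffAt D.isOpen (by simp) hx),
        pdw_eq i hx, pdw_eq i hx]; ring
    rw [setIntegral_congr_fun D.measSet h2, integral_add ((int_ip hu.adm hu.cn.adm).const_mul _) (int_dir hu.adm hu.cn.adm),
      integral_const_mul]
    have := hw _ hu.cn.adm
    unfold dir ip at this
    rw [this]; ring
  have main : ∀ s : ℝ, |s| ≤ 1 → 0 ≤ s * ∫ x in D.carrier, fderiv ℝ φ x e := by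
    intro s hs
    have hVS : ∀ i, D.SC (fun y => (M / c) * (D.cn u y * D.pdw i u y) + s * e i * φ y) := fun i =>
      (contDiffOn_const.mul (hu.cn.mul (hu.pdw i))).add (contDiffOn_const.mul hφ.contDiffOn)
    have h1 := div_SC_nonneg hVS (fun x hx => by
      have e1 : ∑ i, ((M / c) * (D.cn u x * D.pdw i u x) + s * e i * φ x) * pd i D.defining x =
          M / c * D.cn u x ^ 2 + s * (φ x * ∑ i, e i * pd i D.defining x) := by
        rw [sq]
        conv_rhs => rw [show D.cn u x * D.cn u x = D.cn u x * ∑ i, D.pdw i u x * pd i D.defining x from rfl]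
        rw [Finset.mul_sum, Finset.mul_sum, Finset.mul_sum, Finset.mul_sum, ← Finset.sum_add_distrib]
        exact Finset.sum_congr rfl fun i _ => by ring
      rw [e1]
      by_cases hlt : D.cn u x ^ 2 < c
      · rw [h x hx hlt]; simp; positivity
      · push Not at hlt
        have h3 : M ≤ M / c * D.cn u x ^ 2 := by
          calc M = M / c * c := by field_simp
            _ ≤ _ := mul_le_mul_of_nonneg_left hlt (by positivity)
        have h4 := hM x (frontier_subset_closure hx)
        have h5 : |s * (φ x * ∑ i, e i * pd i D.defining x)| ≤ M := by
          rw [abs_mul]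
          calc _ ≤ 1 * M := mul_le_mul hs h4 (abs_nonneg _) zero_le_one
            _ = M := one_mul M
        have := (abs_le.1 h5).1
        linarith)
    have h2 : ∀ x ∈ D.carrier, ∑ i, pd i (fun y => (M / c) * (D.cn u y * D.pdw i u y) + s * e i * φ y) x =
        (M / c) * (∑ i, pd i (fun y => D.cn u y * D.pdw i u y) x) + s * fderiv ℝ φ x e := by
      intro x hx
      rw [fderiv_eq_sum, Finset.mul_sum, Finset.mul_sum, ← Finset.sum_add_distrib]
      refine Finset.sum_congr rfl fun i _ => ?_
      have d1 : DifferentiableAt ℝ (fun y => D.cn u y * D.pdw i u y) x :=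
        (hprod i).smooth.diffAt D.isOpen (by simp) hx
      have d2 : DifferentiableAt ℝ φ x := hφ.differentiable (by simp) x
      rw [pd_add (d1.const_mul _) (d2.const_mul _), pd_const_mul _ d1, pd_const_mul _ d2]; ring
    have i1 : IntegrableOn (fun x => ∑ i, pd i (fun y => D.cn u y * D.pdw i u y) x) D.carrier :=
      integrable_finset_sum _ fun i _ => l2_int ((hprod i).adm.gl2 i)
    have i2 : IntegrableOn (fun x => fderiv ℝ φ x e) D.carrier :=
      l2_int (l2_cont ((hφ.continuous_fderiv (by simp)).clm_apply continuous_const))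
    rw [setIntegral_congr_fun D.measSet h2, integral_add (i1.const_mul _) (i2.const_mul _), integral_const_mul,
      integral_const_mul, hdiv0] at h1
    linarith
  have a1 := main 1 (by simp)
  have a2 := main (-1) (by simp)
  linarith

lemma neumann_bc {u : Eu n → ℝ} {μ : ℝ} (hu : D.SC u) (hw : ∀ v, D.Adm v → D.dir u v = μ * D.ip u v) :
    ∀ x ∈ frontier D.carrier, D.cn u x = 0 := by
  intro x0 hx0
  by_contra hne
  have hρ0 : D.defining x0 = 0 := by have := D.frontier_eq ▸ hx0; exact this
  set c := D.cn u x0 ^ 2 / 2 with hc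
  have hpos : 0 < D.cn u x0 ^ 2 := by positivity
  have hc0 : 0 < c := by positivity
  have hcont : ContinuousOn (fun x => D.cn u x ^ 2) (closure D.carrier) := hu.cn.continuousOn.pow 2
  have hev := (hcont x0 (frontier_subset_closure hx0)).eventually (lt_mem_nhds (show c < D.cn u x0 ^ 2 by rw [hc]; linarith))
  rw [eventually_nhdsWithin_iff] at hev
  obtain ⟨δ, hδ, hball⟩ := Metric.eventually_nhds_iff_ball.1 hev
  obtain ⟨e, he⟩ : ∃ v, 0 < fderiv ℝ D.defining x0 v := by
    by_contra hcon
    push Not at hcon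
    apply D.fderiv_ne hx0
    ext v
    have h1 := hcon v
    have h2 := hcon (-v)
    simp at h2 ⊢; linarith
  have hd : HasDerivAt (fun t : ℝ => D.defining (x0 + t • e)) (fderiv ℝ D.defining x0 e) 0 := by
    have h1 : HasDerivAt (fun t : ℝ => x0 + t • e) e 0 := by
      simpa using ((hasDerivAt_id (0:ℝ)).smul_const e).const_add x0
    have h2 : HasFDerivAt D.defining (fderiv ℝ D.defining x0) (x0 + (0:ℝ) • e) := by
      simpa using (D.rho_diff x0).hasFDerivAt
    exact h2.comp_hasDerivAt (0:ℝ) h1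
  have hsl := (hasDerivAt_iff_tendsto_slope.1 hd).eventually (lt_mem_nhds he)
  have hsl2 : ∀ᶠ t in 𝓝 (0:ℝ), t ≠ 0 → 0 < t * D.defining (x0 + t • e) := by
    have := eventually_nhdsWithin_iff.1 hsl
    filter_upwards [this] with t ht htne
    have h1 := ht htne
    simp only [slope, hρ0, zero_smul, add_zero, sub_zero, vsub_eq_sub, smul_eq_mul] at h1
    have h2 : t * D.defining (x0 + t • e) = t ^ 2 * (t⁻¹ * D.defining (x0 + t • e)) := by field_simp
    rw [h2]; exact mul_pos (by positivity) h1
  obtain ⟨τ, hτ, hτb⟩ := Metric.eventually_nhds_iff_ball.1 hsl2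
  set s := min (τ / 2) (δ / (2 * (‖e‖ + 1))) with hs
  have hs0 : 0 < s := by positivity
  have hsτ : s < τ := (min_le_left _ _).trans_lt (by linarith)
  have hse : s * ‖e‖ ≤ δ / 2 := by
    calc s * ‖e‖ ≤ δ / (2 * (‖e‖ + 1)) * (‖e‖ + 1) :=
          mul_le_mul (min_le_right _ _) (by linarith) (norm_nonneg _) (by positivity)
      _ = δ / 2 := by field_simp
  have hin : D.defining (x0 + (-s) • e) < 0 := by
    have := hτb (-s) (by simp [abs_of_pos hs0, hsτ]) (by linarith)
    by_contra hcon; push Not at hcon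
    nlinarith
  have hout : 0 < D.defining (x0 + s • e) := by
    have := hτb s (by simp [abs_of_pos hs0, hsτ]) (by linarith)
    exact (mul_pos_iff_of_pos_left hs0).1 this
  obtain ⟨r1, hr1, hb1⟩ := Metric.eventually_nhds_iff_ball.1 (D.rho_cont.continuousAt.eventually (gt_mem_nhds hin))
  obtain ⟨r2, hr2, hb2⟩ := Metric.eventually_nhds_iff_ball.1 (D.rho_cont.continuousAt.eventually (lt_mem_nhds hout))
  set r := min (δ / 2) (min r1 r2) with hr
  have hr0 : 0 < r := by positivity
  obtain ⟨b, hbr⟩ := exists_bump (n := n) hr0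
  have hbs : ContDiff ℝ (⊤ : ℕ∞) b := b.contDiff
  have hbz : ∀ y : Eu n, r ≤ ‖y‖ → b y = 0 := fun y hy => b.zero_of_le_dist (by rw [hbr]; simpa using hy)
  have hbc : HasCompactSupport b := b.hasCompactSupport
  obtain ⟨M, hM⟩ := (hbs.continuous_fderiv (by simp)).bounded_above_of_compact_support (hbc.fderiv ℝ)
  set I : ℝ → ℝ := fun t => ∫ x in D.carrier, b (x - (x0 + t • e)) with hI
  have hfd : ∀ (t : ℝ) (x : Eu n), HasDerivAt (fun t : ℝ => b (x - (x0 + t • e))) (fderiv ℝ b (x - (x0 + t • e)) (-e)) t := by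
    intro t x
    have h1 : HasDerivAt (fun t : ℝ => x - (x0 + t • e)) (-e) t := by
      simpa using (((hasDerivAt_id t).smul_const e).const_add x0).const_sub x
    exact (hbs.differentiable (by simp) _).hasFDerivAt.comp_hasDerivAt t h1
  have hc1 : ∀ t : ℝ, Continuous fun x => b (x - (x0 + t • e)) := fun t => hbs.continuous.comp (by fun_prop)
  have hc2 : ∀ t : ℝ, Continuous fun x => fderiv ℝ b (x - (x0 + t • e)) (-e) := fun t =>
    ((hbs.continuous_fderiv (by simp)).comp (by fun_prop : Continuous fun x : Eu n => x - (x0 + t • e))).clm_apply continuous_const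
  have hID : ∀ t, HasDerivAt I (∫ x in D.carrier, fderiv ℝ b (x - (x0 + t • e)) (-e)) t := by
    intro t
    exact (hasDerivAt_integral_of_dominated_loc_of_deriv_le (F := fun t x => b (x - (x0 + t • e)))
      (F' := fun t x => fderiv ℝ b (x - (x0 + t • e)) (-e)) (bound := fun _ => M * ‖-e‖) univ_mem
      (Eventually.of_forall fun t => (hc1 t).aestronglyMeasurable) (l2_int (l2_cont (hc1 t)))
      ((hc2 t).aestronglyMeasurable)
      (Eventually.of_forall fun x t _ => ((fderiv ℝ b _).le_opNorm _).trans (mul_le_mul_of_nonneg_right (hM _) (norm_nonneg _)))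
      (integrable_const _) (Eventually.of_forall fun x t _ => hfd t x)).2
  have hzero : ∀ t ∈ Icc (-s) s, ∫ x in D.carrier, fderiv ℝ b (x - (x0 + t • e)) (-e) = 0 := by
    intro t ht
    have h1 := neumann_aux hu hw hc0 (φ := fun x => b (x - (x0 + t • e))) (hbs.comp (by fun_prop)) (fun x hx hlt => by
      apply hbz
      by_contra hcon
      push Not at hcon
      have : x ∈ Metric.ball x0 δ := by
        rw [Metric.mem_ball, dist_eq_norm]
        have h2 : x - x0 = (x - (x0 + t • e)) + t • e := by abel
        rw [h2]
        have h3 : ‖t • e‖ ≤ δ / 2 := by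
          rw [norm_smul]
          exact (mul_le_mul_of_nonneg_right (abs_le.2 ht) (norm_nonneg _)).trans hse
        have h4 : r ≤ δ / 2 := min_le_left _ _
        linarith [norm_add_le (x - (x0 + t • e)) (t • e)]
      exact absurd hlt (not_lt.2 (hball x this (frontier_subset_closure hx)).le)) (-e)
    have h2 : ∀ x, fderiv ℝ (fun x => b (x - (x0 + t • e))) x = fderiv ℝ b (x - (x0 + t • e)) := fun x =>
      fderiv_comp_sub _
    simpa only [h2] using h1
  have hconst : I s = I (-s) := by
    have := constant_of_has_deriv_right_zero (f := I) (a := -s) (b := s) (fun t _ => (hID t).continuousAt.continuousWithinAt)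
      (fun t ht => by
        have := (hID t).hasDerivWithinAt (s := Ici t)
        rwa [hzero t ⟨ht.1, ht.2.le⟩] at this)
    exact this s ⟨by linarith, le_rfl⟩
  have hIs : I s = 0 := by
    refine setIntegral_eq_zero_of_forall_eq_zero fun x hx => hbz _ ?_
    by_contra hcon
    push Not at hcon
    have h1 := hb2 x (by rw [Metric.mem_ball, dist_eq_norm]; exact hcon.trans_le ((min_le_right _ _).trans (min_le_right _ _)))
    have h2 := D.mem_iff.1 hx
    linarith
  have hIm : 0 < I (-s) := by
    have h1 : I (-s) = ∫ x, b (x - (x0 + (-s) • e)) := by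
      refine setIntegral_eq_integral_of_forall_compl_eq_zero fun x hx => hbz _ ?_
      by_contra hcon
      push Not at hcon
      exact hx (D.mem_iff.2 ((hb1 x (by rw [Metric.mem_ball, dist_eq_norm]; exact hcon.trans_le ((min_le_right _ _).trans (min_le_left _ _)))).trans_le le_rfl))
    rw [h1, integral_sub_right_eq_self (fun x => b x)]
    exact b.integral_pos
  linarith

lemma lap_congr {f g : Eu n → ℝ} (h : EqOn f g (closure D.carrier)) :
    EqOn (lapWithin (closure D.carrier) f) (lapWithin (closure D.carrier) g) (closure D.carrier) := by
  have h1 : ∀ {f g : Eu n → ℝ}, EqOn f g (closure D.carrier) → ∀ i, EqOn (D.pdw i f) (D.pdw i g) (closure D.carrier) := by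
    intro f g h i x hx
    unfold pdw
    rw [fderivWithin_congr h (h hx)]
  intro x hx
  rw [lapWithin_eq', lapWithin_eq']
  exact Finset.sum_congr rfl fun i _ => h1 (h1 h i) i hx

lemma pdw_const_mul {f : Eu n → ℝ} (hf : D.SC f) (c : ℝ) (i : Fin n) :
    EqOn (D.pdw i (fun x => c * f x)) (fun x => c * D.pdw i f x) (closure D.carrier) := fun x hx => by
  simp only [pdw]
  rw [fderivWithin_const_mul (D.udo x hx) (hf.differentiableOn (by simp) x hx)]; rfl

lemma lap_const_mul {f : Eu n → ℝ} (hf : D.SC f) (c : ℝ) :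
    EqOn (lapWithin (closure D.carrier) (fun x => c * f x)) (fun x => c * lapWithin (closure D.carrier) f x) (closure D.carrier) := by
  intro x hx
  simp only [lapWithin_eq']
  rw [Finset.mul_sum]
  refine Finset.sum_congr rfl fun i _ => ?_
  have : D.pdw i (D.pdw i fun x => c * f x) x = D.pdw i (fun x => c * D.pdw i f x) x := by
    conv_lhs => rw [pdw]
    rw [fderivWithin_congr (pdw_const_mul hf c i) (pdw_const_mul hf c i hx)]; rfl
  rw [this]
  exact pdw_const_mul (hf.pdw i) c i hx

/-- first Neumann eigenfunction, smooth up to the boundary -/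
theorem exists_eigen_SC (hn : 1 ≤ n) (hne : D.carrier.Nonempty) :
    ∃ u, D.SC u ∧ D.ip u u = 1 ∧ ∫ x in D.carrier, u x = 0 ∧
      (∀ v, D.Adm v → D.dir u v = D.lam * D.ip u v) := by
  obtain ⟨u, hu, ha, h1, h0, hw⟩ := exists_eigen (D := D) hn hne
  obtain ⟨hs, he⟩ := smooth_ext hu ha hw
  have he' : EqOn (extendFrom D.carrier u) u D.carrier := he
  refine ⟨extendFrom D.carrier u, hs, ?_, ?_, fun v hv => ?_⟩
  · rw [ip_congr he' he', h1]
  · rw [setIntegral_congr_fun D.measSet he', h0]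
  · rw [dir_congr he' (fun _ _ => rfl), ip_congr he' (fun _ _ => rfl), hw v hv]

lemma eig_mem {m : ℕ} (hn : 1 ≤ n) (hne : D.carrier.Nonempty) :
    IsPolyharmonicNeumannEigenvalue D m (D.lam ^ (2 * m)) := by
  obtain ⟨u, hs, h1, h0, hw⟩ := exists_eigen_SC (D := D) hn hne
  have hlap := weak_lap hs hw
  have hbc := neumann_bc hs hw
  have hit : ∀ j, EqOn ((lapWithin (closure D.carrier))^[j] u) (fun x => (-D.lam) ^ j * u x) (closure D.carrier) := by
    intro j
    induction j with
    | zero => intro x _; simp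
    | succ j ih =>
      intro x hx
      rw [Function.iterate_succ_apply', lap_congr ih hx, lap_const_mul hs _ hx]
      simp only
      rw [hlap x hx]; ring
  refine ⟨u, hs, ?_, fun x hx => ?_, fun j _ x hx => ?_⟩
  · by_contra hcon
    push Not at hcon
    have : D.ip u u = 0 := setIntegral_eq_zero_of_forall_eq_zero fun x hx => by simp [hcon x (subset_closure hx)]
    rw [this] at h1; norm_num at h1
  · rw [hit _ (subset_closure hx)]
    simp only
    rw [Even.neg_pow (even_two_mul m)]
  · rw [normalDeriv_zero_iff hx, cn]
    have hx' := frontier_subset_closure hx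
    have : ∀ i, D.pdw i ((lapWithin (closure D.carrier))^[j] u) x = (-D.lam) ^ j * D.pdw i u x := fun i => by
      have := pdw_const_mul hs ((-D.lam) ^ j) i hx'
      simp only at this
      rw [← this, pdw, fderivWithin_congr (hit j) (hit j hx')]; rfl
    simp only [this, mul_assoc]
    rw [← Finset.mul_sum]
    have := hbc x hx
    unfold cn at this
    rw [this, mul_zero]

theorem least_eq {m : ℕ} (hm1 : 1 ≤ m) (hn : 1 ≤ n) (hc : IsConnected D.carrier) {Υ : ℝ}
    (h : IsLeast {Υ : ℝ | 0 < Υ ∧ IsPolyharmonicNeumannEigenvalue D m Υ} Υ) : Υ = D.lam ^ (2 * m) :=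
  le_antisymm (h.2 ⟨pow_pos (lam_pos hn hc) _, eig_mem hn hc.nonempty⟩) (eig_ge hm1 h.1.1 h.1.2)

end SmoothDomain

/-! ## P11a: the radial (Bessel type) profile -/

/-- coefficients -/
def bc (ν : ℝ) (j : ℕ) : ℝ := (-1 / 4) ^ j / (j.factorial * ∏ i ∈ Finset.range j, (ν + i))

/-- the Bessel profile as a power series -/
def bF (ν : ℝ) (s : ℝ) : ℝ := ∑' j, bc ν j * s ^ j

lemma prod_pos' {ν : ℝ} (hν : 1 ≤ ν) (j : ℕ) : 1 ≤ ∏ i ∈ Finset.range j, (ν + i) := by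
  induction j with
  | zero => simp
  | succ j ih =>
    rw [Finset.prod_range_succ]
    have : (1:ℝ) ≤ ν + j := by have : (0:ℝ) ≤ j := Nat.cast_nonneg j
                               linarith
    nlinarith

lemma bc_abs {ν : ℝ} (hν : 1 ≤ ν) (j : ℕ) : |bc ν j| ≤ 1 / j.factorial := by
  unfold bc
  have h1 := prod_pos' hν j
  have h2 : (0:ℝ) < j.factorial := by positivity
  rw [abs_div, abs_of_pos (by positivity : 0 < (j.factorial : ℝ) * ∏ i ∈ Finset.range j, (ν + i))]
  rw [div_le_div_iff₀ (by positivity) h2]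
  have h3 : |((-1 / 4 : ℝ)) ^ j| ≤ 1 := by
    rw [abs_pow]; exact pow_le_one₀ (abs_nonneg _) (by norm_num [abs_le])
  nlinarith

lemma bc_succ {ν : ℝ} (hν : 1 ≤ ν) (j : ℕ) : bc ν (j + 1) * (j + 1) = -1 / (4 * ν) * bc (ν + 1) j := by
  unfold bc
  have h1 := prod_pos' (by linarith : (1:ℝ) ≤ ν + 1) j
  have h2 : ∏ i ∈ Finset.range (j + 1), (ν + i) = ν * ∏ i ∈ Finset.range j, (ν + 1 + i) := by
    rw [Finset.prod_range_succ', mul_comm]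
    congr 1
    · simp
    · exact Finset.prod_congr rfl fun i _ => by push_cast; ring
  rw [h2, Nat.factorial_succ]
  push_cast
  have h3 : (j.factorial : ℝ) ≠ 0 := by positivity
  have h4 : ∏ i ∈ Finset.range j, (ν + 1 + i) ≠ 0 := by positivity
  have h5 : (j:ℝ) + 1 ≠ 0 := by positivity
  have h6 : ν ≠ 0 := by positivity
  field_simp
  ring

lemma bc_rec {ν : ℝ} (hν : 1 ≤ ν) (j : ℕ) :
    bc ν (j + 1) - bc (ν + 1) (j + 1) = -1 / (4 * (ν * (ν + 1))) * bc (ν + 2) j := by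
  have e1 := bc_succ hν j
  have h2 : ∀ j, ν * bc ν j = (ν + j) * bc (ν + 1) j := by
    intro j
    unfold bc
    have h3 : ν * ∏ i ∈ Finset.range j, (ν + 1 + i) = (∏ i ∈ Finset.range j, (ν + i)) * (ν + j) := by
      rw [← Finset.prod_range_succ (fun i : ℕ => ν + (i:ℝ)), Finset.prod_range_succ', mul_comm]
      congr 1
      · exact Finset.prod_congr rfl fun i _ => by push_cast; ring
      · simp
    have h4 := prod_pos' hν j
    have h5 := prod_pos' (by linarith : (1:ℝ) ≤ ν + 1) j
    have h6 : (j.factorial : ℝ) ≠ 0 := by positivity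
    have h7 : ∏ i ∈ Finset.range j, (ν + 1 + i) ≠ 0 := by positivity
    have h8 : ∏ i ∈ Finset.range j, (ν + (i:ℝ)) ≠ 0 := by positivity
    field_simp
    linear_combination h3
  have e2 := h2 (j + 1)
  have e3 := bc_succ (by linarith : (1:ℝ) ≤ ν + 1) j
  rw [show ν + 1 + 1 = ν + 2 by ring] at e3
  have h6 : ν ≠ 0 := by positivity
  have h7 : ν + 1 ≠ 0 := by positivity
  push_cast at e2
  have e4 : ν * (bc ν (j + 1) - bc (ν + 1) (j + 1)) = ν * (-1 / (4 * (ν * (ν + 1))) * bc (ν + 2) j) := by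
    have : ν * (bc ν (j + 1) - bc (ν + 1) (j + 1)) = bc (ν + 1) (j + 1) * (j + 1) := by linarith
    rw [this, e3]
    field_simp
  exact mul_left_cancel₀ h6 e4

lemma bF_summable {ν : ℝ} (hν : 1 ≤ ν) (s : ℝ) : Summable fun j => bc ν j * s ^ j := by
  refine Summable.of_norm_bounded (Real.summable_pow_div_factorial |s|) fun j => ?_
  rw [Real.norm_eq_abs, abs_mul, abs_pow]
  calc _ ≤ 1 / (j.factorial : ℝ) * |s| ^ j := mul_le_mul_of_nonneg_right (bc_abs hν j) (by positivity)
    _ = _ := by ring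

lemma bF_deriv {ν : ℝ} (hν : 1 ≤ ν) (s : ℝ) : HasDerivAt (bF ν) (-1 / (4 * ν) * bF (ν + 1) s) s := by
  set K := |s| + 1 with hK
  have hK0 : 0 ≤ K := by positivity
  set u : ℕ → ℝ := fun j => |bc ν j| * (j * K ^ (j - 1)) with hu
  have hus : Summable u := by
    rw [← summable_nat_add_iff 1]
    refine Summable.of_nonneg_of_le (fun j => by positivity) (fun j => ?_) (Real.summable_pow_div_factorial K)
    simp only [hu, Nat.add_sub_cancel]
    have h1 := bc_abs hν (j + 1)
    calc |bc ν (j + 1)| * ((j + 1 : ℕ) * K ^ j) ≤ 1 / ((j + 1).factorial : ℝ) * ((j + 1 : ℕ) * K ^ j) :=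
          mul_le_mul_of_nonneg_right h1 (by positivity)
      _ = K ^ j / j.factorial := by
          rw [Nat.factorial_succ]; push_cast
          have : (j:ℝ) + 1 ≠ 0 := by positivity
          field_simp
  have hmem : ∀ y ∈ Ioo (-K) K, |y| ≤ K := fun y hy => abs_le.2 ⟨hy.1.le, hy.2.le⟩
  have hsm : s ∈ Ioo (-K) K := by
    exact abs_lt.1 (by rw [hK]; linarith)
  have h := hasDerivAt_tsum_of_isPreconnected (g := fun j y => bc ν j * y ^ j)
    (g' := fun j y => bc ν j * (j * y ^ (j - 1))) hus isOpen_Ioo isPreconnected_Ioo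
    (fun j y _ => (hasDerivAt_pow j y).const_mul _) (fun j y hy => by
      rw [Real.norm_eq_abs, abs_mul, abs_mul, abs_pow, Nat.abs_cast]
      exact mul_le_mul_of_nonneg_left (mul_le_mul_of_nonneg_left (pow_le_pow_left₀ (abs_nonneg _) (hmem y hy) _) (by positivity)) (abs_nonneg _))
    hsm (bF_summable hν s) hsm
  refine h.congr_deriv ?_
  have hs2 : Summable fun j : ℕ => bc ν j * (j * s ^ (j - 1)) := by
    refine Summable.of_norm_bounded hus fun j => ?_
    rw [Real.norm_eq_abs, abs_mul, abs_mul, abs_pow, Nat.abs_cast]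
    exact mul_le_mul_of_nonneg_left (mul_le_mul_of_nonneg_left (pow_le_pow_left₀ (abs_nonneg _) (hmem s hsm) _) (by positivity)) (abs_nonneg _)
  rw [hs2.tsum_eq_zero_add, bF, ← tsum_mul_left]
  simp only [Nat.cast_zero, zero_mul, mul_zero, zero_add, Nat.add_sub_cancel]
  refine tsum_congr fun j => ?_
  rw [← mul_assoc, ← mul_assoc, ← bc_succ hν]; push_cast; ring

lemma bF_deriv' {ν : ℝ} (hν : 1 ≤ ν) : deriv (bF ν) = fun s => -1 / (4 * ν) * bF (ν + 1) s :=
  funext fun s => (bF_deriv hν s).deriv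

lemma bF_smooth {ν : ℝ} (hν : 1 ≤ ν) : ContDiff ℝ (⊤ : ℕ∞) (bF ν) := by
  rw [contDiff_infty]
  intro k
  induction k generalizing ν with
  | zero => exact contDiff_zero.2 (continuous_iff_continuousAt.2 fun s => (bF_deriv hν s).continuousAt)
  | succ k ih =>
    push_cast
    rw [contDiff_succ_iff_deriv]
    refine ⟨fun s => (bF_deriv hν s).differentiableAt, by simp, ?_⟩
    rw [bF_deriv' hν]
    exact contDiff_const.mul (ih (by linarith))

lemma bF_zero (ν : ℝ) : bF ν 0 = 1 := by
  rw [bF, tsum_eq_single 0 (fun j hj => by simp [hj])]; simp [bc]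

lemma bF_ode {ν : ℝ} (hν : 1 ≤ ν) (s : ℝ) :
    4 * s * deriv (deriv (bF ν)) s + 4 * ν * deriv (bF ν) s = - bF ν s := by
  have h1 : (1:ℝ) ≤ ν + 1 := by linarith
  have h2 : (1:ℝ) ≤ ν + 2 := by linarith
  have e2 : deriv (deriv (bF ν)) s = -1 / (4 * ν) * (-1 / (4 * (ν + 1)) * bF (ν + 2) s) := by
    rw [bF_deriv' hν]
    have := ((bF_deriv h1 s).const_mul (-1 / (4 * ν))).deriv
    rw [this, show ν + 1 + 1 = ν + 2 by ring]
  rw [e2, bF_deriv' hν]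
  have hrec : bF ν s - bF (ν + 1) s = -1 / (4 * (ν * (ν + 1))) * s * bF (ν + 2) s := by
    unfold bF
    rw [← (bF_summable hν s).tsum_sub (bF_summable h1 s), ((bF_summable hν s).sub (bF_summable h1 s)).tsum_eq_zero_add,
      ← tsum_mul_left]
    have : bc ν 0 * s ^ 0 - bc (ν + 1) 0 * s ^ 0 = 0 := by simp [bc]
    rw [this, zero_add]
    refine tsum_congr fun j => ?_
    rw [← sub_mul, bc_rec hν]; ring
  have h6 : ν ≠ 0 := by positivity
  have h7 : ν + 1 ≠ 0 := by positivity
  have : bF (ν + 1) s = bF ν s - -1 / (4 * (ν * (ν + 1))) * s * bF (ν + 2) s := by linarith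
  simp only [this]
  field_simp
  ring

/-- monotonicity of r F(r^2) gives positivity of F -/
lemma F_pos {F F' : ℝ → ℝ} (hF : ∀ s, HasDerivAt F (F' s) s) (h0 : 0 < F 0) {T : ℝ}
    (hH : ∀ s ∈ Icc 0 T, 0 ≤ F s + 2 * s * F' s) : ∀ s ∈ Icc 0 T, 0 < F s := by
  intro s hs
  rcases hs.1.eq_or_lt with h | hpos
  · rw [← h]; exact h0
  set r := √s with hr
  have hr0 : 0 < r := Real.sqrt_pos.2 hpos
  have hr2 : r ^ 2 = s := Real.sq_sqrt hs.1
  have hd : ∀ t : ℝ, HasDerivAt (fun t => t * F (t ^ 2)) (F (t ^ 2) + 2 * t ^ 2 * F' (t ^ 2)) t := by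
    intro t
    have h1 : HasDerivAt (fun t : ℝ => t ^ 2) (2 * t) t := by simpa using hasDerivAt_pow 2 t
    have h2 : HasDerivAt (fun t : ℝ => F (t ^ 2)) (F' (t ^ 2) * (2 * t)) t := (hF (t ^ 2)).comp t h1
    exact ((hasDerivAt_id t).mul h2).congr_deriv (by simp; ring)
  have hmono : MonotoneOn (fun t => t * F (t ^ 2)) (Icc 0 r) := by
    refine monotoneOn_of_deriv_nonneg (convex_Icc 0 r) (fun t _ => (hd t).continuousAt.continuousWithinAt)
      (fun t _ => (hd t).differentiableAt.differentiableWithinAt) (fun t ht => ?_)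
    rw [interior_Icc] at ht
    rw [(hd t).deriv]
    exact hH _ ⟨by positivity, (pow_le_pow_left₀ ht.1.le ht.2.le 2).trans (hr2.trans_le hs.2)⟩
  have hcont : Continuous fun t : ℝ => F (t ^ 2) := by
    have : Continuous F := continuous_iff_continuousAt.2 fun s => (hF s).continuousAt
    fun_prop
  have hev : ∀ᶠ t in 𝓝[>] (0:ℝ), 0 < F (t ^ 2) :=
    nhdsWithin_le_nhds (hcont.continuousAt.eventually (lt_mem_nhds (by simpa using h0)))
  obtain ⟨ε, hε, hε1⟩ := (hev.and (Ioo_mem_nhdsGT hr0)).exists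
  have h3 := hmono ⟨hε1.1.le, hε1.2.le⟩ ⟨hr0.le, le_rfl⟩ hε1.2.le
  simp only [hr2] at h3
  have h4 : 0 < ε * F (ε ^ 2) := mul_pos hε1.1 hε
  exact (mul_pos_iff_of_pos_left hr0).1 (h4.trans_le h3)

/-- the profile together with the first critical point -/
theorem exists_profile (n : ℕ) (hn : 1 ≤ n) : ∃ (F F' F'' : ℝ → ℝ) (P : ℝ), 0 < P ∧ ContDiff ℝ (⊤ : ℕ∞) F ∧
    (∀ s, HasDerivAt F (F' s) s) ∧ (∀ s, HasDerivAt F' (F'' s) s) ∧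
    (∀ s, 4 * s * F'' s + (2 * n + 4) * F' s = - F s) ∧
    (∀ s ∈ Icc 0 P, 0 < F s) ∧ (∀ s ∈ Ico 0 P, 0 < F s + 2 * s * F' s) ∧ F P + 2 * P * F' P = 0 := by
  set ν : ℝ := n / 2 + 1 with hν'
  have hn' : (1:ℝ) ≤ n := by exact_mod_cast hn
  have hν : 1 ≤ ν := by rw [hν']; linarith
  set F := bF ν with hF
  set F' := deriv F with hF'
  set F'' := deriv F' with hF''
  have hsm : ContDiff ℝ (⊤ : ℕ∞) F := bF_smooth hν
  have hd1 : ∀ s, HasDerivAt F (F' s) s := fun s => (hsm.differentiable (by simp) s).hasDerivAt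
  have hsm' : ContDiff ℝ (⊤ : ℕ∞) F' := by
    have := (contDiff_infty_iff_deriv (f := F)).1 hsm
    exact this.2
  have hd2 : ∀ s, HasDerivAt F' (F'' s) s := fun s => (hsm'.differentiable (by simp) s).hasDerivAt
  have hode : ∀ s, 4 * s * F'' s + (2 * n + 4) * F' s = - F s := fun s => by
    rw [← bF_ode hν s, hν']; ring
  have h0 : F 0 = 1 := bF_zero ν
  set H : ℝ → ℝ := fun s => F s + 2 * s * F' s with hH
  have hHc : Continuous H := by
    have := hsm.continuous; have := hsm'.continuous; fun_prop
  have hH0 : H 0 = 1 := by simp [hH, h0]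
  have hex : ∃ s, 0 ≤ s ∧ H s = 0 := by
    by_contra hcon
    push Not at hcon
    have hHpos : ∀ s, 0 ≤ s → 0 < H s := by
      intro s hs
      by_contra hle
      push Not at hle
      obtain ⟨t, ht, ht0⟩ := intermediate_value_Icc' hs hHc.continuousOn (show (0:ℝ) ∈ Icc (H s) (H 0) from ⟨hle, by rw [hH0]; norm_num⟩)
      exact hcon t ht.1 ht0
    have hFpos : ∀ s, 0 ≤ s → 0 < F s := fun s hs =>
      F_pos hd1 (by rw [h0]; norm_num) (T := s) (fun t ht => (hHpos t ht.1).le) s ⟨hs, le_rfl⟩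
    set y : ℝ → ℝ := fun s => -(s * F' s) / F s with hy
    have hylt : ∀ s, 0 ≤ s → y s < 1 / 2 := by
      intro s hs
      have h1 := hHpos s hs
      have h2 := hFpos s hs
      simp only [hy]
      rw [div_lt_iff₀ h2]
      simp only [hH] at h1; linarith
    have hyd : ∀ s, 0 < s → HasDerivAt y (-(n / 2) * y s / s + 1 / 4 + y s ^ 2 / s) s := by
      intro s hs
      have h2 := (hFpos s hs.le).ne'
      have h3 := (((hasDerivAt_id s).mul (hd2 s)).neg).div (hd1 s) h2
      refine h3.congr_deriv ?_
      have h4 : F'' s = (- F s - (2 * n + 4) * F' s) / (4 * s) := by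
        rw [eq_div_iff (by positivity)]; linarith [hode s]
      simp only [hy, Pi.neg_apply, Pi.mul_apply, id]
      rw [h4]
      field_simp
      ring
    have hslope : ∀ s : ℝ, 2 * (n:ℝ) ≤ s → (1:ℝ) / 8 ≤ -(n / 2) * y s / s + 1 / 4 + y s ^ 2 / s := by
      intro s hs
      have hs0 : 0 < s := by linarith
      have h1 := hylt s hs0.le
      have h2 : -(1 / 8) ≤ -(n / 2) * y s / s := by
        rw [le_div_iff₀ hs0]; nlinarith
      have h3 : 0 ≤ y s ^ 2 / s := by positivity
      linarith
    have hgrow : ∀ b, 2 * (n:ℝ) ≤ b → 1 / 8 * (b - 2 * n) ≤ y b - y (2 * n) := by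
      intro b hb
      refine (convex_Ici (2 * (n:ℝ))).mul_sub_le_image_sub_of_le_deriv (f := y)
        (fun t ht => (hyd t (lt_of_lt_of_le (by linarith) ht)).continuousAt.continuousWithinAt)
        (fun t ht => (hyd t (lt_of_lt_of_le (by linarith) (interior_subset ht))).differentiableAt.differentiableWithinAt)
        (fun t ht => ?_) (2 * n) (mem_Ici.2 le_rfl) b hb hb
      have ht' := interior_subset ht
      rw [(hyd t (lt_of_lt_of_le (by linarith) ht')).deriv]
      exact hslope t ht'
    have h5 := hylt (2 * n) (by positivity)
    have h6 := hgrow (2 * n + 8 * (1 / 2 - y (2 * n))) (by linarith)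
    have h7 := hylt (2 * n + 8 * (1 / 2 - y (2 * n))) (by linarith)
    linarith
  set S : Set ℝ := {s | 0 ≤ s ∧ H s = 0} with hS
  have hSc : IsClosed S := (isClosed_le continuous_const continuous_id).inter (isClosed_eq hHc continuous_const)
  have hSb : BddBelow S := ⟨0, fun s hs => hs.1⟩
  have hP := hSc.csInf_mem hex hSb
  set P := sInf S with hPdef
  have hP0 : 0 < P := by
    rcases hP.1.eq_or_lt with h | h
    · have := hP.2; rw [← h, hH0] at this; norm_num at this
    · exact h
  have hHpos : ∀ s ∈ Ico 0 P, 0 < H s := by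
    intro s hs
    by_contra hle
    push Not at hle
    obtain ⟨t, ht, ht0⟩ := intermediate_value_Icc' hs.1 hHc.continuousOn (show (0:ℝ) ∈ Icc (H s) (H 0) from ⟨hle, by rw [hH0]; norm_num⟩)
    have := csInf_le hSb (show t ∈ S from ⟨ht.1, ht0⟩)
    linarith [ht.2, hs.2]
  refine ⟨F, F', F'', P, hP0, hsm, hd1, hd2, hode, F_pos hd1 (by rw [h0]; norm_num) (fun s hs => ?_), hHpos, hP.2⟩
  rcases hs.2.eq_or_lt with h | h
  · rw [h]; exact hP.2.ge
  · exact (hHpos s ⟨hs.1, h⟩).le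

/-! ## P11b: Barta type inequality and the model functions on the ball -/

lemma pd_nsq (c : Eu n) (i : Fin n) (y : Eu n) : pd i (fun y => ‖y - c‖ ^ 2) y = 2 * (y i - c i) := by
  rw [← pd_normsq c i y]; congr 1; ext z; rw [norm_sub_rev]

lemma nsq_smooth (c : Eu n) : ContDiff ℝ (⊤ : ℕ∞) (fun y : Eu n => ‖y - c‖ ^ 2) :=
  (contDiff_id.sub contDiff_const).norm_sq ℝ

lemma nsq_diff (c y : Eu n) : DifferentiableAt ℝ (fun y : Eu n => ‖y - c‖ ^ 2) y :=
  (nsq_smooth c).differentiable (by simp) y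

lemma nsq_sum (c y : Eu n) : ‖y - c‖ ^ 2 = ∑ i, (y i - c i) ^ 2 := by
  rw [EuclideanSpace.norm_sq_eq]; simp

/-- linear function -/
def lin (e c : Eu n) (x : Eu n) : ℝ := ∑ i, e i * (x i - c i)

lemma lin_smooth (e c : Eu n) : ContDiff ℝ (⊤ : ℕ∞) (lin e c) :=
  ContDiff.sum fun i _ => contDiff_const.mul (((EuclideanSpace.proj i : Eu n →L[ℝ] ℝ).contDiff).sub contDiff_const)

lemma lin_diff (e c y : Eu n) : DifferentiableAt ℝ (lin e c) y := (lin_smooth e c).differentiable (by simp) y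

lemma pd_coord' (i j : Fin n) (c : ℝ) (y : Eu n) : pd i (fun y => y j - c) y = if i = j then 1 else 0 := by
  have h : HasFDerivAt (fun y : Eu n => y j - c) (EuclideanSpace.proj j : Eu n →L[ℝ] ℝ) y :=
    ((EuclideanSpace.proj j : Eu n →L[ℝ] ℝ).hasFDerivAt).sub_const c
  rw [pd, h.fderiv]; simp [bv, Pi.single_apply, eq_comm]

lemma coord_diff (j : Fin n) (c : ℝ) (y : Eu n) : DifferentiableAt ℝ (fun y : Eu n => y j - c) y :=
  (((EuclideanSpace.proj j : Eu n →L[ℝ] ℝ).hasFDerivAt).sub_const c).differentiableAt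

lemma pd_lin (e c : Eu n) (i : Fin n) (y : Eu n) : pd i (lin e c) y = e i := by
  unfold lin
  rw [pd_sum _ (fun j _ => (coord_diff j (c j) y).const_mul _)]
  simp only [pd_const_mul _ (coord_diff _ _ y), pd_coord']
  simp

lemma deriv_scale {F F' : ℝ → ℝ} (hF : ∀ s, HasDerivAt F (F' s) s) (l s : ℝ) :
    HasDerivAt (fun s => F (l * s)) (l * F' (l * s)) s := by
  have h1 : HasDerivAt (fun s : ℝ => l * s) l s := by simpa using (hasDerivAt_id s).const_mul l
  exact ((hF (l * s)).comp s h1).congr_deriv (by ring)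

/-- gradient of linear times radial -/
lemma pd_linrad {e c : Eu n} {q : ℝ → ℝ} {q' : ℝ} {y : Eu n} (hq : HasDerivAt q q' (‖y - c‖ ^ 2)) (i : Fin n) :
    pd i (fun y => lin e c y * q (‖y - c‖ ^ 2)) y =
      e i * q (‖y - c‖ ^ 2) + 2 * q' * lin e c y * (y i - c i) := by
  have hd : DifferentiableAt ℝ (fun y : Eu n => q (‖y - c‖ ^ 2)) y :=
    (hq.differentiableAt).comp y (nsq_diff c y)
  rw [pd_mul (lin_diff e c y) hd, pd_lin, pd_comp hq (nsq_diff c y), pd_nsq]; ring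

namespace SmoothDomain
variable {D : SmoothDomain n}

theorem barta {φ w : Eu n → ℝ} {l C : ℝ} (hl : 0 ≤ l) (hφ : ContDiff ℝ (⊤ : ℕ∞) φ) (hw : D.SC w)
    (hlap : ∀ x ∈ D.carrier, ∑ i, pd i (pd i φ) x = -l * φ x)
    (hbc : ∀ x ∈ frontier D.carrier, ∑ i, pd i φ x * pd i D.defining x = 0)
    (hwφ : ∀ x ∈ D.carrier, |w x| ≤ C * |φ x|) : l * D.ip w w ≤ D.dir w w := by
  have hA : Continuous fun x => ∑ i, pd i φ x ^ 2 :=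
    continuous_finset_sum _ fun i _ => (pd_contDiff hφ).continuous.pow 2
  obtain ⟨M, hM0, hM⟩ := bdd_on_compact hA D.isCompact_closure
  have hw2 : ∀ x ∈ D.carrier, w x ^ 2 ≤ C ^ 2 * φ x ^ 2 := by
    intro x hx
    have := pow_le_pow_left₀ (abs_nonneg _) (hwφ x hx) 2
    rwa [mul_pow, sq_abs, sq_abs] at this
  set E : ℝ → Eu n → ℝ := fun δ x => w x ^ 2 * δ / (φ x ^ 2 + δ) ^ 2 with hE
  have hEc : ∀ δ > 0, ContinuousOn (E δ) (closure D.carrier) := fun δ hδ =>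
    ((hw.continuousOn.pow 2).mul continuousOn_const).div (((hφ.continuous.continuousOn.pow 2).add continuousOn_const).pow 2)
      (fun x _ => by positivity)
  have key : ∀ δ > 0, 0 ≤ D.dir w w + M * (∫ x in D.carrier, E δ x) - l * D.ip w w + l * C ^ 2 * δ * volume.real D.carrier := by
    intro δ hδ
    set h : ℝ → ℝ := fun t => t / (t ^ 2 + δ) with hh
    have hhd : ∀ t, HasDerivAt h ((δ - t ^ 2) / (t ^ 2 + δ) ^ 2) t := by
      intro t
      have h1 : HasDerivAt (fun t : ℝ => t ^ 2 + δ) (2 * t) t := by simpa using (hasDerivAt_pow 2 t).add_const δ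
      have := (hasDerivAt_id t).div h1 (by positivity : t ^ 2 + δ ≠ 0)
      exact this.congr_deriv (by simp; ring)
    have hhs : ContDiff ℝ (⊤ : ℕ∞) h := contDiff_id.div ((contDiff_id.pow 2).add contDiff_const) (fun t => by
      show t ^ 2 + δ ≠ 0; positivity)
    have hgS : D.SC (fun x => w x * w x * h (φ x)) := (hw.mul hw).mul (hhs.comp hφ).contDiffOn
    have h1 := div_SC (V := fun i x => (w x * w x * h (φ x)) * pd i φ x) (fun i => hgS.mul (pd_contDiff hφ).contDiffOn)
      (fun x hx => by
        have := hbc x hx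
        calc _ = (w x * w x * h (φ x)) * ∑ i, pd i φ x * pd i D.defining x := by
              rw [Finset.mul_sum]; exact Finset.sum_congr rfl fun i _ => by ring
          _ = 0 := by rw [this, mul_zero])
    have hpt : ∀ x ∈ D.carrier, ∑ i, pd i (fun x => (w x * w x * h (φ x)) * pd i φ x) x ≤
        (∑ i, pd i w x * pd i w x) + M * E δ x - l * (w x * w x) + l * C ^ 2 * δ := by
      intro x hx
      have dw := hw.smooth.diffAt D.isOpen (by simp) hx
      have dφ : DifferentiableAt ℝ φ x := hφ.differentiable (by simp) x
      have dh : DifferentiableAt ℝ (fun x => h (φ x)) x := (hhd (φ x)).differentiableAt.comp x dφ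
      have e1 : ∀ i, pd i (fun x => (w x * w x * h (φ x)) * pd i φ x) x =
          (w x * w x * h (φ x)) * pd i (pd i φ) x +
          ((w x * w x) * ((δ - φ x ^ 2) / (φ x ^ 2 + δ) ^ 2) * pd i φ x ^ 2 + 2 * (w x * h (φ x)) * (pd i w x * pd i φ x)) := by
        intro i
        rw [pd_mul (hgS.smooth.diffAt D.isOpen (by simp) hx) ((pd_contDiff hφ).differentiable (by simp) x),
          pd_mul (dw.fun_mul dw) dh, pd_mul dw dw, pd_comp (hhd (φ x)) dφ]
        ring
      have e2 : ∀ i, (w x * w x) * ((δ - φ x ^ 2) / (φ x ^ 2 + δ) ^ 2) * pd i φ x ^ 2 + 2 * (w x * h (φ x)) * (pd i w x * pd i φ x)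
          ≤ pd i w x * pd i w x + E δ x * pd i φ x ^ 2 := by
        intro i
        have e3 : E δ x = w x * w x * (h (φ x) ^ 2 + (δ - φ x ^ 2) / (φ x ^ 2 + δ) ^ 2) := by
          simp only [hE, hh]
          have : φ x ^ 2 + δ ≠ 0 := by positivity
          field_simp
          ring
        rw [e3]
        nlinarith [sq_nonneg (pd i w x - w x * h (φ x) * pd i φ x)]
      rw [Finset.sum_congr rfl fun i _ => e1 i, Finset.sum_add_distrib, ← Finset.mul_sum, hlap x hx]
      have e4 := Finset.sum_le_sum fun i (_ : i ∈ Finset.univ) => e2 i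
      rw [Finset.sum_add_distrib (f := fun i => pd i w x * pd i w x), ← Finset.mul_sum] at e4
      have e5 : E δ x * ∑ i, pd i φ x ^ 2 ≤ M * E δ x := by
        rw [mul_comm]
        exact mul_le_mul_of_nonneg_right ((le_abs_self _).trans (hM x (subset_closure hx))) (by positivity)
      have e6 : w x * w x * h (φ x) * (-l * φ x) ≤ - l * (w x * w x) + l * C ^ 2 * δ := by
        have e7 : w x * w x * h (φ x) * (-l * φ x) = - l * (w x * w x) + l * (w x ^ 2 * δ / (φ x ^ 2 + δ)) := by
          simp only [hh]
          have : φ x ^ 2 + δ ≠ 0 := by positivity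
          field_simp
          ring
        have e8 : w x ^ 2 * δ / (φ x ^ 2 + δ) ≤ C ^ 2 * δ := by
          rw [div_le_iff₀ (by positivity)]
          have := mul_le_mul_of_nonneg_right (hw2 x hx) hδ.le
          nlinarith [mul_nonneg (sq_nonneg C) (sq_nonneg δ)]
        have := mul_le_mul_of_nonneg_left e8 hl
        rw [e7]; linarith
      linarith
    have i1 : IntegrableOn (fun x => ∑ i, pd i w x * pd i w x) D.carrier := int_dir hw.adm hw.adm
    have i2 : IntegrableOn (fun x => M * E δ x) D.carrier := (l2_int (SC.l2 (hEc δ hδ))).const_mul M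
    have i3 : IntegrableOn (fun x => l * (w x * w x)) D.carrier := (int_ip hw.adm hw.adm).const_mul l
    have i12 : IntegrableOn (fun x => (∑ i, pd i w x * pd i w x) + M * E δ x) D.carrier := i1.add i2
    have i123 : IntegrableOn (fun x => (∑ i, pd i w x * pd i w x) + M * E δ x - l * (w x * w x)) D.carrier := i12.sub i3
    have iV : IntegrableOn (fun x => ∑ i, pd i (fun x => (w x * w x * h (φ x)) * pd i φ x) x) D.carrier := by
      have hprod : ∀ i, D.SC (fun x => (w x * w x * h (φ x)) * pd i φ x) := fun i => hgS.mul (pd_contDiff hφ).contDiffOn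
      exact integrable_finset_sum _ fun i _ => l2_int ((hprod i).adm.gl2 i)
    have h2 := setIntegral_mono_on iV (i123.add (integrable_const (l * C ^ 2 * δ))) D.measSet hpt
    rw [h1] at h2
    have h3 : ∫ x in D.carrier, ((∑ i, pd i w x * pd i w x) + M * E δ x - l * (w x * w x) + l * C ^ 2 * δ) =
        D.dir w w + M * (∫ x in D.carrier, E δ x) - l * D.ip w w + l * C ^ 2 * δ * volume.real D.carrier := by
      rw [integral_add i123 (integrable_const _), integral_sub i12 i3, integral_add i1 i2, integral_const_mul, integral_const_mul,
        setIntegral_const, smul_eq_mul]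
      unfold dir ip; ring
    exact h2.trans_eq h3
  have hδ : Tendsto (fun k : ℕ => 1 / ((k:ℝ) + 1)) atTop (𝓝 0) := tendsto_one_div_add_atTop_nhds_zero_nat
  have hδp : ∀ k : ℕ, 0 < 1 / ((k:ℝ) + 1) := fun k => by positivity
  have hElim : Tendsto (fun k : ℕ => ∫ x in D.carrier, E (1 / ((k:ℝ) + 1)) x) atTop (𝓝 (∫ x in D.carrier, (0:ℝ))) := by
    refine tendsto_integral_of_dominated_convergence (fun _ => C ^ 2) (fun k => D.aesm_of_continuousOn ((hEc _ (hδp k)).mono subset_closure))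
      (integrable_const _) (fun k => ?_) ?_
    · filter_upwards [ae_restrict_mem D.measSet] with x hx
      have hd := hδp k
      set δ := 1 / ((k:ℝ) + 1)
      have : 0 ≤ E δ x := by simp only [hE]; positivity
      rw [Real.norm_eq_abs, abs_of_nonneg this]
      simp only [hE]
      rw [div_le_iff₀ (by positivity)]
      have := mul_le_mul_of_nonneg_right (hw2 x hx) hd.le
      have h4 : φ x ^ 2 * δ ≤ (φ x ^ 2 + δ) ^ 2 := by nlinarith [sq_nonneg (φ x ^ 2), mul_nonneg (sq_nonneg (φ x)) hd.le, sq_nonneg δ]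
      calc _ ≤ C ^ 2 * (φ x ^ 2 * δ) := by linarith
        _ ≤ _ := mul_le_mul_of_nonneg_left h4 (sq_nonneg C)
    · filter_upwards [ae_restrict_mem D.measSet] with x hx
      by_cases h0 : φ x = 0
      · have : w x = 0 := by have := hwφ x hx; rw [h0] at this; simpa using this
        simp [hE, this]
      · have hc : ContinuousAt (fun δ : ℝ => w x ^ 2 * δ / (φ x ^ 2 + δ) ^ 2) 0 := by
          refine ContinuousAt.div (by fun_prop) (by fun_prop) ?_
          have : φ x ^ 2 ≠ 0 := by positivity
          simpa using this
        have := hc.tendsto.comp hδ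
        simpa [hE, Function.comp_def] using this
  rw [integral_zero] at hElim
  have hlim : Tendsto (fun k : ℕ => D.dir w w + M * (∫ x in D.carrier, E (1 / ((k:ℝ) + 1)) x) - l * D.ip w w + l * C ^ 2 * (1 / ((k:ℝ) + 1)) * volume.real D.carrier)
      atTop (𝓝 (D.dir w w + M * 0 - l * D.ip w w + l * C ^ 2 * 0 * volume.real D.carrier)) :=
    (((hElim.const_mul M).const_add _).sub_const _).add ((hδ.const_mul _).mul_const _)
  have := ge_of_tendsto' hlim fun k => key _ (hδp k)
  linarith

/-- the standard ball as a smooth domain -/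
def stdBall (c : Eu n) {R : ℝ} (hR : 0 < R) : SmoothDomain n where
  carrier := Metric.ball c R
  defining := fun x => ‖x - c‖ ^ 2 - R ^ 2
  isOpen := Metric.isOpen_ball
  isBounded := Metric.isBounded_ball
  smooth_defining := (nsq_smooth c).sub contDiff_const
  carrier_eq := by
    ext x
    rw [Metric.mem_ball, dist_eq_norm, mem_setOf_eq, sub_neg, sq_lt_sq₀ (norm_nonneg _) hR.le]
  frontier_eq := by
    rw [frontier_ball c hR.ne']
    ext x
    rw [mem_sphere_iff_norm, mem_setOf_eq, sub_eq_zero, sq_eq_sq₀ (norm_nonneg _) hR.le]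
  grad_ne_zero := by
    intro x hx h0
    rw [frontier_ball c hR.ne', mem_sphere_iff_norm] at hx
    have h1 : x - c = 0 := by
      ext i
      have h2 := gradient_apply (fun x => ‖x - c‖ ^ 2 - R ^ 2) x i
      rw [h0, pd_sub (nsq_diff c x) (differentiableAt_const _), pd_nsq, pd_const] at h2
      have h3 : (0:ℝ) = 2 * (x i - c i) - 0 := h2
      show x i - c i = 0
      linarith
    rw [h1, norm_zero] at hx
    exact hR.ne hx

lemma pd_stdBall {c : Eu n} {R : ℝ} (hR : 0 < R) (i : Fin n) (x : Eu n) : pd i (stdBall c hR).defining x = 2 * (x i - c i) := by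
  show pd i (fun x => ‖x - c‖ ^ 2 - R ^ 2) x = _
  rw [pd_sub (nsq_diff c x) (differentiableAt_const _), pd_nsq, pd_const, sub_zero]

/-- the model function satisfies the Helmholtz equation -/
lemma model_lap {F F' F'' : ℝ → ℝ} (hF : ∀ s, HasDerivAt F (F' s) s) (hF' : ∀ s, HasDerivAt F' (F'' s) s)
    (hode : ∀ s, 4 * s * F'' s + (2 * n + 4) * F' s = - F s) (e c : Eu n) (l : ℝ) (x : Eu n) :
    ∑ i, pd i (pd i (fun y => lin e c y * F (l * ‖y - c‖ ^ 2))) x = -l * (lin e c x * F (l * ‖x - c‖ ^ 2)) := by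
  have hq := deriv_scale hF l
  have hq' := deriv_scale hF' l
  have e1 : ∀ i, pd i (fun y => lin e c y * F (l * ‖y - c‖ ^ 2)) = fun y =>
      e i * F (l * ‖y - c‖ ^ 2) + 2 * l * (lin e c y * F' (l * ‖y - c‖ ^ 2) * (y i - c i)) := by
    intro i; funext y
    rw [pd_linrad (q := fun s => F (l * s)) (hq (‖y - c‖ ^ 2)) i]; ring
  have d1 : DifferentiableAt ℝ (fun y : Eu n => F (l * ‖y - c‖ ^ 2)) x :=
    (hq _).differentiableAt.comp x (nsq_diff c x)
  have d2 : DifferentiableAt ℝ (fun y : Eu n => F' (l * ‖y - c‖ ^ 2)) x :=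
    (hq' _).differentiableAt.comp x (nsq_diff c x)
  have d3 := (lin_diff e c x).fun_mul d2
  have e2 : ∀ i, pd i (pd i (fun y => lin e c y * F (l * ‖y - c‖ ^ 2))) x =
      4 * l * F' (l * ‖x - c‖ ^ 2) * (e i * (x i - c i)) + 4 * l ^ 2 * lin e c x * F'' (l * ‖x - c‖ ^ 2) * (x i - c i) ^ 2
        + 2 * l * lin e c x * F' (l * ‖x - c‖ ^ 2) := by
    intro i
    rw [e1 i, pd_add (d1.const_mul _) ((d3.fun_mul (coord_diff i (c i) x)).const_mul _), pd_const_mul _ d1,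
      pd_const_mul _ (d3.fun_mul (coord_diff i (c i) x)), pd_mul d3 (coord_diff i (c i) x), pd_coord,
      pd_linrad (q := fun s => F' (l * s)) (hq' (‖x - c‖ ^ 2)) i,
      show pd i (fun y => F (l * ‖y - c‖ ^ 2)) x = _ from pd_comp (h := fun s => F (l * s)) (f := fun y : Eu n => ‖y - c‖ ^ 2) (x := x) (hq (‖x - c‖ ^ 2)) (nsq_diff c x), pd_nsq]
    ring
  rw [Finset.sum_congr rfl fun i _ => e2 i, Finset.sum_add_distrib, Finset.sum_add_distrib, ← Finset.mul_sum, ← Finset.mul_sum,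
    ← nsq_sum]
  simp only [Finset.sum_const, Finset.card_univ, Fintype.card_fin, nsmul_eq_mul]
  have e3 : ∑ i, e i * (x i - c i) = lin e c x := rfl
  rw [e3]
  linear_combination (l * lin e c x) * hode (l * ‖x - c‖ ^ 2)

end SmoothDomain

/-! ## P11c: lower bound for the first Neumann eigenvalue of the ball -/

namespace SmoothDomain

lemma lam_congr {D D' : SmoothDomain n} (h : D.carrier = D'.carrier) : D.lam = D'.lam := by
  have h1 : ∀ {D D' : SmoothDomain n}, D.carrier = D'.carrier → ∀ v, D.Adm v → D'.Adm v := fun h v hv =>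
    ⟨h ▸ hv.c1, by have := hv.l2; unfold L2 at *; rwa [← h], fun i => by have := hv.gl2 i; unfold L2 at *; rwa [← h]⟩
  have h2 : ∀ v, D.Adm v ↔ D'.Adm v := fun v => ⟨h1 h v, h1 h.symm v⟩
  unfold lam ray ip dir
  simp only [h2, h]

/-- the profile data -/
structure Profile (n : ℕ) (F F' F'' : ℝ → ℝ) (P : ℝ) : Prop where
  pos : 0 < P
  smooth : ContDiff ℝ (⊤ : ℕ∞) F
  d1 : ∀ s, HasDerivAt F (F' s) s
  d2 : ∀ s, HasDerivAt F' (F'' s) s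
  ode : ∀ s, 4 * s * F'' s + (2 * n + 4) * F' s = - F s
  Fpos : ∀ s ∈ Icc 0 P, 0 < F s
  Hpos : ∀ s ∈ Ico 0 P, 0 < F s + 2 * s * F' s
  HP : F P + 2 * P * F' P = 0

variable {c : Eu n} {R : ℝ} (hR : 0 < R) {F F' F'' : ℝ → ℝ} {P : ℝ}

lemma model_bc (hp : Profile n F F' F'' P) (e : Eu n) : ∀ x ∈ frontier (stdBall c hR).carrier,
    ∑ i, pd i (fun y => lin e c y * F (P / R ^ 2 * ‖y - c‖ ^ 2)) x * pd i (stdBall c hR).defining x = 0 := by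
  intro x hx
  have hx : ‖x - c‖ = R := by
    rw [show (stdBall c hR).carrier = Metric.ball c R from rfl, frontier_ball c hR.ne'] at hx
    exact mem_sphere_iff_norm.1 hx
  have hq := deriv_scale hp.d1 (P / R ^ 2) (‖x - c‖ ^ 2)
  have e1 : ∀ i, pd i (fun y => lin e c y * F (P / R ^ 2 * ‖y - c‖ ^ 2)) x * pd i (stdBall c hR).defining x =
      2 * F P * (e i * (x i - c i)) + 4 * (P / R ^ 2 * F' P) * lin e c x * (x i - c i) ^ 2 := fun i => by
    rw [pd_stdBall, pd_linrad (q := fun s => F (P / R ^ 2 * s)) hq i, hx, show P / R ^ 2 * R ^ 2 = P by field_simp]; ring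
  rw [Finset.sum_congr rfl fun i _ => e1 i, Finset.sum_add_distrib, ← Finset.mul_sum, ← Finset.mul_sum, ← nsq_sum, hx,
    show ∑ i, e i * (x i - c i) = lin e c x from rfl]
  have : 4 * (P / R ^ 2 * F' P) * lin e c x * R ^ 2 = 4 * (P * F' P) * lin e c x := by field_simp
  rw [this]; linear_combination 2 * lin e c x * hp.HP

lemma ball_barta (hp : Profile n F F' F'' P) {w : Eu n → ℝ} (e : Eu n) {K : ℝ} (hw : (stdBall c hR).SC w)
    (hK : ∀ x ∈ Metric.ball c R, |w x| ≤ K * |lin e c x|)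
    (hd : (stdBall c hR).dir w w = (stdBall c hR).lam * (stdBall c hR).ip w w) (h0 : 0 < (stdBall c hR).ip w w) :
    P / R ^ 2 ≤ (stdBall c hR).lam := by
  have hl : 0 < P / R ^ 2 := div_pos hp.pos (by positivity)
  obtain ⟨s0, hs0, hmin⟩ := isCompact_Icc.exists_isMinOn (nonempty_Icc.2 hp.pos.le) hp.smooth.continuous.continuousOn
  have hm0 := hp.Fpos s0 hs0
  have hK0 : ∀ x ∈ Metric.ball c R, |lin e c x| ≤ (F s0)⁻¹ * |lin e c x * F (P / R ^ 2 * ‖x - c‖ ^ 2)| := by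
    intro x hx
    have h1 : F s0 ≤ F (P / R ^ 2 * ‖x - c‖ ^ 2) := hmin (by
      rw [mem_ball_iff_norm] at hx
      refine ⟨by positivity, ?_⟩
      have : ‖x - c‖ ^ 2 ≤ R ^ 2 := pow_le_pow_left₀ (norm_nonneg _) hx.le 2
      calc _ ≤ P / R ^ 2 * R ^ 2 := mul_le_mul_of_nonneg_left this hl.le
        _ = P := by field_simp)
    rw [abs_mul, abs_of_pos (hm0.trans_le h1), inv_mul_eq_div, le_div_iff₀ hm0]
    exact mul_le_mul_of_nonneg_left h1 (abs_nonneg _)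
  have key := barta (D := stdBall c hR) (φ := fun y => lin e c y * F (P / R ^ 2 * ‖y - c‖ ^ 2)) (w := w) (C := |K| * (F s0)⁻¹) hl.le
    ((lin_smooth e c).mul (hp.smooth.comp (contDiff_const.mul (nsq_smooth c)))) hw
    (fun x _ => model_lap hp.d1 hp.d2 hp.ode e c _ x) (model_bc hR hp e) ?_
  · rw [hd] at key
    exact le_of_mul_le_mul_right key h0
  · intro x hx
    calc _ ≤ K * |lin e c x| := hK x hx
      _ ≤ |K| * |lin e c x| := mul_le_mul_of_nonneg_right (le_abs_self K) (abs_nonneg _)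
      _ ≤ |K| * ((F s0)⁻¹ * |lin e c x * F (P / R ^ 2 * ‖x - c‖ ^ 2)|) := mul_le_mul_of_nonneg_left (hK0 x hx) (abs_nonneg _)
      _ = _ := by ring

/-- linear reflection in the hyperplane orthogonal to `e` -/
def Lr (e : Eu n) : Eu n ≃ₗᵢ[ℝ] Eu n := (ℝ ∙ e)ᗮ.reflection

lemma Lr_apply (e v : Eu n) : Lr e v = v - (2 * (∑ i, e i * v i) / ‖e‖ ^ 2) • e := by
  rw [Lr, Submodule.reflection_orthogonal_apply, Submodule.reflection_singleton_apply, ← Nat.cast_smul_eq_nsmul ℝ, smul_smul]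
  have : inner ℝ e v = ∑ i, e i * v i := by simp [PiLp.inner_apply, mul_comm]
  rw [this]; simp [mul_div_assoc]

def sg (e c x : Eu n) : Eu n := c + Lr e (x - c)

lemma sg_sub (e c x : Eu n) : x - sg e c x = (2 * lin e c x / ‖e‖ ^ 2) • e := by
  rw [sg, Lr_apply]; simp only [lin, PiLp.sub_apply]; abel

lemma sg_fderiv (e c x : Eu n) : HasFDerivAt (sg e c) ((Lr e : Eu n ≃L[ℝ] Eu n) : Eu n →L[ℝ] Eu n) x := by
  have h1 : HasFDerivAt (fun x => x - c) (ContinuousLinearMap.id ℝ (Eu n)) x := (hasFDerivAt_id x).sub_const c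
  have h2 := ((Lr e : Eu n ≃L[ℝ] Eu n).hasFDerivAt (x := x - c)).comp x h1
  exact h2.const_add c

lemma sg_smooth (e c : Eu n) : ContDiff ℝ (⊤ : ℕ∞) (sg e c) :=
  contDiff_const.add ((Lr e : Eu n ≃L[ℝ] Eu n).contDiff.comp (contDiff_id.sub contDiff_const))

lemma sg_norm (e c x : Eu n) : ‖sg e c x - c‖ = ‖x - c‖ := by
  rw [sg, add_sub_cancel_left, LinearIsometryEquiv.norm_map]

lemma sg_mp (e c : Eu n) : MeasurePreserving (sg e c) :=
  (measurePreserving_add_left volume c).comp ((Lr e).measurePreserving.comp (measurePreserving_sub_right volume c))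

lemma sg_emb (e c : Eu n) : MeasurableEmbedding (sg e c) :=
  (MeasurableEquiv.addLeft c).measurableEmbedding.comp
    ((Lr e).toHomeomorph.measurableEmbedding.comp (MeasurableEquiv.subRight c).measurableEmbedding)

lemma sg_int (e c : Eu n) (g : Eu n → ℝ) : ∫ x in Metric.ball c R, g (sg e c x) = ∫ x in Metric.ball c R, g x := by
  rw [← (sg_mp e c).setIntegral_preimage_emb (sg_emb e c) g]
  congr 2
  ext x; simp only [mem_preimage, mem_ball_iff_norm, sg_norm]

lemma fderiv_sg {u : Eu n → ℝ} {e c x : Eu n} (hu : DifferentiableAt ℝ u (sg e c x)) :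
    fderiv ℝ (fun y => u (sg e c y)) x = (fderiv ℝ u (sg e c x)).comp ((Lr e : Eu n ≃L[ℝ] Eu n) : Eu n →L[ℝ] Eu n) :=
  (hu.hasFDerivAt.comp x (sg_fderiv e c x)).fderiv

lemma sg_lip {g : Eu n → ℝ} (hg : (stdBall c hR).SC g) (e : Eu n) :
    ∃ K, ∀ x ∈ Metric.ball c R, |g x - g (sg e c x)| ≤ K * |lin e c x| := by
  obtain ⟨M, hM0, hM⟩ := fderiv_bdd hg
  refine ⟨M * (2 / ‖e‖ ^ 2 * ‖e‖), fun x hx => ?_⟩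
  have hx' : sg e c x ∈ Metric.ball c R := by rw [mem_ball_iff_norm, sg_norm]; exact mem_ball_iff_norm.1 hx
  have h1 := (convex_ball c R).norm_image_sub_le_of_norm_fderiv_le (f := g) (𝕜 := ℝ)
    (fun y hy => hg.smooth.diffAt (stdBall c hR).isOpen (by simp) hy) hM hx' hx
  rw [Real.norm_eq_abs, sg_sub, norm_smul, Real.norm_eq_abs, abs_div, abs_mul, abs_two, abs_of_nonneg (sq_nonneg ‖e‖)] at h1
  calc _ ≤ _ := h1
    _ = _ := by ring

theorem lam_ball (hp : Profile n F F' F'' P) (hn : 1 ≤ n) : P / R ^ 2 ≤ (stdBall c hR).lam := by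
  set D := stdBall c hR with hD
  have hcar : D.carrier = Metric.ball c R := rfl
  have hconn : IsConnected D.carrier := (convex_ball c R).isConnected ⟨c, Metric.mem_ball_self hR⟩
  have hcl : closure D.carrier = Metric.closedBall c R := closure_ball c hR.ne'
  obtain ⟨u, hu, hu1, hu0, hweak⟩ := exists_eigen_SC (D := D) hn hconn.nonempty
  have hlam := lam_pos (D := D) hn hconn
  have hdu : ∀ x ∈ D.carrier, DifferentiableAt ℝ u x := fun x hx => hu.smooth.diffAt D.isOpen (by simp) hx
  have hsg : ∀ e, ∀ x ∈ D.carrier, sg e c x ∈ D.carrier := fun e x hx => by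
    rw [hcar, mem_ball_iff_norm, sg_norm]; exact mem_ball_iff_norm.1 hx
  have hsgc : ∀ e, MapsTo (sg e c) (closure D.carrier) (closure D.carrier) := fun e x hx => by
    rw [hcl, mem_closedBall_iff_norm] at *; rwa [sg_norm]
  by_cases hsym : ∀ e, ∀ x ∈ closure D.carrier, u x - u (sg e c x) = 0
  · have h1 : ∀ e, ∀ x ∈ D.carrier, fderiv ℝ u x = (fderiv ℝ u (sg e c x)).comp ((Lr e : Eu n ≃L[ℝ] Eu n) : Eu n →L[ℝ] Eu n) := by
      intro e x hx
      rw [← fderiv_sg (hdu _ (hsg e x hx))]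
      refine Filter.EventuallyEq.fderiv_eq ?_
      filter_upwards [D.isOpen.mem_nhds hx] with y hy
      exact sub_eq_zero.1 (hsym e y (subset_closure hy))
    have hLe : ∀ e : Eu n, Lr e e = -e := fun e => by
      rw [Lr]; exact Submodule.reflection_orthogonalComplement_singleton_eq_neg e
    have h2 : ∀ e, ∀ x ∈ D.carrier, lin e c x = 0 → fderiv ℝ u x e = 0 := by
      intro e x hx hl
      have h3 : sg e c x = x := by
        have := sg_sub e c x
        rw [hl] at this
        simp at this
        exact (sub_eq_zero.1 this).symm
      have h4 := congrArg (fun A => A e) (h1 e x hx)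
      simp only [h3, ContinuousLinearMap.comp_apply] at h4
      have h5 : ((Lr e : Eu n ≃L[ℝ] Eu n) : Eu n →L[ℝ] Eu n) e = -e := hLe e
      rw [h5, map_neg] at h4
      linarith
    have hrho : ∀ i x, pd i D.defining x = 2 * (x i - c i) := pd_stdBall hR
    have h6 : ∀ i, ∀ x ∈ closure D.carrier, ‖x - c‖ ^ 2 * D.pdw i u x = (x i - c i) * (2⁻¹ * D.cn u x) := by
      intro i
      have hci : ContDiff ℝ (⊤ : ℕ∞) (fun x : Eu n => x i - c i) :=
        (EuclideanSpace.proj i : Eu n →L[ℝ] ℝ).contDiff.sub contDiff_const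
      have hA : D.SC (fun x => ‖x - c‖ ^ 2 * D.pdw i u x) := (nsq_smooth c).contDiffOn.mul (hu.pdw i)
      have hB : D.SC (fun x => (x i - c i) * (2⁻¹ * D.cn u x)) := hci.contDiffOn.mul (contDiffOn_const.mul hu.cn)
      refine SC.ext_zero hA hB fun x hx => ?_
      simp only [cn, hrho, pdw_eq _ hx]
      have h7 := h2 (‖x - c‖ ^ 2 • bv i - (x i - c i) • (x - c)) x hx (by
        have : ∀ j, (‖x - c‖ ^ 2 • bv i - (x i - c i) • (x - c)) j * (x j - c j) =
            ‖x - c‖ ^ 2 * ((if j = i then 1 else 0) * (x j - c j)) - (x i - c i) * (x j - c j) ^ 2 := fun j => by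
          simp [bv, Pi.single_apply]; split_ifs <;> ring
        rw [lin, Finset.sum_congr rfl fun j _ => this j, Finset.sum_sub_distrib, ← Finset.mul_sum, ← Finset.mul_sum, ← nsq_sum]
        simp; ring)
      rw [map_sub, map_smul, map_smul, fderiv_eq_sum u x (x - c)] at h7
      simp only [smul_eq_mul] at h7
      have h8 : fderiv ℝ u x (bv i) = pd i u x := rfl
      rw [h8] at h7
      have h9 : ∑ j, pd j u x * (2 * (x j - c j)) = 2 * ∑ j, (x - c) j * pd j u x := by
        rw [Finset.mul_sum]; exact Finset.sum_congr rfl fun j _ => by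
          show _ = 2 * ((x j - c j) * pd j u x); ring
      rw [h9]; linarith
    have h10 : ∀ i, ∀ x ∈ frontier D.carrier, D.pdw i u x = 0 := by
      intro i x hx
      have h11 := h6 i x (frontier_subset_closure hx)
      rw [neumann_bc hu hweak x hx, mul_zero, mul_zero] at h11
      rw [hcar, frontier_ball c hR.ne', mem_sphere_iff_norm] at hx
      rw [hx] at h11
      exact (mul_eq_zero.1 h11).resolve_left (by positivity)
    have h12 : ∀ i, D.dir (D.pdw i u) (D.pdw i u) = D.lam * D.ip (D.pdw i u) (D.pdw i u) := by
      intro i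
      have hg := green (hu.pdw i) (hu.pdw i) (fun x hx => by rw [h10 i x hx, zero_mul])
      have : D.ip (D.pdw i u) (lapWithin (closure D.carrier) (D.pdw i u)) = D.ip (D.pdw i u) (fun x => (-D.lam) * D.pdw i u x) := by
        refine ip_congr (fun x _ => rfl) fun x hx => ?_
        have e1 : ∀ j, EqOn (pd j (D.pdw i u)) (pd i (D.pdw j u)) D.carrier := by
          intro j y hy
          rw [pd_congr_on D.isOpen (fun z hz => pdw_eq i hz) hy, pd_congr_on D.isOpen (fun z hz => pdw_eq j hz) hy]
          exact pd_comm D.isOpen (hu.smooth.of_le (WithTop.coe_le_coe.2 (le_top : ((2:ℕ):ℕ∞) ≤ ⊤))) hy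
        have e2 : ∀ j, pd j (pd j (D.pdw i u)) x = pd i (D.pdw j (D.pdw j u)) x := by
          intro j
          have hj : ContDiffOn ℝ 2 (D.pdw j u) D.carrier := (hu.pdw j).smooth.of_le (WithTop.coe_le_coe.2 (le_top : ((2:ℕ):ℕ∞) ≤ ⊤))
          rw [pd_congr_on D.isOpen (e1 j) hx, pd_comm D.isOpen hj hx, pd_congr_on D.isOpen (fun z hz => pdw_eq j hz) hx]
        rw [lapWithin_eq hx, Finset.sum_congr rfl fun j _ => e2 j,
          ← pd_sum _ (fun j _ => ((hu.pdw j).pdw j).smooth.diffAt D.isOpen (by simp) hx)]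
        have e3 : EqOn (fun x => ∑ j, D.pdw j (D.pdw j u) x) (fun x => -D.lam * u x) D.carrier := fun y hy =>
          weak_lap hu hweak y (subset_closure hy)
        rw [pd_congr_on D.isOpen e3 hx, pd_const_mul _ (hdu x hx), pdw_eq i hx]
      rw [this] at hg
      have e4 : D.ip (D.pdw i u) (fun x => (-D.lam) * D.pdw i u x) = -D.lam * D.ip (D.pdw i u) (D.pdw i u) := by
        unfold ip
        rw [← integral_const_mul]
        exact integral_congr_ae (Eventually.of_forall fun x => by simp only []; ring)
      linarith
    by_cases hall : ∀ i, ∀ x ∈ closure D.carrier, D.pdw i u x = 0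
    · exfalso
      have h13 := hweak u hu.adm
      rw [hu1] at h13
      have : D.dir u u = 0 := by
        unfold dir
        refine setIntegral_eq_zero_of_forall_eq_zero fun x hx => Finset.sum_eq_zero fun i _ => ?_
        rw [← pdw_eq i hx, hall i x (subset_closure hx), zero_mul]
      linarith
    · push Not at hall
      obtain ⟨i, hi⟩ := hall
      obtain ⟨K, hK⟩ := sg_lip hR (hu.pdw i) (bv i)
      refine ball_barta hR hp (bv i) (K := K / 2) (hu.pdw i) (fun x hx => ?_) (h12 i) (ip_pos (hu.pdw i) hi)
      have h14 := hK x hx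
      have h15 : (D.pdw i u) (sg (bv i) c x) = - D.pdw i u x := by
        rw [pdw_eq (x := x) i hx, pdw_eq i (hsg _ x hx), pd, pd, h1 (bv i) x hx]
        have h5 : ((Lr (bv i) : Eu n ≃L[ℝ] Eu n) : Eu n →L[ℝ] Eu n) (bv i) = -(bv i) := hLe _
        rw [ContinuousLinearMap.comp_apply, h5, map_neg, neg_neg]
      rw [h15, sub_neg_eq_add, ← two_mul, abs_mul, abs_two] at h14
      linarith
  · push Not at hsym
    obtain ⟨e, he⟩ := hsym
    obtain ⟨K, hK⟩ := sg_lip hR hu e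
    have hus : D.SC (fun x => u (sg e c x)) := hu.comp (sg_smooth e c).contDiffOn (hsgc e)
    have hw : D.SC (fun x => u x - u (sg e c x)) := hu.sub hus
    have hw' : D.SC (fun x => u x + (-1) * u (sg e c x)) := hu.add (contDiffOn_const.mul hus)
    have e0 : (fun x => u x - u (sg e c x)) = fun x => u x + (-1) * u (sg e c x) := by funext x; ring
    have e1 : D.ip (fun x => u (sg e c x)) (fun x => u (sg e c x)) = D.ip u u := sg_int e c (fun x => u x * u x)
    have e2 : D.dir (fun x => u (sg e c x)) (fun x => u (sg e c x)) = D.dir u u := by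
      have e3 : ∀ g : Eu n → ℝ, D.dir g g = ∫ x in D.carrier, ‖fderiv ℝ g x‖ ^ 2 := fun g => by
        unfold dir
        exact integral_congr_ae (Eventually.of_forall fun x => by
          simp only [norm_fderiv_sq]; exact Finset.sum_congr rfl fun i _ => by ring)
      rw [e3, e3, ← show _ = ∫ x in D.carrier, ‖fderiv ℝ u x‖ ^ 2 from sg_int e c (fun x => ‖fderiv ℝ u x‖ ^ 2)]
      refine setIntegral_congr_fun D.measSet fun x hx => ?_
      rw [fderiv_sg (hdu _ (hsg e x hx))]
      congr 1
      exact ContinuousLinearMap.opNorm_comp_linearIsometryEquiv _ (Lr e)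
    refine ball_barta hR hp e hw hK ?_ (ip_pos hw he)
    show D.dir _ _ = D.lam * D.ip _ _
    rw [e0, ip_expand hu.adm hus.adm, dir_expand hu.adm hus.adm, e1, e2, hweak _ hu.adm, hweak _ hus.adm]
    ring

end SmoothDomain

/-! ## P12a: the extended Weinberger profile -/

namespace SmoothDomain

def Df (n : ℕ) (E E' : ℝ → ℝ) (s : ℝ) : ℝ := (n - 1) * E s ^ 2 + (E s + 2 * s * E' s) ^ 2 - s * E s ^ 2

lemma ext_profile {F F' F'' : ℝ → ℝ} {P : ℝ} (hn : 2 ≤ n) (hp : Profile n F F' F'' P) : ∃ (E E' : ℝ → ℝ) (K : ℝ), 0 < K ∧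
    ContDiff ℝ 1 E ∧ (∀ s, HasDerivAt E (E' s) s) ∧ (∀ s ≤ P, E s = F s) ∧ (∀ s ≤ P, E' s = F' s) ∧
    (∀ s, 0 ≤ s → 0 < E s) ∧ (∀ s, P ≤ s → E s = K / √s) ∧ (∀ s ∈ Icc 0 P, Df n E E' P ≤ Df n E E' s) ∧
    (∀ s, P < s → Df n E E' s < Df n E E' P) := by
  have hP := hp.pos
  have hPs : 0 < √P := Real.sqrt_pos.2 hP
  have hFP := hp.Fpos P ⟨hP.le, le_rfl⟩
  have hn1 : (1:ℝ) ≤ n - 1 := by have : (2:ℝ) ≤ n := by exact_mod_cast hn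
                                 linarith
  set K := √P * F P with hK
  have hKpos : 0 < K := mul_pos hPs hFP
  have hF'P : F' P = - F P / (2 * P) := by rw [eq_div_iff (by positivity)]; linarith [hp.HP]
  set E : ℝ → ℝ := fun s => if s ≤ P then F s else K / √s with hE
  set E' : ℝ → ℝ := fun s => if s ≤ P then F' s else - K / (2 * max s P * √(max s P)) with hE'
  have E1 : ∀ s ≤ P, E s = F s := fun s hs => if_pos hs
  have E1' : ∀ s ≤ P, E' s = F' s := fun s hs => if_pos hs
  have E2 : ∀ s, P ≤ s → E s = K / √s := by
    intro s hs
    rcases hs.eq_or_lt with rfl | h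
    · rw [E1 _ le_rfl, hK]; field_simp
    · exact if_neg (not_le.2 h)
  have E2' : ∀ s, P ≤ s → E' s = - K / (2 * s * √s) := by
    intro s hs
    rcases hs.eq_or_lt with rfl | h
    · rw [E1' _ le_rfl, hK, hF'P]; field_simp
    · simp only [hE', if_neg (not_le.2 h), max_eq_left hs]
  have hg : ∀ s, 0 < s → HasDerivAt (fun s => K / √s) (- K / (2 * s * √s)) s := by
    intro s hs
    have hss := Real.sqrt_pos.2 hs
    refine (((hasDerivAt_id s).sqrt hs.ne').inv hss.ne' |>.const_mul K).congr_deriv ?_ |>.congr_of_eventuallyEq ?_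
    · simp only [id, Real.sq_sqrt hs.le]; field_simp
    · exact Eventually.of_forall fun t => by simp [div_eq_mul_inv]
  have hd : ∀ s, HasDerivAt E (E' s) s := by
    intro s
    rcases lt_trichotomy s P with h | rfl | h
    · rw [E1' s h.le]
      exact (hp.d1 s).congr_of_eventuallyEq (by filter_upwards [Iio_mem_nhds h] with t ht using E1 t (le_of_lt ht))
    · have h1 : HasDerivWithinAt E (E' s) (Iic s) s := by
        rw [E1' s le_rfl]; exact (hp.d1 s).hasDerivWithinAt.congr (fun t ht => E1 t ht) (E1 s le_rfl)
      have h2 : HasDerivWithinAt E (E' s) (Ici s) s := by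
        rw [E2' s le_rfl]; exact (hg s hP).hasDerivWithinAt.congr (fun t ht => E2 t ht) (E2 s le_rfl)
      have := h1.union h2
      rwa [Iic_union_Ici, hasDerivWithinAt_univ] at this
    · rw [E2' s h.le]
      exact (hg s (hP.trans h)).congr_of_eventuallyEq (by filter_upwards [Ioi_mem_nhds h] with t ht using E2 t (le_of_lt ht))
  have hF'c : Continuous F' := continuous_iff_continuousAt.2 fun s => (hp.d2 s).continuousAt
  have hE'c : Continuous E' := by
    refine Continuous.if_le hF'c (continuous_const.div (by fun_prop) fun s => ?_) continuous_id continuous_const ?_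
    · have : 0 < max s P := lt_max_of_lt_right hP
      have := Real.sqrt_pos.2 this
      positivity
    · rintro s (rfl : s = P)
      rw [max_self, ← E1' s le_rfl, E2' s le_rfl]
  refine ⟨E, E', K, hKpos, ?_, hd, E1, E1', ?_, E2, ?_, ?_⟩
  · rw [contDiff_one_iff_deriv]
    refine ⟨fun s => (hd s).differentiableAt, ?_⟩
    rwa [show deriv E = E' from funext fun s => (hd s).deriv]
  · intro s hs
    rcases le_total s P with h | h
    · rw [E1 s h]; exact hp.Fpos s ⟨hs, h⟩
    · rw [E2 s h]; exact div_pos hKpos (Real.sqrt_pos.2 (hP.trans_le h))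
  · have hder : ∀ s, HasDerivAt (Df n F F') (-4 * (n - 1) * s * F' s ^ 2 - 2 * (F s + 2 * s * F' s) * F s) s := by
      intro s
      have h1 := ((hp.d1 s).fun_pow 2)
      have h2 : HasDerivAt (fun s => F s + 2 * s * F' s) (F' s + (2 * F' s + 2 * s * F'' s)) s :=
        (hp.d1 s).fun_add (((hasDerivAt_id' s).const_mul 2 |>.fun_mul (hp.d2 s)).congr_deriv (by ring))
      have h3 := ((h1.const_mul ((n:ℝ) - 1)).fun_add (h2.fun_pow 2)).fun_sub ((hasDerivAt_id' s).fun_mul h1)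
      refine h3.congr_deriv ?_
      push_cast
      have e0 : F'' s * s = (-F s - (2 * n + 4) * F' s) / 4 := by linarith [hp.ode s]
      linear_combination (4 * (F s + 2 * s * F' s)) * e0
    have hanti : AntitoneOn (Df n F F') (Icc 0 P) := by
      refine antitoneOn_of_hasDerivWithinAt_nonpos (convex_Icc 0 P) (fun s _ => (hder s).continuousAt.continuousWithinAt)
        (fun s _ => (hder s).hasDerivWithinAt) fun s hs => ?_
      rw [interior_Icc] at hs
      have a1 := hp.Hpos s ⟨hs.1.le, hs.2⟩
      have a2 := hp.Fpos s ⟨hs.1.le, hs.2.le⟩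
      have a3 : 0 ≤ 4 * ((n:ℝ) - 1) * s * F' s ^ 2 := by have := hs.1.le; positivity
      have a4 := mul_pos a1 a2
      linarith
    intro s hs
    simp only [Df, E1 s hs.2, E1' s hs.2, E1 P le_rfl, E1' P le_rfl]
    exact hanti hs ⟨hP.le, le_rfl⟩ hs.2
  · have hform : ∀ s, P ≤ s → Df n E E' s = (n - 1) * K ^ 2 / s - K ^ 2 := by
      intro s hs
      have hs0 := hP.trans_le hs
      have hss := Real.sqrt_pos.2 hs0
      have a1 : E s + 2 * s * E' s = 0 := by rw [E2 s hs, E2' s hs]; field_simp; ring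
      have a2 : E s ^ 2 = K ^ 2 / s := by rw [E2 s hs, div_pow, Real.sq_sqrt hs0.le]
      rw [Df, a1, a2]; field_simp; ring
    intro s hs
    rw [hform s hs.le, hform P le_rfl]
    have : ((n:ℝ) - 1) * K ^ 2 / s < (n - 1) * K ^ 2 / P := div_lt_div_of_pos_left (by positivity) hP hs
    linarith

/-- choice of the centre -/
lemma exists_center (D : SmoothDomain n) (hne : D.carrier.Nonempty) {E : ℝ → ℝ} {P K l : ℝ} (hP : 0 < P) (hK : 0 < K) (hl : 0 < l)
    (hE : Continuous E) (hEp : ∀ s, 0 ≤ s → 0 < E s) (hEK : ∀ s, P ≤ s → E s = K / √s) :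
    ∃ c : Eu n, ∀ i, ∫ x in D.carrier, (x i - c i) * E (l * ‖x - c‖ ^ 2) = 0 := by
  set Q : ℝ → ℝ := fun s => ∫ t in (0:ℝ)..s, E t with hQ
  have hQd : ∀ s, HasDerivAt Q (E s) s := fun s => (hE.integral_hasStrictDerivAt 0 s).hasDerivAt
  have hQmono : MonotoneOn Q (Ici 0) := monotoneOn_of_hasDerivWithinAt_nonneg (convex_Ici 0)
    (fun s _ => (hQd s).continuousAt.continuousWithinAt) (fun s _ => (hQd s).hasDerivWithinAt)
    (fun s hs => by rw [interior_Ici] at hs; exact (hEp s (le_of_lt hs)).le)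
  have hQ0 : Q 0 = 0 := by simp [hQ]
  have hQlow : ∀ s, 0 ≤ s → K * (√s - √P) ≤ Q s := by
    intro s hs
    rcases le_total s P with h | h
    · have h1 : √s ≤ √P := Real.sqrt_le_sqrt h
      have h2 := hQmono (mem_Ici.2 le_rfl) (mem_Ici.2 hs) hs
      rw [hQ0] at h2
      have h3 := mul_nonneg hK.le (sub_nonneg.2 h1)
      linarith
    · have hs0 := hP.trans_le h
      have hss := Real.sqrt_pos.2 hs0
      have hPs := Real.sqrt_pos.2 hP
      have h1 := (convex_Icc P s).mul_sub_le_image_sub_of_le_deriv (f := Q) (C := K / √s)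
        (fun t _ => (hQd t).continuousAt.continuousWithinAt) (fun t _ => (hQd t).differentiableAt.differentiableWithinAt)
        (fun t ht => by
          rw [interior_Icc] at ht
          rw [(hQd t).deriv, hEK t ht.1.le]
          exact div_le_div_of_nonneg_left hK.le (Real.sqrt_pos.2 (hP.trans ht.1)) (Real.sqrt_le_sqrt ht.2.le))
        P ⟨le_rfl, h⟩ s ⟨h, le_rfl⟩ h
      have h2 := hQmono (mem_Ici.2 le_rfl) (mem_Ici.2 hP.le) hP.le
      rw [hQ0] at h2
      have h3 : K / √s * (s - P) = K * (√s - √P) + K * √P * (√s - √P) / √s := by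
        have e1 := Real.sq_sqrt hs0.le; have e2 := Real.sq_sqrt hP.le
        field_simp
        nlinarith [e1, e2]
      have h4 : 0 ≤ K * √P * (√s - √P) / √s := by
        have := sub_nonneg.2 (Real.sqrt_le_sqrt h); positivity
      linarith
  set Ψ : Eu n → ℝ := fun y => Q (l * ‖y‖ ^ 2) with hΨ
  have hQc : ContDiff ℝ 1 Q := by
    rw [contDiff_one_iff_deriv]
    exact ⟨fun s => (hQd s).differentiableAt, by rwa [show deriv Q = E from funext fun s => (hQd s).deriv]⟩
  have hΨc : ContDiff ℝ 1 Ψ := hQc.comp (contDiff_const.mul (contDiff_norm_sq ℝ))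
  have hpdΨ : ∀ i y, pd i Ψ y = 2 * l * (y i * E (l * ‖y‖ ^ 2)) := by
    intro i y
    have h1 := nsq_diff (0 : Eu n) y
    have h2 := pd_nsq (0 : Eu n) i y
    simp only [sub_zero] at h1 h2
    have := pd_comp (i := i) (f := fun y : Eu n => l * ‖y‖ ^ 2) (x := y) (hQd (l * ‖y‖ ^ 2)) (h1.const_mul l)
    rw [pd_const_mul _ h1, h2] at this
    rw [hΨ, this]; simp; ring
  obtain ⟨M, hM⟩ := D.isBounded.exists_norm_le
  have hW : ∀ c0, HasFDerivAt (fun c => ∫ x in D.carrier, Ψ (x - c)) (∫ x in D.carrier, -(fderiv ℝ Ψ (x - c0))) c0 := by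
    intro c0
    have hfc : Continuous (fderiv ℝ Ψ) := hΨc.continuous_fderiv (by simp)
    obtain ⟨C, hC⟩ := (isCompact_closedBall (0 : Eu n) (M + ‖c0‖ + 1)).exists_bound_of_continuousOn hfc.continuousOn
    have hmeas : ∀ c, AEStronglyMeasurable (fun x => Ψ (x - c)) (volume.restrict D.carrier) := fun c =>
      (hΨc.continuous.comp (continuous_id.sub continuous_const)).aestronglyMeasurable
    refine hasFDerivAt_integral_of_dominated_of_fderiv_le (s := Metric.ball c0 1) (bound := fun _ => C) (F := fun c x => Ψ (x - c))
      (F' := fun c x => -(fderiv ℝ Ψ (x - c))) (Metric.ball_mem_nhds c0 one_pos) (Eventually.of_forall hmeas) ?_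
      (hfc.comp (continuous_id.sub continuous_const)).neg.aestronglyMeasurable ?_ (integrable_const _) ?_
    · exact l2_int (l2_cont (hΨc.continuous.comp (continuous_id.sub continuous_const)))
    · filter_upwards [ae_restrict_mem D.measSet] with x hx c hc
      rw [norm_neg]
      refine hC _ ?_
      rw [mem_closedBall_zero_iff]
      have h1 := hM x hx
      have h2 : ‖c‖ ≤ ‖c0‖ + 1 := by
        have := norm_le_norm_add_norm_sub c0 c
        rw [mem_ball_iff_norm] at hc
        rw [norm_sub_rev] at this; linarith
      linarith [norm_sub_le x c]
    · filter_upwards with x c _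
      have h1 : HasFDerivAt (fun c => x - c) (-(ContinuousLinearMap.id ℝ (Eu n))) c := (hasFDerivAt_id c).const_sub x
      have := ((hΨc.differentiable (by simp) (x - c)).hasFDerivAt).comp c h1
      exact this.congr_fderiv (by ext v; simp)
  have hvol : 0 < volume.real D.carrier := vol_real_pos hne
  have hcoer : Tendsto (fun c => ∫ x in D.carrier, Ψ (x - c)) (cocompact (Eu n)) atTop := by
    have h1 : Tendsto (fun c : Eu n => K * (√l * (‖c‖ - M) - √P) * volume.real D.carrier) (cocompact (Eu n)) atTop := by
      refine Tendsto.atTop_mul_const hvol (Tendsto.const_mul_atTop hK ?_)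
      exact tendsto_atTop_add_const_right _ _ (Tendsto.const_mul_atTop (Real.sqrt_pos.2 hl)
        (tendsto_atTop_add_const_right _ _ tendsto_norm_cocompact_atTop))
    refine tendsto_atTop_mono (fun c => ?_) h1
    have h2 : ∫ x in D.carrier, K * (√l * (‖c‖ - M) - √P) = K * (√l * (‖c‖ - M) - √P) * volume.real D.carrier := by
      rw [setIntegral_const, smul_eq_mul, mul_comm]
    rw [← h2]
    refine setIntegral_mono_on (integrable_const _)
      (l2_int (l2_cont (hΨc.continuous.comp (continuous_id.sub continuous_const)))) D.measSet fun x hx => ?_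
    refine le_trans ?_ (hQlow _ (by positivity))
    refine mul_le_mul_of_nonneg_left ?_ hK.le
    rw [Real.sqrt_mul hl.le, Real.sqrt_sq (norm_nonneg _)]
    have h3 : ‖c‖ - M ≤ ‖x - c‖ := by
      have := norm_le_norm_add_norm_sub x c; linarith [hM x hx]
    linarith [mul_le_mul_of_nonneg_left h3 (Real.sqrt_nonneg l)]
  obtain ⟨c, hc⟩ := Continuous.exists_forall_le (continuous_iff_continuousAt.2 fun c => (hW c).continuousAt) hcoer
  refine ⟨c, fun i => ?_⟩
  have h0 : (∫ x in D.carrier, -(fderiv ℝ Ψ (x - c))) = 0 :=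
    IsLocalMin.hasFDerivAt_eq_zero (Eventually.of_forall hc) (hW c)
  have hint : IntegrableOn (fun x => -(fderiv ℝ Ψ (x - c))) D.carrier :=
    (((hΨc.continuous_fderiv (by simp)).comp (continuous_id.sub continuous_const)).neg.continuousOn.integrableOn_compact
      D.isCompact_closure).mono_set subset_closure
  have h1 := ContinuousLinearMap.integral_apply hint (bv i)
  rw [h0] at h1
  have h2 : ∀ x : Eu n, (-(fderiv ℝ Ψ (x - c))) (bv i) = (-2 * l) * ((x i - c i) * E (l * ‖x - c‖ ^ 2)) := fun x => by
    have := hpdΨ i (x - c)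
    show - pd i Ψ (x - c) = _
    rw [this, PiLp.sub_apply]; ring
  simp only [h2, integral_const_mul] at h1
  have h3 : (0:ℝ) = -2 * l * ∫ x in D.carrier, (x i - c i) * E (l * ‖x - c‖ ^ 2) := h1
  exact (mul_eq_zero.1 h3.symm).resolve_left (by linarith)

end SmoothDomain

/-! ## P12b: Weinberger's argument -/

namespace SmoothDomain

lemma lin_bv (i : Fin n) (c x : Eu n) : lin (bv i) c x = x i - c i := by
  simp [lin, bv, Pi.single_apply]

/-- the coordinate test functions -/
def tf (E : ℝ → ℝ) (l : ℝ) (c : Eu n) (i : Fin n) (y : Eu n) : ℝ := lin (bv i) c y * E (l * ‖y - c‖ ^ 2)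

lemma tf_sum {E E' : ℝ → ℝ} (hE : ∀ s, HasDerivAt E (E' s) s) (l : ℝ) (c x : Eu n) :
    ∑ i, ((∑ j, pd j (tf E l c i) x * pd j (tf E l c i) x) - l * (tf E l c i x * tf E l c i x)) = Df n E E' (l * ‖x - c‖ ^ 2) := by
  set s := ‖x - c‖ ^ 2 with hs
  have hss : ∑ j, (x j - c j) ^ 2 = s := (nsq_sum c x).symm
  have hq := deriv_scale hE l s
  have e1 : ∀ i j, pd j (tf E l c i) x * pd j (tf E l c i) x =
      (if j = i then E (l * s) ^ 2 + 4 * (l * E' (l * s)) * E (l * s) * (x i - c i) ^ 2 else 0) +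
        4 * (l * E' (l * s)) ^ 2 * (x i - c i) ^ 2 * (x j - c j) ^ 2 := by
    intro i j
    have h1 : pd j (tf E l c i) x = _ := pd_linrad (e := bv i) (c := c) (q := fun s => E (l * s)) (y := x) hq j
    have h2 : bv i j = if j = i then (1:ℝ) else 0 := by simp [bv, Pi.single_apply]
    rw [h1, lin_bv, h2, ← hs]
    split_ifs with h
    · subst h; ring
    · ring
  have e2 : ∀ i, (∑ j, pd j (tf E l c i) x * pd j (tf E l c i) x) - l * (tf E l c i x * tf E l c i x) =
      E (l * s) ^ 2 + (4 * (l * E' (l * s)) * E (l * s) + 4 * (l * E' (l * s)) ^ 2 * s - l * E (l * s) ^ 2) * (x i - c i) ^ 2 := by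
    intro i
    rw [Finset.sum_congr rfl fun j _ => e1 i j, Finset.sum_add_distrib, ← Finset.mul_sum, hss]
    simp only [Finset.sum_ite_eq', Finset.mem_univ, if_true, tf, lin_bv, ← hs]
    ring
  rw [Finset.sum_congr rfl fun i _ => e2 i, Finset.sum_add_distrib, ← Finset.mul_sum, hss]
  simp only [Finset.sum_const, Finset.card_univ, Fintype.card_fin, nsmul_eq_mul, Df]
  ring

lemma tf_smooth {E : ℝ → ℝ} (hE : ContDiff ℝ 1 E) (l : ℝ) (c : Eu n) (i : Fin n) : ContDiff ℝ 1 (tf E l c i) :=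
  ((lin_smooth (bv i) c).of_le (by exact_mod_cast le_top)).mul
    (hE.comp (contDiff_const.mul ((nsq_smooth c).of_le (by exact_mod_cast le_top))))

lemma tf_total (D : SmoothDomain n) {E E' : ℝ → ℝ} (hc : ContDiff ℝ 1 E) (hE : ∀ s, HasDerivAt E (E' s) s) (l : ℝ) (c : Eu n) :
    ∑ i, (D.dir (tf E l c i) (tf E l c i) - l * D.ip (tf E l c i) (tf E l c i)) =
      ∫ x in D.carrier, Df n E E' (l * ‖x - c‖ ^ 2) := by
  have hA : ∀ i, D.Adm (tf E l c i) := fun i => adm_of_contDiff (tf_smooth hc l c i)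
  have h1 : ∀ i, IntegrableOn (fun x => ∑ j, pd j (tf E l c i) x * pd j (tf E l c i) x) D.carrier := fun i => int_dir (hA i) (hA i)
  have h2 : ∀ i, IntegrableOn (fun x => l * (tf E l c i x * tf E l c i x)) D.carrier := fun i => (int_ip (hA i) (hA i)).const_mul l
  simp only [← tf_sum hE]
  have h3 : ∀ i, IntegrableOn (fun x => (∑ j, pd j (tf E l c i) x * pd j (tf E l c i) x) - l * (tf E l c i x * tf E l c i x)) D.carrier :=
    fun i => (h1 i).sub (h2 i)
  rw [integral_finset_sum _ fun i _ => h3 i]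
  refine Finset.sum_congr rfl fun i _ => ?_
  rw [integral_sub (h1 i) (h2 i), integral_const_mul]; rfl

lemma Df_ball {F F' F'' E E' : ℝ → ℝ} {P R : ℝ} (hR : 0 < R) (hp : Profile n F F' F'' P) (hc : ContDiff ℝ 1 E)
    (hE : ∀ s, HasDerivAt E (E' s) s) (hEF : ∀ s ≤ P, E s = F s) (c : Eu n) :
    ∫ x in Metric.ball c R, Df n E E' (P / R ^ 2 * ‖x - c‖ ^ 2) = 0 := by
  rw [← show _ = ∫ x in Metric.ball c R, Df n E E' (P / R ^ 2 * ‖x - c‖ ^ 2) from tf_total (stdBall c hR) hc hE (P / R ^ 2) c]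
  refine Finset.sum_eq_zero fun i _ => ?_
  set D := stdBall c hR
  set φ : Eu n → ℝ := fun y => lin (bv i) c y * F (P / R ^ 2 * ‖y - c‖ ^ 2) with hφ
  have hφs : ContDiff ℝ (⊤ : ℕ∞) φ := (lin_smooth (bv i) c).mul (hp.smooth.comp (contDiff_const.mul (nsq_smooth c)))
  have hSC : D.SC φ := hφs.contDiffOn
  have heq : EqOn (tf E (P / R ^ 2) c i) φ D.carrier := fun x hx => by
    have hx : ‖x - c‖ < R := mem_ball_iff_norm.1 hx
    rw [tf, hEF]
    have h1 : ‖x - c‖ ^ 2 ≤ R ^ 2 := pow_le_pow_left₀ (norm_nonneg _) hx.le 2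
    calc _ ≤ P / R ^ 2 * R ^ 2 := mul_le_mul_of_nonneg_left h1 (div_pos hp.pos (by positivity)).le
      _ = P := by field_simp
  rw [dir_congr heq heq, ip_congr heq heq]
  have hg := green hSC hSC (fun x hx => by
    have h1 : D.cn φ x = 0 := by
      rw [← model_bc hR hp (bv i) x hx, cn]
      refine Finset.sum_congr rfl fun j _ => ?_
      rw [SmoothDomain.pdw, DifferentiableAt.fderivWithin (hφs.differentiable (by simp) x) (D.udo x (frontier_subset_closure hx))]
      rfl
    rw [h1, mul_zero])
  have h2 : D.ip φ (lapWithin (closure D.carrier) φ) = -(P / R ^ 2) * D.ip φ φ := by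
    unfold ip
    rw [← integral_const_mul]
    refine setIntegral_congr_fun D.measSet fun x hx => ?_
    show φ x * _ = -(P / R ^ 2) * (φ x * φ x)
    rw [lapWithin_eq hx, hφ, model_lap hp.d1 hp.d2 hp.ode (bv i) c _ x]; ring
  rw [h2] at hg
  linarith

theorem weinberger (hn : 2 ≤ n) (D : SmoothDomain n) (hne : D.carrier.Nonempty) {F F' F'' : ℝ → ℝ} {P R : ℝ} (hR : 0 < R)
    (hp : Profile n F F' F'' P) (c0 : Eu n) (hvol : volume D.carrier = volume (Metric.ball c0 R)) :
    D.lam ≤ P / R ^ 2 ∧ (D.lam = P / R ^ 2 → ∃ c, D.carrier = Metric.ball c R) := by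
  obtain ⟨E, E', K, hK, hc1, hEd, hEF, hEF', hEp, hEK, hin, hout⟩ := ext_profile hn hp
  have hl : 0 < P / R ^ 2 := div_pos hp.pos (by positivity)
  set l := P / R ^ 2 with hldef
  have hlR : l * R ^ 2 = P := by rw [hldef]; field_simp
  obtain ⟨c, hcen⟩ := exists_center D hne hp.pos hK hl hc1.continuous hEp hEK
  have hvol' : volume D.carrier = volume (Metric.ball c R) := by
    rw [hvol, Measure.addHaar_ball_center, Measure.addHaar_ball_center volume c]
  set f := tf E l c with hf
  have hA : ∀ i, D.Adm (f i) := fun i => adm_of_contDiff (tf_smooth hc1 l c i)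
  have hlam : ∀ i, D.lam * D.ip (f i) (f i) ≤ D.dir (f i) (f i) := fun i => lam_le (hA i) (by
    rw [← hcen i]; simp only [hf, tf, lin_bv])
  have hA0 : ∀ i, 0 ≤ D.ip (f i) (f i) := fun i => ip_nonneg _
  have hApos : 0 < ∑ i, D.ip (f i) (f i) := by
    have i0 : Fin n := ⟨0, by omega⟩
    refine Finset.sum_pos' (fun i _ => hA0 i) ⟨i0, Finset.mem_univ _, (hA0 i0).lt_of_ne fun h => ?_⟩
    have h1 := zero_of_int (hA i0).c1.continuousOn (int_ip (hA i0) (hA i0)) h.symm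
    obtain ⟨x, hx⟩ := hne
    have h2 : EqOn (fun y : Eu n => y i0 - c i0) (fun _ => 0) D.carrier := fun y hy => by
      have h3 : lin (bv i0) c y * E (l * ‖y - c‖ ^ 2) = 0 := h1 hy
      rw [lin_bv] at h3
      exact (mul_eq_zero.1 h3).resolve_right (hEp _ (by positivity)).ne'
    have h4 := pd_congr_on (i := i0) D.isOpen h2 hx
    rw [pd_coord', pd_const] at h4
    simp at h4
  have hE'c : Continuous E' := by
    rw [← show deriv E = E' from funext fun s => (hEd s).deriv]; exact (contDiff_one_iff_deriv.1 hc1).2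
  set g : Eu n → ℝ := fun x => Df n E E' (l * ‖x - c‖ ^ 2) - Df n E E' P with hg
  have hDc : Continuous (Df n E E') := by
    have := hc1.continuous
    unfold Df; fun_prop
  have hgc : Continuous g := by rw [hg]; fun_prop
  have hgi : ∀ s : Set (Eu n), Bornology.IsBounded s → IntegrableOn g s := fun s hs =>
    (hgc.continuousOn.integrableOn_compact hs.isCompact_closure).mono_set subset_closure
  have iD := hgi _ D.isBounded
  set B := Metric.ball c R with hB
  have iB := hgi B Metric.isBounded_ball
  have hBm : MeasurableSet B := Metric.isOpen_ball.measurableSet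
  have gB : ∀ x ∈ B, 0 ≤ g x := fun x hx => sub_nonneg.2 (hin _ ⟨by positivity, by
    rw [← hlR]
    exact mul_le_mul_of_nonneg_left (pow_le_pow_left₀ (norm_nonneg _) (mem_ball_iff_norm.1 hx).le 2) hl.le⟩)
  have gout : ∀ x, R < ‖x - c‖ → g x < 0 := fun x hx => sub_neg.2 (hout _ (by
    rw [← hlR]
    exact mul_lt_mul_of_pos_left (pow_lt_pow_left₀ hx hR.le two_ne_zero) hl))
  have gO : ∀ x ∈ D.carrier \ B, g x ≤ 0 := fun x hx => by
    have h1 : R ≤ ‖x - c‖ := not_lt.1 fun h => hx.2 (mem_ball_iff_norm.2 h)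
    rcases h1.eq_or_lt with h | h
    · simp only [hg, ← h, hlR, sub_self, le_refl]
    · exact (gout x h).le
  have hfin : ∀ s : Set (Eu n), Bornology.IsBounded s → ∫ x in s, g x = (∫ x in s, Df n E E' (l * ‖x - c‖ ^ 2)) - volume.real s * Df n E E' P := by
    intro s hs
    have hs2 : IntegrableOn (fun x => Df n E E' (l * ‖x - c‖ ^ 2)) s :=
      ((show Continuous fun x : Eu n => Df n E E' (l * ‖x - c‖ ^ 2) by fun_prop).continuousOn.integrableOn_compact hs.isCompact_closure).mono_set subset_closure
    have : IntegrableOn (fun _ : Eu n => Df n E E' P) s := integrableOn_const hs.measure_lt_top.ne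
    rw [integral_sub hs2 this, setIntegral_const, smul_eq_mul]
  have k1 := integral_inter_add_diff hBm iD
  have k2 := integral_inter_add_diff D.measSet iB
  have k3 : 0 ≤ ∫ x in B \ D.carrier, g x := setIntegral_nonneg (hBm.diff D.measSet) fun x hx => gB x hx.1
  have k4 : ∫ x in D.carrier \ B, g x ≤ 0 := setIntegral_nonpos (D.measSet.diff hBm) gO
  rw [inter_comm] at k2
  have k5 := hfin _ D.isBounded
  have k6 := hfin B Metric.isBounded_ball
  rw [Df_ball hR hp hc1 hEd hEF c] at k6
  have hvr : volume.real D.carrier = volume.real B := by rw [measureReal_def, hvol']; rfl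
  rw [hvr] at k5
  have k7 : (D.lam - l) * ∑ i, D.ip (f i) (f i) ≤ ∫ x in D.carrier, Df n E E' (l * ‖x - c‖ ^ 2) := by
    rw [← tf_total D hc1 hEd l c, Finset.mul_sum]
    exact Finset.sum_le_sum fun i _ => by have := hlam i; rw [sub_mul]; linarith
  have k8 : (D.lam - l) * ∑ i, D.ip (f i) (f i) ≤ ∫ x in D.carrier \ B, g x := by linarith
  refine ⟨?_, fun heq => ⟨c, ?_⟩⟩
  · by_contra h
    push Not at h
    have := mul_pos (sub_pos.2 h) hApos
    linarith
  · rw [heq, sub_self, zero_mul] at k8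
    have k9 : D.carrier ⊆ Metric.closedBall c R := by
      by_contra hcon
      obtain ⟨x, hx, hxc⟩ := not_subset.1 hcon
      have iO : IntegrableOn (fun x => -g x) (D.carrier \ B) := (iD.mono_set diff_subset).neg
      have hnn : 0 ≤ᵐ[volume.restrict (D.carrier \ B)] fun x => -g x := by
        filter_upwards [ae_restrict_mem (D.measSet.diff hBm)] with y hy
        exact neg_nonneg.2 (gO y hy)
      have hpos := (setIntegral_pos_iff_support_of_nonneg_ae hnn iO).2 (by
        have hU : IsOpen (D.carrier \ Metric.closedBall c R) := D.isOpen.sdiff Metric.isClosed_closedBall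
        refine (hU.measure_pos volume ⟨x, hx, hxc⟩).trans_le (measure_mono fun y hy => ⟨?_, hy.1, fun h => hy.2 (Metric.ball_subset_closedBall h)⟩)
        have h1 : R < ‖y - c‖ := not_le.1 fun h => hy.2 (mem_closedBall_iff_norm.2 h)
        have := gout y h1
        simp only [Function.mem_support, ne_eq, neg_eq_zero]
        exact this.ne)
      rw [integral_neg] at hpos
      linarith
    have k10 : D.carrier ⊆ B := by
      rw [hB, ← interior_closedBall c hR.ne']; exact interior_maximal k9 D.isOpen
    have k11 : B ⊆ closure D.carrier := by
      by_contra hcon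
      obtain ⟨x, hx, hxc⟩ := not_subset.1 hcon
      have hU : IsOpen (B \ closure D.carrier) := Metric.isOpen_ball.sdiff isClosed_closure
      have h1 := hU.measure_pos volume ⟨x, hx, hxc⟩
      have h2 : volume (B \ D.carrier) = 0 := by
        rw [measure_diff k10 D.measSet.nullMeasurableSet D.vol_lt_top.ne, hvol', tsub_self]
      exact (h1.trans_le (measure_mono (diff_subset_diff_right subset_closure))).ne' h2
    refine Subset.antisymm k10 fun x hx => ?_
    by_contra hxD
    have hfr : x ∈ frontier D.carrier := by
      rw [frontier, D.isOpen.interior_eq]; exact ⟨k11 hx, hxD⟩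
    refine D.fderiv_ne hfr (IsLocalMax.fderiv_eq_zero ?_)
    have hx0 : D.defining x = 0 := by have := hfr; rwa [D.frontier_eq] at this
    filter_upwards [Metric.isOpen_ball.mem_nhds hx] with y hy
    have := k11 hy
    rw [D.closure_eq] at this
    rw [hx0]; exact this

end SmoothDomain

open SmoothDomain in
/-- everything in terms of `lam` -/
lemma lam_compare (hn : 2 ≤ n) (Ω B : SmoothDomain n) (hconn : IsConnected Ω.carrier)
    (c : Eu n) (R : ℝ) (hR : 0 < R) (hBall : B.carrier = Metric.ball c R) (hvol : volume B.carrier = volume Ω.carrier) :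
    Ω.lam ≤ B.lam ∧ (Ω.lam = B.lam ↔ ∃ c' : Eu n, Ω.carrier = Metric.ball c' R) := by
  obtain ⟨F, F', F'', P, h1, h2, h3, h4, h5, h6, h7, h8⟩ := exists_profile n (by omega)
  have hp : Profile n F F' F'' P := ⟨h1, h2, h3, h4, h5, h6, h7, h8⟩
  have hBn : B.carrier.Nonempty := by rw [hBall]; exact ⟨c, Metric.mem_ball_self hR⟩
  obtain ⟨hΩ, hΩ'⟩ := weinberger hn Ω hconn.nonempty hR hp c (by rw [← hvol, hBall])
  obtain ⟨hB, -⟩ := weinberger hn B hBn hR hp c (by rw [hBall])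
  have hlow : ∀ (D : SmoothDomain n) (c' : Eu n), D.carrier = Metric.ball c' R → P / R ^ 2 ≤ D.lam := fun D c' h => by
    rw [lam_congr (D' := stdBall c' hR) h]; exact lam_ball hR hp (by omega)
  have hBe := le_antisymm hB (hlow B c hBall)
  rw [hBe]
  exact ⟨hΩ, hΩ', fun ⟨c', h⟩ => le_antisymm hΩ (hlow Ω c' h)⟩

/-- **Szegő–Weinberger inequality for the even-multi-Laplacian `Δ^(2m)`.**
Let `n ≥ 2`, `m ≥ 1`, and let `Ω` be a bounded connected open set in `ℝⁿ` with smooth boundary.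
Then the first nonzero Neumann eigenvalue of `Δ^(2m)` satisfies `Υ̂₁(Ω) ≤ Υ̂₁(B_Ω)`, where `B_Ω`
is an open ball with the same Lebesgue volume as `Ω`; equality holds iff `Ω` is itself a ball of
that volume. -/
theorem polyharmonic_neumann_szegoWeinberger {n m : ℕ} (hn : 2 ≤ n) (hm : 1 ≤ m)
    (Ω B : SmoothDomain n) (hconn : IsConnected Ω.carrier)
    (c : EuclideanSpace ℝ (Fin n)) (R : ℝ) (hR : 0 < R)
    (hBall : B.carrier = Metric.ball c R)
    (hvol : volume B.carrier = volume Ω.carrier)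
    (Υ₁Ω Υ₁B : ℝ)
    (hΥΩ : IsLeast {Υ : ℝ | 0 < Υ ∧ IsPolyharmonicNeumannEigenvalue Ω m Υ} Υ₁Ω)
    (hΥB : IsLeast {Υ : ℝ | 0 < Υ ∧ IsPolyharmonicNeumannEigenvalue B m Υ} Υ₁B) :
    Υ₁Ω ≤ Υ₁B ∧
      (Υ₁Ω = Υ₁B ↔ ∃ c' : EuclideanSpace ℝ (Fin n), Ω.carrier = Metric.ball c' R) := by
  have h1 := SmoothDomain.least_eq hm (by omega) hconn hΥΩ
  have hBc : IsConnected B.carrier := by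
    rw [hBall]; exact (convex_ball c R).isConnected ⟨c, Metric.mem_ball_self hR⟩
  have h2 := SmoothDomain.least_eq hm (by omega) hBc hΥB
  obtain ⟨h3, h4⟩ := lam_compare hn Ω B hconn c R hR hBall hvol
  have hΩ0 : 0 ≤ Ω.lam := SmoothDomain.lam_nonneg
  have hB0 : 0 ≤ B.lam := SmoothDomain.lam_nonneg
  rw [h1, h2]
  exact ⟨pow_le_pow_left₀ hΩ0 h3 _, (pow_left_inj₀ hΩ0 hB0 (by omega)).trans h4⟩
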